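/- Let e_n be the number of atoms of S_n (the embedding dimension of S_n). Then e_n/n tends to 2 as n → ∞. -/

import Mathlib

open Filter Pointwise

/-- `nthPrime n` is the `n`-th prime number (1-indexed): `nthPrime 1 = 2`, etc. -/
noncomputable def nthPrime (n : ℕ) : ℕ := Nat.nth Nat.Prime (n - 1)

/-- `S n` is the additive submonoid of `ℕ` generated by the primes `q ≥ nthPrime n`. -/
def S (n : ℕ) : AddSubmonoid ℕ :=
  AddSubmonoid.closure {q : ℕ | q.Prime ∧ nthPrime n ≤ q}

/-- `frob n` is the Frobenius number of `S n`: the largest natural number not in `S n`. -/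
noncomputable def frob (n : ℕ) : ℕ := sSup {m : ℕ | m ∉ S n}

/-- `genus n` is the number of natural numbers not in `S n`. -/
noncomputable def genus (n : ℕ) : ℕ := {m : ℕ | m ∉ S n}.ncard

/-- `atoms n` is the minimal generating set `S n \ {0} \ ((S n \ {0}) + (S n \ {0}))`. -/
def atoms (n : ℕ) : Set ℕ :=
  ((S n : Set ℕ) \ {0}) \ (((S n : Set ℕ) \ {0}) + ((S n : Set ℕ) \ {0}))

/-- `u n` is the largest atom of `S n`. -/
noncomputable def u (n : ℕ) : ℕ := sSup (atoms n)

/-- `e n` is the embedding dimension of `S n`: the number of atoms. -/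
noncomputable def e (n : ℕ) : ℕ := (atoms n).ncard

namespace PrimeAtoms

/-- The additive character `exp (2πiθ)`. -/
noncomputable def ex (θ : ℝ) : ℂ := Complex.exp (2 * Real.pi * θ * Complex.I)

/-- The distance from `θ` to the nearest integer. -/
noncomputable def dn (θ : ℝ) : ℝ := |θ - round θ|

/-- The unnormalised Dirichlet kernel `∑_{n < H} exp (2πinθ)`. -/
noncomputable def dirichletSum (H : ℕ) (θ : ℝ) : ℂ := ∑ n ∈ Finset.range H, ex (n * θ)

/-- The Fejér kernel `|∑_{n < H} exp (2πinθ)|² / H`. -/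
noncomputable def fejer (H : ℕ) (θ : ℝ) : ℝ := ‖dirichletSum H θ‖ ^ 2 / H

lemma ex_add (a b : ℝ) : ex (a + b) = ex a * ex b := by
  simp only [ex, ← Complex.exp_add]
  congr 1
  push_cast
  ring

@[simp] lemma ex_zero : ex 0 = 1 := by simp [ex]

@[simp] lemma norm_ex (θ : ℝ) : ‖ex θ‖ = 1 := by
  have : ex θ = Complex.exp ((2 * Real.pi * θ : ℝ) * Complex.I) := by simp [ex]
  rw [this, Complex.norm_exp_ofReal_mul_I]

lemma ex_ne_zero (θ : ℝ) : ex θ ≠ 0 := Complex.exp_ne_zero _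

@[simp] lemma ex_int (n : ℤ) : ex n = 1 := by
  have := Complex.exp_int_mul_two_pi_mul_I n
  rw [ex, ← this]
  congr 1
  push_cast
  ring

lemma ex_neg (θ : ℝ) : ex (-θ) = (starRingEnd ℂ) (ex θ) := by
  simp only [ex, ← Complex.exp_conj]
  congr 1
  simp [Complex.conj_ofNat]

lemma ex_add_int (θ : ℝ) (n : ℤ) : ex (θ + n) = ex θ := by simp [ex_add]

lemma ex_sub_int (θ : ℝ) (n : ℤ) : ex (θ - n) = ex θ := by
  simpa [sub_eq_add_neg] using ex_add_int θ (-n)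

lemma ex_nat_mul (n : ℕ) (θ : ℝ) : ex (n * θ) = ex θ ^ n := by
  rw [ex, ex, ← Complex.exp_nat_mul]
  congr 1
  push_cast
  ring

lemma norm_one_sub_ex_eq (θ : ℝ) : ‖1 - ex θ‖ = 2 * |Real.sin (Real.pi * θ)| := by
  have h : ex θ = Complex.exp (Complex.I * (2 * Real.pi * θ : ℝ)) := by
    simp only [ex]
    congr 1
    push_cast
    ring
  rw [norm_sub_rev, h, Complex.norm_exp_I_mul_ofReal_sub_one]
  rw [norm_mul, Real.norm_eq_abs, Real.norm_eq_abs, abs_two]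
  congr 3
  ring

lemma norm_one_sub_ex_le (θ : ℝ) : ‖1 - ex θ‖ ≤ 2 * Real.pi * |θ| := by
  rw [norm_one_sub_ex_eq]
  have := Real.abs_sin_le_abs (x := Real.pi * θ)
  rw [abs_mul, abs_of_pos Real.pi_pos] at this
  linarith

lemma dn_nonneg (θ : ℝ) : 0 ≤ dn θ := abs_nonneg _

lemma dn_le (θ : ℝ) (n : ℤ) : dn θ ≤ |θ - n| := round_le θ n

lemma dn_add_le (a b : ℝ) : dn (a + b) ≤ dn a + dn b := by
  refine (dn_le _ (round a + round b)).trans ?_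
  refine le_trans (le_of_eq ?_) (abs_add_le _ _)
  push_cast
  ring_nf

lemma dn_neg (a : ℝ) : dn (-a) = dn a := by
  have h (x : ℝ) : dn (-x) ≤ dn x := by
    refine (dn_le _ (-round x)).trans (le_of_eq ?_)
    rw [dn, ← abs_neg]
    push_cast
    ring_nf
  exact le_antisymm (h a) (by simpa using h (-a))

lemma dn_sub_le (a b : ℝ) : dn (a - b) ≤ dn a + dn b := by
  rw [sub_eq_add_neg, ← dn_neg b]
  exact dn_add_le _ _

lemma dn_add_int (a : ℝ) (n : ℤ) : dn (a + n) = dn a := by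
  simp only [dn, round_add_intCast]
  push_cast
  ring_nf

lemma dn_nat_mul_le (n : ℕ) (a : ℝ) : dn (n * a) ≤ n * dn a := by
  refine (dn_le _ (n * round a)).trans (le_of_eq ?_)
  rw [dn]
  push_cast
  rw [← mul_sub, abs_mul, Nat.abs_cast]

lemma four_dn_le (θ : ℝ) : 4 * dn θ ≤ ‖1 - ex θ‖ := by
  have h1 : ex θ = ex (θ - round θ) := (ex_sub_int _ _).symm
  rw [h1, norm_one_sub_ex_eq, dn]
  set t := θ - round θ
  have ht : |t| ≤ 1 / 2 := abs_sub_round θ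
  have h2 := Real.mul_le_sin (x := Real.pi * |t|) (by positivity)
    (by nlinarith [Real.pi_pos])
  have h3 : |Real.sin (Real.pi * t)| = |Real.sin (Real.pi * |t|)| := by
    rcases abs_cases t with ⟨h, _⟩ | ⟨h, _⟩ <;> rw [h]
    simp
  rw [h3]
  have h4 := le_abs_self (Real.sin (Real.pi * |t|))
  have h5 : 2 / Real.pi * (Real.pi * |t|) = 2 * |t| := by
    field_simp
  linarith

lemma norm_one_sub_ex_le_dn (θ : ℝ) : ‖1 - ex θ‖ ≤ 2 * Real.pi * dn θ := by
  rw [← ex_sub_int θ (round θ)]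
  exact norm_one_sub_ex_le _

lemma norm_dirichletSum_le (H : ℕ) (θ : ℝ) : ‖dirichletSum H θ‖ ≤ H := by
  refine (norm_sum_le _ _).trans ?_
  simp

lemma norm_dirichletSum_mul_dn_le (H : ℕ) (θ : ℝ) : ‖dirichletSum H θ‖ * (2 * dn θ) ≤ 1 := by
  have h : dirichletSum H θ * (1 - ex θ) = 1 - ex (H * θ) := by
    simp only [dirichletSum, ex_nat_mul]
    rw [← neg_sub, mul_neg, geom_sum_mul]
    ring
  have h1 : ‖dirichletSum H θ‖ * ‖1 - ex θ‖ ≤ 2 := by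
    rw [← norm_mul, h]
    refine (norm_sub_le _ _).trans ?_
    norm_num
  nlinarith [mul_le_mul_of_nonneg_left (four_dn_le θ) (norm_nonneg (dirichletSum H θ))]

lemma fejer_nonneg (H : ℕ) (θ : ℝ) : 0 ≤ fejer H θ := by
  unfold fejer
  positivity

lemma fejer_le (H : ℕ) (θ : ℝ) : fejer H θ ≤ H := by
  rcases Nat.eq_zero_or_pos H with rfl | hH
  · simp [fejer]
  · have : (0 : ℝ) < H := by exact_mod_cast hH
    rw [fejer, div_le_iff₀ this, ← sq]
    exact pow_le_pow_left₀ (norm_nonneg _) (norm_dirichletSum_le _ _) 2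

lemma fejer_mul_le (H : ℕ) (θ : ℝ) : fejer H θ * (4 * H * dn θ ^ 2) ≤ 1 := by
  rcases Nat.eq_zero_or_pos H with rfl | hH
  · simp [fejer]
  · have : (0 : ℝ) < H := by exact_mod_cast hH
    have h := norm_dirichletSum_mul_dn_le H θ
    have h0 : 0 ≤ ‖dirichletSum H θ‖ * (2 * dn θ) :=
      mul_nonneg (norm_nonneg _) (by linarith [dn_nonneg θ])
    have : fejer H θ * (4 * H * dn θ ^ 2) = (‖dirichletSum H θ‖ * (2 * dn θ)) ^ 2 := by
      rw [fejer]
      field_simp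
      ring
    rw [this]
    nlinarith

lemma fejer_le_of_le_dn {H : ℕ} {θ t : ℝ} (hH : 0 < H) (ht : 0 < t) (h : t ≤ dn θ) :
    fejer H θ ≤ 1 / (4 * H * t ^ 2) := by
  have : (0 : ℝ) < H := by exact_mod_cast hH
  rw [le_div_iff₀ (by positivity)]
  refine le_trans ?_ (fejer_mul_le H θ)
  have := fejer_nonneg H θ
  gcongr

lemma dirichletSum_neg (H : ℕ) (θ : ℝ) :
    dirichletSum H (-θ) = (starRingEnd ℂ) (dirichletSum H θ) := by
  simp only [dirichletSum, map_sum, mul_neg, ex_neg]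

lemma fejer_neg (H : ℕ) (θ : ℝ) : fejer H (-θ) = fejer H θ := by
  simp only [fejer, dirichletSum_neg, RCLike.norm_conj]

lemma le_card_sub_eq (H : ℕ) (m : ℤ) :
    (H : ℤ) - |m| ≤ (((Finset.range H ×ˢ Finset.range H).filter
      (fun p => (p.1 : ℤ) - p.2 = m)).card : ℤ) := by
  have key : (Finset.range (H - m.natAbs)).card ≤
      ((Finset.range H ×ˢ Finset.range H).filter (fun p => (p.1 : ℤ) - p.2 = m)).card := by
    refine Finset.card_le_card_of_injOn (fun j => (j + m.toNat, j + (-m).toNat)) ?_ ?_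
    · intro j hj
      simp only [Finset.coe_range, Set.mem_Iio] at hj
      simp only [Finset.coe_filter, Finset.mem_product, Finset.mem_range, Set.mem_ofPred_eq]
      omega
    · intro a _ b _ h
      simp only [Prod.mk.injEq] at h
      omega
  rw [Finset.card_range] at key
  rw [Int.abs_eq_natAbs]
  omega

lemma window_sum_le (H : ℕ) (n0 : ℤ) (I : Finset ℤ) (hI : ∀ n ∈ I, 2 * |n - n0| ≤ H)
    (g : ℤ → ℝ) (hg : ∀ n, 0 ≤ g n) :
    (H : ℝ) * ∑ n ∈ I, g n ≤
      2 * ∑ p ∈ Finset.range H ×ˢ Finset.range H, g (n0 + p.1 - p.2) := by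
  have h1 : ∀ n ∈ I, (H : ℝ) * g n ≤ 2 * ∑ p ∈ Finset.range H ×ˢ Finset.range H,
      if n = n0 + p.1 - p.2 then g n else 0 := by
    intro n hn
    rw [← Finset.sum_filter, Finset.sum_const, nsmul_eq_mul, ← mul_assoc]
    refine mul_le_mul_of_nonneg_right ?_ (hg n)
    have h2 := le_card_sub_eq H (n - n0)
    have h3 := hI n hn
    have h4 : (Finset.range H ×ˢ Finset.range H).filter (fun p => n = n0 + (p.1 : ℤ) - p.2) =
        (Finset.range H ×ˢ Finset.range H).filter (fun p => (p.1 : ℤ) - p.2 = n - n0) := by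
      refine Finset.filter_congr fun p _ => ?_
      constructor <;> intro h <;> omega
    rw [h4]
    have h5 : (H : ℤ) ≤ 2 * (((Finset.range H ×ˢ Finset.range H).filter
      (fun p => (p.1 : ℤ) - p.2 = n - n0)).card : ℤ) := by linarith
    exact_mod_cast h5
  calc (H : ℝ) * ∑ n ∈ I, g n = ∑ n ∈ I, (H : ℝ) * g n := Finset.mul_sum _ _ _
    _ ≤ ∑ n ∈ I, 2 * ∑ p ∈ Finset.range H ×ˢ Finset.range H,
      (if n = n0 + p.1 - p.2 then g n else 0) := Finset.sum_le_sum h1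
    _ = 2 * ∑ p ∈ Finset.range H ×ˢ Finset.range H, ∑ n ∈ I,
      (if n = n0 + p.1 - p.2 then g n else 0) := by
        rw [← Finset.mul_sum, Finset.sum_comm]
    _ ≤ _ := by
        gcongr with p _
        rw [Finset.sum_ite_eq' I (n0 + p.1 - p.2) g]
        split_ifs
        · exact le_rfl
        · exact hg _

lemma sum_sq_norm_eq {κ : Type*} (K : Finset κ) (z : κ → ℂ) (x : κ → ℝ) (H : ℕ) (n0 : ℤ) :
    ((∑ p ∈ Finset.range H ×ˢ Finset.range H,
      ‖∑ k ∈ K, z k * ex ((n0 + p.1 - p.2 : ℤ) * x k)‖ ^ 2 : ℝ) : ℂ) =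
      ∑ k ∈ K, ∑ l ∈ K, z k * (starRingEnd ℂ) (z l) * ex (n0 * (x k - x l)) *
        (dirichletSum H (x k - x l) * (starRingEnd ℂ) (dirichletSum H (x k - x l))) := by
  push_cast
  have h1 : ∀ p ∈ Finset.range H ×ˢ Finset.range H,
      ((‖∑ k ∈ K, z k * ex ((n0 + p.1 - p.2 : ℝ) * x k)‖ : ℂ)) ^ 2 =
      ∑ k ∈ K, ∑ l ∈ K, z k * (starRingEnd ℂ) (z l) * ex (n0 * (x k - x l)) *
        (ex (p.1 * (x k - x l)) * (starRingEnd ℂ) (ex (p.2 * (x k - x l)))) := by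
    intro p _
    rw [← Complex.mul_conj', map_sum, Finset.sum_mul_sum]
    refine Finset.sum_congr rfl fun k _ => Finset.sum_congr rfl fun l _ => ?_
    have : ex (n0 * (x k - x l)) *
        (ex (p.1 * (x k - x l)) * (starRingEnd ℂ) (ex (p.2 * (x k - x l)))) =
        ex ((n0 + p.1 - p.2) * x k) * (starRingEnd ℂ) (ex ((n0 + p.1 - p.2) * x l)) := by
      rw [← ex_neg, ← ex_neg, ← ex_add, ← ex_add, ← ex_add]
      congr 1
      ring
    rw [mul_assoc (z k * _), this, map_mul]
    ring
  rw [Finset.sum_congr rfl h1, Finset.sum_comm]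
  refine Finset.sum_congr rfl fun k _ => ?_
  rw [Finset.sum_comm]
  refine Finset.sum_congr rfl fun l _ => ?_
  rw [← Finset.mul_sum]
  congr 1
  rw [dirichletSum, map_sum, Finset.sum_mul_sum, Finset.sum_product]

/-- A dual large sieve inequality with the Fejér kernel. -/
theorem sum_sq_norm_le_fejer {κ : Type*} (K : Finset κ) (z : κ → ℂ) (x : κ → ℝ) (H : ℕ)
    (hH : 0 < H) (n0 : ℤ) (I : Finset ℤ) (hI : ∀ n ∈ I, 2 * |n - n0| ≤ H) :
    ∑ n ∈ I, ‖∑ k ∈ K, z k * ex (n * x k)‖ ^ 2 ≤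
      2 * ∑ k ∈ K, ∑ l ∈ K, ‖z k‖ * ‖z l‖ * fejer H (x k - x l) := by
  have hH' : (0 : ℝ) < H := by exact_mod_cast hH
  have h1 := window_sum_le H n0 I hI (fun n => ‖∑ k ∈ K, z k * ex (n * x k)‖ ^ 2)
    (fun n => by positivity)
  have h2 : ∑ p ∈ Finset.range H ×ˢ Finset.range H,
      ‖∑ k ∈ K, z k * ex ((n0 + p.1 - p.2 : ℤ) * x k)‖ ^ 2 ≤
      ∑ k ∈ K, ∑ l ∈ K, ‖z k‖ * ‖z l‖ * (‖dirichletSum H (x k - x l)‖ ^ 2) := by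
    have h3 := congrArg norm (sum_sq_norm_eq K z x H n0)
    rw [Complex.norm_real, Real.norm_of_nonneg (Finset.sum_nonneg fun _ _ => by positivity)] at h3
    rw [h3]
    refine (norm_sum_le _ _).trans (Finset.sum_le_sum fun k _ => ?_)
    refine (norm_sum_le _ _).trans (Finset.sum_le_sum fun l _ => le_of_eq ?_)
    simp only [norm_mul, RCLike.norm_conj, norm_ex]
    ring
  have h4 : ∑ k ∈ K, ∑ l ∈ K, ‖z k‖ * ‖z l‖ * (‖dirichletSum H (x k - x l)‖ ^ 2) =
      H * ∑ k ∈ K, ∑ l ∈ K, ‖z k‖ * ‖z l‖ * fejer H (x k - x l) := by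
    simp only [Finset.mul_sum, fejer]
    refine Finset.sum_congr rfl fun k _ => Finset.sum_congr rfl fun l _ => ?_
    field_simp
  rw [h4] at h2
  have h5 := h1.trans (mul_le_mul_of_nonneg_left h2 zero_le_two)
  refine le_of_mul_le_mul_left (h5.trans (le_of_eq ?_)) hH'
  ring

lemma sum_moebius_divisors (n : ℕ) :
    ∑ d ∈ n.divisors, (ArithmeticFunction.moebius d : ℂ) = if n = 1 then 1 else 0 := by
  have h := congrArg (fun f : ArithmeticFunction ℤ => f n)
    ArithmeticFunction.coe_zeta_mul_moebius
  simp only [ArithmeticFunction.coe_zeta_mul_apply, ArithmeticFunction.one_apply] at h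
  have := congrArg (fun z : ℤ => (z : ℂ)) h
  push_cast at this
  simpa using this

lemma sum_ex_div (m : ℕ) (hm : 0 < m) (n : ℤ) :
    ∑ c ∈ Finset.range m, ex (n * (c / m)) = if (m : ℤ) ∣ n then (m : ℂ) else 0 := by
  have hm' : (m : ℝ) ≠ 0 := by positivity
  split_ifs with h
  · obtain ⟨k, rfl⟩ := h
    have : ∀ c ∈ Finset.range m, ex (((m * k : ℤ) : ℝ) * (c / m)) = 1 := by
      intro c _
      have : ((m * k : ℤ) : ℝ) * (c / m) = ((k * c : ℤ) : ℝ) := by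
        push_cast
        field_simp
      rw [this, ex_int]
    rw [Finset.sum_congr rfl this]
    simp
  · have h1 : ∀ c ∈ Finset.range m, ex (n * (c / m)) = ex (n / m) ^ c := by
      intro c _
      rw [← ex_nat_mul]
      congr 1
      ring
    rw [Finset.sum_congr rfl h1]
    have h2 : ex (n / m) ≠ 1 := by
      intro h2
      apply h
      have h3 := four_dn_le ((n : ℝ) / m)
      rw [h2, sub_self, norm_zero] at h3
      have h4 : (n : ℝ) / m - round ((n : ℝ) / m) = 0 :=
        abs_eq_zero.1 (le_antisymm (by unfold dn at h3; linarith) (abs_nonneg _))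
      refine ⟨round ((n : ℝ) / m), ?_⟩
      have h5 : (n : ℝ) = m * round ((n : ℝ) / m) := by
        have h6 := sub_eq_zero.1 h4
        field_simp at h6
        linarith
      exact_mod_cast h5
    have h3 := geom_sum_mul (ex (n / m)) m
    rw [← ex_nat_mul, mul_div_cancel₀ _ hm', ex_int, sub_self] at h3
    exact (mul_eq_zero.1 h3).resolve_right (sub_ne_zero.2 h2)

/-- The Ramanujan sum `c_r(n)` equals `μ(r)` for `n` coprime to `r`. -/
lemma ramanujan_sum_coprime (r : ℕ) (hr : 0 < r) (n : ℤ) (h : IsCoprime n (r : ℤ)) :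
    ∑ b ∈ (Finset.range r).filter (fun b => r.Coprime b), ex (n * (b / r)) =
      ArithmeticFunction.moebius r := by
  have h1 : ∑ b ∈ (Finset.range r).filter (fun b => r.Coprime b), ex (n * (b / r)) =
      ∑ b ∈ Finset.range r, ∑ d ∈ r.divisors,
        if d ∣ b then (ArithmeticFunction.moebius d : ℂ) * ex (n * (b / r)) else 0 := by
    rw [Finset.sum_filter]
    refine Finset.sum_congr rfl fun b _ => ?_
    have h2 : r.divisors.filter (fun d => d ∣ b) = (r.gcd b).divisors := by
      ext d
      simp only [Finset.mem_filter, Nat.mem_divisors, Nat.dvd_gcd_iff, ne_eq, Nat.gcd_eq_zero_iff]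
      constructor
      · rintro ⟨⟨h3, h4⟩, h5⟩
        exact ⟨⟨h3, h5⟩, fun h6 => h4 h6.1⟩
      · rintro ⟨⟨h3, h5⟩, _⟩
        exact ⟨⟨h3, hr.ne'⟩, h5⟩
    rw [← Finset.sum_filter, h2, ← Finset.sum_mul, sum_moebius_divisors]
    simp only [Nat.coprime_iff_gcd_eq_one]
    split_ifs <;> simp
  rw [h1, Finset.sum_comm]
  have h3 : ∀ d ∈ r.divisors, (∑ b ∈ Finset.range r,
      if d ∣ b then (ArithmeticFunction.moebius d : ℂ) * ex (n * (b / r)) else 0) =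
      if d = r then (ArithmeticFunction.moebius r : ℂ) else 0 := by
    intro d hd
    obtain ⟨m, rfl⟩ := Nat.dvd_of_mem_divisors hd
    have hd0 : 0 < d := Nat.pos_of_mul_pos_right hr
    have hm0 : 0 < m := Nat.pos_of_mul_pos_left hr
    rw [← Finset.sum_filter, ← Finset.mul_sum]
    have h4 : ∑ b ∈ (Finset.range (d * m)).filter (fun b => d ∣ b),
        ex (n * (b / (d * m : ℕ))) = ∑ c ∈ Finset.range m, ex (n * (c / m)) := by
      symm
      refine Finset.sum_bij (fun c _ => d * c) ?_ ?_ ?_ ?_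
      · intro c hc
        simp only [Finset.mem_filter, Finset.mem_range] at hc ⊢
        exact ⟨Nat.mul_lt_mul_of_pos_left hc hd0, dvd_mul_right _ _⟩
      · intro a _ b _ hab
        exact Nat.eq_of_mul_eq_mul_left hd0 hab
      · intro b hb
        simp only [Finset.mem_filter, Finset.mem_range] at hb
        obtain ⟨hb, c, rfl⟩ := hb
        exact ⟨c, Finset.mem_range.2 (Nat.lt_of_mul_lt_mul_left hb), rfl⟩
      · intro c _
        congr 2
        have : (d : ℝ) ≠ 0 := by positivity
        have : (m : ℝ) ≠ 0 := by positivity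
        push_cast
        field_simp
    rw [h4, sum_ex_div m hm0]
    by_cases hm1 : m = 1
    · subst hm1
      simp
    · have h5 : ¬ (m : ℤ) ∣ n := by
        intro h5
        have h6 : (m : ℤ) ∣ ((d * m : ℕ) : ℤ) := by
          push_cast
          exact dvd_mul_left _ _
        have h7 := h.isUnit_of_dvd' h5 h6
        rw [Int.ofNat_isUnit, Nat.isUnit_iff] at h7
        exact hm1 h7
      have h6 : d ≠ d * m := by
        intro h6
        exact hm1 (Nat.eq_of_mul_eq_mul_left hd0 (by omega))
      rw [if_neg h5, if_neg h6, mul_zero]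
  rw [Finset.sum_congr rfl h3, Finset.sum_ite_eq' _ r]
  rw [if_pos (Nat.mem_divisors_self r hr.ne')]

/-- Squarefree numbers up to `R` all of whose prime factors exceed `w`. -/
def sifted (R w : ℕ) : Finset ℕ :=
  (Finset.Icc 1 R).filter (fun r => Squarefree r ∧ ∀ p ∈ r.primeFactors, w < p)

/-- The mass `∑ 1/φ(r)` over sifted `r`. -/
noncomputable def siftMass (R w : ℕ) : ℝ := ∑ r ∈ sifted R w, (1 : ℝ) / r.totient

/-- Reduced fractions in `[0,1)` with sifted denominator, as pairs (denominator, numerator). -/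
def fracs (R w : ℕ) : Finset (Σ _ : ℕ, ℕ) :=
  (sifted R w).sigma (fun r => (Finset.range r).filter (fun b => r.Coprime b))

lemma mem_sifted {R w r : ℕ} : r ∈ sifted R w ↔
    (1 ≤ r ∧ r ≤ R) ∧ Squarefree r ∧ ∀ p ∈ r.primeFactors, w < p := by
  simp [sifted]

lemma mem_fracs {R w : ℕ} {a : Σ _ : ℕ, ℕ} : a ∈ fracs R w ↔
    a.1 ∈ sifted R w ∧ a.2 < a.1 ∧ a.1.Coprime a.2 := by
  simp [fracs]

lemma siftMass_nonneg (R w : ℕ) : 0 ≤ siftMass R w :=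
  Finset.sum_nonneg fun _ _ => by positivity

lemma one_le_siftMass {R : ℕ} (w : ℕ) (hR : 1 ≤ R) : 1 ≤ siftMass R w := by
  have h : (1 : ℕ) ∈ sifted R w := by simp [mem_sifted, hR]
  have := Finset.single_le_sum (f := fun r : ℕ => (1 : ℝ) / r.totient)
    (fun _ _ => by positivity) h
  simpa [siftMass] using this

/-- Summing a function of the denominator over the reduced fractions. -/
lemma sum_fracs (R w : ℕ) (f : ℕ → ℝ) :
    ∑ a ∈ fracs R w, f a.1 = ∑ r ∈ sifted R w, r.totient * f r := by
  rw [fracs, Finset.sum_sigma]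
  refine Finset.sum_congr rfl fun r _ => ?_
  simp only [Finset.sum_const, nsmul_eq_mul, Nat.totient_eq_card_coprime]

lemma totient_pos_of_mem {R w r : ℕ} (h : r ∈ sifted R w) : (0 : ℝ) < r.totient := by
  have := Nat.totient_pos.2 (mem_sifted.1 h).1.1
  exact_mod_cast this

lemma sum_fracs_inv_sq (R w : ℕ) :
    ∑ a ∈ fracs R w, (1 / (a.1.totient : ℝ)) ^ 2 = siftMass R w := by
  rw [sum_fracs R w (fun r => (1 / (r.totient : ℝ)) ^ 2), siftMass]
  refine Finset.sum_congr rfl fun r hr => ?_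
  have := totient_pos_of_mem hr
  field_simp

/-- The sieve weight evaluates to the full mass on integers coprime to all sifted moduli. -/
lemma sum_fracs_ex (R w : ℕ) (n : ℤ) (h : ∀ r ∈ sifted R w, IsCoprime n (r : ℤ)) :
    ∑ a ∈ fracs R w, (ArithmeticFunction.moebius a.1 / a.1.totient : ℂ) *
      ex (n * (a.2 / a.1)) = siftMass R w := by
  rw [fracs, Finset.sum_sigma, siftMass]
  push_cast
  refine Finset.sum_congr rfl fun r hr => ?_
  rw [← Finset.mul_sum, ramanujan_sum_coprime r (mem_sifted.1 hr).1.1 n (h r hr)]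
  have h1 := ArithmeticFunction.moebius_sq_eq_one_of_squarefree (mem_sifted.1 hr).2.1
  have h2 : (ArithmeticFunction.moebius r : ℂ) ^ 2 = 1 := by exact_mod_cast h1
  rw [div_mul_eq_mul_div, ← sq, h2]

lemma sum_fracs_dvd_le (R w p : ℕ) (hp : p.Prime) (hw : w < p) :
    w * ∑ a ∈ (fracs R w).filter (fun a => p ∣ a.1), (1 / (a.1.totient : ℝ)) ^ 2 ≤
      siftMass R w := by
  have h0 : ∑ a ∈ (fracs R w).filter (fun a => p ∣ a.1), (1 / (a.1.totient : ℝ)) ^ 2 =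
      ∑ r ∈ (sifted R w).filter (fun r => p ∣ r), (1 : ℝ) / r.totient := by
    rw [Finset.sum_filter, Finset.sum_filter,
      sum_fracs R w (fun r => if p ∣ r then (1 / (r.totient : ℝ)) ^ 2 else 0)]
    refine Finset.sum_congr rfl fun r hr => ?_
    have := totient_pos_of_mem hr
    split_ifs
    · field_simp
    · simp
  rw [h0, Finset.mul_sum]
  have h1 : ∑ r ∈ (sifted R w).filter (fun r => p ∣ r), (w : ℝ) * (1 / r.totient) ≤
      ∑ r ∈ (sifted R w).filter (fun r => p ∣ r), (1 : ℝ) / (r / p).totient := by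
    refine Finset.sum_le_sum fun r hr => ?_
    rw [Finset.mem_filter] at hr
    obtain ⟨hr, s, rfl⟩ := hr
    rw [Nat.mul_div_cancel_left _ hp.pos]
    have hsq := (mem_sifted.1 hr).2.1
    have hcop : p.Coprime s := (Nat.squarefree_mul_iff.1 hsq).1
    have hs : 0 < s.totient := by
      apply Nat.totient_pos.2
      exact Nat.pos_of_mul_pos_left (mem_sifted.1 hr).1.1
    have hs' : (0 : ℝ) < s.totient := by exact_mod_cast hs
    rw [Nat.totient_mul hcop, Nat.totient_prime hp]
    have hp1 : (w : ℝ) ≤ ((p - 1 : ℕ) : ℝ) := by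
      exact_mod_cast Nat.le_sub_one_of_lt hw
    have hp2 : (0 : ℝ) < ((p - 1 : ℕ) : ℝ) := by
      have := hp.two_le
      exact_mod_cast (by omega : 0 < p - 1)
    push_cast
    rw [mul_one_div, div_le_div_iff₀ (by positivity) hs', one_mul]
    gcongr
  refine h1.trans ?_
  rw [siftMass]
  refine le_trans (le_of_eq ?_) (Finset.sum_le_sum_of_subset_of_nonneg
    (s := ((sifted R w).filter (fun r => p ∣ r)).image (fun r => r / p)) ?_
    (fun _ _ _ => by positivity))
  · rw [Finset.sum_image]
    intro a ha b hb hab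
    simp only [Finset.coe_filter, Set.mem_ofPred_eq] at ha hb
    exact (Nat.div_left_inj ha.2 hb.2).1 hab
  · intro s hs
    rw [Finset.mem_image] at hs
    obtain ⟨r, hr, rfl⟩ := hs
    rw [Finset.mem_filter] at hr
    obtain ⟨hr, s, rfl⟩ := hr
    rw [Nat.mul_div_cancel_left _ hp.pos]
    rw [mem_sifted] at hr ⊢
    obtain ⟨⟨h1, h2⟩, h3, h4⟩ := hr
    have hs : 0 < s := Nat.pos_of_mul_pos_left h1
    refine ⟨⟨hs, le_trans (Nat.le_mul_of_pos_left s hp.pos) h2⟩,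
      (Nat.squarefree_mul_iff.1 h3).2.2, fun q hq => h4 q ?_⟩
    exact Nat.primeFactors_mono (dvd_mul_left s p) (by omega) hq

/-- The real value of a fraction. -/
noncomputable def fv (a : Σ _ : ℕ, ℕ) : ℝ := (a.2 : ℝ) / a.1

lemma eq_int_of_dn_lt {t : ℝ} {D : ℕ} {z : ℤ} (hD : 0 < D) (hz : D * t = z)
    (h : D * dn t < 1) : t = round t := by
  have h1 : |((z - D * round t : ℤ) : ℝ)| < 1 := by
    push_cast
    rw [← hz, ← mul_sub, abs_mul, Nat.abs_cast]
    exact h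
  have h2 : z - D * round t = 0 := by
    rw [← Int.abs_lt_one_iff]
    exact_mod_cast h1
  have hD' : (D : ℝ) ≠ 0 := by positivity
  have h3 : (z : ℝ) = D * round t := by exact_mod_cast sub_eq_zero.1 h2
  rw [h3] at hz
  exact mul_left_cancel₀ hD' hz

lemma fracs_bounds {R w : ℕ} {a : Σ _ : ℕ, ℕ} (ha : a ∈ fracs R w) : 0 < a.1 ∧ a.1 ≤ R := by
  have := (mem_sifted.1 (mem_fracs.1 ha).1).1
  exact ⟨this.1, this.2⟩

lemma den_mul_fv {R w : ℕ} {a : Σ _ : ℕ, ℕ} (ha : a ∈ fracs R w) : (a.1 : ℝ) * fv a = a.2 := by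
  have : (a.1 : ℝ) ≠ 0 := by
    have := (fracs_bounds ha).1
    positivity
  rw [fv]
  field_simp

lemma fv_mem {R w : ℕ} {a : Σ _ : ℕ, ℕ} (ha : a ∈ fracs R w) : 0 ≤ fv a ∧ fv a < 1 := by
  have h := (mem_fracs.1 ha).2.1
  have h0 : (0 : ℝ) < a.1 := by exact_mod_cast (fracs_bounds ha).1
  refine ⟨by unfold fv; positivity, ?_⟩
  rw [fv, div_lt_one h0]
  exact_mod_cast h

lemma fv_inj {R w : ℕ} {a b : Σ _ : ℕ, ℕ} (ha : a ∈ fracs R w) (hb : b ∈ fracs R w)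
    {m : ℤ} (h : fv a - fv b = m) : a = b := by
  have h1 := fv_mem ha
  have h2 := fv_mem hb
  have hm : m = 0 := by
    have h3 : (m : ℝ) < 1 := by linarith
    have h4 : (-1 : ℝ) < m := by linarith
    have h3' : m < 1 := by exact_mod_cast h3
    have h4' : -1 < m := by exact_mod_cast h4
    omega
  rw [hm, Int.cast_zero, sub_eq_zero, fv, fv] at h
  have ha0 := (fracs_bounds ha).1
  have hb0 := (fracs_bounds hb).1
  have ha1 : (a.1 : ℝ) ≠ 0 := by positivity
  have hb1 : (b.1 : ℝ) ≠ 0 := by positivity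
  rw [div_eq_div_iff ha1 hb1] at h
  have h' : a.2 * b.1 = b.2 * a.1 := by exact_mod_cast h
  have hac := (mem_fracs.1 ha).2.2
  have hbc := (mem_fracs.1 hb).2.2
  have h5 : a.1 ∣ b.1 := hac.dvd_of_dvd_mul_left (h' ▸ dvd_mul_left _ _)
  have h6 : b.1 ∣ a.1 := hbc.dvd_of_dvd_mul_left (h' ▸ dvd_mul_left _ _)
  have h7 := Nat.dvd_antisymm h5 h6
  obtain ⟨a1, a2⟩ := a
  obtain ⟨b1, b2⟩ := b
  simp only at h7 h' ha0
  subst h7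
  rw [Nat.eq_of_mul_eq_mul_right ha0 h']

lemma fv_eq_of_close {R w : ℕ} {a b : Σ _ : ℕ, ℕ} (ha : a ∈ fracs R w) (hb : b ∈ fracs R w)
    (h : (R : ℝ) ^ 4 * dn (fv a - fv b) < 1) : a = b := by
  have ha0 := fracs_bounds ha
  have hb0 := fracs_bounds hb
  have hD : 0 < a.1 * b.1 := Nat.mul_pos ha0.1 hb0.1
  have hR : 1 ≤ R := by omega
  refine fv_inj ha hb (eq_int_of_dn_lt hD (z := a.2 * b.1 - b.2 * a.1) ?_ ?_)
  · push_cast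
    rw [← den_mul_fv ha, ← den_mul_fv hb]
    ring
  · refine lt_of_le_of_lt (mul_le_mul_of_nonneg_right ?_ (dn_nonneg _)) h
    have : a.1 * b.1 ≤ R ^ 4 := by
      calc a.1 * b.1 ≤ R * R := Nat.mul_le_mul ha0.2 hb0.2
        _ = R ^ 2 := by ring
        _ ≤ R ^ 4 := Nat.pow_le_pow_right hR (by norm_num)
    exact_mod_cast this

/-- Off-diagonal pairs of fractions whose difference is within `1/(2R⁴)` of `-y` modulo 1. -/
def closePairs (R w : ℕ) (y : ℝ) : Set ((Σ _ : ℕ, ℕ) × (Σ _ : ℕ, ℕ)) :=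
  {p | (p.1 ∈ fracs R w ∧ p.2 ∈ fracs R w) ∧ p.1 ≠ p.2 ∧
    2 * (R : ℝ) ^ 4 * dn (y + fv p.1 - fv p.2) < 1}

lemma closePairs_fst_inj {R w : ℕ} {y : ℝ} : Set.InjOn Prod.fst (closePairs R w y) := by
  rintro ⟨a, b⟩ ⟨⟨_, hb⟩, _, h1⟩ ⟨a', b'⟩ ⟨⟨_, hb'⟩, _, h2⟩ h
  simp only at *
  subst h
  congr 1
  refine fv_eq_of_close hb hb' ?_
  have h3 := dn_sub_le (y + fv a - fv b') (y + fv a - fv b)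
  rw [show y + fv a - fv b' - (y + fv a - fv b) = fv b - fv b' by ring] at h3
  have : (0 : ℝ) ≤ (R : ℝ) ^ 4 := by positivity
  nlinarith

lemma closePairs_snd_inj {R w : ℕ} {y : ℝ} : Set.InjOn Prod.snd (closePairs R w y) := by
  rintro ⟨a, b⟩ ⟨⟨ha, _⟩, _, h1⟩ ⟨a', b'⟩ ⟨⟨ha', _⟩, _, h2⟩ h
  simp only at *
  subst h
  congr 1
  refine fv_eq_of_close ha ha' ?_
  have h3 := dn_sub_le (y + fv a - fv b) (y + fv a' - fv b)
  rw [show y + fv a - fv b - (y + fv a' - fv b) = fv a - fv a' by ring] at h3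
  have : (0 : ℝ) ≤ (R : ℝ) ^ 4 := by positivity
  nlinarith

/-- All close pairs share a large prime. -/
lemma exists_common_prime {R w : ℕ} {y : ℝ} {p0 : (Σ _ : ℕ, ℕ) × (Σ _ : ℕ, ℕ)}
    (h0 : p0 ∈ closePairs R w y) : ∃ q : ℕ, q.Prime ∧ w < q ∧
      ∀ p ∈ closePairs R w y, q ∣ p.1.1 ∨ q ∣ p.2.1 := by
  set ρ : ℚ := (p0.1.2 : ℚ) / p0.1.1 - (p0.2.2 : ℚ) / p0.2.1 with hρ
  have hρ' : (ρ : ℝ) = fv p0.1 - fv p0.2 := by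
    rw [hρ]
    push_cast
    rfl
  have key : ∀ p ∈ closePairs R w y, ρ.den ∣ p.1.1 * p.2.1 := by
    rintro p hp
    have hc : (R : ℝ) ^ 4 * dn (fv p.1 - fv p.2 - (fv p0.1 - fv p0.2)) < 1 := by
      have h3 := dn_sub_le (y + fv p.1 - fv p.2) (y + fv p0.1 - fv p0.2)
      rw [show y + fv p.1 - fv p.2 - (y + fv p0.1 - fv p0.2) =
        fv p.1 - fv p.2 - (fv p0.1 - fv p0.2) by ring] at h3
      have h1 := h0.2.2
      have h2 := hp.2.2
      have : (0 : ℝ) ≤ (R : ℝ) ^ 4 := by positivity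
      nlinarith
    obtain ⟨⟨ha, hb⟩, _, _⟩ := hp
    obtain ⟨⟨ha', hb'⟩, _, _⟩ := h0
    have A := fracs_bounds ha
    have B := fracs_bounds hb
    have A' := fracs_bounds ha'
    have B' := fracs_bounds hb'
    have hD : 0 < (p.1.1 * p.2.1) * (p0.1.1 * p0.2.1) :=
      Nat.mul_pos (Nat.mul_pos A.1 B.1) (Nat.mul_pos A'.1 B'.1)
    have h4 := eq_int_of_dn_lt (t := fv p.1 - fv p.2 - (fv p0.1 - fv p0.2)) hD
      (z := (p.1.2 * p.2.1 - p.2.2 * p.1.1) * (p0.1.1 * p0.2.1) -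
        (p0.1.2 * p0.2.1 - p0.2.2 * p0.1.1) * (p.1.1 * p.2.1)) (by
          push_cast
          rw [← den_mul_fv ha, ← den_mul_fv hb, ← den_mul_fv ha', ← den_mul_fv hb']
          ring) (by
          refine lt_of_le_of_lt (mul_le_mul_of_nonneg_right ?_ (dn_nonneg _)) hc
          have : (p.1.1 * p.2.1) * (p0.1.1 * p0.2.1) ≤ (R * R) * (R * R) :=
            Nat.mul_le_mul (Nat.mul_le_mul A.2 B.2) (Nat.mul_le_mul A'.2 B'.2)
          calc (((p.1.1 * p.2.1) * (p0.1.1 * p0.2.1) : ℕ) : ℝ) ≤ (((R * R) * (R * R) : ℕ) : ℝ) := by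
                exact_mod_cast this
            _ = (R : ℝ) ^ 4 := by push_cast; ring)
    set m := round (fv p.1 - fv p.2 - (fv p0.1 - fv p0.2))
    have h5 : ρ = (((p.1.2 * p.2.1 - p.2.2 * p.1.1 - m * (p.1.1 * p.2.1) : ℤ)) : ℚ) /
        ((p.1.1 * p.2.1 : ℕ) : ℤ) := by
      have hne : ((p.1.1 * p.2.1 : ℕ) : ℝ) ≠ 0 := by
        exact_mod_cast (Nat.mul_pos A.1 B.1).ne'
      have h6 : (ρ : ℝ) = (((p.1.2 * p.2.1 - p.2.2 * p.1.1 - m * (p.1.1 * p.2.1) : ℤ)) : ℝ) /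
          ((p.1.1 * p.2.1 : ℕ) : ℝ) := by
        rw [eq_div_iff hne]
        push_cast
        rw [← h4, ← den_mul_fv ha, ← den_mul_fv hb, hρ']
        ring
      exact_mod_cast h6
    have h7 := Rat.den_dvd (p.1.2 * p.2.1 - p.2.2 * p.1.1 - m * (p.1.1 * p.2.1))
      ((p.1.1 * p.2.1 : ℕ) : ℤ)
    rw [Rat.divInt_eq_div, ← h5] at h7
    exact_mod_cast h7
  have hden : ρ.den ≠ 1 := by
    intro h
    have h1 : ρ = ρ.num := by
      conv_lhs => rw [← Rat.num_div_den ρ, h]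
      simp
    have h2 : fv p0.1 - fv p0.2 = (ρ.num : ℤ) := by
      rw [← hρ']
      exact_mod_cast h1
    exact h0.2.1 (fv_inj h0.1.1 h0.1.2 h2)
  have hq := Nat.minFac_prime hden
  have hdvd : ∀ p ∈ closePairs R w y, ρ.den.minFac ∣ p.1.1 ∨ ρ.den.minFac ∣ p.2.1 :=
    fun p hp => (Nat.Prime.dvd_mul hq).1 ((Nat.minFac_dvd _).trans (key p hp))
  refine ⟨ρ.den.minFac, hq, ?_, hdvd⟩
  have hw : ∀ a ∈ fracs R w, ρ.den.minFac ∣ a.1 → w < ρ.den.minFac := by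
    intro a ha hd
    exact (mem_sifted.1 (mem_fracs.1 ha).1).2.2 _
      (Nat.mem_primeFactors.2 ⟨hq, hd, (fracs_bounds ha).1.ne'⟩)
  rcases hdvd p0 h0 with h | h
  · exact hw _ h0.1.1 h
  · exact hw _ h0.1.2 h

lemma sum_weights_of_inj {κ : Type*} (F : Finset κ) (u : κ → ℝ)
    (T : Finset (κ × κ)) (hT : ∀ p ∈ T, p.1 ∈ F ∧ p.2 ∈ F)
    (h1 : Set.InjOn Prod.fst (T : Set (κ × κ))) (h2 : Set.InjOn Prod.snd (T : Set (κ × κ)))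
    (P : κ → Prop) [DecidablePred P] (hP : ∀ p ∈ T, P p.1) (s : ℝ) (hs : 0 < s) :
    ∑ p ∈ T, u p.1 * u p.2 ≤ s / 2 * ∑ a ∈ F.filter P, u a ^ 2 + 1 / (2 * s) * ∑ a ∈ F, u a ^ 2 := by
  classical
  have e1 : ∑ p ∈ T, u p.1 ^ 2 ≤ ∑ a ∈ F.filter P, u a ^ 2 := by
    rw [← Finset.sum_image (f := fun a => u a ^ 2) (g := Prod.fst) h1]
    refine Finset.sum_le_sum_of_subset_of_nonneg ?_ (fun _ _ _ => by positivity)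
    intro a ha
    obtain ⟨p, hp, rfl⟩ := Finset.mem_image.1 ha
    exact Finset.mem_filter.2 ⟨(hT p hp).1, hP p hp⟩
  have e2 : ∑ p ∈ T, u p.2 ^ 2 ≤ ∑ a ∈ F, u a ^ 2 := by
    rw [← Finset.sum_image (f := fun a => u a ^ 2) (g := Prod.snd) h2]
    refine Finset.sum_le_sum_of_subset_of_nonneg ?_ (fun _ _ _ => by positivity)
    intro a ha
    obtain ⟨p, hp, rfl⟩ := Finset.mem_image.1 ha
    exact (hT p hp).2
  calc ∑ p ∈ T, u p.1 * u p.2 ≤ ∑ p ∈ T, (s / 2 * u p.1 ^ 2 + 1 / (2 * s) * u p.2 ^ 2) := by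
        refine Finset.sum_le_sum fun p _ => ?_
        have : s / 2 * u p.1 ^ 2 + 1 / (2 * s) * u p.2 ^ 2 - u p.1 * u p.2 =
          (s * u p.1 - u p.2) ^ 2 / (2 * s) := by
          field_simp
          ring
        have h3 : 0 ≤ (s * u p.1 - u p.2) ^ 2 / (2 * s) := by positivity
        linarith
    _ ≤ _ := by
        rw [Finset.sum_add_distrib, ← Finset.mul_sum, ← Finset.mul_sum]
        gcongr

lemma sum_closePairs_le (R w : ℕ) (hw : 1 ≤ w) (y : ℝ)
    (T : Finset ((Σ _ : ℕ, ℕ) × (Σ _ : ℕ, ℕ))) (hT : ∀ p ∈ T, p ∈ closePairs R w y) :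
    ∑ p ∈ T, (1 / (p.1.1.totient : ℝ)) * (1 / (p.2.1.totient : ℝ)) ≤
      2 * siftMass R w / √w := by
  classical
  have hG := siftMass_nonneg R w
  rcases T.eq_empty_or_nonempty with rfl | ⟨p0, hp0⟩
  · simp only [Finset.sum_empty]
    positivity
  obtain ⟨q, hq, hwq, hdvd⟩ := exists_common_prime (hT p0 hp0)
  have hw' : (0 : ℝ) < w := by exact_mod_cast hw
  have hs : (0 : ℝ) < √w := Real.sqrt_pos.2 hw'
  have hss : √(w : ℝ) * √w = w := Real.mul_self_sqrt hw'.le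
  have hsub : ∀ p ∈ T, p.1 ∈ fracs R w ∧ p.2 ∈ fracs R w := fun p hp => (hT p hp).1
  have hi1 : Set.InjOn Prod.fst (T : Set ((Σ _ : ℕ, ℕ) × (Σ _ : ℕ, ℕ))) :=
    closePairs_fst_inj.mono hT
  have hi2 : Set.InjOn Prod.snd (T : Set ((Σ _ : ℕ, ℕ) × (Σ _ : ℕ, ℕ))) :=
    closePairs_snd_inj.mono hT
  set u : (Σ _ : ℕ, ℕ) → ℝ := fun a => 1 / (a.1.totient : ℝ) with hu
  have hB := sum_fracs_dvd_le R w q hq hwq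
  have hbound : √(w : ℝ) / 2 * ∑ a ∈ (fracs R w).filter (fun a => q ∣ a.1), u a ^ 2 +
      1 / (2 * √w) * ∑ a ∈ fracs R w, u a ^ 2 ≤ siftMass R w / √w := by
    rw [sum_fracs_inv_sq, le_div_iff₀ hs]
    have : 1 / (2 * √(w : ℝ)) * siftMass R w * √w = siftMass R w / 2 := by field_simp
    rw [add_mul, this]
    nlinarith
  have hA : ∑ p ∈ T.filter (fun p => q ∣ p.1.1), u p.1 * u p.2 ≤ siftMass R w / √w := by
    refine le_trans (sum_weights_of_inj (fracs R w) u _ (fun p hp =>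
      hsub p (Finset.mem_filter.1 hp).1) (hi1.mono ?_) (hi2.mono ?_)
      (fun a => q ∣ a.1) (fun p hp => (Finset.mem_filter.1 hp).2) _ hs) hbound
    all_goals exact_mod_cast Finset.filter_subset _ _
  have hC : ∑ p ∈ T.filter (fun p => q ∣ p.2.1), u p.1 * u p.2 ≤ siftMass R w / √w := by
    have e1 : ∑ p ∈ T.filter (fun p => q ∣ p.2.1), u p.1 * u p.2 =
        ∑ p ∈ (T.filter (fun p => q ∣ p.2.1)).image Prod.swap, u p.1 * u p.2 := by
      rw [Finset.sum_image Prod.swap_injective.injOn]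
      exact Finset.sum_congr rfl fun p _ => mul_comm _ _
    rw [e1]
    refine le_trans (sum_weights_of_inj (fracs R w) u _ ?_ ?_ ?_
      (fun a => q ∣ a.1) ?_ _ hs) hbound
    · intro p hp
      obtain ⟨p', hp', rfl⟩ := Finset.mem_image.1 hp
      exact (hsub p' (Finset.mem_filter.1 hp').1).symm
    · rintro p hp p' hp' h
      obtain ⟨a, ha, rfl⟩ := Finset.mem_image.1 hp
      obtain ⟨a', ha', rfl⟩ := Finset.mem_image.1 hp'
      rw [hi2 (Finset.mem_filter.1 ha).1 (Finset.mem_filter.1 ha').1 h]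
    · rintro p hp p' hp' h
      obtain ⟨a, ha, rfl⟩ := Finset.mem_image.1 hp
      obtain ⟨a', ha', rfl⟩ := Finset.mem_image.1 hp'
      rw [hi1 (Finset.mem_filter.1 ha).1 (Finset.mem_filter.1 ha').1 h]
    · intro p hp
      obtain ⟨a, ha, rfl⟩ := Finset.mem_image.1 hp
      exact (Finset.mem_filter.1 ha).2
  have hcover : T ⊆ T.filter (fun p => q ∣ p.1.1) ∪ T.filter (fun p => q ∣ p.2.1) := by
    intro p hp
    rcases hdvd p (hT p hp) with h | h
    · exact Finset.mem_union_left _ (Finset.mem_filter.2 ⟨hp, h⟩)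
    · exact Finset.mem_union_right _ (Finset.mem_filter.2 ⟨hp, h⟩)
  have hnn : ∀ p : (Σ _ : ℕ, ℕ) × (Σ _ : ℕ, ℕ), 0 ≤ u p.1 * u p.2 := fun p => by
    simp only [hu]
    positivity
  calc ∑ p ∈ T, u p.1 * u p.2 ≤
      ∑ p ∈ T.filter (fun p => q ∣ p.1.1) ∪ T.filter (fun p => q ∣ p.2.1), u p.1 * u p.2 :=
        Finset.sum_le_sum_of_subset_of_nonneg hcover (fun p _ _ => hnn p)
    _ ≤ _ := by
        have h := Finset.sum_union_inter (s₁ := T.filter (fun p => q ∣ p.1.1))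
          (s₂ := T.filter (fun p => q ∣ p.2.1)) (f := fun p => u p.1 * u p.2)
        have h' : 0 ≤ ∑ p ∈ T.filter (fun p => q ∣ p.1.1) ∩ T.filter (fun p => q ∣ p.2.1),
          u p.1 * u p.2 := Finset.sum_nonneg fun p _ => hnn p
        rw [mul_div_assoc]
        linarith

lemma sum_fracs_inv_le (R w : ℕ) : ∑ a ∈ fracs R w, 1 / (a.1.totient : ℝ) ≤ R := by
  rw [sum_fracs R w (fun r => 1 / (r.totient : ℝ))]
  have h : ∑ r ∈ sifted R w, (r.totient : ℝ) * (1 / (r.totient : ℝ)) = (sifted R w).card := by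
    rw [Finset.cast_card]
    exact Finset.sum_congr rfl fun r hr => by
      have := totient_pos_of_mem hr
      field_simp
  rw [h]
  have : (sifted R w).card ≤ R := by
    refine (Finset.card_filter_le _ _).trans ?_
    simp
  exact_mod_cast this

/-- The Fejér kernel averaged over differences of sifted fractions. -/
lemma sum_fejer_fracs_le (R w H : ℕ) (hR : 1 ≤ R) (hw : 1 ≤ w) (hH : 0 < H) (y : ℝ) :
    ∑ a ∈ fracs R w, ∑ b ∈ fracs R w, (1 / (a.1.totient : ℝ)) * (1 / (b.1.totient : ℝ)) *
      fejer H (y + fv a - fv b) ≤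
    siftMass R w * fejer H y + 2 * siftMass R w * H / √w + (R : ℝ) ^ 10 / H := by
  classical
  have hH' : (0 : ℝ) < H := by exact_mod_cast hH
  have hR' : (0 : ℝ) < R := by exact_mod_cast hR
  set u : (Σ _ : ℕ, ℕ) → ℝ := fun a => 1 / (a.1.totient : ℝ) with hu
  have hun : ∀ a, 0 ≤ u a := fun a => by
    simp only [hu]
    positivity
  have hpt : ∀ p ∈ fracs R w ×ˢ fracs R w, u p.1 * u p.2 * fejer H (y + fv p.1 - fv p.2) ≤
      (if p.1 = p.2 then u p.1 ^ 2 * fejer H y else 0) +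
      (if p ∈ closePairs R w y then u p.1 * u p.2 * H else 0) +
      u p.1 * u p.2 * ((R : ℝ) ^ 8 / H) := by
    rintro ⟨a, b⟩ hp
    have hp' := Finset.mem_product.1 hp
    have hab : 0 ≤ u a * u b := mul_nonneg (hun a) (hun b)
    have hf := fejer_nonneg H y
    have h3 : 0 ≤ u a * u b * ((R : ℝ) ^ 8 / H) := by positivity
    have h2 : 0 ≤ (if (a, b) ∈ closePairs R w y then u a * u b * H else 0) := by
      split_ifs <;> positivity
    have h1 : 0 ≤ (if a = b then u a ^ 2 * fejer H y else 0) := by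
      split_ifs <;> positivity
    simp only
    by_cases hEq : a = b
    · subst hEq
      rw [if_pos rfl, add_sub_cancel_right]
      rw [sq]
      linarith
    by_cases hcl : (a, b) ∈ closePairs R w y
    · rw [if_pos hcl]
      have := mul_le_mul_of_nonneg_left (fejer_le H (y + fv a - fv b)) hab
      linarith
    · have hdn : 1 / (2 * (R : ℝ) ^ 4) ≤ dn (y + fv a - fv b) := by
        rw [div_le_iff₀ (by positivity)]
        by_contra hlt
        exact hcl ⟨⟨hp'.1, hp'.2⟩, hEq, by linarith⟩
      have h4 := fejer_le_of_le_dn hH (by positivity) hdn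
      have h5 : 1 / (4 * (H : ℝ) * (1 / (2 * (R : ℝ) ^ 4)) ^ 2) = (R : ℝ) ^ 8 / H := by
        field_simp
        norm_num
      rw [h5] at h4
      have := mul_le_mul_of_nonneg_left h4 hab
      linarith
  rw [← Finset.sum_product (s := fracs R w) (t := fracs R w)
    (f := fun p => u p.1 * u p.2 * fejer H (y + fv p.1 - fv p.2))]
  refine (Finset.sum_le_sum hpt).trans ?_
  rw [Finset.sum_add_distrib, Finset.sum_add_distrib]
  refine add_le_add (add_le_add ?_ ?_) ?_
  · rw [Finset.sum_product]
    simp only [Finset.sum_ite_eq]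
    have : ∀ a ∈ fracs R w, (if a ∈ fracs R w then u a ^ 2 * fejer H y else 0) =
      u a ^ 2 * fejer H y := fun a ha => if_pos ha
    rw [Finset.sum_congr rfl this, ← Finset.sum_mul, sum_fracs_inv_sq]
  · rw [← Finset.sum_filter, ← Finset.sum_mul]
    have := sum_closePairs_le R w hw y
      ((fracs R w ×ˢ fracs R w).filter (fun p => p ∈ closePairs R w y))
      (fun p hp => (Finset.mem_filter.1 hp).2)
    rw [mul_div_right_comm]
    exact mul_le_mul_of_nonneg_right this hH'.le
  · rw [← Finset.sum_mul, Finset.sum_product, ← Finset.sum_mul_sum]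
    have h1 := sum_fracs_inv_le R w
    have h0 : 0 ≤ ∑ a ∈ fracs R w, u a := Finset.sum_nonneg fun a _ => hun a
    have h2 : (∑ a ∈ fracs R w, u a) * (∑ a ∈ fracs R w, u a) ≤ R * R :=
      mul_le_mul h1 h1 h0 hR'.le
    calc _ ≤ (R : ℝ) * R * ((R : ℝ) ^ 8 / H) := by gcongr
      _ = _ := by ring

/-- The `TT*` inequality for exponential sums restricted to integers free of small primes. -/
theorem sieve_dual {ι : Type*} (J : Finset ι) (c : ι → ℂ) (x : ι → ℝ) (R w H : ℕ) (hR : 1 ≤ R)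
    (hw : 1 ≤ w) (hH : 0 < H) (n0 : ℤ) (I : Finset ℤ) (hI : ∀ n ∈ I, 2 * |n - n0| ≤ H)
    (hrough : ∀ n ∈ I, ∀ p : ℕ, p.Prime → (p : ℤ) ∣ n → R < p) :
    siftMass R w ^ 2 * ∑ n ∈ I, ‖∑ j ∈ J, c j * ex (n * x j)‖ ^ 2 ≤
      2 * ∑ j ∈ J, ∑ l ∈ J, ‖c j‖ * ‖c l‖ * (siftMass R w * fejer H (x j - x l) +
        2 * siftMass R w * H / √w + (R : ℝ) ^ 10 / H) := by
  have hcop : ∀ n ∈ I, ∀ r ∈ sifted R w, IsCoprime n (r : ℤ) := by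
    intro n hn r hr
    have hr' := (mem_sifted.1 hr).1
    rw [Int.isCoprime_iff_gcd_eq_one]
    by_contra h
    obtain ⟨p, hp, hpd⟩ := Nat.exists_prime_and_dvd h
    have h1 : (p : ℤ) ∣ n := (Int.natCast_dvd_natCast.2 hpd).trans (Int.gcd_dvd_left _ _)
    have h2 : (p : ℤ) ∣ r := (Int.natCast_dvd_natCast.2 hpd).trans (Int.gcd_dvd_right _ _)
    have h3 := Nat.le_of_dvd hr'.1 (Int.natCast_dvd_natCast.1 h2)
    have h4 := hrough n hn p hp h1
    omega
  set z : ι × (Σ _ : ℕ, ℕ) → ℂ := fun k =>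
    c k.1 * (ArithmeticFunction.moebius k.2.1 / k.2.1.totient : ℂ) with hz
  set X : ι × (Σ _ : ℕ, ℕ) → ℝ := fun k => x k.1 + fv k.2 with hX
  have h1 := sum_sq_norm_le_fejer (J ×ˢ fracs R w) z X H hH n0 I hI
  have h2 : ∀ n ∈ I, ‖∑ k ∈ J ×ˢ fracs R w, z k * ex (n * X k)‖ ^ 2 =
      siftMass R w ^ 2 * ‖∑ j ∈ J, c j * ex (n * x j)‖ ^ 2 := by
    intro n hn
    have h3 := sum_fracs_ex R w n (hcop n hn)
    have h4 : ∑ k ∈ J ×ˢ fracs R w, z k * ex (n * X k) =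
        (∑ j ∈ J, c j * ex (n * x j)) * siftMass R w := by
      rw [← h3, Finset.sum_mul_sum, Finset.sum_product]
      refine Finset.sum_congr rfl fun j _ => Finset.sum_congr rfl fun a _ => ?_
      simp only [hz, hX, mul_add, ex_add, fv]
      ring
    rw [h4, norm_mul, Complex.norm_real, Real.norm_of_nonneg (siftMass_nonneg _ _)]
    ring
  rw [Finset.sum_congr rfl h2, ← Finset.mul_sum] at h1
  refine h1.trans (mul_le_mul_of_nonneg_left ?_ zero_le_two)
  rw [Finset.sum_product]
  refine Finset.sum_le_sum fun j _ => ?_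
  have h5 : ∀ a ∈ fracs R w, ∑ k ∈ J ×ˢ fracs R w, ‖z (j, a)‖ * ‖z k‖ * fejer H (X (j, a) - X k) =
      ∑ l ∈ J, ‖c j‖ * ‖c l‖ * ∑ b ∈ fracs R w, (1 / (a.1.totient : ℝ)) *
        (1 / (b.1.totient : ℝ)) * fejer H ((x j - x l) + fv a - fv b) := by
    intro a ha
    rw [Finset.sum_product]
    refine Finset.sum_congr rfl fun l _ => ?_
    rw [Finset.mul_sum]
    refine Finset.sum_congr rfl fun b hb => ?_
    have hnorm : ∀ a ∈ fracs R w, ‖(ArithmeticFunction.moebius a.1 / a.1.totient : ℂ)‖ =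
        1 / (a.1.totient : ℝ) := by
      intro a ha
      have h6 := ArithmeticFunction.abs_moebius_eq_one_of_squarefree
        (mem_sifted.1 (mem_fracs.1 ha).1).2.1
      rw [norm_div, Complex.norm_natCast, Complex.norm_intCast]
      congr 1
      exact_mod_cast h6
    simp only [hz, hX, norm_mul, hnorm a ha, hnorm b hb]
    rw [show x j + fv a - (x l + fv b) = x j - x l + fv a - fv b by ring]
    ring
  rw [Finset.sum_congr rfl h5, Finset.sum_comm]
  refine Finset.sum_le_sum fun l _ => ?_
  rw [← Finset.mul_sum]
  gcongr
  exact sum_fejer_fracs_le R w H hR hw hH _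

/-- The primes up to `w`. -/
def primesTo (w : ℕ) : Finset ℕ := (Finset.Ioc 0 w).filter Nat.Prime

/-- The reciprocal sum over `n ≤ R` not divisible by any element of `P`. -/
noncomputable def recipSum (R : ℕ) (P : Finset ℕ) : ℝ :=
  ∑ n ∈ (Finset.Icc 1 R).filter (fun n => ∀ p ∈ P, ¬ p ∣ n), (1 : ℝ) / n

lemma mem_primesTo {w p : ℕ} : p ∈ primesTo w ↔ p.Prime ∧ p ≤ w := by
  simp only [primesTo, Finset.mem_filter, Finset.mem_Ioc]
  constructor
  · rintro ⟨h1, h2⟩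
    exact ⟨h2, h1.2⟩
  · rintro ⟨h1, h2⟩
    exact ⟨⟨h1.pos, h2⟩, h1⟩

lemma recipSum_insert (R : ℕ) (P : Finset ℕ) (p : ℕ) (hp : 0 < p) :
    (1 - 1 / (p : ℝ)) * recipSum R P ≤ recipSum R (insert p P) := by
  have hp' : (0 : ℝ) < p := by exact_mod_cast hp
  have h1 : recipSum R P = recipSum R (insert p P) +
      ∑ n ∈ ((Finset.Icc 1 R).filter (fun n => ∀ p ∈ P, ¬ p ∣ n)).filter (fun n => p ∣ n),
        (1 : ℝ) / n := by
    rw [recipSum, ← Finset.sum_filter_not_add_sum_filter _ (fun n => p ∣ n), recipSum,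
      Finset.filter_filter]
    congr 1
    refine Finset.sum_congr (Finset.filter_congr fun n _ => ?_) fun _ _ => rfl
    simp only [Finset.mem_insert, forall_eq_or_imp]
    exact and_comm
  have h2 : ∑ n ∈ ((Finset.Icc 1 R).filter (fun n => ∀ p ∈ P, ¬ p ∣ n)).filter (fun n => p ∣ n),
        (1 : ℝ) / n ≤ 1 / p * recipSum R P := by
    rw [recipSum, Finset.mul_sum]
    refine le_trans ?_ (Finset.sum_le_sum_of_subset_of_nonneg
      (s := (((Finset.Icc 1 R).filter (fun n => ∀ p ∈ P, ¬ p ∣ n)).filter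
        (fun n => p ∣ n)).image (fun n => n / p)) ?_ (fun _ _ _ => by positivity))
    · rw [Finset.sum_image]
      · refine Finset.sum_le_sum fun n hn => ?_
        obtain ⟨m, rfl⟩ := (Finset.mem_filter.1 hn).2
        rw [Nat.mul_div_cancel_left _ hp]
        push_cast
        rw [one_div_mul_one_div]
      · intro a ha b hb hab
        exact (Nat.div_left_inj (Finset.mem_filter.1 ha).2 (Finset.mem_filter.1 hb).2).1 hab
    · intro n hn
      obtain ⟨k, hk, rfl⟩ := Finset.mem_image.1 hn
      simp only [Finset.mem_filter, Finset.mem_Icc] at hk ⊢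
      obtain ⟨⟨⟨h1, h2⟩, h3⟩, m, rfl⟩ := hk
      rw [Nat.mul_div_cancel_left _ hp]
      refine ⟨⟨Nat.pos_of_mul_pos_left h1, le_trans (Nat.le_mul_of_pos_left m hp) h2⟩, ?_⟩
      intro q hq hqm
      exact h3 q hq (hqm.mul_left p)
  rw [sub_mul, one_mul]
  linarith

lemma prod_mul_recipSum_le (R : ℕ) (P : Finset ℕ) (hP : ∀ p ∈ P, 1 < p) :
    (∏ p ∈ P, (1 - 1 / (p : ℝ))) * recipSum R ∅ ≤ recipSum R P := by
  induction P using Finset.induction_on with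
  | empty => simp
  | insert p P hp ih =>
    rw [Finset.prod_insert hp, mul_assoc]
    have h1 : 1 < p := hP p (Finset.mem_insert_self _ _)
    have h1' : (1 : ℝ) < p := by exact_mod_cast h1
    refine le_trans (mul_le_mul_of_nonneg_left (ih fun q hq => hP q (Finset.mem_insert_of_mem hq))
      ?_) (recipSum_insert R P p (by omega))
    rw [sub_nonneg, div_le_one (by linarith)]
    exact h1'.le

lemma sum_inv_sq_le (R : ℕ) : ∑ s ∈ Finset.Icc 1 R, 1 / (s : ℝ) ^ 2 ≤ 2 := by
  have h : ∀ n : ℕ, ∑ s ∈ Finset.Icc 1 (n + 1), 1 / (s : ℝ) ^ 2 ≤ 2 - 1 / ((n : ℝ) + 1) := by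
    intro n
    induction n with
    | zero => norm_num
    | succ n ih =>
      rw [Finset.sum_Icc_succ_top (by omega)]
      have : 1 / ((n + 1 + 1 : ℕ) : ℝ) ^ 2 ≤ 1 / (n + 1) - 1 / ((n + 1 : ℕ) + 1) := by
        push_cast
        rw [div_sub_div _ _ (by positivity) (by positivity),
          div_le_div_iff₀ (by positivity) (by positivity)]
        have : (0 : ℝ) ≤ n := by positivity
        nlinarith
      push_cast at this ih ⊢
      linarith
  rcases R with _ | n
  · simp
  · have : (0 : ℝ) ≤ 1 / ((n : ℝ) + 1) := by positivity
    linarith [h n]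

lemma recipSum_primesTo_le (R w : ℕ) : recipSum R (primesTo w) ≤ 2 * siftMass R w := by
  classical
  have h1 : recipSum R (primesTo w) ≤
      ∑ q ∈ sifted R w ×ˢ Finset.Icc 1 R, 1 / (q.1 : ℝ) * (1 / (q.2 : ℝ) ^ 2) := by
    rw [recipSum]
    have hex : ∀ n ∈ (Finset.Icc 1 R).filter (fun n => ∀ p ∈ primesTo w, ¬ p ∣ n),
        ∃ q ∈ sifted R w ×ˢ Finset.Icc 1 R, q.2 ^ 2 * q.1 = n := by
      intro n hn
      simp only [Finset.mem_filter, Finset.mem_Icc] at hn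
      obtain ⟨⟨hn1, hnR⟩, hn2⟩ := hn
      obtain ⟨a, b, ha, hb, hab, hsq⟩ := Nat.sq_mul_squarefree_of_pos hn1
      have ha' : a ≤ n := hab ▸ Nat.le_mul_of_pos_left a (by positivity)
      have hb' : b ≤ n := by
        rw [← hab]
        nlinarith
      refine ⟨(a, b), ?_, hab⟩
      rw [Finset.mem_product, mem_sifted, Finset.mem_Icc]
      refine ⟨⟨⟨ha, ha'.trans hnR⟩, hsq, fun p hp => ?_⟩, hb, hb'.trans hnR⟩
      by_contra hlt
      have hp' := Nat.mem_primeFactors.1 hp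
      exact hn2 p (mem_primesTo.2 ⟨hp'.1, by omega⟩) (hab ▸ hp'.2.1.mul_left _)
    choose! g hg using hex
    have hinj : Set.InjOn g ((Finset.Icc 1 R).filter (fun n => ∀ p ∈ primesTo w, ¬ p ∣ n)) := by
      intro a ha b hb hab
      rw [← (hg a ha).2, ← (hg b hb).2, hab]
    refine le_trans (le_of_eq ?_) (Finset.sum_le_sum_of_subset_of_nonneg
      (s := ((Finset.Icc 1 R).filter (fun n => ∀ p ∈ primesTo w, ¬ p ∣ n)).image g) ?_
      (fun _ _ _ => by positivity))
    · rw [Finset.sum_image hinj]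
      refine Finset.sum_congr rfl fun n hn => ?_
      rw [one_div_mul_one_div]
      have h2 : (((g n).2 ^ 2 * (g n).1 : ℕ) : ℝ) = n := by rw [(hg n hn).2]
      rw [← h2]
      push_cast
      rw [mul_comm]
    · intro q hq
      obtain ⟨n, hn, rfl⟩ := Finset.mem_image.1 hq
      exact (hg n hn).1
  refine h1.trans ?_
  rw [Finset.sum_product]
  simp only [← Finset.mul_sum, ← Finset.sum_mul]
  rw [mul_comm]
  have h2 : ∑ r ∈ sifted R w, 1 / (r : ℝ) ≤ siftMass R w := by
    refine Finset.sum_le_sum fun r hr => ?_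
    have := totient_pos_of_mem hr
    have h3 := Nat.totient_le r
    gcongr
  have h3 : 0 ≤ ∑ r ∈ sifted R w, 1 / (r : ℝ) := Finset.sum_nonneg fun _ _ => by positivity
  exact mul_le_mul (sum_inv_sq_le R) h2 h3 zero_le_two

lemma log_le_recipSum (R : ℕ) : Real.log R ≤ recipSum R ∅ := by
  have h1 := log_le_harmonic_floor (R : ℝ) (by positivity)
  rw [Nat.floor_natCast, harmonic_eq_sum_Icc] at h1
  push_cast at h1
  simpa [recipSum] using h1

/-- Mertens-type product. -/
noncomputable def mertens (w : ℕ) : ℝ := ∏ p ∈ primesTo w, (1 - 1 / (p : ℝ))⁻¹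

lemma one_sub_inv_pos {p : ℕ} (hp : p.Prime) : (0 : ℝ) < 1 - 1 / p := by
  have : (1 : ℝ) < p := by exact_mod_cast hp.one_lt
  rw [sub_pos, div_lt_one (by linarith)]
  exact this

lemma mertens_pos (w : ℕ) : 0 < mertens w :=
  Finset.prod_pos fun _ hp => inv_pos.2 (one_sub_inv_pos (mem_primesTo.1 hp).1)

lemma one_le_inv_factor {p : ℕ} (hp : p.Prime) : (1 : ℝ) ≤ (1 - 1 / (p : ℝ))⁻¹ := by
  refine (one_le_inv₀ (one_sub_inv_pos hp)).2 ?_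
  have : (0 : ℝ) ≤ 1 / p := by positivity
  linarith

lemma primesTo_mono {v w : ℕ} (h : v ≤ w) : primesTo v ⊆ primesTo w := fun _ hp =>
  mem_primesTo.2 ⟨(mem_primesTo.1 hp).1, (mem_primesTo.1 hp).2.trans h⟩

lemma mertens_mono {v w : ℕ} (h : v ≤ w) : mertens v ≤ mertens w :=
  Finset.prod_le_prod_of_subset_of_one_le (primesTo_mono h)
    (fun _ hp => (inv_pos.2 (one_sub_inv_pos (mem_primesTo.1 hp).1)).le)
    fun _ hp _ => one_le_inv_factor (mem_primesTo.1 hp).1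

lemma log_le_mertens_mul (R w : ℕ) : Real.log R ≤ 2 * mertens w * siftMass R w := by
  have h1 := prod_mul_recipSum_le R (primesTo w) (fun p hp => (mem_primesTo.1 hp).1.one_lt)
  have h2 := recipSum_primesTo_le R w
  have h3 := log_le_recipSum R
  have h4 : mertens w * ∏ p ∈ primesTo w, (1 - 1 / (p : ℝ)) = 1 := by
    rw [mertens, ← Finset.prod_mul_distrib]
    exact Finset.prod_eq_one fun p hp => inv_mul_cancel₀ (one_sub_inv_pos (mem_primesTo.1 hp).1).ne'
  have h5 := mertens_pos w
  calc Real.log R ≤ recipSum R ∅ := h3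
    _ = mertens w * ((∏ p ∈ primesTo w, (1 - 1 / (p : ℝ))) * recipSum R ∅) := by
        rw [← mul_assoc, h4, one_mul]
    _ ≤ mertens w * (2 * siftMass R w) := by
        exact mul_le_mul_of_nonneg_left (h1.trans h2) h5.le
    _ = _ := by ring

lemma inv_factor_le_exp {p : ℕ} (hp : p.Prime) : (1 - 1 / (p : ℝ))⁻¹ ≤ Real.exp (2 / p) := by
  have hp2 : (2 : ℝ) ≤ p := by exact_mod_cast hp.two_le
  have h0 := one_sub_inv_pos hp
  rw [inv_le_iff_one_le_mul₀ h0]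
  have h1 := Real.add_one_le_exp (2 / (p : ℝ))
  have h2 : 1 ≤ (2 / (p : ℝ) + 1) * (1 - 1 / p) := by
    have : (2 / (p : ℝ) + 1) * (1 - 1 / p) = 1 + (p - 2) / p ^ 2 := by
      field_simp
      ring
    rw [this]
    have : (0 : ℝ) ≤ (p - 2) / (p : ℝ) ^ 2 := div_nonneg (by linarith) (by positivity)
    linarith
  exact h2.trans (mul_le_mul_of_nonneg_right h1 h0.le)

lemma sum_dyadic_inv_le (k : ℕ) (hk : 1 ≤ k) :
    ∑ p ∈ primesTo (2 ^ (k + 1)) \ primesTo (2 ^ k), 2 / (p : ℝ) ≤ 8 / k := by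
  have hk' : (0 : ℝ) < k := by exact_mod_cast hk
  have hl2 := Real.log_pos one_lt_two
  have h1 : ∀ p ∈ primesTo (2 ^ (k + 1)) \ primesTo (2 ^ k), 2 / (p : ℝ) ≤
      Real.log p * (2 / (2 ^ k * (k * Real.log 2))) := by
    intro p hp
    rw [Finset.mem_sdiff, mem_primesTo, mem_primesTo] at hp
    have hp2 : 2 ^ k < p := by
      by_contra h
      exact hp.2 ⟨hp.1.1, by omega⟩
    have hp3 : (2 : ℝ) ^ k ≤ p := by exact_mod_cast hp2.le
    have h2k : (0 : ℝ) < 2 ^ k := by positivity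
    have hlog : k * Real.log 2 ≤ Real.log p := by
      rw [← Real.log_pow]
      exact Real.log_le_log h2k hp3
    have hp0 : (0 : ℝ) < p := h2k.trans_le hp3
    rw [mul_div_assoc', div_le_div_iff₀ hp0 (by positivity)]
    calc 2 * (2 ^ k * (k * Real.log 2)) ≤ 2 * (p * Real.log p) := by gcongr
      _ = _ := by ring
  refine (Finset.sum_le_sum h1).trans ?_
  rw [← Finset.sum_mul]
  have h2 : ∑ p ∈ primesTo (2 ^ (k + 1)) \ primesTo (2 ^ k), Real.log p ≤
      Real.log 4 * 2 ^ (k + 1) := by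
    have h3 := Chebyshev.theta_le_log4_mul_x (x := ((2 ^ (k + 1) : ℕ) : ℝ)) (by positivity)
    rw [Chebyshev.theta, Nat.floor_natCast] at h3
    push_cast at h3
    refine le_trans (Finset.sum_le_sum_of_subset_of_nonneg Finset.sdiff_subset fun p hp _ =>
      Real.log_nonneg ?_) h3
    exact_mod_cast (mem_primesTo.1 hp).1.one_lt.le
  have h4 : Real.log 4 = 2 * Real.log 2 := by
    rw [show (4 : ℝ) = 2 ^ 2 by norm_num, Real.log_pow]
    norm_num
  calc _ ≤ Real.log 4 * 2 ^ (k + 1) * (2 / (2 ^ k * (k * Real.log 2))) := by gcongr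
    _ = 8 / k := by
      rw [h4, pow_succ]
      field_simp
      norm_num

lemma mertens_dyadic (k : ℕ) (hk : 1 ≤ k) :
    mertens (2 ^ (k + 1)) ≤ mertens (2 ^ k) * Real.exp (8 / k) := by
  have hsub : primesTo (2 ^ k) ⊆ primesTo (2 ^ (k + 1)) :=
    primesTo_mono (Nat.pow_le_pow_right (by norm_num) (by omega))
  rw [mertens, ← Finset.prod_sdiff hsub, mul_comm, ← mertens]
  refine mul_le_mul_of_nonneg_left ?_ (mertens_pos _).le
  have hprime : ∀ p ∈ primesTo (2 ^ (k + 1)) \ primesTo (2 ^ k), p.Prime := fun p hp =>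
    (mem_primesTo.1 (Finset.mem_sdiff.1 hp).1).1
  refine (Finset.prod_le_prod (fun p hp => (inv_pos.2 (one_sub_inv_pos (hprime p hp))).le)
    fun p hp => inv_factor_le_exp (hprime p hp)).trans ?_
  rw [← Real.exp_sum]
  exact Real.exp_le_exp.2 (sum_dyadic_inv_le k hk)

lemma exists_mertens_le (κ : ℝ) (hκ : 0 < κ) :
    ∃ C : ℝ, 0 < C ∧ ∀ w : ℕ, 1 ≤ w → mertens w ≤ C * (w : ℝ) ^ κ := by
  obtain ⟨K0, hK0⟩ := exists_nat_ge (8 / (κ * Real.log 2))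
  have hl2 := Real.log_pos one_lt_two
  have hpow : ∀ K : ℕ, mertens (2 ^ K) ≤ mertens (2 ^ (K0 + 1)) * (2 : ℝ) ^ (κ * K) := by
    intro K
    rcases le_or_gt K (K0 + 1) with h | h
    · refine (mertens_mono (Nat.pow_le_pow_right (by norm_num) h)).trans ?_
      refine le_mul_of_one_le_right (mertens_pos _).le ?_
      exact Real.one_le_rpow one_le_two (by positivity)
    · induction K, h.le using Nat.le_induction with
      | base => omega
      | succ k hk ih =>
        have ih' : mertens (2 ^ k) ≤ mertens (2 ^ (K0 + 1)) * (2 : ℝ) ^ (κ * k) := by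
          rcases hk.eq_or_lt with h' | h'
          · rw [← h']
            refine le_mul_of_one_le_right (mertens_pos _).le ?_
            exact Real.one_le_rpow one_le_two (by positivity)
          · exact ih h'
        have hk1 : 1 ≤ k := by omega
        have hk0 : (0 : ℝ) < k := by exact_mod_cast hk1
        have hkK : (K0 : ℝ) ≤ k := by exact_mod_cast (by omega : K0 ≤ k)
        have h8 : Real.exp (8 / k) ≤ (2 : ℝ) ^ κ := by
          rw [Real.rpow_def_of_pos two_pos, Real.exp_le_exp, div_le_iff₀ hk0]
          have h9 := hK0.trans hkK
          rw [div_le_iff₀ (by positivity)] at h9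
          linarith
        refine (mertens_dyadic k hk1).trans ?_
        push_cast
        rw [mul_add, mul_one, Real.rpow_add two_pos, ← mul_assoc]
        exact mul_le_mul ih' h8 (Real.exp_pos _).le
          (mul_nonneg (mertens_pos _).le (by positivity))
  refine ⟨mertens (2 ^ (K0 + 1)) * 2 ^ κ, mul_pos (mertens_pos _) (by positivity), fun w hw => ?_⟩
  have h1 : w ≤ 2 ^ (Nat.log 2 w + 1) := (Nat.lt_pow_succ_log_self (by norm_num) w).le
  have h2 : 2 ^ Nat.log 2 w ≤ w := Nat.pow_log_le_self 2 (by omega)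
  refine (mertens_mono h1).trans ((hpow _).trans ?_)
  push_cast
  rw [mul_add, mul_one, Real.rpow_add two_pos, mul_comm ((2 : ℝ) ^ _), ← mul_assoc]
  refine mul_le_mul_of_nonneg_left ?_ (mul_nonneg (mertens_pos _).le
    (Real.rpow_nonneg two_pos.le _))
  rw [mul_comm, Real.rpow_mul two_pos.le, Real.rpow_natCast]
  refine Real.rpow_le_rpow (by positivity) ?_ hκ.le
  exact_mod_cast h2

/-- The mass of sifted moduli is at least `log R` up to a loss of an arbitrarily small power. -/
theorem exists_log_le_siftMass (κ : ℝ) (hκ : 0 < κ) :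
    ∃ C : ℝ, 0 < C ∧ ∀ R w : ℕ, 1 ≤ w → Real.log R ≤ C * (w : ℝ) ^ κ * siftMass R w := by
  obtain ⟨C, hC, h⟩ := exists_mertens_le κ hκ
  refine ⟨2 * C, by positivity, fun R w hw => (log_le_mertens_mul R w).trans ?_⟩
  have := siftMass_nonneg R w
  have := h w hw
  rw [mul_assoc 2 C]
  gcongr

open ArithmeticFunction in
lemma sum_vonMangoldt_minFac_eq_le (N p : ℕ) (hN : 1 ≤ N) :
    ∑ n ∈ (Finset.Ioc 0 N).filter (fun n => n.minFac = p), vonMangoldt n ≤ Real.log N := by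
  by_cases hp : p.Prime
  swap
  · rw [Finset.sum_eq_zero]
    · exact Real.log_natCast_nonneg N
    · intro n hn
      rw [Finset.mem_filter] at hn
      have : n = 1 := by
        by_contra h
        exact hp (hn.2 ▸ Nat.minFac_prime h)
      simp [this]
  have hL : p ^ Nat.log p N ≤ N := Nat.pow_log_le_self p (by lia)
  have hpos : 0 < p ^ Nat.log p N := pow_pos hp.pos _
  calc ∑ n ∈ (Finset.Ioc 0 N).filter (fun n => n.minFac = p), vonMangoldt n
      = ∑ n ∈ ((Finset.Ioc 0 N).filter (fun n => n.minFac = p)).filter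
          (fun n => vonMangoldt n ≠ 0), vonMangoldt n := (Finset.sum_filter_ne_zero _).symm
    _ ≤ ∑ n ∈ (p ^ Nat.log p N).divisors, vonMangoldt n := by
        apply Finset.sum_le_sum_of_subset_of_nonneg
        · intro n hn
          simp only [Finset.mem_filter, Finset.mem_Ioc, vonMangoldt_ne_zero_iff] at hn
          obtain ⟨⟨⟨h0, hnN⟩, hmin⟩, hpp⟩ := hn
          rw [isPrimePow_nat_iff] at hpp
          obtain ⟨q, k, hq, hk, rfl⟩ := hpp
          rw [hq.pow_minFac (by lia)] at hmin
          subst hmin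
          rw [Nat.mem_divisors]
          refine ⟨pow_dvd_pow _ ?_, hpos.ne'⟩
          exact (Nat.le_log_iff_pow_le hq.one_lt (by lia)).2 hnN
        · intros; exact vonMangoldt_nonneg
    _ = Real.log ((p ^ Nat.log p N : ℕ) : ℝ) := vonMangoldt_sum
    _ ≤ Real.log N := by
        apply Real.log_le_log
        · exact_mod_cast hpos
        · exact_mod_cast hL

open ArithmeticFunction in
lemma sum_vonMangoldt_minFac_le (N R : ℕ) (hN : 1 ≤ N) :
    ∑ n ∈ (Finset.Ioc 0 N).filter (fun n => n.minFac ≤ R), vonMangoldt n ≤ R * Real.log N := by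
  rw [← Finset.sum_fiberwise_of_maps_to (t := Finset.Icc 1 R) (g := Nat.minFac)]
  · calc _ ≤ ∑ p ∈ Finset.Icc 1 R, Real.log N := by
          apply Finset.sum_le_sum
          intro p hp
          refine le_trans ?_ (sum_vonMangoldt_minFac_eq_le N p hN)
          apply Finset.sum_le_sum_of_subset_of_nonneg
          · intro n hn
            simp only [Finset.mem_filter] at hn ⊢
            exact ⟨hn.1.1, hn.2⟩
          · intros; exact vonMangoldt_nonneg
      _ = _ := by simp
  · intro n hn
    rw [Finset.mem_filter] at hn
    rw [Finset.mem_Icc]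
    exact ⟨n.minFac_pos, hn.2⟩

open ArithmeticFunction in
lemma sum_vonMangoldt_le (N : ℕ) : ∑ n ∈ Finset.Ioc 0 N, vonMangoldt n ≤ 6 * N := by
  have h := Chebyshev.psi_le_const_mul_self (x := N) (by positivity)
  rw [Chebyshev.psi, Nat.floor_natCast] at h
  have h4 : Real.log 4 ≤ 2 := by
    have : Real.log 4 = 2 * Real.log 2 := by
      rw [show (4 : ℝ) = 2 ^ 2 by norm_num, Real.log_pow]; norm_num
    linarith [Real.log_two_lt_d9]
  have : (0 : ℝ) ≤ N := by positivity
  nlinarith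

open ArithmeticFunction in
lemma sum_sq_le_of_le_vonMangoldt (N : ℕ) (f : ℕ → ℝ) (hf : ∀ n, 0 ≤ f n ∧ f n ≤ vonMangoldt n) :
    ∑ n ∈ Finset.Ioc 0 N, f n ^ 2 ≤ 6 * N * Real.log N := by
  calc ∑ n ∈ Finset.Ioc 0 N, f n ^ 2 ≤ ∑ n ∈ Finset.Ioc 0 N, vonMangoldt n * Real.log N := by
        apply Finset.sum_le_sum
        intro n hn
        rw [Finset.mem_Ioc] at hn
        have h1 : vonMangoldt n ≤ Real.log N :=
          vonMangoldt_le_log.trans (Real.log_le_log (by exact_mod_cast hn.1) (by exact_mod_cast hn.2))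
        rw [sq]
        exact mul_le_mul (hf n).2 ((hf n).2.trans h1) (hf n).1 vonMangoldt_nonneg
    _ ≤ _ := by
        rw [← Finset.sum_mul]
        exact mul_le_mul_of_nonneg_right (sum_vonMangoldt_le N) (Real.log_natCast_nonneg N)

/-- Integer root: for `N ≥ 1` there is `R` with `R ^ 20 ≤ N` and `log N ≤ 20 log (2R)`. -/
lemma exists_root (N : ℕ) (hN : 1 ≤ N) :
    ∃ R : ℕ, 1 ≤ R ∧ R ^ 20 ≤ N ∧ Real.log N ≤ 20 * Real.log (2 * R) := by
  refine ⟨Nat.findGreatest (fun R => R ^ 20 ≤ N) N, ?_, ?_, ?_⟩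
  · exact Nat.le_findGreatest hN (by simpa using hN)
  · exact Nat.findGreatest_spec (P := fun R => R ^ 20 ≤ N) (m := 1) hN (by simpa using hN)
  · set R := Nat.findGreatest (fun R => R ^ 20 ≤ N) N
    have h1 : 1 ≤ R := Nat.le_findGreatest hN (by simpa using hN)
    have h2 : N < (R + 1) ^ 20 := by
      by_contra h
      push Not at h
      have h3 : R + 1 ≤ N := le_trans (Nat.le_self_pow (by norm_num) _) h
      have := Nat.le_findGreatest (P := fun R => R ^ 20 ≤ N) h3 h
      change R + 1 ≤ R at this
      lia
    have h3 : (N : ℝ) ≤ (2 * R : ℝ) ^ 20 := by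
      have : N ≤ (2 * R) ^ 20 := h2.le.trans (Nat.pow_le_pow_left (by lia) _)
      exact_mod_cast this
    calc Real.log N ≤ Real.log ((2 * R : ℝ) ^ 20) := Real.log_le_log (by exact_mod_cast hN) h3
      _ = _ := by rw [Real.log_pow]; norm_num

/-- The exponential sum `∑_{0 < n ≤ N} f(n) e(nθ)`. -/
noncomputable def expSum (f : ℕ → ℝ) (N : ℕ) (θ : ℝ) : ℂ :=
  ∑ n ∈ Finset.Ioc 0 N, (f n : ℂ) * ex (n * θ)

lemma sum_mul_expSum {ι : Type*} (f : ℕ → ℝ) (N : ℕ) (J : Finset ι) (c : ι → ℂ) (x : ι → ℝ) :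
    ∑ j ∈ J, c j * expSum f N (x j) =
      ∑ n ∈ Finset.Ioc 0 N, (f n : ℂ) * ∑ j ∈ J, c j * ex (n * x j) := by
  simp only [expSum, Finset.mul_sum]
  rw [Finset.sum_comm]
  refine Finset.sum_congr rfl fun n _ => Finset.sum_congr rfl fun j _ => by ring

open ArithmeticFunction in
lemma rough_part_le {ι : Type*} (C1 : ℝ) (hC1 : 0 < C1) (N m R : ℕ) (hN : 1 ≤ N) (hm : 1 ≤ m)
    (hmN : m ^ 10 ≤ N) (hR : 1 ≤ R) (hRN : R ^ 20 ≤ N)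
    (hlog : Real.log N ≤ 40 * C1 * m * siftMass R (m ^ 10))
    (f : ℕ → ℝ) (hf : ∀ n, 0 ≤ f n ∧ f n ≤ vonMangoldt n)
    (J : Finset ι) (c : ι → ℂ) (x : ι → ℝ) :
    (∑ n ∈ (Finset.Ioc 0 N).filter (fun n => R < n.minFac),
      f n * ‖∑ j ∈ J, c j * ex (n * x j)‖) ^ 2 ≤ 2400 * C1 * N * m *
      ∑ j ∈ J, ∑ l ∈ J, ‖c j‖ * ‖c l‖ * (fejer (2 * N) (x j - x l) + N / m ^ 5) := by
  set G := siftMass R (m ^ 10) with hG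
  have hG1 : 1 ≤ G := one_le_siftMass _ hR
  have hm0 : (0 : ℝ) < m := by exact_mod_cast hm
  have hN0 : (0 : ℝ) < N := by exact_mod_cast hN
  set I := (Finset.Ioc 0 N).filter (fun n => R < n.minFac) with hI
  set T : ℕ → ℝ := fun n => ‖∑ j ∈ J, c j * ex (n * x j)‖ with hT
  have h1 : (∑ n ∈ I, f n * T n) ^ 2 ≤ (∑ n ∈ I, f n ^ 2) * ∑ n ∈ I, T n ^ 2 :=
    Finset.sum_mul_sq_le_sq_mul_sq _ _ _
  have h2 : ∑ n ∈ I, f n ^ 2 ≤ 6 * N * (40 * C1 * m * G) := by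
    calc _ ≤ ∑ n ∈ Finset.Ioc 0 N, f n ^ 2 :=
          Finset.sum_le_sum_of_subset_of_nonneg (Finset.filter_subset _ _) (fun _ _ _ => sq_nonneg _)
      _ ≤ _ := sum_sq_le_of_le_vonMangoldt N f hf
      _ ≤ _ := by gcongr
  have h3 := sieve_dual J c x R (m ^ 10) (2 * N) hR (Nat.one_le_pow _ _ hm) (by lia) 0
    (I.map Nat.castEmbedding) (by
      intro n hn
      rw [Finset.mem_map] at hn
      obtain ⟨k, hk, rfl⟩ := hn
      rw [hI, Finset.mem_filter, Finset.mem_Ioc] at hk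
      simp only [Nat.castEmbedding_apply, sub_zero, Nat.abs_cast]
      lia) (by
      intro n hn p hp hpn
      rw [Finset.mem_map] at hn
      obtain ⟨k, hk, rfl⟩ := hn
      rw [hI, Finset.mem_filter, Finset.mem_Ioc] at hk
      simp only [Nat.castEmbedding_apply] at hpn
      exact hk.2.trans_le (Nat.minFac_le_of_dvd hp.two_le (by exact_mod_cast hpn)))
  rw [Finset.sum_map] at h3
  simp only [Nat.castEmbedding_apply, Int.cast_natCast] at h3
  rw [← hG] at h3
  have hsq : √(((m ^ 10 : ℕ)) : ℝ) = (m : ℝ) ^ 5 := by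
    rw [show (((m ^ 10 : ℕ)) : ℝ) = ((m : ℝ) ^ 5) ^ 2 by push_cast; ring]
    exact Real.sqrt_sq (by positivity)
  have hm5 : (m : ℝ) ^ 5 ≤ N := by
    have : m ^ 5 ≤ m ^ 10 := Nat.pow_le_pow_right hm (by norm_num)
    exact_mod_cast this.trans hmN
  have hR10 : (R : ℝ) ^ 10 ≤ N := by
    have : R ^ 10 ≤ R ^ 20 := Nat.pow_le_pow_right hR (by norm_num)
    exact_mod_cast this.trans hRN
  set Q := ∑ j ∈ J, ∑ l ∈ J, ‖c j‖ * ‖c l‖ * (fejer (2 * N) (x j - x l) + N / m ^ 5) with hQ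
  have h4 : ∑ j ∈ J, ∑ l ∈ J, ‖c j‖ * ‖c l‖ * (G * fejer (2 * N) (x j - x l) +
        2 * G * ((2 * N : ℕ) : ℝ) / √(((m ^ 10 : ℕ)) : ℝ) + (R : ℝ) ^ 10 / ((2 * N : ℕ) : ℝ)) ≤
        5 * G * Q := by
    rw [hQ, Finset.mul_sum]
    refine Finset.sum_le_sum fun j _ => ?_
    rw [Finset.mul_sum]
    refine Finset.sum_le_sum fun l _ => ?_
    rw [mul_left_comm (5 * G)]
    refine mul_le_mul_of_nonneg_left ?_ (by positivity)
    rw [hsq]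
    have e1 : (R : ℝ) ^ 10 / ((2 * N : ℕ) : ℝ) ≤ 1 := by
      rw [div_le_one (by positivity)]
      push_cast
      linarith
    have e2 : 1 ≤ (N : ℝ) / m ^ 5 := by
      rwa [one_le_div (by positivity)]
    have e3 := fejer_nonneg (2 * N) (x j - x l)
    have e4 : 2 * G * ((2 * N : ℕ) : ℝ) / (m : ℝ) ^ 5 = 4 * G * (N / m ^ 5) := by
      push_cast; ring
    rw [e4]
    have e5 : 1 * 1 ≤ G * ((N : ℝ) / m ^ 5) := mul_le_mul hG1 e2 (by norm_num) (by linarith)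
    have e6 : 0 ≤ G * fejer (2 * N) (x j - x l) := by positivity
    nlinarith
  have h5 : G ^ 2 * ∑ n ∈ I, T n ^ 2 ≤ 2 * (5 * G * Q) := h3.trans (by linarith)
  have h6 : G * ∑ n ∈ I, T n ^ 2 ≤ 10 * Q := by
    have : G * (G * ∑ n ∈ I, T n ^ 2) ≤ G * (10 * Q) := by nlinarith
    exact le_of_mul_le_mul_left this (by linarith)
  calc _ ≤ _ := h1
    _ ≤ (6 * N * (40 * C1 * m * G)) * ∑ n ∈ I, T n ^ 2 :=
        mul_le_mul_of_nonneg_right h2 (Finset.sum_nonneg fun _ _ => sq_nonneg _)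
    _ = 240 * C1 * N * m * (G * ∑ n ∈ I, T n ^ 2) := by ring
    _ ≤ 240 * C1 * N * m * (10 * Q) := mul_le_mul_of_nonneg_left h6 (by positivity)
    _ = _ := by ring

open ArithmeticFunction in
/-- Bilinear sieve inequality: for `0 ≤ f ≤ Λ`, the `f`-weighted mean of the absolute value of an
exponential polynomial is controlled by a Fejér energy, with losses polynomial in `m` only. -/
theorem sum_mul_norm_sq_le : ∃ C : ℝ, 1 ≤ C ∧ ∃ N0 : ℕ, 1 ≤ N0 ∧ ∀ N ≥ N0, ∀ m : ℕ, 1 ≤ m →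
    m ^ 10 ≤ N → ∀ f : ℕ → ℝ, (∀ n, 0 ≤ f n ∧ f n ≤ vonMangoldt n) →
    ∀ {ι : Type} (J : Finset ι) (c : ι → ℂ) (x : ι → ℝ),
    (∑ n ∈ Finset.Ioc 0 N, f n * ‖∑ j ∈ J, c j * ex (n * x j)‖) ^ 2 ≤ C * N * m *
      ∑ j ∈ J, ∑ l ∈ J, ‖c j‖ * ‖c l‖ * (fejer (2 * N) (x j - x l) + N / m ^ 5) := by
  obtain ⟨C1, hC1, hlogG⟩ := exists_log_le_siftMass (1 / 10) (by norm_num)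
  refine ⟨4800 * C1 + 3200, by linarith, 2 ^ 20 + 1, by norm_num, ?_⟩
  intro N hN m hm hmN f hf ι J c x
  have hN1 : 1 ≤ N := le_trans (by norm_num) hN
  obtain ⟨R, hR, hRN, hlogN⟩ := exists_root N hN1
  have hm0 : (0 : ℝ) < m := by exact_mod_cast hm
  have hN0 : (0 : ℝ) < N := by exact_mod_cast hN1
  have hR0 : (0 : ℝ) < R := by exact_mod_cast hR
  have hR2 : 2 ≤ R := by
    by_contra h
    have : R = 1 := by lia
    subst this
    have h2 : (20 : ℝ) * Real.log (2 * (1 : ℕ)) = Real.log (2 ^ 20) := by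
      rw [Real.log_pow]; norm_num
    rw [h2, Real.log_le_log_iff hN0 (by positivity)] at hlogN
    have : N ≤ 2 ^ 20 := by exact_mod_cast hlogN
    lia
  have hR2' : (2 : ℝ) ≤ R := by exact_mod_cast hR2
  have hlogN' : Real.log N ≤ 40 * Real.log R := by
    rw [Real.log_mul (by norm_num) hR0.ne'] at hlogN
    have := Real.log_le_log (by norm_num) hR2'
    linarith
  have hlog : Real.log N ≤ 40 * C1 * m * siftMass R (m ^ 10) := by
    have := hlogG R (m ^ 10) (Nat.one_le_pow _ _ hm)
    have e : (((m ^ 10 : ℕ)) : ℝ) ^ (1 / 10 : ℝ) = m := by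
      rw [Nat.cast_pow, ← Real.rpow_natCast, ← Real.rpow_mul hm0.le]
      norm_num
    rw [e] at this
    linarith
  have hA := rough_part_le C1 hC1 N m R hN1 hm hmN hR hRN hlog f hf J c x
  set Q := ∑ j ∈ J, ∑ l ∈ J, ‖c j‖ * ‖c l‖ * (fejer (2 * N) (x j - x l) + N / m ^ 5) with hQ
  set T : ℕ → ℝ := fun n => ‖∑ j ∈ J, c j * ex (n * x j)‖ with hT
  set A := ∑ j ∈ J, ‖c j‖ with hAdef
  have hA0 : 0 ≤ A := Finset.sum_nonneg fun _ _ => norm_nonneg _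
  have hTA : ∀ n, T n ≤ A := by
    intro n
    refine (norm_sum_le _ _).trans (Finset.sum_le_sum fun j _ => ?_)
    rw [norm_mul, norm_ex, mul_one]
  have hsmall : ∑ n ∈ (Finset.Ioc 0 N).filter (fun n => ¬ R < n.minFac), f n * T n ≤
      40 * R ^ 2 * A := by
    calc _ ≤ ∑ n ∈ (Finset.Ioc 0 N).filter (fun n => n.minFac ≤ R), vonMangoldt n * A := by
          simp only [not_lt]
          refine Finset.sum_le_sum fun n _ => ?_
          exact mul_le_mul (hf n).2 (hTA n) (norm_nonneg _) vonMangoldt_nonneg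
      _ ≤ (R * Real.log N) * A := by
          rw [← Finset.sum_mul]
          exact mul_le_mul_of_nonneg_right (sum_vonMangoldt_minFac_le N R hN1) hA0
      _ ≤ (R * (40 * R)) * A := by
          have := Real.log_le_self hR0.le
          gcongr
          linarith
      _ = _ := by ring
  have hsmall0 : 0 ≤ ∑ n ∈ (Finset.Ioc 0 N).filter (fun n => ¬ R < n.minFac), f n * T n :=
    Finset.sum_nonneg fun n _ => mul_nonneg (hf n).1 (norm_nonneg _)
  have hQA : A ^ 2 * (N / m ^ 5) ≤ Q := by
    rw [hQ, sq, hAdef, Finset.sum_mul_sum, Finset.sum_mul]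
    refine Finset.sum_le_sum fun j _ => ?_
    rw [Finset.sum_mul]
    refine Finset.sum_le_sum fun l _ => ?_
    refine mul_le_mul_of_nonneg_left ?_ (by positivity)
    linarith [fejer_nonneg (2 * N) (x j - x l)]
  have hsq2 : (40 * (R : ℝ) ^ 2 * A) ^ 2 ≤ 1600 * N * m * Q := by
    have hR4 : (R : ℝ) ^ 4 ≤ N := by
      have : R ^ 4 ≤ R ^ 20 := Nat.pow_le_pow_right hR (by norm_num)
      exact_mod_cast this.trans hRN
    have hm4 : (m : ℝ) ^ 4 ≤ N := by
      have : m ^ 4 ≤ m ^ 10 := Nat.pow_le_pow_right hm (by norm_num)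
      exact_mod_cast this.trans hmN
    calc (40 * (R : ℝ) ^ 2 * A) ^ 2 = 1600 * R ^ 4 * A ^ 2 := by ring
      _ ≤ 1600 * N * A ^ 2 := by gcongr
      _ ≤ 1600 * N * (m * (A ^ 2 * (N / m ^ 5))) := by
          have : (m : ℝ) * (A ^ 2 * (N / m ^ 5)) = A ^ 2 * (N / m ^ 4) := by
            field_simp
          rw [this]
          have : 1 ≤ (N : ℝ) / m ^ 4 := by rwa [one_le_div (by positivity)]
          have := mul_le_mul_of_nonneg_left this (sq_nonneg A)
          rw [mul_one] at this
          gcongr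
      _ ≤ 1600 * N * (m * Q) := by gcongr
      _ = _ := by ring
  rw [← Finset.sum_filter_add_sum_filter_not _ (fun n => R < n.minFac)]
  have := mul_self_le_mul_self hsmall0 hsmall
  set a := ∑ n ∈ (Finset.Ioc 0 N).filter (fun n => R < n.minFac), f n * T n
  set b := ∑ n ∈ (Finset.Ioc 0 N).filter (fun n => ¬ R < n.minFac), f n * T n
  have := sq_nonneg (a - b)
  nlinarith

open ArithmeticFunction in
theorem norm_sum_expSum_sq_le : ∃ C : ℝ, 1 ≤ C ∧ ∃ N0 : ℕ, 1 ≤ N0 ∧ ∀ N ≥ N0, ∀ m : ℕ, 1 ≤ m →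
    m ^ 10 ≤ N → ∀ f : ℕ → ℝ, (∀ n, 0 ≤ f n ∧ f n ≤ vonMangoldt n) →
    ∀ {ι : Type} (J : Finset ι) (c : ι → ℂ) (x : ι → ℝ),
    ‖∑ j ∈ J, c j * expSum f N (x j)‖ ^ 2 ≤ C * N * m *
      ∑ j ∈ J, ∑ l ∈ J, ‖c j‖ * ‖c l‖ * (fejer (2 * N) (x j - x l) + N / m ^ 5) := by
  obtain ⟨C, hC, N0, hN0, hmain⟩ := sum_mul_norm_sq_le
  refine ⟨C, hC, N0, hN0, fun N hN m hm hmN f hf ι J c x => le_trans ?_ (hmain N hN m hm hmN f hf J c x)⟩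
  gcongr
  rw [sum_mul_expSum]
  refine (norm_sum_le _ _).trans (Finset.sum_le_sum fun n _ => ?_)
  rw [norm_mul, Complex.norm_real, Real.norm_of_nonneg (hf n).1]

lemma sum_ex_mul_conj (M : ℕ) (hM : 0 < M) (n k : ℕ) (hn : n < M) (hk : k < M) (y : ℝ) :
    ∑ r ∈ Finset.range M, ex (n * (r / M - y)) * (starRingEnd ℂ) (ex (k * (r / M - y))) =
      if n = k then (M : ℂ) else 0 := by
  have h1 : ∀ r : ℕ, ex (n * (r / M - y)) * (starRingEnd ℂ) (ex (k * (r / M - y))) =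
      ex ((((n : ℤ) - k : ℤ) : ℝ) * (r / M)) * ex (-(((n : ℤ) - k : ℤ) : ℝ) * y) := by
    intro r
    rw [← ex_neg, ← ex_add, ← ex_add]
    congr 1
    push_cast
    ring
  simp only [h1]
  rw [← Finset.sum_mul, sum_ex_div M hM]
  by_cases h : n = k
  · subst h
    simp
  · rw [if_neg h, if_neg, zero_mul]
    intro hd
    have := Int.le_of_dvd (a := (M : ℤ)) (b := |(n : ℤ) - k|) (by
      rw [abs_pos]; lia) ((dvd_abs _ _).2 hd)
    have h3 : |(n : ℤ) - k| < M := by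
      rw [abs_lt]; constructor <;> lia
    lia

/-- Parseval on the `M`-th roots of unity (translated by `y`). -/
lemma plancherel (M : ℕ) (S : Finset ℕ) (hS : S ⊆ Finset.range M) (a : ℕ → ℂ) (y : ℝ) :
    ∑ r ∈ Finset.range M, ‖∑ n ∈ S, a n * ex (n * (r / M - y))‖ ^ 2 = M * ∑ n ∈ S, ‖a n‖ ^ 2 := by
  rcases Nat.eq_zero_or_pos M with rfl | hM
  · simp
  have : ((∑ r ∈ Finset.range M, ‖∑ n ∈ S, a n * ex (n * (r / M - y))‖ ^ 2 : ℝ) : ℂ) =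
      ((M * ∑ n ∈ S, ‖a n‖ ^ 2 : ℝ) : ℂ) := by
    push_cast
    have h1 : ∀ z : ℂ, ((‖z‖ : ℝ) : ℂ) ^ 2 = z * (starRingEnd ℂ) z := fun z => by
      rw [Complex.mul_conj, Complex.normSq_eq_norm_sq]; push_cast; rfl
    simp only [h1, map_sum, map_mul]
    simp only [Finset.sum_mul_sum]
    rw [Finset.sum_comm, Finset.mul_sum]
    refine Finset.sum_congr rfl fun n hn => ?_
    rw [Finset.sum_comm]
    have h2 : ∀ k ∈ S, ∑ r ∈ Finset.range M, a n * ex (n * (r / M - y)) *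
        ((starRingEnd ℂ) (a k) * (starRingEnd ℂ) (ex (k * (r / M - y)))) =
        if n = k then M * (a n * (starRingEnd ℂ) (a n)) else 0 := by
      intro k hk
      have := sum_ex_mul_conj M hM n k (Finset.mem_range.1 (hS hn)) (Finset.mem_range.1 (hS hk)) y
      calc _ = (a n * (starRingEnd ℂ) (a k)) * ∑ r ∈ Finset.range M,
            ex (n * (r / M - y)) * (starRingEnd ℂ) (ex (k * (r / M - y))) := by
            rw [Finset.mul_sum]
            exact Finset.sum_congr rfl fun r _ => by ring
        _ = _ := by
            rw [this]
            split_ifs with h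
            · subst h; ring
            · simp
    rw [Finset.sum_congr rfl h2, Finset.sum_ite_eq, if_pos hn]
  exact_mod_cast this

lemma sum_fejer_roots (M H : ℕ) (hH : 0 < H) (hM : H ≤ M) (y : ℝ) :
    ∑ r ∈ Finset.range M, fejer H (r / M - y) = M := by
  have := plancherel M (Finset.range H) (Finset.range_mono hM) (fun _ => 1) y
  simp only [fejer, dirichletSum]
  rw [← Finset.sum_div]
  simp only [one_mul] at this
  rw [this]
  have : (H : ℝ) ≠ 0 := by positivity
  simp
  field_simp

lemma plancherel_expSum (f : ℕ → ℝ) (N M : ℕ) (h : N < M) :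
    ∑ r ∈ Finset.range M, ‖expSum f N (r / M)‖ ^ 2 = M * ∑ n ∈ Finset.Ioc 0 N, f n ^ 2 := by
  have := plancherel M (Finset.Ioc 0 N) (fun n hn => by
    rw [Finset.mem_Ioc] at hn; rw [Finset.mem_range]; lia) (fun n => f n) 0
  simp only [sub_zero] at this
  simp only [expSum]
  rw [this]
  simp

open ArithmeticFunction in
/-- Large spectrum bound for functions dominated by `Λ`. -/
theorem card_large_le : ∃ C : ℝ, 1 ≤ C ∧ ∃ N0 : ℕ, 1 ≤ N0 ∧ ∀ N ≥ N0, ∀ M : ℕ, 2 * N ≤ M →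
    ∀ f : ℕ → ℝ, (∀ n, 0 ≤ f n ∧ f n ≤ vonMangoldt n) → ∀ η : ℝ, 0 < η → η ≤ 1 → 1 ≤ η ^ 20 * N →
    ∀ J ⊆ Finset.range M, (∀ r ∈ J, η * N ≤ ‖expSum f N (r / M)‖) →
    (J.card : ℝ) * η ^ 3 * N ≤ C * M := by
  obtain ⟨C, hC, N0, hN0, hmain⟩ := norm_sum_expSum_sq_le
  obtain ⟨N1, hN1⟩ := exists_nat_ge ((4 * C) ^ 20)
  refine ⟨8 * C ^ 2, by nlinarith, N0 + N1, by lia, ?_⟩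
  intro N hN M hM f hf η hη hη1 hηN J hJ hlarge
  have hNpos : 1 ≤ N := by lia
  have hN' : (0 : ℝ) < N := by exact_mod_cast hNpos
  set m := ⌈2 * C / η⌉₊ with hm
  have hx : 2 ≤ 2 * C / η := by
    rw [le_div_iff₀ hη]; nlinarith
  have hm1 : 2 * C / η ≤ m := Nat.le_ceil _
  have hm2 : (m : ℝ) ≤ 4 * C / η := by
    have := Nat.ceil_lt_add_one (a := 2 * C / η) (by linarith)
    have e : 4 * C / η = 2 * C / η + 2 * C / η := by ring
    linarith
  have hm0 : 1 ≤ m := by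
    have : (1 : ℝ) ≤ m := by linarith
    exact_mod_cast this
  have hmN : m ^ 10 ≤ N := by
    have h1 : ((m : ℝ) ^ 10) ^ 2 ≤ (N : ℝ) ^ 2 := by
      calc ((m : ℝ) ^ 10) ^ 2 = (m : ℝ) ^ 20 := by ring
        _ ≤ (4 * C / η) ^ 20 := by gcongr
        _ = (4 * C) ^ 20 * (1 / η ^ 20) := by ring
        _ ≤ N * N := by
            gcongr
            · exact hN1.trans (by exact_mod_cast (by lia : N1 ≤ N))
            · rw [div_le_iff₀ (by positivity)]; linarith
        _ = _ := by ring
    have := (pow_le_pow_iff_left₀ (by positivity) hN'.le (by norm_num)).1 h1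
    exact_mod_cast this
  have key := hmain N (by lia) m hm0 hmN f hf J
    (fun r => (starRingEnd ℂ) (expSum f N (r / M)) / ‖expSum f N (r / M)‖) (fun r => (r : ℝ) / M)
  have hc : ∀ r : ℕ, ‖(starRingEnd ℂ) (expSum f N (r / M)) / (‖expSum f N (r / M)‖ : ℂ)‖ ≤ 1 := by
    intro r
    rw [norm_div, Complex.norm_conj, Complex.norm_real, norm_norm]
    exact div_self_le_one _
  have hcF : ∀ r : ℕ, (starRingEnd ℂ) (expSum f N (r / M)) / (‖expSum f N (r / M)‖ : ℂ) *
      expSum f N (r / M) = ((‖expSum f N (r / M)‖ : ℝ) : ℂ) := by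
    intro r
    by_cases h : expSum f N (r / M) = 0
    · simp [h]
    · have h' : (‖expSum f N (r / M)‖ : ℂ) ≠ 0 := by
        exact_mod_cast (norm_ne_zero_iff.2 h)
      field_simp
      rw [mul_comm, Complex.mul_conj, Complex.normSq_eq_norm_sq]
      push_cast; ring
  simp only [hcF] at key
  rw [← Complex.ofReal_sum, Complex.norm_real,
    Real.norm_of_nonneg (Finset.sum_nonneg fun _ _ => norm_nonneg _)] at key
  have hlow : (J.card : ℝ) * (η * N) ≤ ∑ r ∈ J, ‖expSum f N (r / M)‖ := by
    rw [← nsmul_eq_mul]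
    exact Finset.card_nsmul_le_sum _ _ _ hlarge
  have hup : ∑ j ∈ J, ∑ l ∈ J,
      ‖(starRingEnd ℂ) (expSum f N ((j : ℕ) / M)) / (‖expSum f N ((j : ℕ) / M)‖ : ℂ)‖ *
      ‖(starRingEnd ℂ) (expSum f N ((l : ℕ) / M)) / (‖expSum f N ((l : ℕ) / M)‖ : ℂ)‖ *
        (fejer (2 * N) ((j : ℝ) / M - l / M) + N / m ^ 5) ≤
      J.card * M + J.card * (J.card * (N / (m : ℝ) ^ 5)) := by
    calc _ ≤ ∑ j ∈ J, ∑ l ∈ J, (fejer (2 * N) ((l : ℝ) / M - j / M) + N / (m : ℝ) ^ 5) := by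
          refine Finset.sum_le_sum fun j _ => Finset.sum_le_sum fun l _ => ?_
          have h1 := mul_le_one₀ (hc j) (norm_nonneg _) (hc l)
          have h2 := fejer_nonneg (2 * N) ((l : ℝ) / M - j / M)
          have h3 : fejer (2 * N) ((j : ℝ) / M - l / M) = fejer (2 * N) ((l : ℝ) / M - j / M) := by
            rw [← fejer_neg]; congr 1; ring
          rw [h3]
          exact mul_le_of_le_one_left (by positivity) h1
      _ ≤ ∑ j ∈ J, (M + J.card * (N / (m : ℝ) ^ 5)) := by
          refine Finset.sum_le_sum fun j _ => ?_
          rw [Finset.sum_add_distrib, Finset.sum_const, nsmul_eq_mul]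
          gcongr
          exact (Finset.sum_le_sum_of_subset_of_nonneg hJ fun _ _ _ => fejer_nonneg _ _).trans
            (sum_fejer_roots M (2 * N) (by lia) hM ((j : ℝ) / M)).le
      _ = _ := by rw [Finset.sum_const, nsmul_eq_mul]; ring
  set j : ℝ := (J.card : ℝ) with hj
  have hj0 : 0 ≤ j := by positivity
  have hm' : (0 : ℝ) < m := by exact_mod_cast hm0
  have h1 : (j * (η * N)) ^ 2 ≤ C * N * m * (j * M + j * (j * (N / (m : ℝ) ^ 5))) :=
    (pow_le_pow_left₀ (by positivity) hlow 2).trans (key.trans (by gcongr))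
  rcases hj0.eq_or_lt with h0 | hjp
  · rw [← h0]; simp; positivity
  have h2 : j * η ^ 2 * N ≤ C * m * M + C * j * N / (m : ℝ) ^ 4 := by
    have e1 : (j * (η * N)) ^ 2 = (j * N) * (j * η ^ 2 * N) := by ring
    have e2 : C * N * m * (j * M + j * (j * (N / (m : ℝ) ^ 5))) =
        (j * N) * (C * m * M + C * j * N / (m : ℝ) ^ 4) := by
      field_simp
    rw [e1, e2] at h1
    exact le_of_mul_le_mul_left h1 (by positivity)
  have h3 : C / (m : ℝ) ^ 4 ≤ η ^ 2 / 2 := by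
    rw [div_le_iff₀ (by positivity)]
    have h4 : 2 * C ≤ η * m := by
      rw [div_le_iff₀ hη] at hm1; linarith
    have h5 : (1 : ℝ) ≤ m := by exact_mod_cast hm0
    have h6 : (2 * C) ^ 2 ≤ (η * m) ^ 2 := by gcongr
    have h7 : (1 : ℝ) ≤ (m : ℝ) ^ 2 := one_le_pow₀ h5
    have h8 : (η * m) ^ 2 * 1 ≤ (η * m) ^ 2 * (m : ℝ) ^ 2 := by gcongr
    nlinarith
  have h4 : C * j * N / (m : ℝ) ^ 4 ≤ j * η ^ 2 * N / 2 := by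
    have := mul_le_mul_of_nonneg_left h3 (by positivity : 0 ≤ j * N)
    calc _ = j * N * (C / (m : ℝ) ^ 4) := by ring
      _ ≤ _ := this
      _ = _ := by ring
  have h5 : j * η ^ 2 * N ≤ 2 * C * M * (4 * C / η) := by
    have : C * m * M ≤ C * (4 * C / η) * M := by gcongr
    linarith
  have h6 := mul_le_mul_of_nonneg_right h5 hη.le
  calc j * η ^ 3 * N = j * η ^ 2 * N * η := by ring
    _ ≤ _ := h6
    _ = _ := by field_simp; ring

lemma dyadic_pow_four_le (t a : ℝ) (ht : 0 ≤ t) (hta : t < a) (L : ℕ) :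
    t < a / 2 ^ L ∨
      t ^ 4 ≤ ∑ k ∈ Finset.range L, (a / 2 ^ k) ^ 4 * if a / 2 ^ (k + 1) ≤ t then 1 else 0 := by
  induction L with
  | zero => left; simpa using hta
  | succ L ih =>
    by_cases h : t < a / 2 ^ (L + 1)
    · exact Or.inl h
    · right
      push Not at h
      rw [Finset.sum_range_succ, if_pos h]
      have ha : 0 ≤ a := ht.trans hta.le
      have hs : 0 ≤ ∑ k ∈ Finset.range L, (a / 2 ^ k) ^ 4 *
          if a / 2 ^ (k + 1) ≤ t then (1 : ℝ) else 0 :=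
        Finset.sum_nonneg fun k _ => mul_nonneg (by positivity) (by split_ifs <;> norm_num)
      rcases ih with h1 | h1
      · have : t ^ 4 ≤ (a / 2 ^ L) ^ 4 := pow_le_pow_left₀ ht h1.le 4
        linarith
      · have : 0 ≤ (a / 2 ^ L) ^ 4 * 1 := by positivity
        linarith

lemma sum_two_pow_neg_le (L : ℕ) : ∑ k ∈ Finset.range L, (1 / 2 ^ k : ℝ) ≤ 2 := by
  have := sum_geometric_two_le L
  simpa [one_div, inv_pow] using this

open ArithmeticFunction in
lemma norm_expSum_le (f : ℕ → ℝ) (hf : ∀ n, 0 ≤ f n ∧ f n ≤ vonMangoldt n) (N : ℕ) (θ : ℝ) :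
    ‖expSum f N θ‖ ≤ 6 * N := by
  refine le_trans ?_ (sum_vonMangoldt_le N)
  refine (norm_sum_le _ _).trans (Finset.sum_le_sum fun n _ => ?_)
  rw [norm_mul, norm_ex, mul_one, Complex.norm_real, Real.norm_of_nonneg (hf n).1]
  exact (hf n).2

lemma eventually_log_pow_le (C : ℝ) (k : ℕ) :
    ∃ N0 : ℕ, ∀ N : ℕ, N0 ≤ N → C * Real.log N ^ k ≤ N := by
  have h := (isLittleO_log_rpow_atTop (r := 1 / (k + 1)) (by positivity)).pow (n := k + 1)
    (by lia)
  have h2 : Tendsto (fun n : ℕ => Real.log n) atTop atTop :=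
    Real.tendsto_log_atTop.comp tendsto_natCast_atTop_atTop
  have h3 := (Asymptotics.IsLittleO.bound h one_pos)
  have h4 := (tendsto_natCast_atTop_atTop (R := ℝ)).eventually h3
  obtain ⟨N0, hN0⟩ := Filter.eventually_atTop.1 (h4.and ((h2.eventually_ge_atTop C).and
    ((h2.eventually_ge_atTop 0).and (Filter.eventually_ge_atTop 1))))
  refine ⟨N0, fun N hN => ?_⟩
  obtain ⟨h5, h6, h7, h8⟩ := hN0 N hN
  have hN' : (0 : ℝ) < N := by exact_mod_cast h8
  have h9 : (((N : ℝ)) ^ (1 / (k + 1) : ℝ)) ^ (k + 1) = N := by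
    rw [← Real.rpow_natCast, ← Real.rpow_mul hN'.le]
    push_cast
    rw [one_div, inv_mul_cancel₀ (by positivity), Real.rpow_one]
  simp only [h9, one_mul, Real.norm_eq_abs, abs_pow, abs_of_nonneg h7, abs_of_pos hN'] at h5
  calc C * Real.log N ^ k ≤ Real.log N * Real.log N ^ k := by gcongr
    _ = Real.log N ^ (k + 1) := by ring
    _ ≤ N := h5

open ArithmeticFunction in
/-- The small values of the exponential sum contribute little to the fourth moment. -/
theorem sum_small_pow_four_le : ∃ C : ℝ, 1 ≤ C ∧ ∀ η : ℝ, 0 < η → η ≤ 1 → ∃ N0 : ℕ, 1 ≤ N0 ∧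
    ∀ N ≥ N0, ∀ M : ℕ, 2 * N ≤ M → ∀ f : ℕ → ℝ, (∀ n, 0 ≤ f n ∧ f n ≤ vonMangoldt n) →
    ∑ r ∈ (Finset.range M).filter (fun r : ℕ => ‖expSum f N (r / M)‖ < η * N),
      ‖expSum f N (r / M)‖ ^ 4 ≤ C * η * N ^ 3 * M := by
  obtain ⟨C, hC, N1, hN1, hcard⟩ := card_large_le
  refine ⟨16 * C + 1, by linarith, fun η hη hη1 => ?_⟩
  obtain ⟨N2, hN2⟩ := eventually_log_pow_le ((2 / η) ^ 20) 20
  have hlogt : Tendsto (fun n : ℕ => Real.log n) atTop atTop :=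
    Real.tendsto_log_atTop.comp tendsto_natCast_atTop_atTop
  obtain ⟨N3, hN3⟩ := Filter.eventually_atTop.1 (hlogt.eventually_ge_atTop 6)
  refine ⟨N1 + N2 + N3, by lia, fun N hN M hM f hf => ?_⟩
  have hlog6 : 6 ≤ Real.log N := hN3 N (by lia)
  have hNp : (0 : ℝ) < N := by
    have : 0 < N := by lia
    exact_mod_cast this
  obtain ⟨L, hL1, hL2⟩ := exists_nat_pow_near (x := Real.log N) (y := (2 : ℝ)) (by linarith) (by norm_num)
  set F : ℕ → ℝ := fun r => ‖expSum f N (r / M)‖ with hF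
  have hF0 : ∀ r, 0 ≤ F r := fun r => norm_nonneg _
  have hlevel : ∀ k < L + 1, 1 ≤ (η / 2 ^ (k + 1)) ^ 20 * N := by
    intro k hk
    have h1 : (2 : ℝ) ^ (k + 1) ≤ 2 * Real.log N := by
      calc (2 : ℝ) ^ (k + 1) ≤ 2 ^ (L + 1) := pow_le_pow_right₀ (by norm_num) (by lia)
        _ = 2 * 2 ^ L := by ring
        _ ≤ _ := by linarith
    have h2 := hN2 N (by lia)
    calc (1 : ℝ) = (η / (2 * Real.log N)) ^ 20 * ((2 / η) ^ 20 * Real.log N ^ 20) := by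
          have : Real.log N ≠ 0 := by linarith
          field_simp
      _ ≤ (η / (2 * Real.log N)) ^ 20 * N := by gcongr
      _ ≤ _ := by gcongr
  have hpt : ∀ r ∈ (Finset.range M).filter (fun r : ℕ => F r < η * N), F r ^ 4 ≤
      (η * N / 2 ^ (L + 1)) ^ 2 * F r ^ 2 + ∑ k ∈ Finset.range (L + 1), (η * N / 2 ^ k) ^ 4 *
        if η * N / 2 ^ (k + 1) ≤ F r then 1 else 0 := by
    intro r hr
    rcases dyadic_pow_four_le (F r) (η * N) (hF0 r) (Finset.mem_filter.1 hr).2 (L + 1) with h | h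
    · have h1 : F r ^ 2 ≤ (η * N / 2 ^ (L + 1)) ^ 2 := pow_le_pow_left₀ (hF0 r) h.le 2
      have h2 : F r ^ 2 * F r ^ 2 ≤ (η * N / 2 ^ (L + 1)) ^ 2 * F r ^ 2 := by gcongr
      have hs : 0 ≤ ∑ k ∈ Finset.range (L + 1), (η * N / 2 ^ k) ^ 4 *
          if η * N / 2 ^ (k + 1) ≤ F r then (1 : ℝ) else 0 :=
        Finset.sum_nonneg fun k _ => mul_nonneg (by positivity) (by split_ifs <;> norm_num)
      nlinarith
    · have : 0 ≤ (η * N / 2 ^ (L + 1)) ^ 2 * F r ^ 2 := by positivity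
      linarith
  calc ∑ r ∈ (Finset.range M).filter (fun r : ℕ => F r < η * N), F r ^ 4
      ≤ ∑ r ∈ (Finset.range M).filter (fun r : ℕ => F r < η * N),
        ((η * N / 2 ^ (L + 1)) ^ 2 * F r ^ 2 + ∑ k ∈ Finset.range (L + 1), (η * N / 2 ^ k) ^ 4 *
        if η * N / 2 ^ (k + 1) ≤ F r then 1 else 0) := Finset.sum_le_sum hpt
    _ ≤ ∑ r ∈ Finset.range M,
        ((η * N / 2 ^ (L + 1)) ^ 2 * F r ^ 2 + ∑ k ∈ Finset.range (L + 1), (η * N / 2 ^ k) ^ 4 *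
        if η * N / 2 ^ (k + 1) ≤ F r then 1 else 0) := by
        apply Finset.sum_le_sum_of_subset_of_nonneg (Finset.filter_subset _ _)
        intro r _ _
        refine add_nonneg (by positivity) ?_
        exact Finset.sum_nonneg fun k _ => mul_nonneg (by positivity) (by split_ifs <;> norm_num)
    _ = (η * N / 2 ^ (L + 1)) ^ 2 * ∑ r ∈ Finset.range M, F r ^ 2 +
        ∑ k ∈ Finset.range (L + 1), (η * N / 2 ^ k) ^ 4 *
          (((Finset.range M).filter (fun r : ℕ => η / 2 ^ (k + 1) * N ≤ F r)).card : ℝ) := by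
        rw [Finset.sum_add_distrib, ← Finset.mul_sum, Finset.sum_comm]
        congr 1
        refine Finset.sum_congr rfl fun k _ => ?_
        rw [← Finset.mul_sum, Finset.sum_boole]
        congr 4
        ext r
        rw [div_mul_eq_mul_div]
    _ ≤ η * N ^ 3 * M + ∑ k ∈ Finset.range (L + 1), 8 * C * η * N ^ 3 * M * (1 / 2 ^ k) := by
        refine add_le_add ?_ (Finset.sum_le_sum fun k hk => ?_)
        · rw [plancherel_expSum f N M (by
            have : 0 < N := by exact_mod_cast hNp
            lia)]
          have h1 := sum_sq_le_of_le_vonMangoldt N f hf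
          calc (η * N / 2 ^ (L + 1)) ^ 2 * (M * ∑ n ∈ Finset.Ioc 0 N, f n ^ 2)
              ≤ (η * N / Real.log N) ^ 2 * (M * (6 * N * Real.log N)) := by
                gcongr
            _ = (η * N ^ 3 * M) * (η * (6 / Real.log N)) := by
                have : Real.log N ≠ 0 := by linarith
                field_simp
            _ ≤ (η * N ^ 3 * M) * 1 := by
                gcongr
                have : 6 / Real.log N ≤ 1 := by rw [div_le_one (by linarith)]; exact hlog6
                have h6 : 0 ≤ 6 / Real.log N := by positivity
                nlinarith
            _ = _ := mul_one _
        · have h1 := hcard N (by lia) M hM f hf (η / 2 ^ (k + 1)) (by positivity) (by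
            rw [div_le_one (by positivity)]
            exact hη1.trans (one_le_pow₀ (by norm_num))) (hlevel k (Finset.mem_range.1 hk))
            ((Finset.range M).filter (fun r : ℕ => η / 2 ^ (k + 1) * N ≤ F r))
            (Finset.filter_subset _ _) (fun r hr => (Finset.mem_filter.1 hr).2)
          set j : ℝ := (((Finset.range M).filter
            (fun r : ℕ => η / 2 ^ (k + 1) * N ≤ F r)).card : ℝ)
          have h2 := mul_le_mul_of_nonneg_left h1
            (by positivity : 0 ≤ 8 * η * N ^ 3 * (1 / 2 ^ k : ℝ))
          calc (η * N / 2 ^ k) ^ 4 * j =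
              8 * η * N ^ 3 * (1 / 2 ^ k : ℝ) * (j * (η / 2 ^ (k + 1)) ^ 3 * N) := by
                rw [pow_succ]; field_simp; ring
            _ ≤ _ := h2
            _ = _ := by ring
    _ = η * N ^ 3 * M + 8 * C * η * N ^ 3 * M * ∑ k ∈ Finset.range (L + 1), (1 / 2 ^ k : ℝ) := by
        rw [← Finset.mul_sum]
    _ ≤ η * N ^ 3 * M + 8 * C * η * N ^ 3 * M * 2 := by
        gcongr
        exact sum_two_pow_neg_le _
    _ = _ := by ring

open ArithmeticFunction in
/-- Fourth moment bound for functions dominated by `Λ`. -/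
theorem sum_pow_four_le : ∃ C : ℝ, 1 ≤ C ∧ ∃ N0 : ℕ, 1 ≤ N0 ∧
    ∀ N ≥ N0, ∀ M : ℕ, 2 * N ≤ M → ∀ f : ℕ → ℝ, (∀ n, 0 ≤ f n ∧ f n ≤ vonMangoldt n) →
    ∑ r ∈ Finset.range M, ‖expSum f N (r / M)‖ ^ 4 ≤ C * N ^ 3 * M := by
  obtain ⟨C1, hC1, h1⟩ := sum_small_pow_four_le
  obtain ⟨N1, hN1, h1⟩ := h1 1 one_pos le_rfl
  obtain ⟨C2, hC2, N2, hN2, h2⟩ := card_large_le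
  refine ⟨C1 + 1296 * C2, by linarith, N1 + N2, by lia, fun N hN M hM f hf => ?_⟩
  have hNp : (1 : ℝ) ≤ N := by
    have : 1 ≤ N := by lia
    exact_mod_cast this
  rw [← Finset.sum_filter_add_sum_filter_not _ (fun r : ℕ => ‖expSum f N (r / M)‖ < 1 * N)]
  have h3 := h1 N (by lia) M hM f hf
  set J := (Finset.range M).filter (fun r : ℕ => ¬ ‖expSum f N (r / M)‖ < 1 * N) with hJ
  have h4 := h2 N (by lia) M hM f hf 1 one_pos le_rfl (by linarith) J (Finset.filter_subset _ _)
    (fun r hr => not_lt.1 (Finset.mem_filter.1 hr).2)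
  have h5 : ∑ r ∈ J, ‖expSum f N (r / M)‖ ^ 4 ≤ J.card * (6 * (N : ℝ)) ^ 4 := by
    rw [← nsmul_eq_mul]
    refine Finset.sum_le_card_nsmul _ _ _ fun r _ => ?_
    exact pow_le_pow_left₀ (norm_nonneg _) (norm_expSum_le f hf N _) 4
  have h6 : (J.card : ℝ) * (6 * (N : ℝ)) ^ 4 ≤ 1296 * C2 * N ^ 3 * M := by
    have := mul_le_mul_of_nonneg_left h4 (by positivity : 0 ≤ 1296 * (N : ℝ) ^ 3)
    calc _ = 1296 * (N : ℝ) ^ 3 * (J.card * 1 ^ 3 * N) := by ring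
      _ ≤ _ := this
      _ = _ := by ring
  calc _ ≤ C1 * 1 * N ^ 3 * M + 1296 * C2 * N ^ 3 * M := add_le_add h3 (h5.trans h6)
    _ = _ := by ring

/-- The Fourier transform of the triangle function on `[-L, L]`. -/
noncomputable def fk (L v : ℝ) : ℝ := 2 * (1 - Real.cos (L * v)) / (L * v ^ 2)

lemma fk_nonneg (L v : ℝ) (hL : 0 < L) : 0 ≤ fk L v := by
  have := Real.cos_le_one (L * v)
  unfold fk
  have : 0 ≤ 1 - Real.cos (L * v) := by linarith
  positivity

lemma fk_mul_sq_le (L v : ℝ) (hL : 0 < L) : fk L v * v ^ 2 ≤ 4 / L := by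
  rcases eq_or_ne v 0 with rfl | hv
  · simp; positivity
  · have h1 : fk L v * v ^ 2 = 2 * (1 - Real.cos (L * v)) / L := by
      unfold fk; field_simp
    rw [h1]
    gcongr
    linarith [Real.neg_one_le_cos (L * v)]

lemma fk_le (L v : ℝ) (hL : 0 < L) : fk L v ≤ L := by
  rcases eq_or_ne v 0 with rfl | hv
  · simp [fk]; positivity
  · unfold fk
    rw [div_le_iff₀ (by positivity)]
    have := Real.one_sub_sq_div_two_le_cos (x := L * v)
    nlinarith

lemma fk_le_inv (L v : ℝ) (hL : 0 < L) : fk L v ≤ (L + 4 / L) * (1 + v ^ 2)⁻¹ := by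
  rw [← div_eq_mul_inv, le_div_iff₀ (by positivity)]
  have h1 := fk_mul_sq_le L v hL
  have h2 := fk_le L v hL
  linarith

lemma le_fk (L v : ℝ) (hL : 0 < L) (hv : v ≠ 0) (h : |v| ≤ 1 / L) :
    4 * L / Real.pi ^ 2 ≤ fk L v := by
  unfold fk
  have h1 : |L * v| ≤ Real.pi := by
    rw [abs_mul, abs_of_pos hL]
    have : L * |v| ≤ L * (1 / L) := by gcongr
    rw [mul_one_div_cancel hL.ne'] at this
    linarith [Real.pi_gt_three]
  have h2 := Real.cos_le_one_sub_mul_cos_sq h1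
  have h3 : 2 * (2 / Real.pi ^ 2 * (L * v) ^ 2) / (L * v ^ 2) ≤
      2 * (1 - Real.cos (L * v)) / (L * v ^ 2) := by
    gcongr
    linarith
  refine le_trans (le_of_eq ?_) h3
  field_simp
  ring

@[fun_prop]
lemma measurable_fk (L : ℝ) : Measurable (fk L) := by
  unfold fk
  fun_prop

lemma integrable_fk (L : ℝ) (hL : 0 < L) (y : ℝ) :
    MeasureTheory.Integrable (fun u => fk L (y - u)) := by
  have h : MeasureTheory.Integrable (fk L) := by
    refine (integrable_inv_one_add_sq.const_mul (L + 4 / L)).mono'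
      (measurable_fk L).aestronglyMeasurable (Eventually.of_forall fun v => ?_)
    rw [Real.norm_of_nonneg (fk_nonneg L v hL)]
    exact fk_le_inv L v hL
  exact h.comp_sub_left y

/-- Half of the Fourier integral of the triangle. -/
lemma integral_triangle_half (L v : ℝ) (hL : 0 < L) (hv : v ≠ 0) :
    ∫ t in (0 : ℝ)..L, ((1 - t / L : ℝ) : ℂ) * Complex.exp (Complex.I * (t * v)) =
      -Complex.exp (Complex.I * (L * v)) / (L * v ^ 2) + Complex.I / v + 1 / (L * v ^ 2) := by
  have hL' : (L : ℂ) ≠ 0 := by exact_mod_cast hL.ne'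
  have hv' : (v : ℂ) ≠ 0 := by exact_mod_cast hv
  have hderiv : ∀ t ∈ Set.uIcc 0 L, HasDerivAt (fun t : ℝ =>
      (((1 - t / L : ℝ) : ℂ) / (Complex.I * v) - 1 / (L * v ^ 2)) *
        Complex.exp (Complex.I * (t * v)))
      (((1 - t / L : ℝ) : ℂ) * Complex.exp (Complex.I * (t * v))) t := by
    intro t _
    have h1 : HasDerivAt (fun t : ℝ => (((1 - t / L : ℝ) : ℂ) / (Complex.I * v) -
        1 / (L * v ^ 2))) (((-(1 / L) : ℝ) : ℂ) / (Complex.I * v)) t := by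
      have : HasDerivAt (fun t : ℝ => (1 - t / L : ℝ)) (-(1 / L)) t := by
        simpa using ((hasDerivAt_id t).div_const L).const_sub 1
      exact (this.ofReal_comp.div_const _).sub_const _
    have h2 : HasDerivAt (fun t : ℝ => Complex.exp (Complex.I * (t * v)))
        (Complex.exp (Complex.I * (t * v)) * (Complex.I * v)) t := by
      have : HasDerivAt (fun t : ℝ => Complex.I * ((t : ℂ) * v)) (Complex.I * (1 * v)) t :=
        (((hasDerivAt_id t).ofReal_comp).mul_const (v : ℂ)).const_mul Complex.I
      simpa using this.cexp
    refine (h1.mul h2).congr_deriv ?_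
    push_cast
    field_simp
    linear_combination -Complex.I_sq
  rw [intervalIntegral.integral_eq_sub_of_hasDerivAt hderiv]
  · push_cast
    field_simp
    simp only [sub_self, mul_zero, zero_mul, sub_zero, zero_sub, Complex.exp_zero]
    linear_combination (-(L : ℂ) * v) * Complex.I_sq
  · apply Continuous.intervalIntegrable
    fun_prop

lemma integral_triangle (L v : ℝ) (hL : 0 < L) (hv : v ≠ 0) :
    ∫ t in (-L)..L, ((1 - |t| / L : ℝ) : ℂ) * Complex.exp (Complex.I * (t * v)) = fk L v := by
  have hcont : Continuous fun t : ℝ => ((1 - |t| / L : ℝ) : ℂ) * Complex.exp (Complex.I * (t * v)) := by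
    fun_prop
  rw [← intervalIntegral.integral_add_adjacent_intervals (b := 0) (hcont.intervalIntegrable _ _)
    (hcont.intervalIntegrable _ _)]
  have h1 : ∫ t in (0 : ℝ)..L, ((1 - |t| / L : ℝ) : ℂ) * Complex.exp (Complex.I * (t * v)) =
      ∫ t in (0 : ℝ)..L, ((1 - t / L : ℝ) : ℂ) * Complex.exp (Complex.I * (t * v)) := by
    apply intervalIntegral.integral_congr
    intro t ht
    rw [Set.uIcc_of_le hL.le] at ht
    simp only [abs_of_nonneg ht.1]
  have h2 : ∫ t in (-L)..(0 : ℝ), ((1 - |t| / L : ℝ) : ℂ) * Complex.exp (Complex.I * (t * v)) =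
      ∫ t in (0 : ℝ)..L, ((1 - t / L : ℝ) : ℂ) * Complex.exp (Complex.I * (t * (-v : ℝ))) := by
    have := intervalIntegral.integral_comp_neg (a := 0) (b := L)
      (fun t : ℝ => ((1 - |t| / L : ℝ) : ℂ) * Complex.exp (Complex.I * (t * v)))
    rw [neg_zero] at this
    rw [← this]
    apply intervalIntegral.integral_congr
    intro t ht
    rw [Set.uIcc_of_le hL.le] at ht
    simp only [abs_neg, abs_of_nonneg ht.1]
    push_cast
    ring_nf
  rw [h1, h2, integral_triangle_half L v hL hv, integral_triangle_half L (-v) hL (neg_ne_zero.2 hv)]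
  have hL' : (L : ℂ) ≠ 0 := by exact_mod_cast hL.ne'
  have hv' : (v : ℂ) ≠ 0 := by exact_mod_cast hv
  unfold fk
  push_cast
  rw [Complex.cos]
  have e1 : Complex.exp (Complex.I * (L * -(v : ℂ))) = Complex.exp (-((L : ℂ) * v) * Complex.I) := by
    congr 1; ring
  have e2 : Complex.exp (Complex.I * (L * (v : ℂ))) = Complex.exp ((L : ℂ) * v * Complex.I) := by
    congr 1; ring
  rw [e1, e2]
  field_simp
  ring

open MeasureTheory in
lemma fejer_identity (b : ℝ → ℝ) (hb : Measurable b) (D : ℝ) (hD : ∀ u, |b u| ≤ D) (h : ℝ → ℂ)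
    (ε : ℝ) (hε : 0 < ε)
    (heq : ∀ t : ℝ, ∫ u in Set.Ioi (0 : ℝ), (b u : ℂ) * Complex.exp (-(ε + t * Complex.I) * u) = h t)
    (L : ℝ) (hL : 0 < L) (y : ℝ) :
    ∫ t in (-L)..L, ((1 - |t| / L : ℝ) : ℂ) * Complex.exp (Complex.I * (t * y)) * h t =
      ((∫ u in Set.Ioi (0 : ℝ), Real.exp (-ε * u) * b u * fk L (y - u) : ℝ) : ℂ) := by
  have hLL : -L ≤ L := by linarith
  have h1 : ∀ t : ℝ, ((1 - |t| / L : ℝ) : ℂ) * Complex.exp (Complex.I * (t * y)) * h t =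
      ∫ u in Set.Ioi (0 : ℝ), (((1 - |t| / L : ℝ) : ℂ) * Complex.exp (Complex.I * (t * (y - u)))) *
        ((Real.exp (-ε * u) * b u : ℝ) : ℂ) := by
    intro t
    rw [← heq, ← integral_const_mul]
    refine integral_congr_ae (Eventually.of_forall fun u => ?_)
    simp only
    push_cast
    rw [mul_assoc, mul_assoc]
    congr 1
    have h2 : Complex.exp (Complex.I * (t * y)) * Complex.exp (-(ε + t * Complex.I) * u) =
        Complex.exp (Complex.I * (t * (y - u))) * Complex.exp (-ε * u) := by
      rw [← Complex.exp_add, ← Complex.exp_add]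
      congr 1
      ring
    linear_combination (b u : ℂ) * h2
  simp only [h1]
  rw [intervalIntegral.integral_of_le hLL, integral_integral_swap, ← integral_complex_ofReal]
  · refine integral_congr_ae ?_
    have hne : ∀ᵐ u ∂(volume.restrict (Set.Ioi (0 : ℝ))), u ≠ y := by
      apply ae_restrict_of_ae
      simp [ae_iff, measure_singleton]
    filter_upwards [hne] with u hu
    rw [integral_mul_const, ← intervalIntegral.integral_of_le hLL]
    have := integral_triangle L (y - u) hL (sub_ne_zero.2 hu.symm)
    push_cast at this ⊢
    rw [this]
    ring
  · have hg1 : Integrable (fun t : ℝ => (1 : ℂ)) (volume.restrict (Set.Ioc (-L) L)) :=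
      integrable_const _
    have hg2 : Integrable (fun u : ℝ => ((Real.exp (-ε * u) * b u : ℝ) : ℂ))
        (volume.restrict (Set.Ioi (0 : ℝ))) := by
      have h2 := (integrableOn_exp_mul_Ioi (a := -ε) (by linarith) 0)
      have h3 := Integrable.bdd_mul (c := D) h2 (hb.aestronglyMeasurable)
        (Eventually.of_forall fun u => by simpa using hD u)
      have h4 : Integrable (fun u : ℝ => Real.exp (-ε * u) * b u)
          (volume.restrict (Set.Ioi (0 : ℝ))) :=
        h3.congr (Eventually.of_forall fun u => mul_comm _ _)
      exact h4.ofReal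
    have h3 := hg1.mul_prod hg2
    refine (Integrable.bdd_mul (c := 1 + 1) (f := fun z : ℝ × ℝ =>
      ((1 - |z.1| / L : ℝ) : ℂ) * Complex.exp (Complex.I * (z.1 * (y - z.2)))) h3 ?_ ?_).congr ?_
    · apply Continuous.aestronglyMeasurable
      fun_prop
    · have : ∀ᵐ z ∂((volume.restrict (Set.Ioc (-L) L)).prod (volume.restrict (Set.Ioi (0 : ℝ)))),
          z.1 ∈ Set.Ioc (-L) L := by
        have := Measure.ae_prod_mem_iff_ae_ae_mem (μ := volume.restrict (Set.Ioc (-L) L))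
          (ν := volume.restrict (Set.Ioi (0 : ℝ))) (s := Set.Ioc (-L) L ×ˢ Set.univ)
          (measurableSet_Ioc.prod MeasurableSet.univ)
        have h5 := this.2 (by
          filter_upwards [ae_restrict_mem measurableSet_Ioc] with x hx
          exact Eventually.of_forall fun y => ⟨hx, trivial⟩)
        filter_upwards [h5] with z hz using hz.1
      filter_upwards [this] with z hz
      rw [norm_mul]
      have e1 : ‖Complex.exp (Complex.I * (z.1 * (y - z.2)))‖ = 1 := by
        rw [mul_comm]
        have := Complex.norm_exp_ofReal_mul_I (z.1 * (y - z.2))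
        push_cast at this
        exact this
      rw [e1, mul_one, Complex.norm_real, Real.norm_eq_abs]
      have : |z.1| ≤ L := abs_le.2 ⟨hz.1.le, hz.2⟩
      have h6 : |z.1| / L ≤ 1 := by rw [div_le_one hL]; exact this
      have h7 : 0 ≤ |z.1| / L := by positivity
      rw [abs_le]; constructor <;> linarith
    · refine Eventually.of_forall fun z => ?_
      simp [Function.uncurry]

open MeasureTheory in
theorem tendsto_fejer_average (b : ℝ → ℝ) (hb : Measurable b) (D : ℝ) (hD : ∀ u, |b u| ≤ D)
    (h : ℝ → ℝ → ℂ)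
    (hc : ContinuousOn (fun p : ℝ × ℝ => h p.1 p.2) (Set.Ici 0 ×ˢ Set.univ))
    (heq : ∀ ε : ℝ, 0 < ε → ∀ t : ℝ,
      ∫ u in Set.Ioi (0 : ℝ), (b u : ℂ) * Complex.exp (-(ε + t * Complex.I) * u) = h ε t)
    (L : ℝ) (hL : 0 < L) :
    Tendsto (fun y => ∫ u in Set.Ioi (0 : ℝ), b u * fk L (y - u)) atTop (nhds 0) := by
  have hLL : -L ≤ L := by linarith
  have hkey : ∀ y : ℝ, ∫ t in (-L)..L, ((1 - |t| / L : ℝ) : ℂ) * Complex.exp (Complex.I * (t * y)) *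
      h 0 t = ((∫ u in Set.Ioi (0 : ℝ), b u * fk L (y - u) : ℝ) : ℂ) := by
    intro y
    have hne : (nhdsWithin (0 : ℝ) (Set.Ioi 0)).NeBot := inferInstance
    have t1 : Tendsto (fun ε : ℝ => ∫ t in (-L)..L, ((1 - |t| / L : ℝ) : ℂ) *
        Complex.exp (Complex.I * (t * y)) * h ε t) (nhdsWithin 0 (Set.Ioi 0))
        (nhds (∫ t in (-L)..L, ((1 - |t| / L : ℝ) : ℂ) *
        Complex.exp (Complex.I * (t * y)) * h 0 t)) := by
      have hcont : ContinuousOn (fun p : ℝ × ℝ => ((1 - |p.2| / L : ℝ) : ℂ) *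
          Complex.exp (Complex.I * (p.2 * y)) * h p.1 p.2) (Set.Icc 0 1 ×ˢ Set.Icc (-L) L) := by
        apply ContinuousOn.mul
        · apply Continuous.continuousOn
          fun_prop
        · exact hc.mono (Set.prod_mono (fun x hx => hx.1) (Set.subset_univ _))
      obtain ⟨Bd, hBd⟩ := (isCompact_Icc.prod isCompact_Icc).exists_bound_of_continuousOn hcont
      apply intervalIntegral.tendsto_integral_filter_of_dominated_convergence (fun _ => Bd)
      · filter_upwards [Ioo_mem_nhdsGT (by norm_num : (0 : ℝ) < 1)] with ε hε
        apply ContinuousOn.aestronglyMeasurable _ measurableSet_uIoc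
        rw [Set.uIoc_of_le hLL]
        refine ContinuousOn.comp (t := Set.Icc 0 1 ×ˢ Set.Icc (-L) L) (f := fun t : ℝ => (ε, t)) hcont
          (by fun_prop) ?_
        intro t ht
        exact ⟨⟨hε.1.le, hε.2.le⟩, ⟨ht.1.le, ht.2⟩⟩
      · filter_upwards [Ioo_mem_nhdsGT (by norm_num : (0 : ℝ) < 1)] with ε hε
        refine Eventually.of_forall fun t ht => ?_
        rw [Set.uIoc_of_le hLL] at ht
        exact hBd (ε, t) ⟨⟨hε.1.le, hε.2.le⟩, ⟨ht.1.le, ht.2⟩⟩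
      · exact intervalIntegrable_const
      · refine Eventually.of_forall fun t ht => ?_
        refine Tendsto.const_mul _ ?_
        have h1 := hc (0, t) ⟨Set.mem_Ici.2 le_rfl, trivial⟩
        have h2 : Tendsto (fun ε : ℝ => (ε, t)) (nhdsWithin 0 (Set.Ioi 0))
            (nhdsWithin ((0 : ℝ), t) (Set.Ici 0 ×ˢ Set.univ)) := by
          apply tendsto_nhdsWithin_of_tendsto_nhds_of_eventually_within
          · exact ((continuous_id.prodMk continuous_const).tendsto' (0 : ℝ) (0, t) rfl).mono_left
              nhdsWithin_le_nhds
          · filter_upwards [self_mem_nhdsWithin] with ε hε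
            exact ⟨Set.mem_Ici.2 (le_of_lt hε), trivial⟩
        exact h1.tendsto.comp h2
    have t2 : Tendsto (fun ε : ℝ => ∫ u in Set.Ioi (0 : ℝ), Real.exp (-ε * u) * b u * fk L (y - u))
        (nhdsWithin 0 (Set.Ioi 0)) (nhds (∫ u in Set.Ioi (0 : ℝ), b u * fk L (y - u))) := by
      apply tendsto_integral_filter_of_dominated_convergence (fun u => D * fk L (y - u))
      · refine Eventually.of_forall fun ε => Measurable.aestronglyMeasurable ?_
        fun_prop
      · filter_upwards [self_mem_nhdsWithin] with ε hε
        filter_upwards [ae_restrict_mem measurableSet_Ioi] with u hu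
        rw [norm_mul, norm_mul, Real.norm_of_nonneg (fk_nonneg L _ hL),
          Real.norm_of_nonneg (Real.exp_pos _).le]
        refine mul_le_mul_of_nonneg_right ?_ (fk_nonneg L _ hL)
        have h1 : Real.exp (-ε * u) ≤ 1 := by
          rw [Real.exp_le_one_iff]
          have : 0 < ε * u := mul_pos hε hu
          linarith
        have h2 : ‖b u‖ ≤ D := hD u
        calc _ ≤ 1 * ‖b u‖ := by gcongr
          _ ≤ D := by linarith
      · exact ((integrable_fk L hL y).const_mul D).restrict
      · refine Eventually.of_forall fun u => ?_
        have : Continuous fun ε : ℝ => Real.exp (-ε * u) * b u * fk L (y - u) := by fun_prop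
        exact (this.tendsto' 0 _ (by simp)).mono_left nhdsWithin_le_nhds
    have t2' := (Complex.continuous_ofReal.tendsto _).comp t2
    refine tendsto_nhds_unique t1 (t2'.congr' ?_)
    filter_upwards [self_mem_nhdsWithin] with ε hε
    exact (fejer_identity b hb D hD (h ε) ε hε (heq ε hε) L hL y).symm
  have hRL := Real.tendsto_integral_exp_smul_cocompact (fun t : ℝ =>
    Set.indicator (Set.Ioc (-L) L) (fun t => ((1 - |t| / L : ℝ) : ℂ) * h 0 t) t)
  have hscale : Tendsto (fun y : ℝ => -y / (2 * Real.pi)) atTop (cocompact ℝ) := by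
    refine Tendsto.mono_right ?_ atBot_le_cocompact
    exact (tendsto_neg_atTop_atBot).atBot_div_const (by positivity)
  have h2 := hRL.comp hscale
  have h3 : Tendsto (fun y : ℝ => ((∫ u in Set.Ioi (0 : ℝ), b u * fk L (y - u) : ℝ) : ℂ)) atTop
      (nhds 0) := by
    refine h2.congr fun y => ?_
    rw [← hkey y, intervalIntegral.integral_of_le hLL, ← integral_indicator measurableSet_Ioc]
    simp only [Function.comp]
    refine integral_congr_ae (Eventually.of_forall fun t => ?_)
    simp only [Set.indicator]
    split_ifs
    · rw [Circle.smul_def, Real.fourierChar_apply]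
      have : (((2 * Real.pi * -(t * (-y / (2 * Real.pi))) : ℝ) : ℂ)) * Complex.I =
          Complex.I * (t * y) := by
        push_cast
        have : (Real.pi : ℂ) ≠ 0 := by exact_mod_cast Real.pi_ne_zero
        field_simp
      rw [this, smul_eq_mul]
      ring
    · simp
  have h4 := (Complex.continuous_re.tendsto _).comp h3
  simpa using! h4

open MeasureTheory in
lemma fejer_average_ge (δ h D : ℝ) (hδ : 0 < δ) (hh : 0 < h) (hD0 : 0 < D) :
    ∃ L > 0, ∃ c > 0, ∀ b : ℝ → ℝ, Measurable b → (∀ u, |b u| ≤ D) → ∀ y > h,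
      (∀ u, |y - u| ≤ h → δ ≤ b u) → c ≤ ∫ u in Set.Ioi (0 : ℝ), b u * fk L (y - u) := by
  have hpi := Real.pi_pos
  set E : ℝ := D * 4 * (1 + 1 / h ^ 2) with hE
  have hE0 : 0 < E := by positivity
  obtain ⟨L, hL1, hL2⟩ : ∃ L : ℝ, 1 / h ≤ L ∧ E * Real.pi ^ 3 / (4 * δ) ≤ L :=
    ⟨_, le_max_left _ _, le_max_right _ _⟩
  have hL : 0 < L := lt_of_lt_of_le (by positivity) hL1
  have hLh : 1 / L ≤ h := by rw [div_le_iff₀ hL]; rw [div_le_iff₀ hh] at hL1; linarith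
  refine ⟨L, hL, 4 * δ / Real.pi ^ 2, by positivity, fun b hb hbD y hy hby => ?_⟩
  have hi1 : Integrable (fun u => b u * fk L (y - u)) :=
    Integrable.bdd_mul (c := D) (integrable_fk L hL y) hb.aestronglyMeasurable
      (Eventually.of_forall fun u => hbD u)
  have hi2 : Integrable (fun u : ℝ => E / L * (1 + (y - u) ^ 2)⁻¹) :=
    ((integrable_inv_one_add_sq).comp_sub_left y).const_mul _
  have hI2 : ∫ u in Set.Ioi (0 : ℝ), E / L * (1 + (y - u) ^ 2)⁻¹ ≤ 4 * δ / Real.pi ^ 2 := by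
    calc _ ≤ ∫ u : ℝ, E / L * (1 + (y - u) ^ 2)⁻¹ :=
          setIntegral_le_integral hi2 (Eventually.of_forall fun u => by positivity)
      _ = E / L * Real.pi := by
          rw [integral_const_mul, integral_sub_left_eq_self (fun u : ℝ => (1 + u ^ 2)⁻¹),
            integral_univ_inv_one_add_sq]
      _ ≤ _ := by
          rw [div_mul_eq_mul_div, div_le_div_iff₀ hL (by positivity)]
          rw [div_le_iff₀ (by positivity)] at hL2
          nlinarith
  have hpt : ∀ u, 0 ≤ b u * fk L (y - u) + E / L * (1 + (y - u) ^ 2)⁻¹ := by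
    intro u
    have h0 := fk_nonneg L (y - u) hL
    by_cases hu : |y - u| ≤ h
    · have := hby u hu
      have : 0 ≤ b u := by linarith
      positivity
    · push Not at hu
      have hv : h ^ 2 < (y - u) ^ 2 := by
        rw [← sq_abs (y - u)]
        gcongr
      have hv0 : 0 < (y - u) ^ 2 := lt_trans (by positivity) hv
      have h1 := fk_mul_sq_le L (y - u) hL
      have h2 : fk L (y - u) ≤ 4 / L * (1 + 1 / h ^ 2) * (1 + (y - u) ^ 2)⁻¹ := by
        rw [← div_eq_mul_inv, le_div_iff₀ (by positivity)]
        have h3 : 1 + (y - u) ^ 2 ≤ (y - u) ^ 2 * (1 + 1 / h ^ 2) := by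
          have : 1 ≤ (y - u) ^ 2 * (1 / h ^ 2) := by
            rw [mul_one_div, le_div_iff₀ (by positivity)]; linarith
          linarith
        calc _ ≤ fk L (y - u) * ((y - u) ^ 2 * (1 + 1 / h ^ 2)) := by gcongr
          _ = (fk L (y - u) * (y - u) ^ 2) * (1 + 1 / h ^ 2) := by ring
          _ ≤ _ := by gcongr
      have h3 := (abs_le.1 (hbD u)).1
      have h4 : -(D * fk L (y - u)) ≤ b u * fk L (y - u) := by nlinarith
      have h5 : D * fk L (y - u) ≤ D * (4 / L * (1 + 1 / h ^ 2) * (1 + (y - u) ^ 2)⁻¹) := by gcongr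
      have h6 : D * (4 / L * (1 + 1 / h ^ 2) * (1 + (y - u) ^ 2)⁻¹) =
        E / L * (1 + (y - u) ^ 2)⁻¹ := by rw [hE]; ring
      linarith
  have hbig : 8 * δ / Real.pi ^ 2 ≤
      ∫ u in Set.Ioi (0 : ℝ), (b u * fk L (y - u) + E / L * (1 + (y - u) ^ 2)⁻¹) := by
    have hsub : Set.Icc (y - 1 / L) (y + 1 / L) ⊆ Set.Ioi 0 := fun u hu => by
      rw [Set.mem_Ioi]; linarith [hu.1]
    calc 8 * δ / Real.pi ^ 2 = ∫ u in Set.Icc (y - 1 / L) (y + 1 / L), δ * (4 * L / Real.pi ^ 2) := by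
          rw [setIntegral_const, Measure.real, Real.volume_Icc, ENNReal.toReal_ofReal (by
            have : 0 < 1 / L := by positivity
            linarith), smul_eq_mul]
          field_simp
          ring
      _ ≤ ∫ u in Set.Icc (y - 1 / L) (y + 1 / L),
          (b u * fk L (y - u) + E / L * (1 + (y - u) ^ 2)⁻¹) := by
          apply setIntegral_mono_ae_restrict
          · exact (continuous_const.integrableOn_Icc)
          · exact (hi1.add hi2).integrableOn
          · have hne : ∀ᵐ u ∂(volume.restrict (Set.Icc (y - 1 / L) (y + 1 / L))), u ≠ y := by
              apply ae_restrict_of_ae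
              simp [ae_iff, measure_singleton]
            filter_upwards [hne, ae_restrict_mem measurableSet_Icc] with u hu hu2
            have hu3 : |y - u| ≤ 1 / L := abs_le.2 ⟨by linarith [hu2.2], by linarith [hu2.1]⟩
            have h1 := le_fk L (y - u) hL (sub_ne_zero.2 hu.symm) hu3
            have h2 := hby u (hu3.trans hLh)
            have h3 : 0 ≤ E / L * (1 + (y - u) ^ 2)⁻¹ := by positivity
            have h4 : δ * (4 * L / Real.pi ^ 2) ≤ b u * fk L (y - u) := by gcongr; linarith
            linarith
      _ ≤ _ := by
          apply setIntegral_mono_set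
          · exact (hi1.add hi2).integrableOn
          · exact Eventually.of_forall hpt
          · exact hsub.eventuallyLE
  rw [integral_add hi1.integrableOn hi2.integrableOn] at hbig
  have : 8 * δ / Real.pi ^ 2 = 2 * (4 * δ / Real.pi ^ 2) := by ring
  linarith

open MeasureTheory in
lemma integral_partial_sum_exp (f : ℕ → ℝ) (hf : ∀ n, 0 ≤ f n) (C : ℝ)
    (hC : ∀ N : ℕ, ∑ n ∈ Finset.Icc 1 N, f n ≤ C * N) (s : ℂ) (hs : 1 < s.re) :
    ∫ u in Set.Ioi (0 : ℝ), (((∑ n ∈ Finset.Icc 1 ⌊Real.exp u⌋₊, f n) * Real.exp (-u) : ℝ) : ℂ) *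
      Complex.exp (-(s - 1) * u) = LSeries (fun n => (f n : ℂ)) s / s := by
  have hO : (fun n : ℕ => ∑ k ∈ Finset.Icc 1 n, f k) =O[atTop] fun n => (n : ℝ) ^ (1 : ℝ) := by
    refine Asymptotics.IsBigO.of_bound C (Eventually.of_forall fun n => ?_)
    rw [Real.rpow_one, Real.norm_of_nonneg (Finset.sum_nonneg fun i _ => hf i), Real.norm_natCast]
    exact hC n
  have h1 := LSeries_eq_mul_integral_of_nonneg f (r := 1) zero_le_one hs hO hf
  have hs0 : s ≠ 0 := by rintro rfl; simp at hs; linarith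
  rw [h1, mul_div_cancel_left₀ _ hs0]
  have h2 : Real.exp '' Set.Ioi 0 = Set.Ioi 1 := by
    ext x
    constructor
    · rintro ⟨u, hu, rfl⟩
      exact Real.one_lt_exp_iff.2 hu
    · intro hx
      exact ⟨Real.log x, Real.log_pos hx, Real.exp_log (lt_trans one_pos hx)⟩
  rw [← h2, integral_image_eq_integral_abs_deriv_smul measurableSet_Ioi
    (fun x _ => (Real.hasDerivAt_exp x).hasDerivWithinAt) Real.exp_injective.injOn]
  refine integral_congr_ae (Eventually.of_forall fun u => ?_)
  simp only
  rw [abs_of_pos (Real.exp_pos u), Complex.real_smul,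
    Complex.cpow_def_of_ne_zero (by exact_mod_cast (Real.exp_pos u).ne'), ← Complex.ofReal_log
    (Real.exp_pos u).le, Real.log_exp]
  push_cast
  have h3 : Complex.exp (-u) * Complex.exp (-(s - 1) * u) =
      Complex.exp u * Complex.exp (u * -(s + 1)) := by
    rw [← Complex.exp_add, ← Complex.exp_add]
    congr 1
    ring
  linear_combination (∑ n ∈ Finset.Icc 1 ⌊Real.exp u⌋₊, (f n : ℂ)) * h3

open MeasureTheory in
theorem wiener_ikehara (f : ℕ → ℝ) (hf : ∀ n, 0 ≤ f n) (C A : ℝ)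
    (hC : ∀ N : ℕ, ∑ n ∈ Finset.Icc 1 N, f n ≤ C * N) (G : ℂ → ℂ)
    (hG : ContinuousOn G {s | 1 ≤ s.re})
    (hGf : ∀ s : ℂ, 1 < s.re → G s = LSeries (fun n => (f n : ℂ)) s - A / (s - 1)) :
    Tendsto (fun N : ℕ => (∑ n ∈ Finset.Icc 1 N, f n) / N) atTop (nhds A) := by
  set B : ℝ → ℝ := fun u => (∑ n ∈ Finset.Icc 1 ⌊Real.exp u⌋₊, f n) * Real.exp (-u) with hB
  have hSnn : ∀ N : ℕ, 0 ≤ ∑ n ∈ Finset.Icc 1 N, f n := fun N => Finset.sum_nonneg fun i _ => hf i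
  have hC0 : 0 ≤ C := by have := (hSnn 1).trans (hC 1); simpa using this
  have hB0 : ∀ u, 0 ≤ B u := fun u => mul_nonneg (hSnn _) (Real.exp_pos _).le
  have hBC : ∀ u, B u ≤ C := by
    intro u
    calc B u ≤ (C * ⌊Real.exp u⌋₊) * Real.exp (-u) := by
          exact mul_le_mul_of_nonneg_right (hC _) (Real.exp_pos _).le
      _ ≤ (C * Real.exp u) * Real.exp (-u) := by
          gcongr
          exact Nat.floor_le (Real.exp_pos _).le
      _ = C := by rw [mul_assoc, ← Real.exp_add]; simp
  have hBm : Measurable B := by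
    have : Measurable fun N : ℕ => ∑ n ∈ Finset.Icc 1 N, f n := measurable_from_nat
    exact (this.comp (Nat.measurable_floor.comp Real.measurable_exp)).mul
      (Real.measurable_exp.comp measurable_neg)
  have hBmono : ∀ u v, u ≤ v → B u ≤ B v * Real.exp (v - u) := by
    intro u v huv
    have h1 : ∑ n ∈ Finset.Icc 1 ⌊Real.exp u⌋₊, f n ≤ ∑ n ∈ Finset.Icc 1 ⌊Real.exp v⌋₊, f n := by
      apply Finset.sum_le_sum_of_subset_of_nonneg
      · exact Finset.Icc_subset_Icc_right (Nat.floor_mono (Real.exp_le_exp.2 huv))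
      · intros; exact hf _
    calc B u ≤ (∑ n ∈ Finset.Icc 1 ⌊Real.exp v⌋₊, f n) * Real.exp (-u) :=
          mul_le_mul_of_nonneg_right h1 (Real.exp_pos _).le
      _ = _ := by
          simp only [hB]
          rw [mul_assoc, ← Real.exp_add]
          congr 2
          ring
  set D : ℝ := C + |A| + 1 with hD
  have hD0 : 0 < D := by positivity
  have hbD : ∀ u, |B u - A| ≤ D := fun u => by
    calc |B u - A| ≤ |B u| + |A| := abs_sub _ _
      _ ≤ D := by rw [abs_of_nonneg (hB0 u)]; linarith [hBC u]
  set h : ℝ → ℝ → ℂ := fun ε t => (G (1 + ε + t * Complex.I) - A) / (1 + ε + t * Complex.I) with hh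
  have hbm : Measurable fun u => B u - A := hBm.sub_const _
  have hcont : ContinuousOn (fun p : ℝ × ℝ => h p.1 p.2) (Set.Ici 0 ×ˢ Set.univ) := by
    have hc0 : Continuous fun p : ℝ × ℝ => (1 + p.1 + p.2 * Complex.I : ℂ) := by fun_prop
    have hmaps : Set.MapsTo (fun p : ℝ × ℝ => (1 + p.1 + p.2 * Complex.I : ℂ))
        (Set.Ici 0 ×ˢ Set.univ) {s | 1 ≤ s.re} := by
      rintro ⟨a, c⟩ ⟨ha, -⟩
      simpa using! ha
    refine ContinuousOn.div ((hG.comp hc0.continuousOn hmaps).sub continuousOn_const)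
      hc0.continuousOn ?_
    intro p hp h0
    have h1 : (1 : ℝ) ≤ (1 + p.1 + p.2 * Complex.I : ℂ).re := hmaps hp
    rw [h0] at h1
    simp at h1
    linarith
  have heq : ∀ ε : ℝ, 0 < ε → ∀ t : ℝ, ∫ u in Set.Ioi (0 : ℝ), ((B u - A : ℝ) : ℂ) *
      Complex.exp (-(ε + t * Complex.I) * u) = h ε t := by
    intro ε hε t
    set s : ℂ := 1 + ε + t * Complex.I with hs
    have hsre : 1 < s.re := by simp [hs, hε]
    have hs0 : s ≠ 0 := by rintro h0; rw [h0] at hsre; simp at hsre; linarith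
    have hs1 : s - 1 ≠ 0 := by
      intro h0
      have : (s - 1).re = 0 := by rw [h0]; simp
      simp at this
      linarith
    have hss : (ε + t * Complex.I : ℂ) = s - 1 := by rw [hs]; ring
    have hre : (-(s - 1)).re < 0 := by simp; linarith
    have hi := integrableOn_exp_mul_complex_Ioi hre 0
    have hi1 : IntegrableOn (fun u : ℝ => (B u : ℂ) * Complex.exp (-(s - 1) * u)) (Set.Ioi 0) :=
      Integrable.bdd_mul (c := C) hi (Complex.measurable_ofReal.comp hBm).aestronglyMeasurable
        (Eventually.of_forall fun u => by
          simp only [Complex.norm_real, Real.norm_of_nonneg (hB0 u)]; exact hBC u)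
    have hi2 : IntegrableOn (fun u : ℝ => (A : ℂ) * Complex.exp (-(s - 1) * u)) (Set.Ioi 0) :=
      hi.const_mul _
    have e1 := integral_partial_sum_exp f hf C hC s hsre
    have e2 := integral_exp_mul_complex_Ioi hre 0
    rw [hss]
    have e3 : ∫ u in Set.Ioi (0 : ℝ), ((B u - A : ℝ) : ℂ) * Complex.exp (-(s - 1) * u) =
        (∫ u in Set.Ioi (0 : ℝ), (B u : ℂ) * Complex.exp (-(s - 1) * u)) -
        ∫ u in Set.Ioi (0 : ℝ), (A : ℂ) * Complex.exp (-(s - 1) * u) := by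
      rw [← integral_sub hi1 hi2]
      refine integral_congr_ae (Eventually.of_forall fun u => ?_)
      simp only
      push_cast
      ring
    rw [e3, e1, integral_const_mul, e2]
    simp only [hh]
    rw [← hs, hGf s hsre]
    simp only [Complex.ofReal_zero, mul_zero, Complex.exp_zero]
    field_simp
    ring
  have hBt : Tendsto B atTop (nhds A) := by
    rw [Metric.tendsto_atTop']
    suffices ∀ δ > 0, ∀ᶠ Y in atTop, |B Y - A| < δ by
      intro δ hδ
      obtain ⟨N, hN⟩ := eventually_atTop.1 (this δ hδ)
      exact ⟨N, fun n hn => by rw [Real.dist_eq]; exact hN n hn.le⟩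
    intro δ hδ
    obtain ⟨r, hr0, hr1, hr2⟩ : ∃ r > 0, A + δ / 2 < (A + δ) * Real.exp (-(2 * r)) ∧
        (A - δ) * Real.exp (2 * r) < A - δ / 2 := by
      have c1 : Tendsto (fun r : ℝ => (A + δ) * Real.exp (-(2 * r))) (nhdsWithin 0 (Set.Ioi 0))
          (nhds (A + δ)) := by
        have : Continuous fun r : ℝ => (A + δ) * Real.exp (-(2 * r)) := by fun_prop
        exact (this.tendsto' 0 _ (by simp)).mono_left nhdsWithin_le_nhds
      have c2 : Tendsto (fun r : ℝ => (A - δ) * Real.exp (2 * r)) (nhdsWithin 0 (Set.Ioi 0))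
          (nhds (A - δ)) := by
        have : Continuous fun r : ℝ => (A - δ) * Real.exp (2 * r) := by fun_prop
        exact (this.tendsto' 0 _ (by simp)).mono_left nhdsWithin_le_nhds
      obtain ⟨r, h1, h2, h3⟩ := ((c1.eventually_const_lt (by linarith : A + δ / 2 < A + δ)).and
        ((c2.eventually_lt_const (by linarith : A - δ < A - δ / 2)).and self_mem_nhdsWithin)).exists
      exact ⟨r, h3, h1, h2⟩
    obtain ⟨L, hL, c, hc, hcb⟩ := fejer_average_ge (δ / 2) r D (by linarith) hr0 hD0
    have hft := tendsto_fejer_average _ hbm D hbD h hcont heq L hL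
    have hev1 : ∀ᶠ y in atTop, |∫ u in Set.Ioi (0 : ℝ), (B u - A) * fk L (y - u)| < c := by
      have := hft.abs
      rw [abs_zero] at this
      exact this.eventually_lt_const hc
    have ta : Tendsto (fun Y : ℝ => Y + r) atTop atTop := tendsto_atTop_add_const_right _ _ tendsto_id
    have tb : Tendsto (fun Y : ℝ => Y - r) atTop atTop :=
      tendsto_atTop_add_const_right _ (-r) tendsto_id
    filter_upwards [ta.eventually hev1, tb.eventually hev1, eventually_gt_atTop (2 * r)]
      with Y hY1 hY2 hY3
    rw [abs_lt]
    constructor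
    · by_contra hcon
      push Not at hcon
      have := hcb (fun u => A - B u) (by fun_prop) (fun u => by rw [abs_sub_comm]; exact hbD u)
        (Y - r) (by linarith) (fun u hu => by
          rw [abs_le] at hu
          have h1 := hBmono u Y (by linarith)
          have h2 : B Y * Real.exp (Y - u) ≤ (A - δ) * Real.exp (2 * r) := by
            apply mul_le_mul (by linarith) (Real.exp_le_exp.2 (by linarith)) (Real.exp_pos _).le
            linarith [hB0 Y]
          linarith)
      have e : ∫ u in Set.Ioi (0 : ℝ), (A - B u) * fk L (Y - r - u) =
          -∫ u in Set.Ioi (0 : ℝ), (B u - A) * fk L (Y - r - u) := by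
        rw [← integral_neg]
        congr 1
        ext u
        ring
      rw [e] at this
      linarith [(abs_lt.1 hY2).1]
    · by_contra hcon
      push Not at hcon
      have := hcb (fun u => B u - A) hbm hbD (Y + r) (by linarith) (fun u hu => by
          rw [abs_le] at hu
          have h1 := hBmono Y u (by linarith)
          have h3 : B u = B u * Real.exp (u - Y) * Real.exp (-(u - Y)) := by
            rw [mul_assoc, ← Real.exp_add]; simp
          have h4 : (A + δ) * Real.exp (-(2 * r)) ≤ B u := by
            rw [h3]
            apply mul_le_mul (by linarith) (Real.exp_le_exp.2 (by linarith)) (Real.exp_pos _).le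
            have := hB0 u
            positivity
          linarith)
      linarith [(abs_lt.1 hY1).2]
  have hlog : Tendsto (fun N : ℕ => Real.log N) atTop atTop :=
    Real.tendsto_log_atTop.comp tendsto_natCast_atTop_atTop
  refine (hBt.comp hlog).congr' ?_
  filter_upwards [eventually_gt_atTop 0] with N hN
  have hN0 : (0 : ℝ) < N := by exact_mod_cast hN
  simp only [hB, Function.comp, Real.exp_neg, Real.exp_log hN0, Nat.floor_natCast]
  rw [div_eq_mul_inv]

lemma tendsto_sum_residueClass (q : ℕ) [NeZero q] (a : ZMod q) (ha : IsUnit a) :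
    Tendsto (fun N : ℕ => (∑ n ∈ Finset.Ioc 0 N, ArithmeticFunction.vonMangoldt.residueClass a n) / N)
      atTop (nhds (q.totient : ℝ)⁻¹) := by
  have h := wiener_ikehara (ArithmeticFunction.vonMangoldt.residueClass a)
    (ArithmeticFunction.vonMangoldt.residueClass_nonneg a) 6 (q.totient : ℝ)⁻¹ (fun N =>
      (Finset.sum_le_sum fun n _ => ArithmeticFunction.vonMangoldt.residueClass_le a n).trans
        (sum_vonMangoldt_le N)) _
    (ArithmeticFunction.vonMangoldt.continuousOn_LFunctionResidueClassAux a) (fun s hs => by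
      have := ArithmeticFunction.vonMangoldt.eqOn_LFunctionResidueClassAux ha hs
      rw [this]
      push_cast
      rfl)
  exact h

lemma tendsto_sum_vonMangoldt :
    Tendsto (fun N : ℕ => (∑ n ∈ Finset.Ioc 0 N, ArithmeticFunction.vonMangoldt n) / N)
      atTop (nhds 1) := by
  have h := tendsto_sum_residueClass 1 1 isUnit_one
  simp only [Nat.totient_one, Nat.cast_one, inv_one] at h
  refine h.congr fun N => ?_
  congr 1
  refine Finset.sum_congr rfl fun n _ => ?_
  rw [ArithmeticFunction.vonMangoldt.residueClass, Set.indicator_of_mem]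
  exact Subsingleton.elim (α := ZMod 1) _ _

lemma tendsto_theta_div : Tendsto (fun N : ℕ => Chebyshev.theta N / N) atTop (nhds 1) := by
  have h1 := tendsto_sum_vonMangoldt
  have h2 : Tendsto (fun N : ℕ => 2 * (Real.log N / Real.sqrt N)) atTop (nhds 0) := by
    have := (isLittleO_log_rpow_atTop (r := 1 / 2) (by norm_num)).tendsto_div_nhds_zero
    have := (this.comp tendsto_natCast_atTop_atTop).const_mul 2
    simp only [mul_zero] at this
    refine this.congr fun N => ?_
    simp [Function.comp, Real.sqrt_eq_rpow]
  have h3 : Tendsto (fun N : ℕ => Chebyshev.theta N / N -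
      (∑ n ∈ Finset.Ioc 0 N, ArithmeticFunction.vonMangoldt n) / N) atTop (nhds 0) := by
    refine squeeze_zero_norm' ?_ h2
    filter_upwards [eventually_ge_atTop 1] with N hN
    have hN0 : (1 : ℝ) ≤ N := by exact_mod_cast hN
    have := Chebyshev.abs_psi_sub_theta_le_sqrt_mul_log hN0
    rw [Chebyshev.psi, Nat.floor_natCast] at this
    rw [← sub_div, norm_div, Real.norm_natCast, Real.norm_eq_abs, abs_sub_comm, div_le_iff₀ (by linarith)]
    refine this.trans (le_of_eq ?_)
    have hs : Real.sqrt N * Real.sqrt N = N := Real.mul_self_sqrt (by linarith)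
    have : 0 < Real.sqrt N := Real.sqrt_pos.2 (by linarith)
    field_simp
    rw [sq, hs, mul_comm]
  simpa using h3.add h1

lemma tendsto_primeCounting :
    Tendsto (fun N : ℕ => (Nat.primeCounting N : ℝ) * Real.log N / N) atTop (nhds 1) := by
  have h1 := tendsto_theta_div
  have h2 := (Chebyshev.primeCounting_sub_theta_div_log_isBigO).comp_tendsto
    (tendsto_natCast_atTop_atTop (R := ℝ))
  have hl : Tendsto (fun N : ℕ => Real.log N) atTop atTop :=
    Real.tendsto_log_atTop.comp tendsto_natCast_atTop_atTop
  have h3 : Tendsto (fun N : ℕ => ((Nat.primeCounting N : ℝ) - Chebyshev.theta N / Real.log N) *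
      (Real.log N / N)) atTop (nhds 0) := by
    obtain ⟨c, hc⟩ := h2.bound
    have h4 : Tendsto (fun N : ℕ => c * (Real.log N)⁻¹) atTop (nhds 0) := by
      simpa using (tendsto_inv_atTop_zero.comp hl).const_mul c
    refine squeeze_zero_norm' ?_ h4
    filter_upwards [hc, eventually_ge_atTop 2, hl.eventually_gt_atTop 0] with N hN hN2 hlN
    have hN0 : (0 : ℝ) < N := by exact_mod_cast (by omega : 0 < N)
    simp only [Function.comp, Nat.floor_natCast] at hN
    rw [norm_mul, Real.norm_of_nonneg (by positivity : 0 ≤ Real.log N / N)]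
    calc _ ≤ c * ‖(N : ℝ) / Real.log N ^ 2‖ * (Real.log N / N) := by gcongr
      _ = _ := by
        rw [Real.norm_of_nonneg (by positivity)]
        field_simp
  refine (by simpa using h3.add h1 : Tendsto _ _ _).congr' ?_
  filter_upwards [hl.eventually_gt_atTop 0, eventually_ge_atTop 2] with N hlN hN2
  have hN0 : (0 : ℝ) < N := by exact_mod_cast (by omega : 0 < N)
  field_simp
  ring

lemma dn_eq_abs (x : ℝ) (hx : |x| < 1 / 2) : dn x = |x| := by
  have : round x = 0 := by
    rw [round_eq, Int.floor_eq_zero_iff]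
    rw [abs_lt] at hx
    constructor <;> linarith
  rw [dn, this]
  simp

lemma exists_dn_le_of_card (θ ε δ : ℝ) (H : ℕ) (hε : 0 ≤ ε) (hδ : 0 < δ) (hεδ : 64 * ε ≤ δ)
    (hδ1 : δ ≤ 1) (hH : 8 ≤ δ ^ 2 * H) (J : Finset ℕ) (hJ : J ⊆ Finset.range H)
    (hJH : δ * H ≤ J.card) (hJd : ∀ j ∈ J, dn (j * θ) ≤ ε) :
    ∃ q : ℕ, 1 ≤ q ∧ (q : ℝ) ≤ 2 / δ ∧ dn (q * θ) ≤ 4 * ε * q / (δ * H) := by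
  have hH0 : (0 : ℝ) < H := by
    by_contra h
    push Not at h
    nlinarith [sq_nonneg δ]
  have hδH : 8 ≤ δ * H := by nlinarith
  set s : ℕ := ⌈2 / δ⌉₊ with hs
  have hs1 : 2 / δ ≤ s := Nat.le_ceil _
  have hs2 : (s : ℝ) < 2 / δ + 1 := Nat.ceil_lt_add_one (by positivity)
  have hs0 : 0 < s := Nat.ceil_pos.2 (by positivity)
  have hpairs : ∃ q : ℕ, 1 ≤ q ∧ q < s ∧ dn (q * θ) ≤ 2 * ε := by
    have hcard : (Finset.range (H / s + 1)).card < J.card := by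
      rw [Finset.card_range]
      have h1 : ((H / s : ℕ) : ℝ) ≤ H / s := Nat.cast_div_le
      have h2 : (H : ℝ) / s ≤ δ * H / 2 := by
        rw [div_le_iff₀ (by exact_mod_cast hs0)]
        rw [div_le_iff₀ hδ] at hs1
        nlinarith
      have : (((H / s + 1 : ℕ)) : ℝ) < J.card := by
        push_cast
        linarith
      exact_mod_cast this
    obtain ⟨a, ha, b, hb, hab, hfab⟩ := Finset.exists_ne_map_eq_of_card_lt_of_maps_to hcard
      (f := fun j => j / s) (fun j hj => by
        have := Finset.mem_range.1 (hJ hj)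
        simp only [Finset.coe_range, Set.mem_Iio]
        exact Nat.lt_succ_of_le (Nat.div_le_div_right this.le))
    wlog hlt : a < b generalizing a b
    · exact this b hb a ha hab.symm hfab.symm (by omega)
    refine ⟨b - a, by omega, ?_, ?_⟩
    · have h1 := Nat.div_add_mod a s
      have h2 := Nat.div_add_mod b s
      rw [hfab] at h1
      have := Nat.mod_lt b hs0
      omega
    · rw [Nat.cast_sub hlt.le, sub_mul]
      have := dn_sub_le (b * θ) (a * θ)
      linarith [hJd a ha, hJd b hb]
  obtain ⟨q, hq1, hqs, hqd⟩ := hpairs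
  have hq0 : (1 : ℝ) ≤ q := by exact_mod_cast hq1
  have hqδ : (q : ℝ) ≤ 2 / δ := by
    have : ((q + 1 : ℕ) : ℝ) ≤ s := by exact_mod_cast hqs
    push_cast at this
    linarith
  refine ⟨q, hq1, hqδ, ?_⟩
  set β : ℝ := q * θ - round (q * θ) with hβ
  have hdβ : dn (q * θ) = |β| := rfl
  rw [hdβ] at hqd ⊢
  rcases eq_or_ne β 0 with h0 | h0
  · rw [h0, abs_zero]; positivity
  have hβ0 : 0 < |β| := abs_pos.2 h0
  set R : ℕ := ⌊1 / (2 * |β|)⌋₊ with hR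
  have hR1 : (R : ℝ) ≤ 1 / (2 * |β|) := Nat.floor_le (by positivity)
  have hR2 : 1 / (4 * |β|) ≤ R := by
    have h1 : 1 / (2 * |β|) - 1 < R := Nat.sub_one_lt_floor _
    have h2 : 1 / (2 * |β|) - 1 / (4 * |β|) = 1 / (4 * |β|) := by field_simp; norm_num
    have h3 : 1 ≤ 1 / (4 * |β|) := by
      rw [le_div_iff₀ (by positivity)]
      linarith
    linarith
  have hR0 : 0 < R := by
    have : (0 : ℝ) < R := lt_of_lt_of_le (by positivity) hR2
    exact_mod_cast this
  have hmaps : ∀ j ∈ J, (j % q, j / q / R) ∈ Finset.range q ×ˢ Finset.range (H / q / R + 1) := by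
    intro j hj
    have := Finset.mem_range.1 (hJ hj)
    simp only [Finset.mem_product, Finset.mem_range]
    exact ⟨Nat.mod_lt _ hq1, Nat.lt_succ_of_le (Nat.div_le_div_right (Nat.div_le_div_right this.le))⟩
  have hfib : ∀ p ∈ Finset.range q ×ˢ Finset.range (H / q / R + 1),
      (J.filter fun j => (j % q, j / q / R) = p).card ≤ ⌊2 * ε / |β|⌋₊ + 1 := by
    intro p _
    set F := J.filter fun j => (j % q, j / q / R) = p with hF
    rcases F.eq_empty_or_nonempty with h | hne
    · rw [h]; simp
    set j0 := F.min' hne with hj0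
    have hj0F : j0 ∈ F := F.min'_mem hne
    have hsub : ∀ j ∈ F, j / q ∈ Finset.Icc (j0 / q) (j0 / q + ⌊2 * ε / |β|⌋₊) := by
      intro j hj
      have hle : j0 ≤ j := F.min'_le j hj
      have hle' : j0 / q ≤ j / q := Nat.div_le_div_right hle
      rw [Finset.mem_Icc]
      refine ⟨hle', ?_⟩
      have h1 := (Finset.mem_filter.1 hj).2
      have h2 := (Finset.mem_filter.1 hj0F).2
      rw [← h2, Prod.mk.injEq] at h1
      set i := j / q with hi
      set i0 := j0 / q with hi0
      have e1 := Nat.div_add_mod j q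
      have e2 := Nat.div_add_mod j0 q
      rw [h1.1] at e1
      have hjj : (j : ℝ) - j0 = q * ((i - i0 : ℕ) : ℝ) := by
        have c1 : (j : ℝ) = q * i + (j0 % q : ℕ) := by exact_mod_cast e1.symm
        have c2 : (j0 : ℝ) = q * i0 + (j0 % q : ℕ) := by exact_mod_cast e2.symm
        rw [Nat.cast_sub hle', c1]
        linear_combination -c2
      have hlt : i - i0 < R := by
        have a1 := Nat.div_add_mod i R
        have a2 := Nat.div_add_mod i0 R
        rw [h1.2] at a1
        have := Nat.mod_lt i hR0
        omega
      have hlt' : ((i - i0 : ℕ) : ℝ) < R := by exact_mod_cast hlt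
      have hd1 : dn ((j : ℝ) * θ - j0 * θ) ≤ 2 * ε := by
        have := dn_sub_le (j * θ) (j0 * θ)
        linarith [hJd j (Finset.mem_filter.1 hj).1, hJd j0 (Finset.mem_filter.1 hj0F).1]
      have hd2 : (j : ℝ) * θ - j0 * θ = ((i - i0 : ℕ) : ℝ) * β +
          (((i - i0 : ℕ) : ℤ) * round (q * θ) : ℤ) := by
        rw [← sub_mul, hjj, hβ]
        push_cast
        ring
      rw [hd2, dn_add_int, dn_eq_abs, abs_mul, Nat.abs_cast] at hd1
      · have : i - i0 ≤ ⌊2 * ε / |β|⌋₊ := Nat.le_floor (by rw [le_div_iff₀ hβ0]; exact hd1)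
        omega
      · rw [abs_mul, Nat.abs_cast]
        calc _ < (R : ℝ) * |β| := by gcongr
          _ ≤ 1 / (2 * |β|) * |β| := by gcongr
          _ = 1 / 2 := by field_simp
    have hinj : Set.InjOn (fun j => j / q) F := by
      intro a ha b hb hab
      have h1 := (Finset.mem_filter.1 ha).2
      have h2 := (Finset.mem_filter.1 hb).2
      rw [← h2, Prod.mk.injEq] at h1
      have e1 := Nat.div_add_mod a q
      have e2 := Nat.div_add_mod b q
      simp only at hab
      rw [hab, h1.1] at e1
      omega
    have := Finset.card_le_card_of_injOn _ hsub hinj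
    rw [Nat.card_Icc] at this
    omega
  have hcard := Finset.card_le_mul_card_image_of_maps_to hmaps _ hfib
  rw [Finset.card_product, Finset.card_range, Finset.card_range] at hcard
  have hcard' : (J.card : ℝ) ≤ (2 * ε / |β| + 1) * (q * (4 * H * |β| / q + 1)) := by
    have h1 : ((⌊2 * ε / |β|⌋₊ : ℕ) : ℝ) ≤ 2 * ε / |β| := Nat.floor_le (by positivity)
    have h2 : ((H / q / R : ℕ) : ℝ) ≤ 4 * H * |β| / q := by
      calc ((H / q / R : ℕ) : ℝ) ≤ ((H / q : ℕ) : ℝ) / R := Nat.cast_div_le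
        _ ≤ (H / q : ℝ) / (1 / (4 * |β|)) := by gcongr; exact Nat.cast_div_le
        _ = _ := by field_simp
    calc (J.card : ℝ) ≤ (((⌊2 * ε / |β|⌋₊ + 1) * (q * (H / q / R + 1)) : ℕ) : ℝ) := by
          exact_mod_cast hcard
      _ = ((⌊2 * ε / |β|⌋₊ : ℝ) + 1) * (q * (((H / q / R : ℕ) : ℝ) + 1)) := by push_cast; rfl
      _ ≤ _ := by gcongr
  have e : (2 * ε / |β| + 1) * (q * (4 * H * |β| / q + 1)) =
      8 * H * ε + 4 * H * |β| + 2 * ε * q / |β| + q := by field_simp; ring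
  rw [e] at hcard'
  have hq2 : (q : ℝ) ≤ δ * H / 4 := by
    have : 2 / δ ≤ δ * H / 4 := by
      rw [div_le_iff₀ hδ]; nlinarith
    linarith
  have h3 : δ * H / 2 ≤ 2 * ε * q / |β| := by nlinarith
  rw [le_div_iff₀ hβ0] at h3
  rw [le_div_iff₀ (by positivity)]
  linarith

lemma sum_divisorsAntidiagonal_eq {M : Type*} [AddCommMonoid M] (N : ℕ) (g : ℕ → ℕ → M) :
    ∑ n ∈ Finset.Ioc 0 N, ∑ p ∈ n.divisorsAntidiagonal, g p.1 p.2 =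
      ∑ a ∈ Finset.Ioc 0 N, ∑ b ∈ Finset.Ioc 0 (N / a), g a b := by
  rw [Finset.sum_sigma', Finset.sum_sigma']
  refine Finset.sum_bij' (fun x _ => ⟨x.2.1, x.2.2⟩) (fun y _ => ⟨y.1 * y.2, (y.1, y.2)⟩) ?_ ?_ ?_ ?_ ?_
  · rintro ⟨n, a, b⟩ h
    simp only [Finset.mem_sigma, Finset.mem_Ioc, Nat.mem_divisorsAntidiagonal] at h ⊢
    obtain ⟨⟨h1, h2⟩, h3, h4⟩ := h
    have ha : 0 < a := Nat.pos_of_ne_zero (by rintro rfl; simp at h3; omega)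
    have hb : 0 < b := Nat.pos_of_ne_zero (by rintro rfl; simp at h3; omega)
    refine ⟨⟨ha, ?_⟩, hb, ?_⟩
    · nlinarith
    · rw [Nat.le_div_iff_mul_le ha, mul_comm]; omega
  · rintro ⟨a, b⟩ h
    simp only [Finset.mem_sigma, Finset.mem_Ioc, Nat.mem_divisorsAntidiagonal] at h ⊢
    obtain ⟨⟨h1, h2⟩, h3, h4⟩ := h
    rw [Nat.le_div_iff_mul_le h1] at h4
    have := Nat.mul_pos h1 h3
    refine ⟨⟨this, by linarith⟩, trivial, this.ne'⟩
  · rintro ⟨n, a, b⟩ h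
    simp only [Finset.mem_sigma, Nat.mem_divisorsAntidiagonal] at h
    obtain ⟨-, rfl, -⟩ := h
    rfl
  · rintro ⟨a, b⟩ h; rfl
  · rintro ⟨n, a, b⟩ h; rfl

open ArithmeticFunction in
lemma sum_moebius_mul_log_sq (n : ℕ) (hn : 1 ≤ n) :
    ∑ d ∈ n.divisors, (moebius d : ℝ) * Real.log d ^ 2 =
      ∑ p ∈ n.divisorsAntidiagonal, vonMangoldt p.1 * vonMangoldt p.2 - vonMangoldt n * Real.log n := by
  set F : ArithmeticFunction ℝ := pmul (moebius : ArithmeticFunction ℝ) log with hF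
  have h1 : (zeta : ArithmeticFunction ℝ) * F = -vonMangoldt := by
    ext m
    rw [coe_zeta_mul_apply, ArithmeticFunction.neg_apply, ← sum_moebius_mul_log_eq]
    simp [hF, pmul_apply]
  have h2 : log * F = -(vonMangoldt * vonMangoldt) := by
    rw [← vonMangoldt_mul_zeta, mul_assoc, h1]
    exact mul_neg vonMangoldt vonMangoldt
  have h3 := congrArg (fun f : ArithmeticFunction ℝ => f n) h2
  simp only [ArithmeticFunction.neg_apply, mul_apply] at h3
  have h4 : Real.log n * ∑ d ∈ n.divisors, (moebius d : ℝ) * Real.log d =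
      ∑ d ∈ n.divisors, (moebius d : ℝ) * Real.log d ^ 2 +
      ∑ p ∈ n.divisorsAntidiagonal, log p.1 * F p.2 := by
    rw [Nat.sum_divisorsAntidiagonal' (fun i j => log i * F j), ← Finset.sum_add_distrib,
      Finset.mul_sum]
    refine Finset.sum_congr rfl fun d hd => ?_
    obtain ⟨hdn, -⟩ := Nat.mem_divisors.1 hd
    have hd0 : d ≠ 0 := by rintro rfl; simp at hdn; omega
    simp only [hF, pmul_apply, log_apply, intCoe_apply]
    rw [Nat.cast_div hdn (by exact_mod_cast hd0), Real.log_div (by positivity) (by positivity)]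
    ring
  have h5 := sum_moebius_mul_log_eq (n := n)
  simp only [log_apply] at h5
  rw [h3, h5] at h4
  linarith

open ArithmeticFunction in
lemma selberg_identity (l : ℝ) (n : ℕ) (hn : 1 ≤ n) :
    ∑ d ∈ n.divisors, (moebius d : ℝ) * (l - Real.log d) ^ 2 =
      (if n = 1 then l ^ 2 else 0) + (2 * l - Real.log n) * vonMangoldt n +
      ∑ p ∈ n.divisorsAntidiagonal, vonMangoldt p.1 * vonMangoldt p.2 := by
  have h1 := sum_moebius_mul_log_sq n hn
  have h2 := sum_moebius_mul_log_eq (n := n)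
  have h3 : ∑ d ∈ n.divisors, (moebius d : ℝ) = if n = 1 then 1 else 0 := by
    have := congrArg (fun f : ArithmeticFunction ℤ => f n) coe_zeta_mul_moebius
    simp only [coe_zeta_mul_apply, one_apply] at this
    exact_mod_cast this
  have h4 : ∑ d ∈ n.divisors, (moebius d : ℝ) * (l - Real.log d) ^ 2 =
      l ^ 2 * ∑ d ∈ n.divisors, (moebius d : ℝ) -
      2 * l * ∑ d ∈ n.divisors, (moebius d : ℝ) * log d +
      ∑ d ∈ n.divisors, (moebius d : ℝ) * Real.log d ^ 2 := by
    rw [Finset.mul_sum, Finset.mul_sum, ← Finset.sum_sub_distrib, ← Finset.sum_add_distrib]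
    refine Finset.sum_congr rfl fun d _ => ?_
    rw [log_apply]
    ring
  rw [h4, h1, h2, h3]
  split_ifs <;> ring

open ArithmeticFunction in
lemma sum_vonMangoldt_mul_log_div_le (N : ℕ) :
    ∑ n ∈ Finset.Ioc 0 N, vonMangoldt n * (Real.log N - Real.log n) ≤ 6 * N := by
  have hlog : ∀ n : ℕ, 0 < n → ∀ k, Real.log (n + k : ℕ) - Real.log n ≤
      ∑ j ∈ Finset.range k, (1 / (n + j : ℕ) : ℝ) := by
    intro n hn k
    induction k with
    | zero => simp
    | succ k ih =>
      rw [Finset.sum_range_succ]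
      have hp : (0 : ℝ) < (n + k : ℕ) := by positivity
      have h1 : Real.log (n + (k + 1) : ℕ) - Real.log (n + k : ℕ) ≤ 1 / (n + k : ℕ) := by
        rw [← Real.log_div (by positivity) (by positivity)]
        refine (Real.log_le_sub_one_of_pos (by positivity)).trans (le_of_eq ?_)
        field_simp
        push_cast
        ring
      linarith
  calc ∑ n ∈ Finset.Ioc 0 N, vonMangoldt n * (Real.log N - Real.log n)
      ≤ ∑ n ∈ Finset.Ioc 0 N, ∑ j ∈ Finset.Ico 1 N, if n ≤ j then vonMangoldt n * (1 / (j : ℝ)) else 0 := by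
        refine Finset.sum_le_sum fun n hn => ?_
        rw [Finset.mem_Ioc] at hn
        rw [← Finset.sum_filter, ← Finset.mul_sum]
        refine mul_le_mul_of_nonneg_left ?_ vonMangoldt_nonneg
        have := hlog n hn.1 (N - n)
        rw [Nat.add_sub_cancel' hn.2] at this
        refine this.trans (le_of_eq ?_)
        rw [← Finset.sum_Ico_eq_sum_range (fun j : ℕ => (1 / (j : ℝ)))]
        congr 1
        ext j
        simp only [Finset.mem_filter, Finset.mem_Ico]
        omega
    _ = ∑ j ∈ Finset.Ico 1 N, (1 / (j : ℝ)) * ∑ n ∈ Finset.Ioc 0 j, vonMangoldt n := by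
        rw [Finset.sum_comm]
        refine Finset.sum_congr rfl fun j hj => ?_
        rw [Finset.mem_Ico] at hj
        rw [← Finset.sum_filter, Finset.mul_sum]
        refine Finset.sum_congr ?_ fun n _ => by ring
        ext n
        simp only [Finset.mem_filter, Finset.mem_Ioc]
        omega
    _ ≤ ∑ j ∈ Finset.Ico 1 N, (6 : ℝ) := by
        refine Finset.sum_le_sum fun j hj => ?_
        rw [Finset.mem_Ico] at hj
        have hj0 : (0 : ℝ) < j := by exact_mod_cast hj.1
        rw [one_div_mul_eq_div, div_le_iff₀ hj0]
        exact sum_vonMangoldt_le j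
    _ ≤ 6 * N := by
        rw [Finset.sum_const, Nat.card_Ico, nsmul_eq_mul, mul_comm]
        gcongr
        exact Nat.sub_le _ _

/-- The Type I part of Selberg's identity. -/
noncomputable def selbergSum (N : ℕ) (θ : ℝ) : ℂ :=
  ∑ d ∈ Finset.Ioc 0 N, ((ArithmeticFunction.moebius d : ℝ) * (Real.log N - Real.log d) ^ 2 : ℝ) *
    ∑ k ∈ Finset.Ioc 0 (N / d), ex (k * (d * θ))

/-- The bilinear part of Selberg's identity. -/
noncomputable def bilinSum (N : ℕ) (θ : ℝ) : ℂ :=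
  ∑ m ∈ Finset.Ioc 0 N, (ArithmeticFunction.vonMangoldt m : ℂ) *
    expSum ArithmeticFunction.vonMangoldt (N / m) (m * θ)

open ArithmeticFunction in
lemma norm_selberg_le (N : ℕ) (θ : ℝ) :
    ‖Real.log N * expSum vonMangoldt N θ + bilinSum N θ - selbergSum N θ‖ ≤
      Real.log N ^ 2 + 6 * N := by
  have h1 : selbergSum N θ = ∑ n ∈ Finset.Ioc 0 N,
      ((∑ d ∈ n.divisors, (moebius d : ℝ) * (Real.log N - Real.log d) ^ 2 : ℝ) : ℂ) * ex (n * θ) := by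
    have := sum_divisorsAntidiagonal_eq N (fun a b =>
      (((moebius a : ℝ) * (Real.log N - Real.log a) ^ 2 : ℝ) : ℂ) * ex (b * (a * θ)))
    simp only [selbergSum, Finset.mul_sum]
    rw [← this]
    refine Finset.sum_congr rfl fun n _ => ?_
    rw [Complex.ofReal_sum, Finset.sum_mul, ← Nat.map_div_right_divisors, Finset.sum_map]
    refine Finset.sum_congr rfl fun d hd => ?_
    congr 2
    rw [← mul_assoc]
    congr 1
    exact_mod_cast Nat.div_mul_cancel (Nat.dvd_of_mem_divisors hd)
  have h2 : bilinSum N θ = ∑ n ∈ Finset.Ioc 0 N,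
      ((∑ p ∈ n.divisorsAntidiagonal, vonMangoldt p.1 * vonMangoldt p.2 : ℝ) : ℂ) * ex (n * θ) := by
    have := sum_divisorsAntidiagonal_eq N (fun a b =>
      (vonMangoldt a : ℂ) * ((vonMangoldt b : ℂ) * ex (b * (a * θ))))
    simp only [bilinSum, expSum, Finset.mul_sum]
    rw [← this]
    refine Finset.sum_congr rfl fun n _ => ?_
    rw [Complex.ofReal_sum, Finset.sum_mul]
    refine Finset.sum_congr rfl fun p hp => ?_
    have : (p.1 : ℝ) * p.2 = n := by exact_mod_cast (Nat.mem_divisorsAntidiagonal.1 hp).1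
    rw [← this, show (p.1 : ℝ) * p.2 * θ = p.2 * (p.1 * θ) by ring]
    push_cast
    ring
  have h3 : Real.log N * expSum vonMangoldt N θ + bilinSum N θ - selbergSum N θ =
      -∑ n ∈ Finset.Ioc 0 N, (((if n = 1 then Real.log N ^ 2 else 0) +
        vonMangoldt n * (Real.log N - Real.log n) : ℝ) : ℂ) * ex (n * θ) := by
    rw [h1, h2, expSum, Finset.mul_sum, ← Finset.sum_add_distrib, ← Finset.sum_sub_distrib,
      ← Finset.sum_neg_distrib]
    refine Finset.sum_congr rfl fun n hn => ?_
    rw [Finset.mem_Ioc] at hn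
    rw [selberg_identity _ n hn.1]
    push_cast
    ring
  rw [h3, norm_neg]
  refine (norm_sum_le _ _).trans ?_
  have h4 : ∀ n ∈ Finset.Ioc 0 N, ‖(((if n = 1 then Real.log N ^ 2 else 0) +
        vonMangoldt n * (Real.log N - Real.log n) : ℝ) : ℂ) * ex (n * θ)‖ =
        (if n = 1 then Real.log N ^ 2 else 0) + vonMangoldt n * (Real.log N - Real.log n) := by
    intro n hn
    rw [Finset.mem_Ioc] at hn
    rw [norm_mul, norm_ex, mul_one, Complex.norm_real, Real.norm_of_nonneg]
    have : Real.log n ≤ Real.log N := Real.log_le_log (by exact_mod_cast hn.1) (by exact_mod_cast hn.2)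
    have h5 : 0 ≤ vonMangoldt n * (Real.log N - Real.log n) := mul_nonneg vonMangoldt_nonneg (by linarith)
    split_ifs <;> positivity
  rw [Finset.sum_congr rfl h4, Finset.sum_add_distrib, Finset.sum_ite_eq']
  have := sum_vonMangoldt_mul_log_div_le N
  split_ifs
  · linarith
  · have : 0 ≤ Real.log N ^ 2 := sq_nonneg _
    linarith

lemma exists_factored_mul_coprime (q : ℕ) (hq : q ≠ 0) (n : ℕ) (hn : n ≠ 0) :
    ∃ u v, n = u * v ∧ u ∈ Nat.factoredNumbers q.primeFactors ∧ v.Coprime q := by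
  induction n using Nat.strong_induction_on with
  | _ n ih =>
    by_cases h : n.Coprime q
    · exact ⟨1, n, by simp, by simp [Nat.mem_factoredNumbers], h⟩
    · obtain ⟨p, hp, hpn, hpq⟩ := Nat.Prime.not_coprime_iff_dvd.1 h
      obtain ⟨m, rfl⟩ := hpn
      have hm : m ≠ 0 := by rintro rfl; simp at hn
      obtain ⟨u, v, h1, h2, h3⟩ := ih m (by nlinarith [hp.two_le, Nat.pos_of_ne_zero hm]) hm
      refine ⟨p * u, v, by rw [h1, mul_assoc], Nat.mul_mem_factoredNumbers ?_ h2, h3⟩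
      refine Nat.mem_factoredNumbers_of_primeFactors_subset hp.ne_zero ?_
      rw [hp.primeFactors]
      simp [hp, hpq, hq]

lemma sum_moebius_coprime (q : ℕ) (hq : q ≠ 0) (n : ℕ) (hn : n ≠ 0)
    [Decidable (n ∈ Nat.factoredNumbers q.primeFactors)] :
    ∑ d ∈ n.divisors with d.Coprime q, (ArithmeticFunction.moebius d : ℝ) =
      if n ∈ Nat.factoredNumbers q.primeFactors then 1 else 0 := by
  obtain ⟨u, v, huv, hu, hv⟩ := exists_factored_mul_coprime q hq n hn
  have hu0 : u ≠ 0 := Nat.ne_zero_of_mem_factoredNumbers hu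
  have hcop : ∀ d : ℕ, d.Coprime q → d.Coprime u := by
    intro d hd
    by_contra h
    obtain ⟨p, hp, hpd, hpu⟩ := Nat.Prime.not_coprime_iff_dvd.1 h
    have := Nat.primeFactors_subset_of_mem_factoredNumbers hu (Nat.mem_primeFactors.2 ⟨hp, hpu, hu0⟩)
    exact Nat.Prime.not_coprime_iff_dvd.2 ⟨p, hp, hpd, (Nat.mem_primeFactors.1 this).2.1⟩ hd
  have hv0 : v ≠ 0 := by rintro rfl; simp at huv; exact hn huv
  have h1 : n.divisors.filter (fun d => d.Coprime q) = v.divisors := by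
    ext d
    simp only [Finset.mem_filter, Nat.mem_divisors]
    constructor
    · rintro ⟨⟨h1, -⟩, h2⟩
      rw [huv] at h1
      exact ⟨(hcop d h2).dvd_of_dvd_mul_left h1, hv0⟩
    · rintro ⟨h1, -⟩
      exact ⟨⟨huv ▸ h1.mul_left u, hn⟩, Nat.Coprime.coprime_dvd_left h1 hv⟩
  have h2 : (∑ d ∈ v.divisors, (ArithmeticFunction.moebius d : ℝ)) = if v = 1 then 1 else 0 := by
    exact_mod_cast sum_moebius_divisors v
  rw [h1, h2]
  refine if_congr ⟨?_, ?_⟩ rfl rfl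
  · rintro rfl
    rw [huv, mul_one]
    exact hu
  · intro h
    by_contra hv1
    obtain ⟨p, hp, hpv⟩ := Nat.exists_prime_and_dvd hv1
    have := Nat.primeFactors_subset_of_mem_factoredNumbers h
      (Nat.mem_primeFactors.2 ⟨hp, huv ▸ hpv.mul_left u, hn⟩)
    exact Nat.Prime.not_coprime_iff_dvd.2 ⟨p, hp, hpv, (Nat.mem_primeFactors.1 this).2.1⟩ hv

open Classical in
lemma sum_factored_eq (q : ℕ) (hq : q ≠ 0) (N : ℕ) (g : ℕ → ℝ) :
    ∑ d ∈ Finset.Ioc 0 N with d.Coprime q, (ArithmeticFunction.moebius d : ℝ) *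
      ∑ k ∈ Finset.Ioc 0 (N / d), g (d * k) =
      ∑ n ∈ Finset.Ioc 0 N with n ∈ Nat.factoredNumbers q.primeFactors, g n := by
  have := sum_divisorsAntidiagonal_eq N
    (fun a b => (if a.Coprime q then (ArithmeticFunction.moebius a : ℝ) else 0) * g (a * b))
  rw [Finset.sum_filter, Finset.sum_filter]
  have h2 : ∀ d ∈ Finset.Ioc 0 N, (if d.Coprime q then (ArithmeticFunction.moebius d : ℝ) *
      ∑ k ∈ Finset.Ioc 0 (N / d), g (d * k) else 0) = ∑ b ∈ Finset.Ioc 0 (N / d),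
      (if d.Coprime q then (ArithmeticFunction.moebius d : ℝ) else 0) * g (d * b) := by
    intro d _
    split_ifs
    · rw [Finset.mul_sum]
    · simp
  rw [Finset.sum_congr rfl h2, ← this]
  refine Finset.sum_congr rfl fun n hn => ?_
  rw [Finset.mem_Ioc] at hn
  have h3 : ∀ p ∈ n.divisorsAntidiagonal,
      (if p.1.Coprime q then (ArithmeticFunction.moebius p.1 : ℝ) else 0) * g (p.1 * p.2) =
      (if p.1.Coprime q then (ArithmeticFunction.moebius p.1 : ℝ) else 0) * g n := by
    intro p hp
    rw [(Nat.mem_divisorsAntidiagonal.1 hp).1]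
  rw [Finset.sum_congr rfl h3, Nat.sum_divisorsAntidiagonal
    (fun i _ => (if i.Coprime q then (ArithmeticFunction.moebius i : ℝ) else 0) * g n),
    ← Finset.sum_mul, ← Finset.sum_filter, sum_moebius_coprime q hq n (by omega)]
  split_ifs <;> simp

lemma abs_moebius_le (d : ℕ) : |(ArithmeticFunction.moebius d : ℝ)| ≤ 1 := by
  exact_mod_cast ArithmeticFunction.abs_moebius_le_one (n := d)

lemma abs_sum_moebius_div_le (q : ℕ) (hq : q ≠ 0) (N : ℕ) :
    |∑ d ∈ Finset.Ioc 0 N with d.Coprime q, (ArithmeticFunction.moebius d : ℝ) / d| ≤ 2 := by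
  classical
  rcases Nat.eq_zero_or_pos N with rfl | hN
  · simp
  have h1 := sum_factored_eq q hq N (fun _ => 1)
  simp only [Finset.sum_const, Nat.card_Ioc, nsmul_eq_mul, mul_one, Nat.sub_zero] at h1
  have hc : ((((Finset.Ioc 0 N).filter (fun n => n ∈ Nat.factoredNumbers q.primeFactors)).card : ℕ) : ℝ)
      ≤ N := by
    exact_mod_cast (Finset.card_filter_le _ _).trans (by simp)
  have hN0 : (0 : ℝ) < N := by exact_mod_cast hN
  have h2 : |(N : ℝ) * ∑ d ∈ Finset.Ioc 0 N with d.Coprime q, (ArithmeticFunction.moebius d : ℝ) / d -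
      ∑ d ∈ Finset.Ioc 0 N with d.Coprime q, (ArithmeticFunction.moebius d : ℝ) * (N / d : ℕ)| ≤ N := by
    rw [Finset.mul_sum, ← Finset.sum_sub_distrib]
    refine (Finset.abs_sum_le_sum_abs _ _).trans ?_
    calc _ ≤ ∑ d ∈ Finset.Ioc 0 N with d.Coprime q, (1 : ℝ) := by
          refine Finset.sum_le_sum fun d hd => ?_
          have hd0 : 0 < d := (Finset.mem_Ioc.1 (Finset.mem_filter.1 hd).1).1
          have hd1 : (0 : ℝ) < d := by exact_mod_cast hd0
          have e : (N : ℝ) * ((ArithmeticFunction.moebius d : ℝ) / d) -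
            (ArithmeticFunction.moebius d : ℝ) * (N / d : ℕ) =
            (ArithmeticFunction.moebius d : ℝ) * ((N : ℝ) / d - (N / d : ℕ)) := by ring
          rw [e, abs_mul]
          have h3 : |(N : ℝ) / d - (N / d : ℕ)| ≤ 1 := by
            rw [← Nat.floor_div_eq_div (K := ℝ), abs_le]
            have := Nat.floor_le (a := (N : ℝ) / d) (by positivity)
            have := Nat.lt_floor_add_one ((N : ℝ) / d)
            constructor <;> linarith
          nlinarith [abs_moebius_le d, abs_nonneg ((N : ℝ) / d - (N / d : ℕ)),
            abs_nonneg (ArithmeticFunction.moebius d : ℝ)]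
      _ ≤ N := by
        rw [Finset.sum_const, nsmul_eq_mul, mul_one]
        exact_mod_cast (Finset.card_filter_le _ _).trans (by simp)
  rw [h1] at h2
  set S := ∑ d ∈ Finset.Ioc 0 N with d.Coprime q, (ArithmeticFunction.moebius d : ℝ) / d
  have hc0 : (0 : ℝ) ≤ (((Finset.Ioc 0 N).filter (fun n => n ∈ Nat.factoredNumbers q.primeFactors)).card : ℕ) :=
    by positivity
  rw [abs_le] at h2 ⊢
  constructor
  · by_contra h
    push Not at h
    nlinarith
  · by_contra h
    push Not at h
    nlinarith

open Classical in
lemma sum_inv_factored_le (q : ℕ) (hq : q ≠ 0) (N : ℕ) :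
    ∑ n ∈ Finset.Ioc 0 N with n ∈ Nat.factoredNumbers q.primeFactors, (1 : ℝ) / n ≤
      q / q.totient := by
  let f : ℕ →* ℝ :=
    { toFun := fun n => (n : ℝ)⁻¹
      map_one' := by simp
      map_mul' := fun a b => by push_cast; rw [mul_inv] }
  have hf : ∀ n : ℕ, f n = (n : ℝ)⁻¹ := fun n => rfl
  obtain ⟨h1, h2⟩ := EulerProduct.summable_and_hasSum_factoredNumbers_prod_filter_prime_geometric
    (f := f) (fun {p} hp => by
      rw [hf, norm_inv, Real.norm_natCast]
      exact inv_lt_one_of_one_lt₀ (by exact_mod_cast hp.one_lt)) q.primeFactors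
  have h3 : ∏ p ∈ q.primeFactors with p.Prime, (1 - f p)⁻¹ = q / q.totient := by
    rw [Finset.filter_true_of_mem (fun p hp => Nat.prime_of_mem_primeFactors hp)]
    have h4 : (q.totient : ℝ) = q * ∏ p ∈ q.primeFactors, (1 - f p) := by
      have := congrArg (fun x : ℚ => (x : ℝ)) (Nat.totient_eq_mul_prod_factors q)
      push_cast at this
      simpa only [hf] using this
    rw [h4, Finset.prod_inv_distrib, div_mul_eq_div_div, div_self (by exact_mod_cast hq), one_div]
  rw [h3] at h2
  have h5 := h2.summable.sum_le_tsum
    (((Finset.Ioc 0 N).filter (fun n => n ∈ Nat.factoredNumbers q.primeFactors)).subtype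
      (fun n => n ∈ Nat.factoredNumbers q.primeFactors))
    (fun i _ => by rw [hf]; positivity)
  rw [h2.tsum_eq, Finset.sum_subtype_of_mem (f := fun n => f n) (by simp)] at h5
  simpa [hf] using h5

lemma abs_sum_inv_sub_log_le (y : ℝ) (hy : 1 ≤ y) :
    |∑ k ∈ Finset.Ioc 0 ⌊y⌋₊, (1 : ℝ) / k - Real.log y - Real.eulerMascheroniConstant| ≤ 2 / y := by
  set n := ⌊y⌋₊ with hn
  have hn1 : 1 ≤ n := Nat.one_le_floor_iff _ |>.2 hy
  have hn0 : (0 : ℝ) < n := by exact_mod_cast hn1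
  have h1 : (n : ℝ) ≤ y := Nat.floor_le (by linarith)
  have h2 : y < n + 1 := Nat.lt_floor_add_one y
  have hH : ∑ k ∈ Finset.Ioc 0 n, (1 : ℝ) / k = (harmonic n : ℝ) := by
    rw [harmonic_eq_sum_Icc]
    push_cast
    exact Finset.sum_congr rfl fun k _ => one_div _
  rw [hH]
  have h3 := Real.eulerMascheroniSeq_lt_eulerMascheroniConstant n
  have h4 := Real.eulerMascheroniConstant_lt_eulerMascheroniSeq' n
  rw [Real.eulerMascheroniSeq] at h3
  rw [Real.eulerMascheroniSeq', if_neg (by omega)] at h4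
  have h5 : Real.log (n + 1) - Real.log n ≤ 1 / n := by
    rw [← Real.log_div (by positivity) (by positivity)]
    refine (Real.log_le_sub_one_of_pos (by positivity)).trans (le_of_eq ?_)
    field_simp
    ring
  have h6 : (1 : ℝ) / n ≤ 2 / y := by
    rw [div_le_div_iff₀ hn0 (by linarith)]
    have : (1 : ℝ) ≤ n := by exact_mod_cast hn1
    linarith
  have h7 := Real.log_le_log hn0 h1
  have h8 := Real.log_le_log (by linarith) h2.le
  rw [abs_le]
  constructor <;> linarith

lemma abs_sum_moebius_mul_log_le (q : ℕ) (hq : q ≠ 0) (t : ℝ) (ht : 1 ≤ t) :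
    |∑ d ∈ Finset.Ioc 0 ⌊t⌋₊ with d.Coprime q, (ArithmeticFunction.moebius d : ℝ) / d *
      (Real.log t - Real.log d)| ≤ q / q.totient + 4 := by
  classical
  set N := ⌊t⌋₊ with hN
  set s := (Finset.Ioc 0 N).filter (fun d => d.Coprime q) with hs
  have ht0 : 0 < t := by linarith
  have h1 := sum_factored_eq q hq N (fun n => 1 / n)
  have h2 := sum_inv_factored_le q hq N
  rw [← h1] at h2
  have h3 : 0 ≤ ∑ d ∈ s, (ArithmeticFunction.moebius d : ℝ) *
      ∑ k ∈ Finset.Ioc 0 (N / d), 1 / ((d * k : ℕ) : ℝ) := by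
    rw [h1]
    exact Finset.sum_nonneg fun _ _ => by positivity
  have h4 := abs_sum_moebius_div_le q hq N
  set γ := Real.eulerMascheroniConstant with hγ
  have hγ1 : γ < 2 / 3 := Real.eulerMascheroniConstant_lt_two_thirds
  have hγ0 : 1 / 2 < γ := Real.one_half_lt_eulerMascheroniConstant
  have h5 : |∑ d ∈ s, (ArithmeticFunction.moebius d : ℝ) *
      ∑ k ∈ Finset.Ioc 0 (N / d), 1 / ((d * k : ℕ) : ℝ) -
      (∑ d ∈ s, (ArithmeticFunction.moebius d : ℝ) / d * (Real.log t - Real.log d) +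
      γ * ∑ d ∈ s, (ArithmeticFunction.moebius d : ℝ) / d)| ≤ 2 := by
    rw [Finset.mul_sum, ← Finset.sum_add_distrib, ← Finset.sum_sub_distrib]
    refine (Finset.abs_sum_le_sum_abs _ _).trans ?_
    calc _ ≤ ∑ d ∈ s, 2 / t := by
          refine Finset.sum_le_sum fun d hd => ?_
          have hd' := Finset.mem_Ioc.1 (Finset.mem_filter.1 hd).1
          have hd0 : (0 : ℝ) < d := by exact_mod_cast hd'.1
          have hdt : (d : ℝ) ≤ t := (Nat.le_floor_iff ht0.le).1 hd'.2
          have e1 : ∑ k ∈ Finset.Ioc 0 (N / d), 1 / ((d * k : ℕ) : ℝ) =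
              1 / d * ∑ k ∈ Finset.Ioc 0 ⌊t / d⌋₊, (1 : ℝ) / k := by
            rw [Nat.floor_div_natCast, Finset.mul_sum]
            refine Finset.sum_congr rfl fun k _ => ?_
            push_cast
            ring
          rw [e1, ← Real.log_div ht0.ne' hd0.ne']
          have e2 : (ArithmeticFunction.moebius d : ℝ) *
              (1 / d * ∑ k ∈ Finset.Ioc 0 ⌊t / d⌋₊, (1 : ℝ) / k) -
              ((ArithmeticFunction.moebius d : ℝ) / d * Real.log (t / d) +
              γ * ((ArithmeticFunction.moebius d : ℝ) / d)) =
              (ArithmeticFunction.moebius d : ℝ) * (1 / d * (∑ k ∈ Finset.Ioc 0 ⌊t / d⌋₊, (1 : ℝ) / k -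
                Real.log (t / d) - γ)) := by ring
          rw [e2, abs_mul, abs_mul, abs_of_pos (by positivity : (0 : ℝ) < 1 / d)]
          have e3 := abs_sum_inv_sub_log_le (t / d) ((one_le_div hd0).2 hdt)
          calc _ ≤ 1 * (1 / (d : ℝ) * (2 / (t / d))) := by
                gcongr
                exact abs_moebius_le d
            _ = 2 / t := by field_simp
      _ ≤ t * (2 / t) := by
        rw [Finset.sum_const, nsmul_eq_mul]
        gcongr
        refine le_trans ?_ (Nat.floor_le ht0.le)
        exact_mod_cast (Finset.card_filter_le _ _).trans (by simp [hN])
      _ = 2 := by field_simp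
  set A := ∑ d ∈ s, (ArithmeticFunction.moebius d : ℝ) / d
  set B := ∑ d ∈ s, (ArithmeticFunction.moebius d : ℝ) / d * (Real.log t - Real.log d)
  set D := ∑ d ∈ s, (ArithmeticFunction.moebius d : ℝ) *
      ∑ k ∈ Finset.Ioc 0 (N / d), 1 / ((d * k : ℕ) : ℝ)
  have h6 : (0 : ℝ) ≤ (q : ℝ) / q.totient := by positivity
  rw [abs_le] at h4 h5 ⊢
  constructor <;> nlinarith

lemma hasDerivAt_max_sq (x : ℝ) : HasDerivAt (fun x : ℝ => max x 0 ^ 2) (2 * max x 0) x := by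
  have h : (fun x : ℝ => max x 0 ^ 2) = fun x : ℝ => (x ^ 2 + x * |x|) / 2 := by
    ext y
    rcases le_total 0 y with hy | hy
    · rw [max_eq_left hy, abs_of_nonneg hy]; ring
    · rw [max_eq_right hy, abs_of_nonpos hy]; ring
  rw [h]
  rcases lt_trichotomy x 0 with hx | rfl | hx
  · rw [max_eq_right hx.le]
    refine (hasDerivAt_const x (0 : ℝ)).congr_deriv (by simp) |>.congr_of_eventuallyEq ?_
    filter_upwards [Iio_mem_nhds hx] with y hy
    rw [abs_of_neg hy]; ring
  · have h0 : HasDerivAt (fun x : ℝ => x * |x|) 0 0 := by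
      rw [hasDerivAt_iff_tendsto_slope]
      have : Tendsto (fun y : ℝ => |y|) (nhdsWithin 0 {0}ᶜ) (nhds 0) := by
        have := (continuous_abs (G := ℝ)).tendsto 0
        rw [abs_zero] at this
        exact this.mono_left nhdsWithin_le_nhds
      refine this.congr' ?_
      filter_upwards [self_mem_nhdsWithin] with y hy
      have hy' : y ≠ 0 := hy
      simp [slope_def_field, hy']
    refine (((hasDerivAt_pow 2 (0 : ℝ)).add h0).div_const 2).congr_deriv (by simp)
  · rw [max_eq_left hx.le]
    refine (hasDerivAt_pow 2 x).congr_deriv (by simp) |>.congr_of_eventuallyEq ?_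
    filter_upwards [Ioi_mem_nhds hx] with y hy
    rw [abs_of_pos hy]; ring

lemma abs_sum_moebius_mul_log_sq_le (q : ℕ) (hq : q ≠ 0) (t : ℝ) (ht : 1 ≤ t) :
    |∑ d ∈ Finset.Ioc 0 ⌊t⌋₊ with d.Coprime q, (ArithmeticFunction.moebius d : ℝ) / d *
      (Real.log t - Real.log d) ^ 2| ≤ 2 * (q / q.totient + 4) * Real.log t := by
  set N := ⌊t⌋₊ with hN
  set s := (Finset.Ioc 0 N).filter (fun d => d.Coprime q) with hs
  have ht0 : 0 < t := by linarith
  set Ψ : ℝ → ℝ := fun u => ∑ d ∈ s, (ArithmeticFunction.moebius d : ℝ) / d *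
    max (u - Real.log d) 0 ^ 2 with hΨ
  have hd : ∀ u, HasDerivAt Ψ (∑ d ∈ s, (ArithmeticFunction.moebius d : ℝ) / d *
      (2 * max (u - Real.log d) 0)) u := by
    intro u
    refine HasDerivAt.fun_sum fun d _ => ?_
    have := (hasDerivAt_max_sq (u - Real.log d)).comp u ((hasDerivAt_id u).sub_const (Real.log d))
    rw [mul_one] at this
    exact this.const_mul _
  have key : ∀ u ∈ Set.Ico 0 (Real.log t), ‖∑ d ∈ s, (ArithmeticFunction.moebius d : ℝ) / d *
      (2 * max (u - Real.log d) 0)‖ ≤ 2 * (q / q.totient + 4) := by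
    intro u hu
    have h1 := abs_sum_moebius_mul_log_le q hq (Real.exp u) (Real.one_le_exp hu.1)
    have hexp : Real.exp u ≤ t := by
      rw [← Real.exp_log ht0]
      exact Real.exp_le_exp.2 hu.2.le
    have h2 : ∑ d ∈ s, (ArithmeticFunction.moebius d : ℝ) / d * (2 * max (u - Real.log d) 0) =
        2 * ∑ d ∈ Finset.Ioc 0 ⌊Real.exp u⌋₊ with d.Coprime q, (ArithmeticFunction.moebius d : ℝ) / d *
      (Real.log (Real.exp u) - Real.log d) := by
      rw [Finset.mul_sum]
      symm
      refine Finset.sum_subset_zero_on_sdiff ?_ ?_ ?_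
      · exact Finset.filter_subset_filter _ (Finset.Ioc_subset_Ioc_right (Nat.floor_le_floor hexp))
      · intro d hd
        simp only [hs, Finset.mem_sdiff, Finset.mem_filter, Finset.mem_Ioc, not_and] at hd
        have : ⌊Real.exp u⌋₊ < d := by
          by_contra h
          push Not at h
          exact hd.2 ⟨hd.1.1.1, h⟩ hd.1.2
        rw [Nat.floor_lt (Real.exp_pos u).le] at this
        have := Real.log_le_log (Real.exp_pos u) this.le
        rw [Real.log_exp] at this
        rw [max_eq_right (by linarith)]
        ring
      · intro d hd
        have hd' := Finset.mem_Ioc.1 (Finset.mem_filter.1 hd).1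
        have := Real.log_le_log (by exact_mod_cast hd'.1)
          ((Nat.le_floor_iff (Real.exp_pos u).le).1 hd'.2)
        rw [Real.log_exp] at this ⊢
        rw [max_eq_left (by linarith)]
        ring
    rw [h2, norm_mul, Real.norm_eq_abs, Real.norm_eq_abs, abs_two]
    linarith
  have h3 := norm_image_sub_le_of_norm_deriv_le_segment' (f := Ψ) (a := 0) (b := Real.log t)
    (fun x _ => (hd x).hasDerivWithinAt) key (Real.log t) (Set.right_mem_Icc.2 (Real.log_nonneg ht))
  have h4 : Ψ 0 = 0 := by
    refine Finset.sum_eq_zero fun d hd => ?_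
    have := Real.log_natCast_nonneg d
    rw [max_eq_right (by linarith)]
    ring
  rw [h4, sub_zero, sub_zero, Real.norm_eq_abs] at h3
  refine le_trans (le_of_eq ?_) h3
  congr 1
  refine Finset.sum_congr rfl fun d hd => ?_
  have hd' := Finset.mem_Ioc.1 (Finset.mem_filter.1 hd).1
  have := Real.log_le_log (by exact_mod_cast hd'.1) ((Nat.le_floor_iff ht0.le).1 hd'.2)
  rw [max_eq_left (by linarith)]

lemma tendsto_totient (B : ℕ) : ∃ Q : ℕ, ∀ q : ℕ, Q < q → B < q.totient := by
  refine ⟨(2 * B).factorial, fun q hq => ?_⟩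
  by_contra h
  push Not at h
  have hq0 : 0 < q := lt_of_le_of_lt (Nat.zero_le _) hq
  refine absurd (Nat.le_of_dvd (Nat.factorial_pos _) ?_) (not_le.2 hq)
  refine (Nat.dvd_iff_prime_pow_dvd_dvd _ _).2 fun p k hp hpk => ?_
  rcases Nat.eq_zero_or_pos k with rfl | hk
  · simp
  refine Nat.dvd_factorial (pow_pos hp.pos k) ?_
  have h1 := Nat.le_of_dvd (Nat.totient_pos.2 hq0) (Nat.totient_dvd_of_dvd hpk)
  rw [Nat.totient_prime_pow hp hk] at h1
  obtain ⟨j, rfl⟩ : ∃ j, k = j + 1 := ⟨k - 1, by omega⟩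
  simp only [Nat.add_sub_cancel] at h1
  have h2 : p ≤ 2 * (p - 1) := by have := hp.two_le; omega
  calc p ^ (j + 1) = p ^ j * p := pow_succ _ _
    _ ≤ p ^ j * (2 * (p - 1)) := Nat.mul_le_mul_left _ h2
    _ = 2 * (p ^ j * (p - 1)) := by ring
    _ ≤ 2 * B := by omega

lemma sum_inv_le_of_card (B : Finset ℕ) (D : ℕ) (δ : ℝ) (hδ : 0 ≤ δ)
    (hB : ∀ h, 1 ≤ h → h ≤ D → (((B.filter (· ≤ h)).card : ℕ) : ℝ) ≤ δ * h)
    (hB0 : ∀ d ∈ B, 1 ≤ d) (hBD : ∀ d ∈ B, d ≤ D) :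
    ∑ d ∈ B, (1 : ℝ) / d ≤ δ * (2 + Real.log D) := by
  have key : ∀ h, h ≤ D → ∑ d ∈ B.filter (· ≤ h), (1 : ℝ) / d ≤
      ((B.filter (· ≤ h)).card : ℕ) / (h + 1) + δ * harmonic h := by
    intro h
    induction h with
    | zero =>
      intro _
      have : B.filter (· ≤ 0) = ∅ := by
        ext d
        simp only [Finset.mem_filter, Finset.notMem_empty, iff_false, not_and, not_le]
        exact fun hd => hB0 d hd
      rw [this]
      simp
    | succ h ih =>
      intro hh
      have ih' := ih (by omega)
      have hc := hB (h + 1) (by omega) hh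
      have e1 : B.filter (· ≤ h + 1) = B.filter (· ≤ h) ∪ B.filter (· = h + 1) := by
        ext d
        simp only [Finset.mem_filter, Finset.mem_union]
        have : d ≤ h + 1 ↔ d ≤ h ∨ d = h + 1 := by omega
        rw [this]
        tauto
      have hdis : Disjoint (B.filter (· ≤ h)) (B.filter (· = h + 1)) := by
        rw [Finset.disjoint_left]
        intro d h1 h2
        have := (Finset.mem_filter.1 h1).2
        have := (Finset.mem_filter.1 h2).2
        omega
      have e2 : ∑ d ∈ B.filter (· = h + 1), (1 : ℝ) / d = (B.filter (· = h + 1)).card / ((h : ℝ) + 1) := by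
        rw [Finset.sum_congr rfl (g := fun _ => 1 / ((h : ℝ) + 1)), Finset.sum_const, nsmul_eq_mul]
        · ring
        · intro d hd
          rw [(Finset.mem_filter.1 hd).2]
          push_cast
          rfl
      rw [e1, Finset.card_union_of_disjoint hdis] at hc
      rw [e1, Finset.sum_union hdis, Finset.card_union_of_disjoint hdis, e2, harmonic_succ]
      push_cast at hc ⊢
      set a : ℝ := (((B.filter (· ≤ h)).card : ℕ) : ℝ)
      set b : ℝ := (((B.filter (· = h + 1)).card : ℕ) : ℝ)
      have hh0 : (0 : ℝ) ≤ h := by positivity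
      have e3 : (a + b) / ((h : ℝ) + 1) ≤ (a + b) / (h + 1 + 1) + δ * ((h : ℝ) + 1)⁻¹ := by
        have h1 : (a + b) / ((h : ℝ) + 1) - (a + b) / (h + 1 + 1) =
            (a + b) / (((h : ℝ) + 1) * (h + 1 + 1)) := by field_simp; ring
        have h2 : (a + b) / (((h : ℝ) + 1) * (h + 1 + 1)) ≤ δ * ((h : ℝ) + 1)⁻¹ := by
          rw [← div_eq_mul_inv, div_le_div_iff₀ (by positivity) (by positivity)]
          nlinarith [mul_nonneg hδ hh0, mul_nonneg (mul_nonneg hδ hh0) hh0]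
        linarith
      rw [add_div] at e3
      rw [mul_add]
      linarith
  have hD := key D le_rfl
  have hBB : B.filter (· ≤ D) = B := Finset.filter_true_of_mem hBD
  rw [hBB] at hD
  rcases Nat.eq_zero_or_pos D with rfl | hD0
  · have : B = ∅ := by
      ext d
      simp only [Finset.notMem_empty, iff_false]
      intro h
      have := hB0 d h
      have := hBD d h
      omega
    rw [this]
    simp
    positivity
  have h1 := hB D hD0 le_rfl
  rw [hBB] at h1
  have hDp : (0 : ℝ) < D := by exact_mod_cast hD0
  have h2 : ((B.card : ℕ) : ℝ) / (D + 1) ≤ δ := by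
    rw [div_le_iff₀ (by positivity)]
    nlinarith
  have h3 := mul_le_mul_of_nonneg_left (harmonic_le_one_add_log D) hδ
  linarith

lemma norm_sum_ex_le (K : ℕ) (φ : ℝ) : ‖∑ k ∈ Finset.Ioc 0 K, ex (k * φ)‖ ≤ K := by
  refine (norm_sum_le _ _).trans ?_
  simp [norm_ex]

lemma norm_sum_ex_mul_dn_le (K : ℕ) (φ : ℝ) :
    ‖∑ k ∈ Finset.Ioc 0 K, ex (k * φ)‖ * (2 * dn φ) ≤ 1 := by
  have : ∑ k ∈ Finset.Ioc 0 K, ex (k * φ) = ex φ * dirichletSum K φ := by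
    rw [dirichletSum, Finset.mul_sum, Finset.sum_bij_ne_zero (fun k _ _ => k - 1)]
    · intro a h _
      simp only [Finset.mem_Ioc, Finset.mem_range] at h ⊢
      omega
    · intro a h _ b h' _ hab
      simp only [Finset.mem_Ioc] at h h'
      omega
    · intro b hb _
      refine ⟨b + 1, ?_, ex_ne_zero _, by simp⟩
      simp only [Finset.mem_Ioc, Finset.mem_range] at hb ⊢
      omega
    · intro a h _
      simp only [Finset.mem_Ioc] at h
      rw [← ex_add, Nat.cast_sub (by omega)]
      congr 1
      push_cast
      ring
  rw [this, norm_mul, norm_ex, one_mul]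
  exact norm_dirichletSum_mul_dn_le _ _

lemma sum_norm_sum_ex_le (N : ℕ) (θ : ℝ) (hl : 128 ≤ Real.log N) (D : ℕ)
    (hD : D * Real.log N ^ 10 ≤ N)
    (hq : ∀ q : ℕ, 1 ≤ q → (q : ℝ) ≤ Real.log N ^ 9 → Real.log N ^ 13 / N < dn (q * θ)) :
    ∑ d ∈ Finset.Ioc 0 D, ‖∑ k ∈ Finset.Ioc 0 (N / d), ex (k * (d * θ))‖ ≤ N / Real.log N ^ 2 := by
  set l := Real.log N with hldef
  have hl0 : 0 < l := by linarith
  have hN0 : (0 : ℝ) < N := by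
    rcases Nat.eq_zero_or_pos N with rfl | h
    · simp at hldef; linarith
    · exact_mod_cast h
  set B := (Finset.Ioc 0 D).filter (fun d : ℕ => dn (d * θ) ≤ l ^ 4 * d / N) with hB
  have hlogD : Real.log D ≤ l := by
    rcases Nat.eq_zero_or_pos D with rfl | h
    · simp; linarith
    · refine Real.log_le_log (by exact_mod_cast h) ?_
      have : (1 : ℝ) ≤ l ^ 10 := one_le_pow₀ (by linarith)
      have h0 : (0 : ℝ) < D := by exact_mod_cast h
      nlinarith
  have hcard : ∀ h, 1 ≤ h → h ≤ D → (((B.filter (· ≤ h)).card : ℕ) : ℝ) ≤ 1 / l ^ 4 * h := by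
    intro h h1 hhD
    by_contra hcon
    push Not at hcon
    have hh1 : (1 : ℝ) ≤ h := by exact_mod_cast h1
    have hhD' : (h : ℝ) ≤ D := by exact_mod_cast hhD
    have hJd : ∀ j ∈ B.filter (· ≤ h), dn (j * θ) ≤ l ^ 4 * h / N := by
      intro j hj
      have hj1 := Finset.mem_filter.1 hj
      refine (Finset.mem_filter.1 hj1.1).2.trans ?_
      have : (j : ℝ) ≤ h := by exact_mod_cast hj1.2
      gcongr
    by_cases hsmall : (h : ℝ) < 32 * l ^ 8
    · have hne : (B.filter (· ≤ h)).Nonempty := by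
        rw [← Finset.card_pos]
        have : (0 : ℝ) < ((B.filter (· ≤ h)).card : ℕ) := lt_of_le_of_lt (by positivity) hcon
        exact_mod_cast this
      obtain ⟨d, hd⟩ := hne
      have hd1 := Finset.mem_filter.1 hd
      have hd2 := Finset.mem_Ioc.1 (Finset.mem_filter.1 hd1.1).1
      have hdh : (d : ℝ) ≤ h := by exact_mod_cast hd1.2
      have h9 : 32 * l ^ 8 ≤ l ^ 9 := by
        rw [pow_succ l 8]
        nlinarith [pow_pos hl0 8]
      refine absurd (hJd d hd) (not_le.2 (lt_of_le_of_lt ?_ (hq d hd2.1 (by linarith))))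
      rw [show l ^ 13 = l ^ 4 * l ^ 9 by ring]
      gcongr
      linarith
    · push Not at hsmall
      have hε : 64 * (l ^ 4 * h / N) ≤ 1 / (2 * l ^ 4) := by
        have : (h : ℝ) / N ≤ 1 / l ^ 10 := by
          rw [div_le_div_iff₀ hN0 (by positivity)]
          nlinarith [pow_pos hl0 10]
        calc 64 * (l ^ 4 * h / N) = 64 * l ^ 4 * (h / N) := by ring
          _ ≤ 64 * l ^ 4 * (1 / l ^ 10) := by gcongr
          _ = 128 / l ^ 2 * (1 / (2 * l ^ 4)) := by field_simp; norm_num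
          _ ≤ 1 * (1 / (2 * l ^ 4)) := by
            gcongr
            rw [div_le_one (by positivity)]
            nlinarith
          _ = _ := one_mul _
      have hH : (8 : ℝ) ≤ (1 / (2 * l ^ 4)) ^ 2 * (h + 1 : ℕ) := by
        push_cast
        have : (1 / (2 * l ^ 4)) ^ 2 * (32 * l ^ 8) = 8 := by field_simp; norm_num
        nlinarith [sq_nonneg (1 / (2 * l ^ 4))]
      have hl4 : (1 : ℝ) ≤ l ^ 4 := one_le_pow₀ (by linarith)
      obtain ⟨q, hq1, hq2, hq3⟩ := exists_dn_le_of_card θ (l ^ 4 * h / N) (1 / (2 * l ^ 4)) (h + 1)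
        (by positivity) (by positivity) hε (by rw [div_le_one (by positivity)]; linarith) hH
        (B.filter (· ≤ h)) (by
          intro j hj
          have := (Finset.mem_filter.1 hj).2
          simp only [Finset.mem_range]
          omega) (by
          push_cast
          have : 1 / (2 * l ^ 4) * ((h : ℝ) + 1) = 1 / l ^ 4 * (((h : ℝ) + 1) / 2) := by
            field_simp
          rw [this]
          refine le_trans ?_ hcon.le
          gcongr
          linarith) hJd
      have hq4 : (q : ℝ) ≤ 4 * l ^ 4 := by
        refine hq2.trans (le_of_eq ?_)
        field_simp
        norm_num
      have h9 : 4 * l ^ 4 ≤ l ^ 9 := by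
        rw [show l ^ 9 = l ^ 4 * (l ^ 4 * l) by ring]
        have : (4 : ℝ) ≤ l ^ 4 * l := by nlinarith
        nlinarith [pow_pos hl0 4]
      refine absurd hq3 (not_le.2 (lt_of_le_of_lt ?_ (hq q hq1 (by linarith))))
      push_cast
      calc 4 * (l ^ 4 * (h : ℝ) / N) * q / (1 / (2 * l ^ 4) * ((h : ℝ) + 1))
          = 8 * l ^ 8 * q / N * (h / (h + 1)) := by field_simp; norm_num
        _ ≤ 8 * l ^ 8 * (4 * l ^ 4) / N * 1 := by
          gcongr
          rw [div_le_one (by positivity)]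
          linarith
        _ = 32 * l ^ 12 / N := by ring
        _ ≤ l ^ 13 / N := by
          gcongr
          rw [pow_succ l 12]
          nlinarith [pow_pos hl0 12]
  have hS := sum_inv_le_of_card B D (1 / l ^ 4) (by positivity) hcard
    (fun d hd => (Finset.mem_Ioc.1 (Finset.mem_filter.1 hd).1).1)
    (fun d hd => (Finset.mem_Ioc.1 (Finset.mem_filter.1 hd).1).2)
  have hterm : ∀ d ∈ Finset.Ioc 0 D, ‖∑ k ∈ Finset.Ioc 0 (N / d), ex (k * (d * θ))‖ ≤
      (if dn (d * θ) ≤ l ^ 4 * d / N then (N : ℝ) * (1 / d) else 0) + N / (2 * l ^ 4) * (1 / d) := by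
    intro d hd
    have hd0 : (0 : ℝ) < d := by exact_mod_cast (Finset.mem_Ioc.1 hd).1
    split_ifs with hc
    · have h1 := norm_sum_ex_le (N / d) (d * θ)
      have h2 : ((N / d : ℕ) : ℝ) ≤ N / d := Nat.cast_div_le
      have h3 : 0 ≤ (N : ℝ) / (2 * l ^ 4) * (1 / d) := by positivity
      rw [mul_one_div]
      linarith
    · push Not at hc
      have h1 := norm_sum_ex_mul_dn_le (N / d) (d * θ)
      set X := ‖∑ k ∈ Finset.Ioc 0 (N / d), ex (k * (d * θ))‖
      have hX : 0 ≤ X := norm_nonneg _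
      have h2 : X * (2 * (l ^ 4 * d / N)) ≤ 1 := le_trans (by gcongr) h1
      rw [zero_add]
      calc X = X * (2 * (l ^ 4 * d / N)) * (N / (2 * l ^ 4) * (1 / d)) := by field_simp
        _ ≤ 1 * (N / (2 * l ^ 4) * (1 / d)) := by gcongr
        _ = _ := one_mul _
  have hharm : ∑ d ∈ Finset.Ioc 0 D, (1 : ℝ) / d ≤ 1 + Real.log D := by
    have := harmonic_le_one_add_log D
    rw [harmonic_eq_sum_Icc] at this
    push_cast at this
    simp only [one_div]
    exact this
  refine (Finset.sum_le_sum hterm).trans ?_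
  rw [Finset.sum_add_distrib, ← Finset.sum_filter, ← Finset.mul_sum, ← Finset.mul_sum]
  calc _ ≤ N * (1 / l ^ 4 * (2 + l)) + N / (2 * l ^ 4) * (1 + l) := by
        refine add_le_add (mul_le_mul_of_nonneg_left (hS.trans ?_) hN0.le)
          (mul_le_mul_of_nonneg_left (hharm.trans (by linarith)) (by positivity))
        gcongr
    _ ≤ N * (1 / l ^ 4 * (2 * l)) + N / (2 * l ^ 4) * (2 * l) := by gcongr <;> linarith
    _ = 3 / l * (N / l ^ 2) := by field_simp; norm_num
    _ ≤ 1 * (N / l ^ 2) := by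
      gcongr
      rw [div_le_one hl0]
      linarith
    _ = _ := one_mul _

lemma sum_inv_mul_log_sq_tail_le (X L : ℝ) (hL : 0 ≤ L) (E Y : ℕ) (hY : (Y : ℝ) ≤ X)
    (hE : Real.log X - Real.log (E + 1 : ℕ) ≤ L) :
    ∑ j ∈ Finset.Ioc E Y, (1 : ℝ) / j * (Real.log X - Real.log j) ^ 2 ≤ (1 + L) ^ 3 := by
  rcases lt_or_ge Y E with h | hEY
  · rw [Finset.Ioc_eq_empty (by omega)]
    simp
    positivity
  rcases Nat.eq_zero_or_pos Y with rfl | hY0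
  · simp
    positivity
  have h1 : ∀ j ∈ Finset.Ioc E Y, (1 : ℝ) / j * (Real.log X - Real.log j) ^ 2 ≤ 1 / j * L ^ 2 := by
    intro j hj
    rw [Finset.mem_Ioc] at hj
    have hj0 : (0 : ℝ) < j := by
      have : 0 < j := by omega
      exact_mod_cast this
    have hjY : (j : ℝ) ≤ Y := by exact_mod_cast hj.2
    have h2 : Real.log j ≤ Real.log X := Real.log_le_log hj0 (hjY.trans hY)
    have h3 : Real.log (E + 1 : ℕ) ≤ Real.log j :=
      Real.log_le_log (by positivity) (by exact_mod_cast hj.1)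
    have : (Real.log X - Real.log j) ^ 2 ≤ L ^ 2 := pow_le_pow_left₀ (by linarith) (by linarith) 2
    gcongr
  have h4 : ∑ j ∈ Finset.Ioc E Y, (1 : ℝ) / j ≤ 1 + L := by
    have e1 : (harmonic Y : ℝ) = harmonic E + ∑ j ∈ Finset.Ioc E Y, (1 : ℝ) / j := by
      have e2 : ∀ n, (harmonic n : ℝ) = ∑ j ∈ Finset.Ioc 0 n, (1 : ℝ) / j := by
        intro n
        rw [harmonic_eq_sum_Icc]
        push_cast
        exact Finset.sum_congr rfl fun k _ => (one_div _).symm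
      rw [e2, e2, ← Finset.Ioc_union_Ioc_eq_Ioc (Nat.zero_le E) hEY,
        Finset.sum_union (Finset.Ioc_disjoint_Ioc_of_le le_rfl)]
    have e3 := harmonic_le_one_add_log Y
    have e4 := log_add_one_le_harmonic E
    have e5 : Real.log Y ≤ Real.log X := Real.log_le_log (by exact_mod_cast hY0) hY
    linarith
  refine (Finset.sum_le_sum h1).trans ?_
  rw [← Finset.sum_mul]
  calc _ ≤ (1 + L) * L ^ 2 := by gcongr
    _ ≤ (1 + L) * (1 + L) ^ 2 := by gcongr; linarith
    _ = _ := by ring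

lemma norm_sum_ex_sub_le (Y j : ℕ) (hj : 0 < j) (β : ℝ) :
    ‖∑ k ∈ Finset.Ioc 0 (Y / j), ex (k * (j * β)) - (1 / (j : ℝ) : ℝ) * ∑ s ∈ Finset.Ioc 0 Y, ex (s * β)‖ ≤
      1 + 2 * Real.pi * |β| * Y := by
  have hj0 : (0 : ℝ) < j := by exact_mod_cast hj
  have key : ∀ K : ℕ, ‖(j : ℂ) * ∑ k ∈ Finset.Ioc 0 K, ex (k * (j * β)) -
      ∑ s ∈ Finset.Ioc 0 (K * j), ex (s * β)‖ ≤ K * j * (2 * Real.pi * (j * |β|)) := by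
    intro K
    induction K with
    | zero => simp
    | succ K ih =>
      rw [← Finset.insert_Ioc_right_eq_Ioc_add_one (Nat.zero_le K), Finset.sum_insert (by simp),
        ← Finset.Ioc_union_Ioc_eq_Ioc (Nat.zero_le (K * j)) (by nlinarith : K * j ≤ (K + 1) * j),
        Finset.sum_union (Finset.Ioc_disjoint_Ioc_of_le le_rfl)]
      have h1 : ‖(j : ℂ) * ex ((K + 1 : ℕ) * (j * β)) -
          ∑ s ∈ Finset.Ioc (K * j) ((K + 1) * j), ex (s * β)‖ ≤ j * (2 * Real.pi * (j * |β|)) := by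
        have e1 : (j : ℂ) * ex ((K + 1 : ℕ) * (j * β)) =
            ∑ s ∈ Finset.Ioc (K * j) ((K + 1) * j), ex ((K + 1 : ℕ) * (j * β)) := by
          rw [Finset.sum_const, Nat.card_Ioc, nsmul_eq_mul]
          congr 2
          rw [add_mul, one_mul, Nat.add_sub_cancel_left]
        rw [e1, ← Finset.sum_sub_distrib]
        refine (norm_sum_le _ _).trans ?_
        calc _ ≤ ∑ s ∈ Finset.Ioc (K * j) ((K + 1) * j), 2 * Real.pi * (j * |β|) := by
              refine Finset.sum_le_sum fun s hs => ?_
              rw [Finset.mem_Ioc] at hs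
              have e2 : ex ((K + 1 : ℕ) * (j * β)) - ex (s * β) =
                  -(ex ((K + 1 : ℕ) * (j * β)) * ((ex ((s : ℝ) * β - (K + 1 : ℕ) * (j * β))) - 1)) := by
                rw [mul_sub, mul_one, ← ex_add]
                ring_nf
              rw [e2, norm_neg, norm_mul, norm_ex, one_mul, norm_sub_rev]
              refine (norm_one_sub_ex_le _).trans ?_
              gcongr
              rw [← mul_assoc, ← sub_mul, abs_mul]
              gcongr
              have h3 : (s : ℝ) ≤ (K + 1 : ℕ) * j := by exact_mod_cast hs.2
              have h4 : (K : ℝ) * j ≤ s := by exact_mod_cast hs.1.le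
              push_cast at h3 ⊢
              rw [abs_le]
              constructor <;> nlinarith
          _ = _ := by
            rw [Finset.sum_const, Nat.card_Ioc, nsmul_eq_mul, add_mul, one_mul, Nat.add_sub_cancel_left]
      have e3 : (j : ℂ) * (ex ((K + 1 : ℕ) * (j * β)) + ∑ k ∈ Finset.Ioc 0 K, ex (k * (j * β))) -
          (∑ s ∈ Finset.Ioc 0 (K * j), ex (s * β) + ∑ s ∈ Finset.Ioc (K * j) ((K + 1) * j), ex (s * β)) =
          ((j : ℂ) * ∑ k ∈ Finset.Ioc 0 K, ex (k * (j * β)) - ∑ s ∈ Finset.Ioc 0 (K * j), ex (s * β)) +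
          ((j : ℂ) * ex ((K + 1 : ℕ) * (j * β)) -
          ∑ s ∈ Finset.Ioc (K * j) ((K + 1) * j), ex (s * β)) := by ring
      rw [e3]
      refine (norm_add_le _ _).trans ((add_le_add ih h1).trans (le_of_eq ?_))
      push_cast
      ring
  have hmul : Y / j * j ≤ Y := Nat.div_mul_le_self Y j
  have h5 : ‖∑ s ∈ Finset.Ioc 0 Y, ex (s * β) - ∑ s ∈ Finset.Ioc 0 (Y / j * j), ex (s * β)‖ ≤ j := by
    rw [← Finset.Ioc_union_Ioc_eq_Ioc (Nat.zero_le _) hmul,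
        Finset.sum_union (Finset.Ioc_disjoint_Ioc_of_le le_rfl), add_sub_cancel_left]
    refine (norm_sum_le _ _).trans ?_
    simp only [norm_ex, Finset.sum_const, Nat.card_Ioc, nsmul_eq_mul, mul_one]
    have := Nat.lt_div_mul_add (a := Y) hj
    exact_mod_cast (by omega : Y - Y / j * j ≤ j)
  have h6 := key (Y / j)
  have h7 : ((Y / j : ℕ) : ℝ) * j ≤ Y := by exact_mod_cast hmul
  have e4 : ∑ k ∈ Finset.Ioc 0 (Y / j), ex (k * (j * β)) - (1 / (j : ℝ) : ℝ) * ∑ s ∈ Finset.Ioc 0 Y, ex (s * β) =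
      (1 / (j : ℝ) : ℝ) * (((j : ℂ) * ∑ k ∈ Finset.Ioc 0 (Y / j), ex (k * (j * β)) -
      ∑ s ∈ Finset.Ioc 0 (Y / j * j), ex (s * β)) -
      (∑ s ∈ Finset.Ioc 0 Y, ex (s * β) - ∑ s ∈ Finset.Ioc 0 (Y / j * j), ex (s * β))) := by
    have : (j : ℂ) ≠ 0 := by exact_mod_cast hj.ne'
    generalize ∑ k ∈ Finset.Ioc 0 (Y / j), ex (k * (j * β)) = A
    generalize ∑ s ∈ Finset.Ioc 0 (Y / j * j), ex (s * β) = B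
    generalize ∑ s ∈ Finset.Ioc 0 Y, ex (s * β) = E
    push_cast
    field_simp
    ring
  rw [e4, norm_mul, Complex.norm_real, Real.norm_of_nonneg (by positivity)]
  calc _ ≤ 1 / (j : ℝ) * (Y * (2 * Real.pi * (j * |β|)) + j) := by
        refine mul_le_mul_of_nonneg_left ((norm_sub_le _ _).trans (add_le_add (h6.trans ?_) h5))
          (by positivity)
        gcongr
    _ = _ := by field_simp; ring

lemma exists_coprime_approx (θ : ℝ) (q : ℕ) (hq : 1 ≤ q) :
    ∃ (r : ℕ) (a : ℤ), 1 ≤ r ∧ r ≤ q ∧ IsCoprime (r : ℤ) a ∧ |r * θ - a| ≤ dn (q * θ) := by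
  set b := round (q * θ) with hb
  have hg : 0 < Int.gcd (q : ℤ) b := Int.gcd_pos_of_ne_zero_left _ (by exact_mod_cast (by omega : q ≠ 0))
  set g := Int.gcd (q : ℤ) b with hgdef
  obtain ⟨r, hr⟩ : g ∣ q := by exact_mod_cast Int.gcd_dvd_left (q : ℤ) b
  obtain ⟨a, ha⟩ : (g : ℤ) ∣ b := Int.gcd_dvd_right (q : ℤ) b
  have hr1 : 1 ≤ r := Nat.pos_of_ne_zero (by rintro rfl; simp at hr; omega)
  have hg1 : (1 : ℝ) ≤ g := by exact_mod_cast hg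
  refine ⟨r, a, hr1, by nlinarith, ?_, ?_⟩
  · rw [Int.isCoprime_iff_gcd_eq_one]
    have h1 : Int.gcd ((g : ℤ) * r) ((g : ℤ) * a) = g := by
      rw [← ha, hgdef]
      congr 1
      exact_mod_cast hr.symm
    rw [Int.gcd_mul_left, Int.natAbs_natCast] at h1
    exact Nat.eq_of_mul_eq_mul_left hg (by rw [h1, mul_one])
  · rw [dn, ← hb, ha, hr]
    push_cast
    have : (g : ℝ) * r * θ - g * a = g * (r * θ - a) := by ring
    rw [this, abs_mul, abs_of_nonneg (by linarith : (0 : ℝ) ≤ g)]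
    nlinarith [abs_nonneg (r * θ - a)]

lemma le_dn_of_not_dvd (θ : ℝ) (q : ℕ) (hq : 1 ≤ q) (a : ℤ) (hqa : IsCoprime (q : ℤ) a) (d : ℕ)
    (hd : ¬ q ∣ d) (hs : d * |q * θ - a| ≤ 1 / 2) : 1 / (2 * q) ≤ dn (d * θ) := by
  have hq0 : (0 : ℝ) < q := by exact_mod_cast hq
  set m := round (d * θ) with hm
  have h1 : (d : ℤ) * a - m * q ≠ 0 := by
    intro h
    have : (q : ℤ) ∣ d * a := ⟨m, by linarith⟩
    exact hd (by exact_mod_cast hqa.dvd_of_dvd_mul_right this)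
  have h2 : (1 : ℝ) ≤ |(d : ℝ) * a - m * q| := by
    have := Int.one_le_abs h1
    exact_mod_cast this
  have h3 : (d : ℝ) * a - m * q = q * (d * θ - m) - d * (q * θ - a) := by ring
  rw [h3] at h2
  have h4 := abs_sub (q * (d * θ - m)) (d * (q * θ - a))
  rw [abs_mul (q : ℝ), abs_mul (d : ℝ), Nat.abs_cast, Nat.abs_cast] at h4
  rw [dn, ← hm, div_le_iff₀ (by positivity)]
  linarith

/-- The main term bound for the Type I sum near a rational with denominator `q`. -/
lemma norm_selbergSum_le_of_approx (N : ℕ) (θ : ℝ) (hl : 128 ≤ Real.log N) (q : ℕ) (hq : 1 ≤ q)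
    (a : ℤ) (hqa : IsCoprime (q : ℤ) a) (hql : (q : ℝ) ≤ Real.log N ^ 9)
    (hβ : |q * θ - a| ≤ Real.log N ^ 13 / N) :
    ‖selbergSum N θ‖ ≤ ‖∑ s ∈ Finset.Ioc 0 (N / q), ex (s * (q * θ - a))‖ *
      (2 * (q / q.totient + 4) * Real.log N) +
      N * (2 * (1 + 40 * Real.log (Real.log N)) ^ 3 + 2) := by
  set l := Real.log N with hldef
  have hl0 : 0 < l := by linarith
  have hN0 : (0 : ℝ) < N := by
    rcases Nat.eq_zero_or_pos N with rfl | h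
    · simp at hldef; linarith
    · exact_mod_cast h
  set β := q * θ - a with hβdef
  have hq0 : (0 : ℝ) < q := by exact_mod_cast hq
  set D := ⌊N / l ^ 40⌋₊ with hDdef
  have hD1 : (D : ℝ) ≤ N / l ^ 40 := Nat.floor_le (by positivity)
  have hD2 : N / l ^ 40 < D + 1 := Nat.lt_floor_add_one _
  set L := 40 * Real.log l with hL
  have hL0 : 0 ≤ L := by have := Real.log_nonneg (by linarith : 1 ≤ l); positivity
  have hDN : D ≤ N := by
    have : (D : ℝ) ≤ N := hD1.trans (div_le_self hN0.le (one_le_pow₀ (by linarith)))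
    exact_mod_cast this
  have hlogD : l - Real.log (D + 1 : ℕ) ≤ L := by
    have h1 := Real.log_le_log (by positivity) hD2.le
    rw [Real.log_div hN0.ne' (by positivity), Real.log_pow] at h1
    push_cast at h1 ⊢
    linarith
  set Y := N / q with hY
  set I := ∑ s ∈ Finset.Ioc 0 Y, ex (s * β) with hI
  have hYr : (Y : ℝ) ≤ N / q := Nat.cast_div_le
  have hIY : ‖I‖ ≤ N := (norm_sum_ex_le Y β).trans
    (hYr.trans (div_le_self hN0.le (by exact_mod_cast hq)))
  set c : ℕ → ℝ := fun d => (ArithmeticFunction.moebius d : ℝ) * (l - Real.log d) ^ 2 with hc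
  have hcabs : ∀ d, 1 ≤ d → d ≤ N → |c d| ≤ l ^ 2 := by
    intro d h1 h2
    have h3 := Real.log_natCast_nonneg d
    have h4 : Real.log d ≤ l := Real.log_le_log (by exact_mod_cast h1) (by exact_mod_cast h2)
    rw [hc]
    simp only
    rw [abs_mul, abs_of_nonneg (sq_nonneg (l - Real.log d))]
    calc _ ≤ 1 * l ^ 2 := by
          gcongr
          · exact abs_moebius_le d
          · linarith
      _ = _ := one_mul _
  have hV : selbergSum N θ = ∑ d ∈ Finset.Ioc 0 N, (c d : ℂ) *
      ∑ k ∈ Finset.Ioc 0 (N / d), ex (k * (d * θ)) := rfl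
  -- the tail
  have htail : ‖∑ d ∈ Finset.Ioc D N, (c d : ℂ) * ∑ k ∈ Finset.Ioc 0 (N / d), ex (k * (d * θ))‖ ≤
      N * (1 + L) ^ 3 := by
    refine (norm_sum_le _ _).trans ?_
    refine le_trans ?_ (mul_le_mul_of_nonneg_left
      (sum_inv_mul_log_sq_tail_le N L hL0 D N le_rfl hlogD) hN0.le)
    rw [Finset.mul_sum]
    refine Finset.sum_le_sum fun d hd => ?_
    rw [norm_mul, Complex.norm_real, Real.norm_eq_abs, hc]
    simp only
    rw [abs_mul, abs_of_nonneg (sq_nonneg (l - Real.log d))]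
    have h1 := norm_sum_ex_le (N / d) (d * θ)
    have h2 : ((N / d : ℕ) : ℝ) ≤ N / d := Nat.cast_div_le
    calc _ ≤ 1 * (l - Real.log d) ^ 2 * (N / d) := by
          gcongr
          · exact abs_moebius_le d
          · exact h1.trans h2
      _ = _ := by ring
  -- multiples of `q`
  have hsplit : ∑ d ∈ Finset.Ioc 0 D, (c d : ℂ) * ∑ k ∈ Finset.Ioc 0 (N / d), ex (k * (d * θ)) =
      ∑ j ∈ Finset.Ioc 0 (D / q), (c (q * j) : ℂ) * ∑ k ∈ Finset.Ioc 0 (Y / j), ex (k * (j * β)) +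
      ∑ d ∈ Finset.Ioc 0 D with ¬ q ∣ d, (c d : ℂ) * ∑ k ∈ Finset.Ioc 0 (N / d), ex (k * (d * θ)) := by
    rw [← Finset.sum_filter_add_sum_filter_not (Finset.Ioc 0 D) (fun d => q ∣ d)]
    congr 1
    symm
    refine Finset.sum_bij (fun j _ => q * j) ?_ ?_ ?_ ?_
    · intro j hj
      rw [Finset.mem_Ioc] at hj
      rw [Finset.mem_filter, Finset.mem_Ioc]
      exact ⟨⟨Nat.mul_pos hq hj.1, by
        have := (Nat.le_div_iff_mul_le hq).1 hj.2
        linarith⟩, dvd_mul_right _ _⟩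
    · intro j _ j' _ h
      exact Nat.eq_of_mul_eq_mul_left hq h
    · intro d hd
      rw [Finset.mem_filter, Finset.mem_Ioc] at hd
      obtain ⟨⟨h1, h2⟩, j, rfl⟩ := hd
      refine ⟨j, Finset.mem_Ioc.2 ⟨Nat.pos_of_mul_pos_left h1, ?_⟩, rfl⟩
      rw [Nat.le_div_iff_mul_le hq]
      linarith
    · intro j hj
      rw [Nat.div_div_eq_div_mul]
      congr 1
      refine Finset.sum_congr rfl fun k _ => ?_
      have : (k : ℝ) * ((q * j : ℕ) * θ) = k * (j * β) + ((k * j * a : ℤ) : ℝ) := by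
        rw [hβdef]
        push_cast
        ring
      rw [this, ex_add_int]
  have hDβ : (D : ℝ) * |β| ≤ 1 / 2 := by
    calc (D : ℝ) * |β| ≤ N / l ^ 40 * (l ^ 13 / N) := by gcongr
      _ = 1 / l ^ 27 := by field_simp
      _ ≤ 1 / 2 := by
        have : l ≤ l ^ 27 := le_self_pow₀ (by linarith) (by norm_num)
        gcongr
        linarith
  have hl40 : N / l ^ 40 * (l ^ 9 * l ^ 2) ≤ N / l := by
    rw [div_mul_eq_mul_div, div_le_div_iff₀ (by positivity) hl0]
    rw [mul_assoc]
    gcongr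
    rw [← pow_add, ← pow_succ]
    exact pow_le_pow_right₀ (by linarith) (by norm_num)
  have hnon : ‖∑ d ∈ Finset.Ioc 0 D with ¬ q ∣ d, (c d : ℂ) *
      ∑ k ∈ Finset.Ioc 0 (N / d), ex (k * (d * θ))‖ ≤ N / l := by
    refine (norm_sum_le _ _).trans ?_
    calc _ ≤ ∑ d ∈ Finset.Ioc 0 D with ¬ q ∣ d, l ^ 2 * q := by
          refine Finset.sum_le_sum fun d hd => ?_
          obtain ⟨h1, h2⟩ := Finset.mem_filter.1 hd
          rw [Finset.mem_Ioc] at h1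
          have hdD : (d : ℝ) ≤ D := by exact_mod_cast h1.2
          rw [norm_mul, Complex.norm_real, Real.norm_eq_abs]
          have h3 := hcabs d h1.1 (h1.2.trans hDN)
          have h4 := le_dn_of_not_dvd θ q hq a hqa d h2 (le_trans (by gcongr) hDβ)
          have h5 := norm_sum_ex_mul_dn_le (N / d) (d * θ)
          have h6 : ‖∑ k ∈ Finset.Ioc 0 (N / d), ex (k * (d * θ))‖ ≤ q := by
            set X := ‖∑ k ∈ Finset.Ioc 0 (N / d), ex (k * (d * θ))‖
            have hX : 0 ≤ X := norm_nonneg _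
            calc X = X * (2 * (1 / (2 * q))) * q := by field_simp
              _ ≤ X * (2 * dn (d * θ)) * q := by gcongr
              _ ≤ 1 * q := by gcongr
              _ = q := one_mul _
          gcongr
      _ ≤ D * (l ^ 2 * q) := by
        rw [Finset.sum_const, nsmul_eq_mul]
        gcongr
        exact_mod_cast (Finset.card_filter_le _ _).trans (by simp)
      _ ≤ N / l ^ 40 * (l ^ 2 * l ^ 9) := by gcongr
      _ ≤ N / l := by rw [mul_comm (l ^ 2)]; exact hl40
  -- comparison with the model sum
  have hcomp : ‖∑ j ∈ Finset.Ioc 0 (D / q), (c (q * j) : ℂ) * ∑ k ∈ Finset.Ioc 0 (Y / j), ex (k * (j * β)) -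
      (∑ j ∈ Finset.Ioc 0 (D / q), c (q * j) * (1 / j) : ℝ) * I‖ ≤ N / l := by
    rw [Complex.ofReal_sum, Finset.sum_mul, ← Finset.sum_sub_distrib]
    refine (norm_sum_le _ _).trans ?_
    calc _ ≤ ∑ j ∈ Finset.Ioc 0 (D / q), l ^ 2 * (8 * l ^ 13) := by
          refine Finset.sum_le_sum fun j hj => ?_
          rw [Finset.mem_Ioc] at hj
          have h1 := norm_sum_ex_sub_le Y j hj.1 β
          have e : (c (q * j) : ℂ) * ∑ k ∈ Finset.Ioc 0 (Y / j), ex (k * (j * β)) -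
            ((c (q * j) * (1 / j) : ℝ) : ℂ) * I = (c (q * j) : ℂ) *
            (∑ k ∈ Finset.Ioc 0 (Y / j), ex (k * (j * β)) - (1 / (j : ℝ) : ℝ) * I) := by
            push_cast
            ring
          rw [e, norm_mul, Complex.norm_real, Real.norm_eq_abs]
          have hqj : q * j ≤ N := by
            have := (Nat.le_div_iff_mul_le hq).1 hj.2
            linarith
          have h2 : 1 + 2 * Real.pi * |β| * Y ≤ 8 * l ^ 13 := by
            have hp := Real.pi_lt_d2
            have h13 : (1 : ℝ) ≤ l ^ 13 := one_le_pow₀ (by linarith)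
            have hYN : (Y : ℝ) ≤ N := hYr.trans (div_le_self hN0.le (by exact_mod_cast hq))
            calc 1 + 2 * Real.pi * |β| * Y ≤ l ^ 13 + 2 * 3.15 * (l ^ 13 / N) * N := by
                  gcongr
              _ = 7.3 * l ^ 13 := by field_simp; norm_num
              _ ≤ 8 * l ^ 13 := by gcongr; norm_num
          refine mul_le_mul (hcabs (q * j) (Nat.mul_pos hq hj.1) hqj) (h1.trans h2) (norm_nonneg _)
            (by positivity)
      _ ≤ D * (l ^ 2 * (8 * l ^ 13)) := by
        rw [Finset.sum_const, nsmul_eq_mul]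
        gcongr
        simp only [Nat.card_Ioc, Nat.sub_zero]
        exact Nat.div_le_self _ _
      _ ≤ N / l ^ 40 * (l ^ 2 * (l * l ^ 13)) := by gcongr; linarith
      _ ≤ N / l := by
        rw [div_mul_eq_mul_div, div_le_div_iff₀ (by positivity) hl0, mul_assoc]
        gcongr
        rw [← pow_succ', ← pow_add, ← pow_succ]
        exact pow_le_pow_right₀ (by linarith) (by norm_num)
  have hlogq : ∀ j : ℕ, 0 < j → l - Real.log (q * j : ℕ) = Real.log (N / q) - Real.log j := by
    intro j hj
    have : (j : ℝ) ≠ 0 := by exact_mod_cast hj.ne'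
    push_cast
    rw [Real.log_div hN0.ne' hq0.ne', Real.log_mul hq0.ne' this]
    ring
  have hDY : D / q ≤ Y := Nat.div_le_div_right hDN
  have hext : |∑ j ∈ Finset.Ioc (D / q) Y, c (q * j) * (1 / j)| ≤ (1 + L) ^ 3 := by
    refine (Finset.abs_sum_le_sum_abs _ _).trans ?_
    refine le_trans (Finset.sum_le_sum fun j hj => ?_)
      (sum_inv_mul_log_sq_tail_le (N / q) L hL0 (D / q) Y hYr ?_)
    · rw [Finset.mem_Ioc] at hj
      have hj0 : 0 < j := lt_of_le_of_lt (Nat.zero_le _) hj.1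
      rw [hc]
      simp only
      rw [hlogq j hj0, abs_mul, abs_mul, abs_of_nonneg (sq_nonneg (Real.log (N / q) - Real.log j)),
        abs_of_nonneg (by positivity : (0 : ℝ) ≤ 1 / j)]
      calc _ ≤ 1 * (Real.log (N / q) - Real.log j) ^ 2 * (1 / j) := by
            gcongr
            exact abs_moebius_le _
        _ = _ := by ring
    · rw [← hlogq _ (Nat.succ_pos _)]
      refine le_trans ?_ hlogD
      have : D + 1 ≤ q * (D / q + 1) := by
        have := Nat.lt_mul_div_succ D hq
        omega
      have := Real.log_le_log (by positivity : (0 : ℝ) < (D + 1 : ℕ)) ((Nat.cast_le (α := ℝ)).2 this)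
      linarith
  have hmain : |∑ j ∈ Finset.Ioc 0 Y, c (q * j) * (1 / j)| ≤ 2 * (q / q.totient + 4) * l := by
    have hNq : (1 : ℝ) ≤ N / q := by
      rw [one_le_div hq0]
      have h1 : l ^ 9 ≤ N := by
        have h5 : l ^ 16 / (Nat.factorial 16 : ℕ) ≤ Real.exp l := Real.pow_div_factorial_le_exp l hl0.le 16
        have h6 : Real.exp l = N := Real.exp_log hN0
        rw [← h6]
        refine le_trans ?_ h5
        rw [le_div_iff₀ (by positivity), show l ^ 16 = l ^ 9 * l ^ 7 by ring]
        gcongr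
        calc ((Nat.factorial 16 : ℕ) : ℝ) ≤ 128 ^ 7 := by norm_num [Nat.factorial]
          _ ≤ l ^ 7 := by gcongr
      linarith
    have h1 := abs_sum_moebius_mul_log_sq_le q (by omega) (N / q) hNq
    rw [Nat.floor_div_natCast, Nat.floor_natCast, ← hY] at h1
    have h2 : ∑ j ∈ Finset.Ioc 0 Y, c (q * j) * (1 / j) = (ArithmeticFunction.moebius q : ℝ) *
        ∑ d ∈ Finset.Ioc 0 Y with d.Coprime q, (ArithmeticFunction.moebius d : ℝ) / d *
      (Real.log (N / q) - Real.log d) ^ 2 := by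
      rw [Finset.sum_filter, Finset.mul_sum]
      refine Finset.sum_congr rfl fun j hj => ?_
      rw [Finset.mem_Ioc] at hj
      rw [hc]
      simp only
      rw [hlogq j hj.1]
      split_ifs with hcop
      · have : ArithmeticFunction.moebius (q * j) = ArithmeticFunction.moebius q * ArithmeticFunction.moebius j :=
          ArithmeticFunction.isMultiplicative_moebius.map_mul_of_coprime hcop.symm
        rw [this]
        push_cast
        ring
      · rw [ArithmeticFunction.moebius_eq_zero_of_not_squarefree (n := q * j)
          (fun h => hcop (Nat.coprime_of_squarefree_mul h).symm)]
        simp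
    rw [h2, abs_mul]
    have h3 : Real.log (N / q) ≤ l := by
      rw [Real.log_div hN0.ne' hq0.ne']
      have := Real.log_natCast_nonneg q
      linarith
    calc _ ≤ 1 * (2 * (q / q.totient + 4) * Real.log (N / q)) := by
          gcongr
          exact abs_moebius_le q
      _ ≤ _ := by
        rw [one_mul]
        gcongr
  have hsum : ∑ j ∈ Finset.Ioc 0 (D / q), c (q * j) * (1 / j) =
      ∑ j ∈ Finset.Ioc 0 Y, c (q * j) * (1 / j) - ∑ j ∈ Finset.Ioc (D / q) Y, c (q * j) * (1 / j) := by
    rw [← Finset.Ioc_union_Ioc_eq_Ioc (Nat.zero_le _) hDY,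
        Finset.sum_union (Finset.Ioc_disjoint_Ioc_of_le le_rfl)]
    ring
  rw [hV, ← Finset.Ioc_union_Ioc_eq_Ioc (Nat.zero_le _) hDN,
        Finset.sum_union (Finset.Ioc_disjoint_Ioc_of_le le_rfl), hsplit]
  set A := ∑ j ∈ Finset.Ioc 0 (D / q), (c (q * j) : ℂ) * ∑ k ∈ Finset.Ioc 0 (Y / j), ex (k * (j * β))
  set B := ∑ d ∈ Finset.Ioc 0 D with ¬ q ∣ d, (c d : ℂ) * ∑ k ∈ Finset.Ioc 0 (N / d), ex (k * (d * θ))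
  set T := ∑ d ∈ Finset.Ioc D N, (c d : ℂ) * ∑ k ∈ Finset.Ioc 0 (N / d), ex (k * (d * θ))
  set s := ∑ j ∈ Finset.Ioc 0 (D / q), c (q * j) * (1 / j) with hs
  have hsabs : |s| ≤ 2 * (q / q.totient + 4) * l + (1 + L) ^ 3 := by
    rw [hsum]
    exact (abs_sub _ _).trans (add_le_add hmain hext)
  have hA : ‖A‖ ≤ |s| * ‖I‖ + N / l := by
    have : A = (s : ℂ) * I + (A - (s : ℂ) * I) := by ring
    rw [this]
    refine (norm_add_le _ _).trans (add_le_add (le_of_eq ?_) hcomp)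
    rw [norm_mul, Complex.norm_real, Real.norm_eq_abs]
  have hNl : N / l ≤ N := div_le_self hN0.le (by linarith)
  have hfin : |s| * ‖I‖ ≤ ‖I‖ * (2 * (q / q.totient + 4) * l) + N * (1 + L) ^ 3 := by
    calc |s| * ‖I‖ ≤ (2 * (q / q.totient + 4) * l + (1 + L) ^ 3) * ‖I‖ := by gcongr
      _ = ‖I‖ * (2 * (q / q.totient + 4) * l) + ‖I‖ * (1 + L) ^ 3 := by ring
      _ ≤ _ := by gcongr
  calc ‖A + B + T‖ ≤ ‖A‖ + ‖B‖ + ‖T‖ := norm_add₃_le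
    _ ≤ _ := by linarith

lemma eventually_loglog_le (ε : ℝ) (hε : 0 < ε) : ∃ N0 : ℕ, ∀ N : ℕ, N0 ≤ N →
    128 ≤ Real.log N ∧ 2 * (1 + 40 * Real.log (Real.log N)) ^ 3 + 2 ≤ ε * Real.log N := by
  have h1 : Tendsto (fun N : ℕ => Real.log N) atTop atTop :=
    Real.tendsto_log_atTop.comp tendsto_natCast_atTop_atTop
  have h2 : ∀ᶠ x : ℝ in atTop, 2 * (1 + 40 * Real.log x) ^ 3 + 2 ≤ ε * x := by
    have h3 := (Real.isLittleO_pow_log_id_atTop (n := 3)).bound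
      (c := ε / (2 * 41 ^ 3 + 2)) (by positivity)
    filter_upwards [h3, Real.tendsto_log_atTop.eventually_ge_atTop 1, eventually_ge_atTop 0] with x h4 h5 h6
    rw [Real.norm_of_nonneg (by positivity), id, Real.norm_of_nonneg h6] at h4
    have h7 : (1 + 40 * Real.log x) ^ 3 ≤ (41 * Real.log x) ^ 3 := by gcongr; linarith
    have h8 : (1 : ℝ) ≤ Real.log x ^ 3 := one_le_pow₀ h5
    have h9 : ε / (2 * 41 ^ 3 + 2) * x * (2 * 41 ^ 3 + 2) = ε * x := by field_simp
    rw [mul_pow] at h7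
    nlinarith
  obtain ⟨N0, h⟩ := eventually_atTop.1 ((h1.eventually_ge_atTop 128).and (h1.eventually h2))
  exact ⟨N0, fun N hN => h N hN⟩

/-- If the Type I sum is large then `θ` lies on a major arc with bounded denominator. -/
lemma exists_dn_le_of_selbergSum (ε : ℝ) (hε : 0 < ε) : ∃ Q : ℕ, ∃ N0 : ℕ, ∀ N : ℕ, N0 ≤ N →
    ∀ θ : ℝ, ε * N * Real.log N ≤ ‖selbergSum N θ‖ →
    ∃ q : ℕ, 1 ≤ q ∧ q ≤ Q ∧ dn (q * θ) ≤ (Q : ℝ) / N := by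
  obtain ⟨N0, hN0⟩ := eventually_loglog_le (ε / 2) (by positivity)
  obtain ⟨Q1, hQ1⟩ := tendsto_totient ⌈20 / ε⌉₊
  refine ⟨Q1 + ⌈10 * Q1 / ε⌉₊, N0 + 1, fun N hN θ hV => ?_⟩
  obtain ⟨hl, hT⟩ := hN0 N (by omega)
  have hNp : (0 : ℝ) < N := by
    have : 0 < N := by omega
    exact_mod_cast this
  set l := Real.log N with hldef
  have hl0 : 0 < l := by linarith
  have hlog0 : 0 ≤ Real.log l := Real.log_nonneg (by linarith)
  by_cases hq : ∀ q : ℕ, 1 ≤ q → (q : ℝ) ≤ l ^ 9 → l ^ 13 / N < dn (q * θ)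
  · exfalso
    set D := ⌊N / l ^ 40⌋₊ with hDdef
    have hD1 : (D : ℝ) ≤ N / l ^ 40 := Nat.floor_le (by positivity)
    have hD2 : N / l ^ 40 < D + 1 := Nat.lt_floor_add_one _
    have hDN : D ≤ N := by
      have : (D : ℝ) ≤ N := hD1.trans (div_le_self hNp.le (one_le_pow₀ (by linarith)))
      exact_mod_cast this
    have hlogD : l - Real.log (D + 1 : ℕ) ≤ 40 * Real.log l := by
      have h1 := Real.log_le_log (by positivity) hD2.le
      rw [Real.log_div hNp.ne' (by positivity), Real.log_pow] at h1
      push_cast at h1 ⊢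
      linarith
    have h1 := sum_norm_sum_ex_le N θ hl D (by
      have h2 : l ^ 10 ≤ l ^ 40 := pow_le_pow_right₀ (by linarith) (by norm_num)
      have h3 : (N : ℝ) / l ^ 40 * l ^ 40 = N := by field_simp
      calc (D : ℝ) * l ^ 10 ≤ N / l ^ 40 * l ^ 40 :=
            mul_le_mul hD1 h2 (by positivity) (by positivity)
        _ = N := h3) hq
    have h2 := mul_le_mul_of_nonneg_left
      (sum_inv_mul_log_sq_tail_le N _ (by positivity) D N le_rfl hlogD) hNp.le
    have h3 : ‖selbergSum N θ‖ ≤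
        ∑ d ∈ Finset.Ioc 0 D, l ^ 2 * ‖∑ k ∈ Finset.Ioc 0 (N / d), ex (k * (d * θ))‖ +
        N * ∑ j ∈ Finset.Ioc D N, (1 : ℝ) / j * (l - Real.log j) ^ 2 := by
      rw [selbergSum, Finset.mul_sum]
      refine (norm_sum_le _ _).trans ?_
      rw [← Finset.Ioc_union_Ioc_eq_Ioc (Nat.zero_le _) hDN,
        Finset.sum_union (Finset.Ioc_disjoint_Ioc_of_le le_rfl)]
      refine add_le_add (Finset.sum_le_sum fun d hd => ?_) (Finset.sum_le_sum fun d hd => ?_)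
      · rw [Finset.mem_Ioc] at hd
        have h3 := Real.log_natCast_nonneg d
        have h4 : Real.log d ≤ l := Real.log_le_log (by exact_mod_cast hd.1)
          (by exact_mod_cast hd.2.trans hDN)
        rw [norm_mul, Complex.norm_real, Real.norm_eq_abs, abs_mul,
          abs_of_nonneg (sq_nonneg (Real.log N - Real.log d))]
        refine mul_le_mul_of_nonneg_right ?_ (norm_nonneg _)
        calc _ ≤ 1 * l ^ 2 := by
              gcongr
              · exact abs_moebius_le d
              · linarith
          _ = _ := one_mul _
      · rw [norm_mul, Complex.norm_real, Real.norm_eq_abs, abs_mul,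
          abs_of_nonneg (sq_nonneg (Real.log N - Real.log d))]
        have h1 := norm_sum_ex_le (N / d) (d * θ)
        have h2 : ((N / d : ℕ) : ℝ) ≤ N / d := Nat.cast_div_le
        calc _ ≤ 1 * (l - Real.log d) ^ 2 * (N / d) := by
              gcongr
              · exact abs_moebius_le d
              · exact h1.trans h2
          _ = _ := by ring
    rw [← Finset.mul_sum] at h3
    have h4 : l ^ 2 * (N / l ^ 2) = N := by field_simp
    have h5 := mul_le_mul_of_nonneg_left h1 (sq_nonneg l)
    rw [h4] at h5
    have h6 : ε * N * l ≤ N + N * (1 + 40 * Real.log l) ^ 3 := by linarith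
    have h7 : 0 ≤ (1 + 40 * Real.log l) ^ 3 := by positivity
    nlinarith [mul_pos hNp hε, mul_pos (mul_pos hNp hε) hl0]
  · push Not at hq
    obtain ⟨q0, hq01, hq0l, hq0d⟩ := hq
    obtain ⟨q, a, hq1, hqq0, hqa, hβ0⟩ := exists_coprime_approx θ q0 hq01
    have hqp : (0 : ℝ) < q := by exact_mod_cast hq1
    have hβ := hβ0.trans hq0d
    have h1 := norm_selbergSum_le_of_approx N θ hl q hq1 a hqa
      (le_trans (by exact_mod_cast hqq0) hq0l) hβ
    set I := ‖∑ s ∈ Finset.Ioc 0 (N / q), ex (s * (q * θ - a))‖ with hI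
    have hI0 : 0 ≤ I := norm_nonneg _
    have hIY : I ≤ N / q := (norm_sum_ex_le _ _).trans Nat.cast_div_le
    have hφ0 : 0 < q.totient := Nat.totient_pos.2 hq1
    have hφ : (1 : ℝ) ≤ q.totient := by exact_mod_cast hφ0
    have hφq : (q.totient : ℝ) ≤ q := by exact_mod_cast Nat.totient_le q
    have h2 : ε / 2 * N ≤ I * (2 * (q / q.totient + 4)) := by
      have h3 : N * (2 * (1 + 40 * Real.log l) ^ 3 + 2) ≤ N * (ε / 2 * l) := by gcongr
      have h4 : ε / 2 * N * l ≤ I * (2 * (q / q.totient + 4)) * l := by linarith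
      exact le_of_mul_le_mul_right h4 hl0
    have h3 : (q : ℝ) / q.totient + 4 ≤ 5 * (q / q.totient) := by
      have : (1 : ℝ) ≤ q / q.totient := by rw [one_le_div (by linarith)]; exact hφq
      linarith
    have hqQ : q ≤ Q1 := by
      by_contra hcon
      have h4 := hQ1 q (by omega)
      have h5 : 20 / ε < q.totient := Nat.lt_of_ceil_lt h4
      have h6 : ε / 2 * N ≤ N / q * (2 * (5 * (q / q.totient))) := h2.trans (by gcongr)
      have h7 : (N : ℝ) / q * (2 * (5 * (q / q.totient))) = 10 / q.totient * N := by field_simp; norm_num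
      rw [h7] at h6
      have h8 := le_of_mul_le_mul_right h6 hNp
      rw [le_div_iff₀ (by linarith)] at h8
      rw [div_lt_iff₀ hε] at h5
      linarith
    refine ⟨q, hq1, by omega, ?_⟩
    have hβabs : |q * θ - a| < 1 / 2 := by
      refine lt_of_le_of_lt hβ ?_
      have h5 : l ^ 26 / (Nat.factorial 26 : ℕ) ≤ Real.exp l := Real.pow_div_factorial_le_exp l hl0.le 26
      have h6 : Real.exp l = N := Real.exp_log hNp
      rw [div_lt_iff₀ hNp, ← h6]
      refine lt_of_lt_of_le ?_ (mul_le_mul_of_nonneg_left h5 (by norm_num))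
      rw [show l ^ 26 = l ^ 13 * l ^ 13 by ring]
      have h7 : (2 * (Nat.factorial 26 : ℕ) : ℝ) < l ^ 13 := by
        calc (2 * (Nat.factorial 26 : ℕ) : ℝ) < 128 ^ 13 := by norm_num [Nat.factorial]
          _ ≤ l ^ 13 := by gcongr
      rw [mul_div_assoc', lt_div_iff₀ (by positivity)]
      have := mul_lt_mul_of_pos_left h7 (pow_pos hl0 13)
      generalize ((Nat.factorial 26 : ℕ) : ℝ) = F at this ⊢
      nlinarith
    have hdn : dn (q * θ) ≤ |q * θ - a| := dn_le _ a
    refine hdn.trans ?_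
    have h4 := norm_sum_ex_mul_dn_le (N / q) (q * θ - a)
    rw [dn_eq_abs _ hβabs, ← hI] at h4
    have h5 : ε / 2 * N ≤ I * (2 * (5 * q)) := by
      refine h2.trans ?_
      have : (q : ℝ) / q.totient ≤ q := div_le_self hqp.le hφ
      gcongr
      linarith
    have hqQ' : (q : ℝ) ≤ Q1 := by exact_mod_cast hqQ
    have hc := Nat.le_ceil (10 * Q1 / ε : ℝ)
    rw [le_div_iff₀ hNp]
    push_cast
    have h6 : |q * θ - a| * (ε * N) ≤ 10 * q := by
      have h7 := mul_le_mul_of_nonneg_left h5 (abs_nonneg (q * θ - a))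
      nlinarith
    have h7 : |q * θ - a| * N ≤ 10 * Q1 / ε := by
      rw [le_div_iff₀ hε]
      linarith
    have : (0 : ℝ) ≤ Q1 := by positivity
    linarith

lemma sum_mul_fejer_eq (s : Finset ℕ) (c : ℕ → ℝ) (θ : ℝ) (H : ℕ) (hH : 0 < H) :
    (∑ k ∈ s, ∑ l ∈ s, c k * c l * fejer H (k * θ - l * θ)) * H =
      ∑ b ∈ Finset.range H, ∑ a ∈ Finset.range H,
        ‖∑ k ∈ s, (c k : ℂ) * ex (k * (((a : ℝ) - b) * θ))‖ ^ 2 := by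
  have hH0 : (H : ℝ) ≠ 0 := by exact_mod_cast hH.ne'
  have h1 : ∀ φ : ℝ, fejer H φ * H = ‖dirichletSum H φ‖ ^ 2 := fun φ => by
    rw [fejer, div_mul_cancel₀ _ hH0]
  simp only [Finset.sum_mul, mul_assoc, h1]
  apply Complex.ofReal_injective
  push_cast
  simp only [← Complex.mul_conj', dirichletSum, map_sum, map_mul, Complex.conj_ofReal,
    ← ex_neg, Finset.mul_sum, Finset.sum_mul]
  calc _ = ∑ k ∈ s, ∑ b ∈ Finset.range H, ∑ l ∈ s, ∑ a ∈ Finset.range H,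
      (c k : ℂ) * ((c l : ℂ) * (ex (a * (k * θ - l * θ)) * ex (-(b * (k * θ - l * θ))))) := by
        refine Finset.sum_congr rfl fun k _ => ?_
        rw [Finset.sum_comm]
    _ = ∑ b ∈ Finset.range H, ∑ k ∈ s, ∑ a ∈ Finset.range H, ∑ l ∈ s,
      (c k : ℂ) * ((c l : ℂ) * (ex (a * (k * θ - l * θ)) * ex (-(b * (k * θ - l * θ))))) := by
        rw [Finset.sum_comm]
        refine Finset.sum_congr rfl fun b _ => Finset.sum_congr rfl fun k _ => ?_
        rw [Finset.sum_comm]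
    _ = _ := by
        refine Finset.sum_congr rfl fun b _ => ?_
        rw [Finset.sum_comm]
        refine Finset.sum_congr rfl fun a _ => ?_
        rw [Finset.sum_comm]
        refine Finset.sum_congr rfl fun k _ => Finset.sum_congr rfl fun l _ => ?_
        rw [← ex_add, mul_mul_mul_comm, ← ex_add]
        have : (a : ℝ) * (l * θ - k * θ) + -(b * (l * θ - k * θ)) =
            l * ((a - b) * θ) + -(k * ((a - b) * θ)) := by ring
        rw [this]
        ring

lemma sum_fejer_shift_le (H L : ℕ) (θ : ℝ) (a : ℕ) (ha : a < H) :
    ∑ b ∈ Finset.range H, fejer L ((a : ℝ) * θ - b * θ) ≤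
      2 * ∑ j ∈ Finset.range H, fejer L (j * θ) := by
  rw [Finset.range_eq_Ico, ← Finset.sum_Ico_consecutive _ (Nat.zero_le a) ha.le, two_mul]
  refine add_le_add ?_ ?_
  · rw [Finset.sum_Ico_eq_sum_range, tsub_zero, ← Finset.sum_range_reflect]
    calc _ = ∑ j ∈ Finset.range a, fejer L ((j + 1 : ℕ) * θ) := by
          refine Finset.sum_congr rfl fun j hj => ?_
          rw [Finset.mem_range] at hj
          congr 1
          have : ((0 + (a - 1 - j) : ℕ) : ℝ) = a - 1 - j := by
            rw [Nat.zero_add, Nat.cast_sub (by omega), Nat.cast_sub (by omega)]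
            simp
          rw [this]
          push_cast
          ring
      _ = ∑ j ∈ Finset.Ico 1 (a + 1), fejer L (j * θ) := by
          rw [Finset.sum_Ico_eq_sum_range]
          exact Finset.sum_congr rfl fun j _ => by rw [add_comm]
      _ ≤ _ := Finset.sum_le_sum_of_subset_of_nonneg
          (Finset.Ico_subset_Ico (by norm_num) (by omega)) fun _ _ _ => fejer_nonneg _ _
  · rw [Finset.sum_Ico_eq_sum_range]
    calc _ = ∑ j ∈ Finset.range (H - a), fejer L (j * θ) := by
          refine Finset.sum_congr rfl fun j _ => ?_
          rw [← fejer_neg]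
          congr 1
          push_cast
          ring
      _ ≤ _ := Finset.sum_le_sum_of_subset_of_nonneg (by
          intro j hj
          simp only [Finset.mem_range, Finset.mem_Ico] at hj ⊢
          omega) fun _ _ _ => fejer_nonneg _ _

lemma exists_dn_le_of_sum_fejer (c : ℝ) (hc : 0 < c) : ∃ Q R : ℕ, ∀ M K : ℕ, R ≤ M → R ≤ K →
    ∀ θ : ℝ, c * M * K ≤ ∑ j ∈ Finset.range (2 * M), fejer (2 * K) (j * θ) →
    ∃ q : ℕ, 1 ≤ q ∧ q ≤ Q ∧ dn (q * θ) * (M * K) ≤ Q := by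
  set δ := min 1 (c / 8) with hδdef
  have hδ : 0 < δ := by positivity
  have hδ1 : δ ≤ 1 := min_le_left _ _
  have hδc : δ ≤ c / 8 := min_le_right _ _
  set A := 1 + 1 / c with hAdef
  have hA : 0 < A := by positivity
  refine ⟨⌈2 / δ⌉₊ + ⌈4 * A / δ ^ 2⌉₊, 1 + ⌈64 * A / δ⌉₊ + ⌈8 / δ ^ 2⌉₊,
    fun M K hM hK θ hsum => ?_⟩
  have hM0 : (0 : ℝ) < M := by
    have : 0 < M := by omega
    exact_mod_cast this
  have hK0 : (0 : ℝ) < K := by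
    have : 0 < K := by omega
    exact_mod_cast this
  have hK1 : 64 * A / δ ≤ K := (Nat.le_ceil _).trans (by exact_mod_cast (by omega))
  have hM1 : 8 / δ ^ 2 ≤ M := (Nat.le_ceil _).trans (by exact_mod_cast (by omega))
  set J := (Finset.range (2 * M)).filter (fun j : ℕ => c * K / 4 ≤ fejer (2 * K) (j * θ)) with hJ
  have hcard : c * M * K ≤ J.card * (2 * K) + (2 * M) * (c * K / 4) := by
    refine hsum.trans ?_
    rw [← Finset.sum_filter_add_sum_filter_not (Finset.range (2 * M))
      (fun j : ℕ => c * K / 4 ≤ fejer (2 * K) (j * θ))]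
    refine add_le_add ?_ ?_
    · have := Finset.sum_le_card_nsmul J (fun j : ℕ => fejer (2 * K) (j * θ)) (2 * K)
        fun j _ => (fejer_le _ _).trans (by push_cast; rfl)
      rwa [nsmul_eq_mul] at this
    · have := Finset.sum_le_card_nsmul ((Finset.range (2 * M)).filter
        (fun j : ℕ => ¬ c * K / 4 ≤ fejer (2 * K) (j * θ))) (fun j : ℕ => fejer (2 * K) (j * θ))
        (c * K / 4) fun j hj => (not_le.1 (Finset.mem_filter.1 hj).2).le
      rw [nsmul_eq_mul] at this
      refine this.trans ?_
      gcongr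
      have h := Finset.card_filter_le (Finset.range (2 * M))
        (fun j : ℕ => ¬ c * K / 4 ≤ fejer (2 * K) (j * θ))
      rw [Finset.card_range] at h
      exact_mod_cast h
  have hJc : δ * (2 * M : ℕ) ≤ J.card := by
    have h1 : c * M / 4 * (2 * K) ≤ J.card * (2 * K) := by linarith
    have h2 := le_of_mul_le_mul_right h1 (by positivity)
    push_cast
    nlinarith
  obtain ⟨q, hq1, hq2, hq3⟩ := exists_dn_le_of_card θ (A / K) δ (2 * M) (by positivity) hδ (by
      rw [div_le_iff₀ hδ] at hK1
      rw [mul_div_assoc', div_le_iff₀ hK0]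
      linarith) hδ1 (by
      rw [div_le_iff₀ (by positivity)] at hM1
      push_cast
      linarith) J (Finset.filter_subset _ _) hJc (by
      intro j hj
      have h1 := (Finset.mem_filter.1 hj).2
      have h2 := fejer_mul_le (2 * K) (j * θ)
      have h3 : c * K / 4 * (4 * (2 * K : ℕ) * dn (j * θ) ^ 2) ≤ 1 :=
        le_trans (by gcongr) h2
      push_cast at h3
      have h4 : 2 * (dn (j * θ) * K) ^ 2 ≤ 1 / c := by
        rw [le_div_iff₀ hc]
        linarith
      rw [le_div_iff₀ hK0]
      refine abs_le_of_sq_le_sq' ?_ hA.le |>.2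
      have : 0 < 1 / c := by positivity
      rw [hAdef]
      nlinarith)
  have hq0 : (0 : ℝ) < q := by exact_mod_cast hq1
  refine ⟨q, hq1, ?_, ?_⟩
  · have : (q : ℝ) ≤ ⌈2 / δ⌉₊ := hq2.trans (Nat.le_ceil _)
    have : q ≤ ⌈2 / δ⌉₊ := by exact_mod_cast this
    omega
  · have h1 := Nat.le_ceil (4 * A / δ ^ 2)
    have h0 : (0 : ℝ) ≤ ⌈2 / δ⌉₊ := by positivity
    push_cast at hq3 ⊢
    have h2 : dn (q * θ) * (M * K) ≤ 4 * A / δ ^ 2 := by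
      calc dn (q * θ) * (M * K) ≤ 4 * (A / K) * q / (δ * (2 * M)) * (M * K) := by gcongr
        _ = 2 * A / δ * q := by field_simp; norm_num
        _ ≤ 2 * A / δ * (2 / δ) := by gcongr
        _ = _ := by field_simp; norm_num
    linarith

lemma exists_nat_le_pow_four (x : ℝ) : ∃ w : ℕ, 1 ≤ w ∧ x ≤ (w : ℝ) ^ 4 := by
  refine ⟨⌈x⌉₊ + 1, by omega, (Nat.le_ceil x).trans ?_⟩
  push_cast
  refine le_trans (by linarith) (le_self_pow₀ (by linarith [Nat.cast_nonneg (α := ℝ) ⌈x⌉₊])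
    (by norm_num : (4 : ℕ) ≠ 0))

open ArithmeticFunction in
lemma exists_le_sum_fejer_of_bilinear (c : ℝ) (hc : 0 < c) : ∃ c1 : ℝ, 0 < c1 ∧ ∃ R : ℕ,
    ∀ M K : ℕ, R ≤ M → ∀ θ : ℝ,
    c * M * K ≤ ∑ m ∈ Finset.Ioc 0 M, vonMangoldt m * ‖expSum vonMangoldt K (m * θ)‖ →
    c1 * M * K ^ 2 ≤ ∑ k ∈ Finset.Ioc 0 K, ∑ l ∈ Finset.Ioc 0 K,
      vonMangoldt k * vonMangoldt l * fejer (2 * M) (k * θ - l * θ) := by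
  obtain ⟨C, hC, N0, hN0, hmain⟩ := sum_mul_norm_sq_le
  obtain ⟨w, hw, hw4⟩ := exists_nat_le_pow_four (72 * C / c ^ 2)
  have hw0 : (0 : ℝ) < w := by exact_mod_cast hw
  refine ⟨c ^ 2 / (2 * C * w), by positivity, N0 + w ^ 10 + 1, fun M K hM θ hX => ?_⟩
  have hM0 : (0 : ℝ) < M := by
    have : 0 < M := by omega
    exact_mod_cast this
  have h1 := hmain M (by omega) w hw (by omega) vonMangoldt
    (fun n => ⟨vonMangoldt_nonneg, le_rfl⟩) (Finset.Ioc 0 K) (fun k => (vonMangoldt k : ℂ))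
    (fun k => k * θ)
  have h2 : ∀ m : ℕ, ∑ k ∈ Finset.Ioc 0 K, (vonMangoldt k : ℂ) * ex (m * (k * θ)) =
      expSum vonMangoldt K (m * θ) := fun m => Finset.sum_congr rfl fun k _ => by
    rw [mul_left_comm]
  simp only [h2, Complex.norm_real, Real.norm_of_nonneg vonMangoldt_nonneg, mul_add,
    Finset.sum_add_distrib] at h1
  set E := ∑ k ∈ Finset.Ioc 0 K, ∑ l ∈ Finset.Ioc 0 K,
      vonMangoldt k * vonMangoldt l * fejer (2 * M) (k * θ - l * θ) with hE
  have h3 : ∑ k ∈ Finset.Ioc 0 K, ∑ l ∈ Finset.Ioc 0 K,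
      vonMangoldt k * vonMangoldt l * (M / (w : ℝ) ^ 5) ≤ (6 * K) ^ 2 * (M / (w : ℝ) ^ 5) := by
    simp only [← Finset.sum_mul, ← Finset.sum_mul_sum]
    have := sum_vonMangoldt_le K
    have h0 : 0 ≤ ∑ k ∈ Finset.Ioc 0 K, vonMangoldt k :=
      Finset.sum_nonneg fun _ _ => vonMangoldt_nonneg
    rw [← sq]
    gcongr
  have h4 : (c * M * K) ^ 2 ≤ C * M * w * E + C * M * w * ((6 * K) ^ 2 * (M / (w : ℝ) ^ 5)) := by
    refine (pow_le_pow_left₀ (by positivity) hX 2).trans (h1.trans ?_)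
    gcongr
  have h5 : C * M * w * ((6 * K) ^ 2 * (M / (w : ℝ) ^ 5)) ≤ (c * M * K) ^ 2 / 2 := by
    rw [div_le_iff₀ (by positivity)] at hw4
    calc _ = 36 * C * (M * K) ^ 2 / (w : ℝ) ^ 4 := by field_simp; ring
      _ ≤ _ := by
        rw [div_le_iff₀ (by positivity)]
        nlinarith [sq_nonneg ((M : ℝ) * K)]
  rw [div_mul_eq_mul_div, div_mul_eq_mul_div, div_le_iff₀ (by positivity)]
  have h6 : (c * M * K) ^ 2 ≤ 2 * (C * M * w * E) := by linarith
  have h7 : M * (c ^ 2 * M * K ^ 2) ≤ M * (E * (2 * C * w)) := by linarith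
  exact le_of_mul_le_mul_left h7 hM0

open ArithmeticFunction in
lemma exists_le_sum_fejer_of_sum_sq (c : ℝ) (hc : 0 < c) : ∃ c1 : ℝ, 0 < c1 ∧ ∃ R : ℕ,
    ∀ M K : ℕ, R ≤ M → R ≤ K → ∀ θ : ℝ, c * M * K ^ 2 ≤ ∑ k ∈ Finset.Ioc 0 K, ∑ l ∈ Finset.Ioc 0 K,
      vonMangoldt k * vonMangoldt l * fejer (2 * M) (k * θ - l * θ) →
    c1 * M * K ≤ ∑ j ∈ Finset.range (2 * M), fejer (2 * K) (j * θ) := by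
  obtain ⟨C, hC, N0, hN0, hmain⟩ := norm_sum_expSum_sq_le
  obtain ⟨w, hw, hw4⟩ := exists_nat_le_pow_four (4 * C / c)
  have hw0 : (0 : ℝ) < w := by exact_mod_cast hw
  refine ⟨c / (4 * C * w), by positivity, N0 + w ^ 10 + 1, fun M K hM hK θ hX => ?_⟩
  have hM0 : (0 : ℝ) < M := by
    have : 0 < M := by omega
    exact_mod_cast this
  have hK0 : (0 : ℝ) < K := by
    have : 0 < K := by omega
    exact_mod_cast this
  set G := ∑ j ∈ Finset.range (2 * M), fejer (2 * K) (j * θ) with hG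
  have h1 := sum_mul_fejer_eq (Finset.Ioc 0 K) vonMangoldt θ (2 * M) (by omega)
  set E := ∑ k ∈ Finset.Ioc 0 K, ∑ l ∈ Finset.Ioc 0 K,
      vonMangoldt k * vonMangoldt l * fejer (2 * M) (k * θ - l * θ) with hE
  obtain ⟨b, hb, hEb⟩ : ∃ b ∈ Finset.range (2 * M), E ≤ ∑ a ∈ Finset.range (2 * M),
      ‖expSum vonMangoldt K (((a : ℝ) - b) * θ)‖ ^ 2 := by
    refine Finset.exists_le_of_sum_le ⟨0, Finset.mem_range.2 (by omega)⟩ ?_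
    rw [Finset.sum_const, Finset.card_range, nsmul_eq_mul, mul_comm, h1]
    rfl
  set F : ℕ → ℂ := fun a => expSum vonMangoldt K (((a : ℝ) - b) * θ) with hF
  set E' := ∑ a ∈ Finset.range (2 * M), ‖F a‖ ^ 2 with hE'
  have hE'0 : 0 < E' := lt_of_lt_of_le (by positivity) (hX.trans hEb)
  have h2 := hmain K (by omega) w hw (by omega) vonMangoldt
    (fun n => ⟨vonMangoldt_nonneg, le_rfl⟩) (Finset.range (2 * M)) (fun a => starRingEnd ℂ (F a))
    (fun a => ((a : ℝ) - b) * θ)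
  have h3 : ∑ j ∈ Finset.range (2 * M), starRingEnd ℂ (F j) *
      expSum vonMangoldt K (((j : ℝ) - b) * θ) = (E' : ℂ) := by
    rw [hE']
    push_cast
    exact Finset.sum_congr rfl fun j _ => Complex.conj_mul' _
  rw [h3, Complex.norm_real, Real.norm_of_nonneg hE'0.le] at h2
  simp only [RCLike.norm_conj] at h2
  set P : ℕ → ℕ → ℝ := fun i j => fejer (2 * K) (((i : ℝ) - b) * θ - ((j : ℝ) - b) * θ) +
    K / (w : ℝ) ^ 5 with hP
  have hP0 : ∀ i j, 0 ≤ P i j := fun i j => add_nonneg (fejer_nonneg _ _) (by positivity)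
  have hPs : ∀ i j, P i j = P j i := fun i j => by
    rw [hP]
    simp only
    rw [← fejer_neg, neg_sub]
  have hrow : ∀ i ∈ Finset.range (2 * M), ∑ j ∈ Finset.range (2 * M), P i j ≤
      2 * G + 2 * M * (K / (w : ℝ) ^ 5) := by
    intro i hi
    rw [hP, Finset.sum_add_distrib, Finset.sum_const, Finset.card_range, nsmul_eq_mul]
    push_cast
    gcongr
    refine le_trans (le_of_eq ?_) (sum_fejer_shift_le (2 * M) (2 * K) θ i (Finset.mem_range.1 hi))
    refine Finset.sum_congr rfl fun j _ => ?_
    congr 1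
    ring
  have h4 : ∑ j ∈ Finset.range (2 * M), ∑ l ∈ Finset.range (2 * M), ‖F j‖ * ‖F l‖ * P j l ≤
      E' * (2 * G + 2 * M * (K / (w : ℝ) ^ 5)) := by
    have h5 : ∑ j ∈ Finset.range (2 * M), ∑ l ∈ Finset.range (2 * M), ‖F j‖ ^ 2 * P j l ≤
        E' * (2 * G + 2 * M * (K / (w : ℝ) ^ 5)) := by
      rw [hE', Finset.sum_mul]
      refine Finset.sum_le_sum fun j hj => ?_
      rw [← Finset.mul_sum]
      exact mul_le_mul_of_nonneg_left (hrow j hj) (sq_nonneg _)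
    have h6 : ∑ j ∈ Finset.range (2 * M), ∑ l ∈ Finset.range (2 * M), ‖F l‖ ^ 2 * P j l =
        ∑ j ∈ Finset.range (2 * M), ∑ l ∈ Finset.range (2 * M), ‖F j‖ ^ 2 * P j l := by
      rw [Finset.sum_comm]
      exact Finset.sum_congr rfl fun j _ => Finset.sum_congr rfl fun l _ => by rw [hPs]
    have h7 : ∑ j ∈ Finset.range (2 * M), ∑ l ∈ Finset.range (2 * M), 2 * (‖F j‖ * ‖F l‖ * P j l) ≤
        ∑ j ∈ Finset.range (2 * M), ∑ l ∈ Finset.range (2 * M),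
          (‖F j‖ ^ 2 * P j l + ‖F l‖ ^ 2 * P j l) :=
      Finset.sum_le_sum fun j _ => Finset.sum_le_sum fun l _ => by
        nlinarith [mul_nonneg (sq_nonneg (‖F j‖ - ‖F l‖)) (hP0 j l)]
    simp only [Finset.sum_add_distrib, ← Finset.mul_sum] at h7
    simp only [← Finset.mul_sum] at h5 h6
    linarith
  have h5 : E' ≤ C * K * w * (2 * G + 2 * M * (K / (w : ℝ) ^ 5)) := by
    have h6 : E' * E' ≤ E' * (C * K * w * (2 * G + 2 * M * (K / (w : ℝ) ^ 5))) := by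
      calc E' * E' = E' ^ 2 := (sq _).symm
        _ ≤ C * K * w * (E' * (2 * G + 2 * M * (K / (w : ℝ) ^ 5))) :=
            h2.trans (mul_le_mul_of_nonneg_left h4 (by positivity))
        _ = _ := by ring
    exact le_of_mul_le_mul_left h6 hE'0
  have h6 : C * K * w * (2 * M * (K / (w : ℝ) ^ 5)) ≤ c * M * K ^ 2 / 2 := by
    rw [div_le_iff₀ hc] at hw4
    calc _ = 2 * C * (M * K ^ 2) / (w : ℝ) ^ 4 := by field_simp
      _ ≤ _ := by
        rw [div_le_iff₀ (by positivity)]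
        have : (0 : ℝ) ≤ M * K ^ 2 := by positivity
        nlinarith
  rw [div_mul_eq_mul_div, div_mul_eq_mul_div, div_le_iff₀ (by positivity)]
  have h7 : K * (c * M * K) ≤ K * (G * (4 * C * w)) := by
    have := hX.trans (hEb.trans h5)
    rw [mul_add] at this
    linarith
  exact le_of_mul_le_mul_left h7 hK0

open ArithmeticFunction in
/-- A large bilinear sum forces `θ` onto a major arc. -/
lemma exists_dn_le_of_bilinear (c : ℝ) (hc : 0 < c) : ∃ Q R : ℕ, ∀ M K : ℕ, R ≤ M → R ≤ K →
    ∀ θ : ℝ, c * M * K ≤ ∑ m ∈ Finset.Ioc 0 M, vonMangoldt m * ‖expSum vonMangoldt K (m * θ)‖ →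
    ∃ q : ℕ, 1 ≤ q ∧ q ≤ Q ∧ dn (q * θ) * (M * K) ≤ Q := by
  obtain ⟨c1, hc1, R1, h1⟩ := exists_le_sum_fejer_of_bilinear c hc
  obtain ⟨c2, hc2, R2, h2⟩ := exists_le_sum_fejer_of_sum_sq c1 hc1
  obtain ⟨Q, R3, h3⟩ := exists_dn_le_of_sum_fejer c2 hc2
  exact ⟨Q, R1 + R2 + R3, fun M K hM hK θ h => h3 M K (by omega) (by omega) θ
    (h2 M K (by omega) (by omega) θ (h1 M K (by omega) θ h))⟩

lemma sum_Ioc_le_of_blocks (g : ℕ → ℝ) (hg : ∀ n, 0 ≤ g n) (r R Z : ℕ) (hr : 1 ≤ r) (hrR : r ≤ R)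
    (hR : 3 ≤ R) (B : ℝ) (hB : ∀ M, R < M → M ≤ Z → ∑ m ∈ Finset.Ioc (M - M / r) M, g m ≤ B)
    (M : ℕ) (hRM : R < M) (hMZ : M ≤ Z) :
    ∑ m ∈ Finset.Ioc R M, g m ≤ 2 * r * B * Real.log M := by
  induction M using Nat.strong_induction_on with
  | _ M ih =>
    have hb := hB M hRM hMZ
    have hB0 : 0 ≤ B := (Finset.sum_nonneg fun _ _ => hg _).trans hb
    have hM0 : (0 : ℝ) < M := by exact_mod_cast (by omega : 0 < M)
    have hr1 : (1 : ℝ) ≤ r := by exact_mod_cast hr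
    rcases le_or_gt (M - M / r) R with h | h
    · have h1 : (1 : ℝ) ≤ Real.log M := by
        rw [Real.le_log_iff_exp_le hM0]
        have h3 : (3 : ℝ) ≤ M := by exact_mod_cast (by omega)
        linarith [Real.exp_one_lt_d9]
      have h2 : ∑ m ∈ Finset.Ioc R M, g m ≤ B := (Finset.sum_le_sum_of_subset_of_nonneg
        (Finset.Ioc_subset_Ioc h le_rfl) fun _ _ _ => hg _).trans hb
      have h3 : 1 * B * 1 ≤ (2 * r) * B * Real.log M := by gcongr; linarith
      linarith
    · have hd : 1 ≤ M / r := (Nat.one_le_div_iff hr).2 (by omega)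
      have hlt : M - M / r < M := by omega
      have h1 := ih (M - M / r) hlt h (by omega)
      rw [← Finset.Ioc_union_Ioc_eq_Ioc h.le hlt.le,
        Finset.sum_union (Finset.Ioc_disjoint_Ioc_of_le le_rfl)]
      have h0 : (0 : ℝ) < (M - M / r : ℕ) := by exact_mod_cast (by omega)
      have h2 : 1 ≤ 2 * r * (Real.log M - Real.log (M - M / r : ℕ)) := by
        have h3 := Real.log_le_sub_one_of_pos (div_pos h0 hM0)
        rw [Real.log_div h0.ne' hM0.ne'] at h3
        have h4 : ((M - M / r : ℕ) : ℝ) / M - 1 ≤ - (1 / (2 * r)) := by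
          rw [div_sub_one hM0.ne', div_le_iff₀ hM0, Nat.cast_sub (Nat.div_le_self _ _)]
          have h5 : M ≤ 2 * r * (M / r) := by
            have h6 := Nat.div_add_mod M r
            have h7 := Nat.mod_lt M hr
            nlinarith
          have h5' : (M : ℝ) ≤ 2 * r * (M / r : ℕ) := by exact_mod_cast h5
          have h6 : 1 / (2 * (r : ℝ)) * M ≤ (M / r : ℕ) := by
            rw [div_mul_eq_mul_div, one_mul, div_le_iff₀ (by positivity)]
            linarith
          linarith
        have h5 : 2 * (r : ℝ) * (1 / (2 * r)) = 1 := by field_simp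
        nlinarith
      nlinarith

open ArithmeticFunction in
lemma exists_sum_vonMangoldt_Ioc_le (κ : ℝ) (hκ : 0 < κ) : ∃ R : ℕ, ∀ a b : ℕ, a ≤ b → R ≤ b →
    ∑ n ∈ Finset.Ioc a b, vonMangoldt n ≤ (b : ℝ) - a + κ * b := by
  have h1 := Metric.tendsto_atTop.1 tendsto_sum_vonMangoldt (κ / 4) (by positivity)
  obtain ⟨R1, h1⟩ := h1
  have h2 : ∀ n : ℕ, R1 + 1 ≤ n →
      |∑ k ∈ Finset.Ioc 0 n, vonMangoldt k - n| ≤ κ / 4 * n := fun n hn => by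
    have h3 := (h1 n (by omega)).le
    have hn0 : (0 : ℝ) < n := by exact_mod_cast (by omega : 0 < n)
    rw [Real.dist_eq, div_sub_one hn0.ne', abs_div, abs_of_pos hn0, div_le_iff₀ hn0] at h3
    exact h3
  refine ⟨R1 + 1 + ⌈2 * (R1 + 1) / κ⌉₊, fun a b hab hb => ?_⟩
  have hs : ∑ n ∈ Finset.Ioc a b, vonMangoldt n =
      ∑ n ∈ Finset.Ioc 0 b, vonMangoldt n - ∑ n ∈ Finset.Ioc 0 a, vonMangoldt n := by
    rw [← Finset.Ioc_union_Ioc_eq_Ioc (Nat.zero_le _) hab,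
      Finset.sum_union (Finset.Ioc_disjoint_Ioc_of_le le_rfl)]
    ring
  rw [hs]
  have hb1 := (abs_le.1 (h2 b (by omega))).2
  have hb2 : 2 * ((R1 : ℝ) + 1) / κ ≤ b := (Nat.le_ceil _).trans
    ((Nat.cast_le (α := ℝ)).2 (by omega))
  rw [div_le_iff₀ hκ] at hb2
  have hab' : (a : ℝ) ≤ b := by exact_mod_cast hab
  rcases le_or_gt (R1 + 1) a with h | h
  · have ha1 := (abs_le.1 (h2 a h)).1
    nlinarith
  · have ha1 : (a : ℝ) ≤ R1 + 1 := by exact_mod_cast h.le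
    have ha0 : 0 ≤ ∑ n ∈ Finset.Ioc 0 a, vonMangoldt n :=
      Finset.sum_nonneg fun _ _ => vonMangoldt_nonneg
    nlinarith

open ArithmeticFunction in
lemma norm_expSum_sub_le (K' K : ℕ) (h : K' ≤ K) (φ : ℝ) :
    ‖expSum vonMangoldt K' φ‖ ≤ ‖expSum vonMangoldt K φ‖ +
      ∑ n ∈ Finset.Ioc K' K, vonMangoldt n := by
  have h1 : expSum vonMangoldt K' φ = expSum vonMangoldt K φ -
      ∑ n ∈ Finset.Ioc K' K, (vonMangoldt n : ℂ) * ex (n * φ) := by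
    rw [expSum, expSum, ← Finset.Ioc_union_Ioc_eq_Ioc (Nat.zero_le _) h,
      Finset.sum_union (Finset.Ioc_disjoint_Ioc_of_le le_rfl)]
    ring
  rw [h1]
  refine (norm_sub_le _ _).trans ?_
  gcongr
  refine (norm_sum_le _ _).trans (Finset.sum_le_sum fun n _ => ?_)
  rw [norm_mul, norm_ex, mul_one, Complex.norm_real, Real.norm_of_nonneg vonMangoldt_nonneg]

open ArithmeticFunction in
lemma exists_block_of_bilinSum (ε : ℝ) (hε : 0 < ε) : ∃ c : ℝ, 0 < c ∧ ∀ R : ℕ, ∃ N0 : ℕ,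
    ∀ N ≥ N0, ∀ θ : ℝ, ε * N * Real.log N ≤ ‖bilinSum N θ‖ →
    ∃ M K : ℕ, R ≤ M ∧ R ≤ K ∧ N ≤ 2 * (M * K) ∧
      c * M * K ≤ ∑ m ∈ Finset.Ioc 0 M, vonMangoldt m * ‖expSum vonMangoldt K (m * θ)‖ := by
  set r := ⌈256 / ε⌉₊ + 2 with hr
  have hr2 : 2 ≤ r := by omega
  have hr0 : (0 : ℝ) < r := by exact_mod_cast (by omega : 0 < r)
  have hrε : 256 / ε ≤ r := (Nat.le_ceil _).trans (by exact_mod_cast (by omega))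
  obtain ⟨R1, hR1⟩ := exists_sum_vonMangoldt_Ioc_le (1 / r) (by positivity)
  refine ⟨ε / (32 * r), by positivity, fun R => ?_⟩
  set R' := R + R1 + r + 3 with hR'
  obtain ⟨N1, hN1⟩ := eventually_atTop.1
    ((Real.tendsto_log_atTop.comp tendsto_natCast_atTop_atTop).eventually_ge_atTop (100 * R' / ε + 1))
  refine ⟨N1 + (R' + 1) * R', fun N hN θ hbil => ?_⟩
  have hlog : 100 * R' / ε + 1 ≤ Real.log N := hN1 N (by omega)
  have hN0 : 0 < N := by nlinarith
  have hNr : (0 : ℝ) < N := by exact_mod_cast hN0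
  set Z := N / R' with hZ
  have hZR : R' < Z := by
    have : R' + 1 ≤ N / R' := (Nat.le_div_iff_mul_le (by omega)).2 (by omega)
    omega
  by_contra! hcon
  set g : ℕ → ℝ := fun m => vonMangoldt m * ‖expSum vonMangoldt (N / m) (m * θ)‖ with hg
  have hg0 : ∀ n, 0 ≤ g n := fun n => mul_nonneg vonMangoldt_nonneg (norm_nonneg _)
  have hblock : ∀ M, R' < M → M ≤ Z → ∑ m ∈ Finset.Ioc (M - M / r) M, g m ≤ ε * N / (8 * r) := by
    intro M hM hMZ
    have hMR : M * R' ≤ N := (Nat.le_div_iff_mul_le (by omega)).1 hMZ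
    have hdr : 2 * (M / r) ≤ M := by
      have := Nat.div_mul_le_self M r
      nlinarith
    obtain ⟨M0, hM0⟩ : ∃ M0, M0 = M - M / r := ⟨_, rfl⟩
    rw [← hM0]
    have hM02 : M ≤ 2 * M0 := by omega
    have hM0p : 0 < M0 := by omega
    have hM0r : (0 : ℝ) < M0 := by exact_mod_cast hM0p
    have hMr : (0 : ℝ) < M := by exact_mod_cast (by omega : 0 < M)
    obtain ⟨K, hK⟩ : ∃ K, K = N / M0 := ⟨_, rfl⟩
    have hK' : R' ≤ N / M := (Nat.le_div_iff_mul_le (by omega)).2 (by rw [mul_comm]; exact hMR)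
    have hKK : N / M ≤ K := by rw [hK]; exact Nat.div_le_div_left (by omega) hM0p
    have hKN : K * M0 ≤ N := by rw [hK]; exact Nat.div_mul_le_self _ _
    have hNK : N < (K + 1) * M0 := by
      rw [hK]; exact Nat.lt_mul_of_div_lt (Nat.lt_succ_self _) hM0p
    have hNMK : N ≤ 2 * (M * K) := by
      calc N ≤ (K + 1) * M0 := hNK.le
        _ ≤ (2 * K) * M := Nat.mul_le_mul (by omega) (by omega)
        _ = _ := by ring
    have hF := hcon M K (by omega) (by omega) hNMK
    have hKr : (0 : ℝ) < K := by exact_mod_cast (by omega : 0 < K)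
    have hMM : (M : ℝ) - M0 ≤ M / r := by
      have h1 : ((M / r : ℕ) : ℝ) ≤ M / r := Nat.cast_div_le
      rw [hM0, Nat.cast_sub (Nat.div_le_self _ _)]
      linarith
    have hinc : ∑ n ∈ Finset.Ioc (N / M) K, vonMangoldt n ≤ 4 * K / r := by
      refine (hR1 _ _ hKK (by omega)).trans ?_
      have h1 : (N : ℝ) / M - 1 ≤ (N / M : ℕ) := by
        have h2 : (N : ℝ) < ((N / M : ℕ) + 1) * M := by
          exact_mod_cast (Nat.lt_mul_of_div_lt (Nat.lt_succ_self _) (by omega))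
        rw [← div_lt_iff₀ hMr] at h2
        linarith
      have h2 : (K : ℝ) ≤ N / M0 := by rw [le_div_iff₀ hM0r]; exact_mod_cast hKN
      have h3 : (N : ℝ) / M0 ≤ K + 1 := by rw [div_le_iff₀ hM0r]; exact_mod_cast hNK.le
      have h4 : (N : ℝ) / M0 - N / M ≤ (N / M0) / r := by
        have h5 : (N : ℝ) / M0 - N / M = N / M0 * ((M - M0) / M) := by field_simp
        have h6 : ((M : ℝ) - M0) / M ≤ 1 / r := by
          rw [div_le_div_iff₀ hMr hr0]
          rw [le_div_iff₀ hr0] at hMM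
          linarith
        rw [h5, div_eq_mul_one_div (_ / _) (r : ℝ)]
        gcongr
      have h5 : (N : ℝ) / M0 / r ≤ (K + 1) / r := by gcongr
      have h6 : (1 : ℝ) / r ≤ 1 := by
        rw [div_le_one hr0]; exact_mod_cast (by omega)
      have h7 : (1 : ℝ) ≤ K / r := by
        rw [one_le_div hr0]; exact_mod_cast (by omega)
      have h8 : ((K : ℝ) + 1) / r = K / r + 1 / r := by ring
      have h9 : 4 * (K : ℝ) / r = 4 * (K / r) := by ring
      have h10 : 1 / (r : ℝ) * K = K / r := by ring
      linarith
    have hΛ : ∑ m ∈ Finset.Ioc M0 M, vonMangoldt m ≤ 2 * M / r := by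
      refine (hR1 M0 M (by omega) (by omega)).trans ?_
      have h9 : 2 * (M : ℝ) / r = 2 * (M / r) := by ring
      have h10 : 1 / (r : ℝ) * M = M / r := by ring
      linarith
    have hMK : (M : ℝ) * K ≤ 2 * N := by
      have : M * K ≤ 2 * N := by nlinarith
      exact_mod_cast this
    calc ∑ m ∈ Finset.Ioc M0 M, g m
        ≤ ∑ m ∈ Finset.Ioc M0 M, (vonMangoldt m * ‖expSum vonMangoldt K (m * θ)‖ +
          vonMangoldt m * (4 * K / r)) := by
          refine Finset.sum_le_sum fun m hm => ?_
          rw [Finset.mem_Ioc] at hm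
          rw [← mul_add]
          refine mul_le_mul_of_nonneg_left ?_ vonMangoldt_nonneg
          have hmK : N / m ≤ K := by rw [hK]; exact Nat.div_le_div_left hm.1.le hM0p
          have hmM : N / M ≤ N / m := Nat.div_le_div_left hm.2 (by omega)
          refine (norm_expSum_sub_le _ _ hmK _).trans ?_
          gcongr
          exact (Finset.sum_le_sum_of_subset_of_nonneg (Finset.Ioc_subset_Ioc hmM le_rfl)
            fun _ _ _ => vonMangoldt_nonneg).trans hinc
      _ ≤ ε / (32 * r) * M * K + 2 * M / r * (4 * K / r) := by
          rw [Finset.sum_add_distrib, ← Finset.sum_mul]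
          refine add_le_add (le_trans (Finset.sum_le_sum_of_subset_of_nonneg
            (Finset.Ioc_subset_Ioc (Nat.zero_le _) le_rfl) fun _ _ _ =>
              mul_nonneg vonMangoldt_nonneg (norm_nonneg _)) hF.le) (by gcongr)
      _ = (ε / (32 * r) + 8 / r * (1 / r)) * (M * K) := by ring
      _ ≤ (ε / (32 * r) + ε / (32 * r)) * (2 * N) := by
          gcongr ?_ * ?_
          gcongr
          rw [div_le_iff₀ hε] at hrε
          rw [div_mul_div_comm, div_le_div_iff₀ (by positivity) (by positivity)]
          nlinarith
      _ = _ := by field_simp; norm_num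
  have hmid := sum_Ioc_le_of_blocks g hg0 r R' Z (by omega) (by omega) (by omega) _ hblock Z hZR le_rfl
  have hZN : Z ≤ N := Nat.div_le_self _ _
  have hmid' : ∑ m ∈ Finset.Ioc R' Z, g m ≤ ε / 4 * N * Real.log N := by
    refine hmid.trans ?_
    have h1 : Real.log Z ≤ Real.log N := Real.log_le_log (by exact_mod_cast (by omega : 0 < Z))
      (by exact_mod_cast hZN)
    have h2 : 2 * (r : ℝ) * (ε * N / (8 * r)) = ε / 4 * N := by field_simp; norm_num
    rw [h2]
    gcongr
  have hsmall : ∑ m ∈ Finset.Ioc 0 R', g m ≤ 36 * R' * N := by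
    have h1 : ∑ m ∈ Finset.Ioc 0 R', g m ≤ ∑ m ∈ Finset.Ioc 0 R', vonMangoldt m * (6 * N) := by
      refine Finset.sum_le_sum fun m _ => mul_le_mul_of_nonneg_left ?_ vonMangoldt_nonneg
      refine (norm_expSum_le _ (fun n => ⟨vonMangoldt_nonneg, le_rfl⟩) _ _).trans ?_
      gcongr
      exact Nat.div_le_self _ _
    rw [← Finset.sum_mul] at h1
    have h2 := mul_le_mul_of_nonneg_right (sum_vonMangoldt_le R') (by positivity : (0 : ℝ) ≤ 6 * N)
    linarith
  have hlarge : ∑ m ∈ Finset.Ioc Z N, g m ≤ 36 * R' * N := by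
    have h1 : ∑ m ∈ Finset.Ioc Z N, g m ≤ ∑ m ∈ Finset.Ioc Z N, vonMangoldt m * (6 * R') := by
      refine Finset.sum_le_sum fun m hm => mul_le_mul_of_nonneg_left ?_ vonMangoldt_nonneg
      refine (norm_expSum_le _ (fun n => ⟨vonMangoldt_nonneg, le_rfl⟩) _ _).trans ?_
      gcongr
      have h2 := (Finset.mem_Ioc.1 hm).1
      rw [hZ, Nat.div_lt_iff_lt_mul (by omega)] at h2
      exact (Nat.div_lt_of_lt_mul h2).le
    rw [← Finset.sum_mul] at h1
    have h2 : ∑ m ∈ Finset.Ioc Z N, vonMangoldt m ≤ 6 * N := le_trans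
      (Finset.sum_le_sum_of_subset_of_nonneg (Finset.Ioc_subset_Ioc (Nat.zero_le _) le_rfl)
        fun _ _ _ => vonMangoldt_nonneg) (sum_vonMangoldt_le N)
    have h3 := mul_le_mul_of_nonneg_right h2 (by positivity : (0 : ℝ) ≤ 6 * R')
    linarith
  have htot : ‖bilinSum N θ‖ ≤ ∑ m ∈ Finset.Ioc 0 N, g m := by
    refine (norm_sum_le _ _).trans (Finset.sum_le_sum fun m _ => ?_)
    rw [norm_mul, Complex.norm_real, Real.norm_of_nonneg vonMangoldt_nonneg]
  rw [← Finset.Ioc_union_Ioc_eq_Ioc (Nat.zero_le _) hZN,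
    Finset.sum_union (Finset.Ioc_disjoint_Ioc_of_le le_rfl),
    ← Finset.Ioc_union_Ioc_eq_Ioc (Nat.zero_le _) hZR.le,
    Finset.sum_union (Finset.Ioc_disjoint_Ioc_of_le le_rfl)] at htot
  have hfin : ε * N * (3 / 4 * Real.log N) ≤ 72 * R' * N := by linarith
  have h1 : ε * (3 / 4 * Real.log N) * N ≤ 72 * R' * N := by linarith
  have h2 := le_of_mul_le_mul_right h1 hNr
  have h3 : 100 * R' / ε * ε = 100 * (R' : ℝ) := by field_simp
  have h4 : (0 : ℝ) < R' := by exact_mod_cast (by omega : 0 < R')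
  nlinarith

/-- If the bilinear sum is large then `θ` lies on a major arc with bounded denominator. -/
lemma exists_dn_le_of_bilinSum (ε : ℝ) (hε : 0 < ε) : ∃ Q : ℕ, ∃ N0 : ℕ, ∀ N ≥ N0,
    ∀ θ : ℝ, ε * N * Real.log N ≤ ‖bilinSum N θ‖ →
    ∃ q : ℕ, 1 ≤ q ∧ q ≤ Q ∧ dn (q * θ) * N ≤ Q := by
  obtain ⟨c, hc, h1⟩ := exists_block_of_bilinSum ε hε
  obtain ⟨Q, R, h2⟩ := exists_dn_le_of_bilinear c hc
  obtain ⟨N0, h3⟩ := h1 R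
  refine ⟨2 * Q, N0, fun N hN θ h => ?_⟩
  obtain ⟨M, K, hM, hK, hN2, hX⟩ := h3 N hN θ h
  obtain ⟨q, hq1, hq2, hq3⟩ := h2 M K hM hK θ hX
  refine ⟨q, hq1, by omega, ?_⟩
  have h4 : (N : ℝ) ≤ 2 * (M * K) := by exact_mod_cast hN2
  have := mul_le_mul_of_nonneg_left h4 (dn_nonneg (q * θ))
  push_cast
  linarith

open ArithmeticFunction in
/-- A large exponential sum over primes forces `θ` onto a major arc. -/
theorem exists_dn_le_of_expSum (η : ℝ) (hη : 0 < η) : ∃ Q : ℕ, ∃ N0 : ℕ, ∀ N ≥ N0,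
    ∀ θ : ℝ, η * N ≤ ‖expSum vonMangoldt N θ‖ →
    ∃ q : ℕ, 1 ≤ q ∧ q ≤ Q ∧ dn (q * θ) * N ≤ Q := by
  obtain ⟨Q1, N1, h1⟩ := exists_dn_le_of_bilinSum (η / 4) (by positivity)
  obtain ⟨Q2, N2, h2⟩ := exists_dn_le_of_selbergSum (η / 4) (by positivity)
  obtain ⟨N3, h3⟩ := eventually_log_pow_le (4 / η) 1
  obtain ⟨N4, h4⟩ := eventually_atTop.1
    ((Real.tendsto_log_atTop.comp tendsto_natCast_atTop_atTop).eventually_gt_atTop (24 / η))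
  refine ⟨Q1 + Q2, N1 + N2 + N3 + N4 + 1, fun N hN θ hS => ?_⟩
  have hNr : (0 : ℝ) < N := by exact_mod_cast (by omega : 0 < N)
  have h3' := h3 N (by omega)
  have h4' : 24 / η < Real.log N := h4 N (by omega)
  have hl0 : 0 < Real.log N := lt_trans (by positivity) h4'
  have hsel := norm_selberg_le N θ
  have h5 : Real.log N * ‖expSum vonMangoldt N θ‖ ≤
      ‖bilinSum N θ‖ + ‖selbergSum N θ‖ + (Real.log N ^ 2 + 6 * N) := by
    have h6 : (Real.log N : ℂ) * expSum vonMangoldt N θ =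
        (Real.log N * expSum vonMangoldt N θ + bilinSum N θ - selbergSum N θ) +
          selbergSum N θ - bilinSum N θ := by ring
    have h7 : ‖(Real.log N : ℂ) * expSum vonMangoldt N θ‖ =
        Real.log N * ‖expSum vonMangoldt N θ‖ := by
      rw [norm_mul, Complex.norm_real, Real.norm_of_nonneg hl0.le]
    rw [← h7, h6]
    refine (norm_sub_le _ _).trans ?_
    have := norm_add_le (Real.log N * expSum vonMangoldt N θ + bilinSum N θ - selbergSum N θ)
      (selbergSum N θ)
    linarith
  have h8 := mul_le_mul_of_nonneg_left hS hl0.le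
  rw [pow_one, div_mul_eq_mul_div, div_le_iff₀ hη] at h3'
  rw [div_lt_iff₀ hη] at h4'
  have h9 : Real.log N ^ 2 + 6 * N ≤ η / 2 * N * Real.log N := by nlinarith
  rcases le_or_gt (η / 4 * N * Real.log N) ‖bilinSum N θ‖ with h | h
  · obtain ⟨q, hq1, hq2, hq3⟩ := h1 N (by omega) θ h
    exact ⟨q, hq1, by omega, hq3.trans (by push_cast; linarith [Nat.cast_nonneg (α := ℝ) Q2])⟩
  · obtain ⟨q, hq1, hq2, hq3⟩ := h2 N (by omega) θ (by nlinarith)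
    rw [le_div_iff₀ hNr] at hq3
    exact ⟨q, hq1, by omega, hq3.trans (by push_cast; linarith [Nat.cast_nonneg (α := ℝ) Q1])⟩

/-- The logarithmic weight on the primes in `[x, N]`. -/
noncomputable def primeWeight (x N n : ℕ) : ℝ :=
  if n.Prime ∧ x ≤ n ∧ n ≤ N then Real.log n else 0

lemma primeWeight_mem (x N n : ℕ) :
    0 ≤ primeWeight x N n ∧ primeWeight x N n ≤ ArithmeticFunction.vonMangoldt n := by
  rw [primeWeight]
  split_ifs with h
  · exact ⟨Real.log_natCast_nonneg n, (ArithmeticFunction.vonMangoldt_apply_prime h.1).ge⟩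
  · exact ⟨le_rfl, ArithmeticFunction.vonMangoldt_nonneg⟩

open ArithmeticFunction in
lemma exists_sum_vonMangoldt_not_prime_le (γ : ℝ) (hγ : 0 < γ) : ∃ N0 : ℕ, ∀ N ≥ N0,
    ∑ n ∈ Finset.Ioc 0 N with ¬ n.Prime, vonMangoldt n ≤ γ * N := by
  have h := tendsto_sum_vonMangoldt.sub tendsto_theta_div
  rw [sub_self] at h
  obtain ⟨N0, hN0⟩ := eventually_atTop.1 (h.eventually_lt_const hγ)
  refine ⟨N0 + 1, fun N hN => ?_⟩
  have hNr : (0 : ℝ) < N := by exact_mod_cast (by omega : 0 < N)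
  have h1 := hN0 N (by omega)
  rw [← sub_div, div_lt_iff₀ hNr, Chebyshev.theta, Nat.floor_natCast,
    ← Finset.sum_filter_add_sum_filter_not (Finset.Ioc 0 N) (fun n => n.Prime)] at h1
  have h2 : ∑ n ∈ Finset.Ioc 0 N with n.Prime, vonMangoldt n =
      ∑ n ∈ Finset.Ioc 0 N with n.Prime, Real.log n :=
    Finset.sum_congr rfl fun n hn => vonMangoldt_apply_prime (Finset.mem_filter.1 hn).2
  rw [h2] at h1
  linarith

open ArithmeticFunction in
lemma norm_expSum_primeWeight_le (x N L : ℕ) (hx : 1 ≤ x) (hxN : x ≤ N) (hL : N ≤ L) (θ : ℝ) :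
    ‖expSum (primeWeight x N) L θ‖ ≤ ‖expSum vonMangoldt N θ‖ + ‖expSum vonMangoldt (x - 1) θ‖ +
      ∑ n ∈ Finset.Ioc 0 N with ¬ n.Prime, vonMangoldt n := by
  have h1 : expSum (primeWeight x N) L θ = expSum vonMangoldt N θ - expSum vonMangoldt (x - 1) θ -
      ∑ n ∈ Finset.Ioc (x - 1) N with ¬ n.Prime, (vonMangoldt n : ℂ) * ex (n * θ) := by
    have h2 : expSum (primeWeight x N) L θ =
        ∑ n ∈ Finset.Ioc (x - 1) N with n.Prime, (vonMangoldt n : ℂ) * ex (n * θ) := by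
      rw [expSum, eq_comm, Finset.sum_filter]
      refine Finset.sum_subset_zero_on_sdiff (Finset.Ioc_subset_Ioc (Nat.zero_le _) hL)
        (fun n hn => ?_) (fun n hn => ?_)
      · rw [Finset.mem_sdiff, Finset.mem_Ioc, Finset.mem_Ioc] at hn
        rw [primeWeight, if_neg (by omega)]
        simp
      · rw [Finset.mem_Ioc] at hn
        rw [primeWeight]
        by_cases hp : n.Prime
        · rw [if_pos hp, if_pos ⟨hp, by omega, hn.2⟩, vonMangoldt_apply_prime hp]
        · rw [if_neg hp, if_neg (fun h => hp h.1)]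
          simp
    have h3 : expSum vonMangoldt N θ = expSum vonMangoldt (x - 1) θ +
        ∑ n ∈ Finset.Ioc (x - 1) N, (vonMangoldt n : ℂ) * ex (n * θ) := by
      rw [expSum, expSum, ← Finset.Ioc_union_Ioc_eq_Ioc (Nat.zero_le (x - 1)) (by omega : x - 1 ≤ N),
        Finset.sum_union (Finset.Ioc_disjoint_Ioc_of_le le_rfl)]
    rw [h2, h3, ← Finset.sum_filter_add_sum_filter_not (Finset.Ioc (x - 1) N) (fun n => n.Prime)]
    ring
  rw [h1]
  refine (norm_sub_le _ _).trans (add_le_add (norm_sub_le _ _) ((norm_sum_le _ _).trans ?_))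
  refine (Finset.sum_le_sum fun n _ => ?_).trans (Finset.sum_le_sum_of_subset_of_nonneg
    (Finset.filter_subset_filter _ (Finset.Ioc_subset_Ioc (Nat.zero_le _) le_rfl))
    fun _ _ _ => vonMangoldt_nonneg)
  rw [norm_mul, norm_ex, mul_one, Complex.norm_real, Real.norm_of_nonneg vonMangoldt_nonneg]

open ArithmeticFunction in
lemma exists_dn_le_of_primeWeight (C : ℕ) (hC : 1 ≤ C) (η : ℝ) (hη : 0 < η) : ∃ Q X0 : ℕ,
    ∀ x ≥ X0, ∀ L, C * x ≤ L → ∀ θ : ℝ, η * x ≤ ‖expSum (primeWeight x (C * x)) L θ‖ →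
    ∃ q : ℕ, 1 ≤ q ∧ q ≤ Q ∧ dn (q * θ) * x ≤ Q := by
  have hC0 : (0 : ℝ) < C := by exact_mod_cast hC
  obtain ⟨Q, N1, h1⟩ := exists_dn_le_of_expSum (η / (3 * C)) (by positivity)
  obtain ⟨N2, h2⟩ := exists_sum_vonMangoldt_not_prime_le (η / (4 * C)) (by positivity)
  refine ⟨2 * Q, N1 + N2 + 2, fun x hx L hL θ hF => ?_⟩
  have hxr : (0 : ℝ) < x := by exact_mod_cast (by omega : 0 < x)
  have hxC : x ≤ C * x := Nat.le_mul_of_pos_left _ hC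
  have hx1 : ((x - 1 : ℕ) : ℝ) = x - 1 := by rw [Nat.cast_sub (by omega), Nat.cast_one]
  have h3 := h2 (C * x) (by omega)
  have h4 := norm_expSum_primeWeight_le x (C * x) L (by omega) hxC hL θ
  have h5 : η / (4 * C) * (C * x : ℕ) = η / 4 * x := by push_cast; field_simp
  have h6 : η / (3 * C) * (C * x : ℕ) = η / 3 * x := by push_cast; field_simp
  have hηx : 0 < η * x := by positivity
  rcases le_or_gt (η / 3 * x) ‖expSum vonMangoldt (C * x) θ‖ with h | h
  · obtain ⟨q, hq1, hq2, hq3⟩ := h1 (C * x) (by omega) θ (by rw [h6]; exact h)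
    refine ⟨q, hq1, by omega, ?_⟩
    have h7 : (x : ℝ) ≤ (C * x : ℕ) := by exact_mod_cast hxC
    have h8 := mul_le_mul_of_nonneg_left h7 (dn_nonneg (q * θ))
    push_cast at h8 hq3 ⊢
    linarith [Nat.cast_nonneg (α := ℝ) Q]
  · have h7 : η / (3 * C) * (x - 1 : ℕ) ≤ ‖expSum vonMangoldt (x - 1) θ‖ := by
      have h8 : η / (3 * C) * (x - 1 : ℕ) ≤ η / 3 * (x - 1 : ℕ) := by
        gcongr
        have : (1 : ℝ) ≤ C := by exact_mod_cast hC
        linarith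
      rw [hx1] at h8 ⊢
      linarith
    obtain ⟨q, hq1, hq2, hq3⟩ := h1 (x - 1) (by omega) θ h7
    refine ⟨q, hq1, by omega, ?_⟩
    rw [hx1] at hq3
    have h9 : (2 : ℝ) ≤ x := by exact_mod_cast (by omega)
    have := mul_le_mul_of_nonneg_left (by linarith : (x : ℝ) ≤ 2 * (x - 1)) (dn_nonneg (q * θ))
    push_cast
    linarith

/-- The number of representations of `b` as a sum of three units. -/
noncomputable def unitSums (R : Type*) [CommRing R] (b : R) : ℕ :=
  Nat.card {w : R × R // IsUnit w.1 ∧ IsUnit w.2 ∧ IsUnit (b - w.1 - w.2)}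

lemma unitSums_congr {R S : Type*} [CommRing R] [CommRing S] (e : R ≃+* S) (b : R) :
    unitSums R b = unitSums S (e b) := by
  refine Nat.card_congr (Equiv.subtypeEquiv (e.toEquiv.prodCongr e.toEquiv) fun w => ?_)
  simp only [RingEquiv.toEquiv_eq_coe, Equiv.prodCongr_apply, Prod.map_fst, Prod.map_snd,
    EquivLike.coe_coe, ← map_sub, MulEquiv.isUnit_map]

lemma unitSums_prod {R S : Type*} [CommRing R] [CommRing S] (b : R) (c : S) :
    unitSums (R × S) (b, c) = unitSums R b * unitSums S c := by
  rw [unitSums, unitSums, unitSums, ← Nat.card_prod]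
  refine Nat.card_congr
    { toFun := fun w => (⟨(w.1.1.1, w.1.2.1), ?_⟩, ⟨(w.1.1.2, w.1.2.2), ?_⟩)
      invFun := fun w => ⟨((w.1.1.1, w.2.1.1), (w.1.1.2, w.2.1.2)), ?_⟩
      left_inv := fun w => rfl
      right_inv := fun w => rfl }
  · obtain ⟨h1, h2, h3⟩ := w.2
    rw [Prod.isUnit_iff] at h1 h2 h3
    exact ⟨h1.1, h2.1, h3.1⟩
  · obtain ⟨h1, h2, h3⟩ := w.2
    rw [Prod.isUnit_iff] at h1 h2 h3
    exact ⟨h1.2, h2.2, h3.2⟩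
  · obtain ⟨h1, h2, h3⟩ := w.1.2
    obtain ⟨h4, h5, h6⟩ := w.2.2
    simp only [Prod.isUnit_iff]
    exact ⟨⟨h1, h4⟩, ⟨h2, h5⟩, ⟨h3, h6⟩⟩

lemma unitSums_mul (m n : ℕ) (h : m.Coprime n) (b : ℕ) :
    unitSums (ZMod (m * n)) b = unitSums (ZMod m) b * unitSums (ZMod n) b := by
  rw [unitSums_congr (ZMod.chineseRemainder h), ← unitSums_prod]
  congr 1
  simp only [map_natCast]
  rfl

lemma le_unitSums (p : ℕ) [Fact p.Prime] (b : ZMod p) : (p - 1) * (p - 2) ≤ unitSums (ZMod p) b := by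
  classical
  rw [unitSums, Nat.card_eq_fintype_card, Fintype.card_subtype]
  set s := Finset.univ.filter fun w : ZMod p × ZMod p =>
    IsUnit w.1 ∧ IsUnit w.2 ∧ IsUnit (b - w.1 - w.2) with hs
  have hcard : (Finset.univ.erase (0 : ZMod p)).card = p - 1 := by
    rw [Finset.card_erase_of_mem (Finset.mem_univ _), Finset.card_univ, ZMod.card]
  rw [Finset.card_eq_sum_card_fiberwise (f := Prod.fst) (t := Finset.univ.erase (0 : ZMod p))
    (by
      intro w hw
      have := (Finset.mem_filter.1 (Finset.mem_coe.1 hw)).2.1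
      exact Finset.mem_coe.2 (Finset.mem_erase.2 ⟨this.ne_zero, Finset.mem_univ _⟩)), ← hcard,
    ← smul_eq_mul]
  refine Finset.card_nsmul_le_sum _ _ _ fun u hu => ?_
  have hu0 := (Finset.mem_erase.1 hu).1
  have h2 : p - 2 ≤ (Finset.univ \ {0, b - u} : Finset (ZMod p)).card := by
    rw [Finset.card_sdiff_of_subset (Finset.subset_univ _), Finset.card_univ, ZMod.card]
    have := Finset.card_le_two (a := (0 : ZMod p)) (b := b - u)
    omega
  refine h2.trans (Finset.card_le_card_of_injOn (fun v => (u, v)) (fun v hv => ?_)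
    (fun v _ v' _ h => (Prod.mk.inj h).2))
  rw [Finset.mem_coe, Finset.mem_sdiff, Finset.mem_insert, Finset.mem_singleton, not_or] at hv
  simp only [hs, Finset.coe_filter, Finset.mem_filter, Finset.mem_univ, true_and,
    Set.mem_ofPred_eq, and_true, isUnit_iff_ne_zero]
  exact ⟨hu0, hv.2.1, fun h => hv.2.2 (sub_eq_zero.1 h).symm⟩

lemma one_le_unitSums_two (b : ℕ) (hb : Odd b) : 1 ≤ unitSums (ZMod 2) b := by
  have hb1 : (b : ZMod 2) = 1 := by
    obtain ⟨k, rfl⟩ := hb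
    have : ((2 : ℕ) : ZMod 2) = 0 := ZMod.natCast_self 2
    push_cast at this ⊢
    rw [this]
    simp
  rw [unitSums, Nat.one_le_iff_ne_zero, Nat.card_ne_zero]
  exact ⟨⟨⟨(1, 1), isUnit_one, isUnit_one, by rw [hb1]; exact ⟨-1, by decide⟩⟩⟩, inferInstance⟩

/-- The local density of representations of an odd number as a sum of three units. -/
lemma totient_pow_le_unitSums (b : ℕ) (hb : Odd b) (Q : ℕ) (hQ : 2 ≤ Q) :
    Q * (primorial Q).totient ^ 3 ≤ (Q - 1) * (unitSums (ZMod (primorial Q)) b * primorial Q) := by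
  induction Q, hQ using Nat.le_induction with
  | base =>
    have h1 : primorial 2 = 2 := by decide
    rw [h1]
    have := one_le_unitSums_two b hb
    simp only [Nat.totient_two]
    omega
  | succ Q hQ ih =>
    by_cases hp : (Q + 1).Prime
    · have : Fact (Q + 1).Prime := ⟨hp⟩
      have h1 : primorial (Q + 1) = primorial Q * (Q + 1) := by
        rw [primorial, Finset.range_add_one, Finset.filter_insert, if_pos hp,
          Finset.prod_insert (by simp), mul_comm, primorial]
      have hcop : (primorial Q).Coprime (Q + 1) := by
        rw [primorial]
        refine Nat.Coprime.prod_left fun p hp' => ?_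
        rw [Finset.mem_filter, Finset.mem_range] at hp'
        exact (Nat.coprime_primes hp'.2 hp).2 (by omega)
      rw [h1, Nat.totient_mul hcop, Nat.totient_prime hp, unitSums_mul _ _ hcop]
      have h2 := le_unitSums (Q + 1) ((Q + 1 : ℕ) * 0 + b : ZMod (Q + 1))
      simp only [mul_zero, zero_add] at h2
      have h3 : Q + 1 - 2 = Q - 1 := by omega
      rw [Nat.add_sub_cancel, h3] at h2
      rw [Nat.add_sub_cancel]
      calc (Q + 1) * ((primorial Q).totient * Q) ^ 3
          = (Q * (primorial Q).totient ^ 3) * ((Q + 1) * Q ^ 2) := by ring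
        _ ≤ (Q - 1) * (unitSums (ZMod (primorial Q)) b * primorial Q) * ((Q + 1) * Q ^ 2) :=
            Nat.mul_le_mul_right _ ih
        _ = Q * (unitSums (ZMod (primorial Q)) b * (Q * (Q - 1)) * (primorial Q * (Q + 1))) := by ring
        _ ≤ _ := by gcongr
    · have h1 : primorial (Q + 1) = primorial Q := by
        rw [primorial, Finset.range_add_one, Finset.filter_insert, if_neg hp, primorial]
      rw [h1, Nat.add_sub_cancel]
      set u := unitSums (ZMod (primorial Q)) b * primorial Q
      set v := (primorial Q).totient ^ 3
      obtain ⟨k, rfl⟩ : ∃ k, Q = k + 1 := ⟨Q - 1, by omega⟩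
      rw [Nat.add_sub_cancel] at ih
      have hv : v ≤ u := by
        by_contra! hcon
        have : (k + 1) * u < (k + 1) * v := Nat.mul_lt_mul_of_pos_left hcon (by omega)
        nlinarith
      by_contra! hcon
      nlinarith

lemma totient_pow_le_unitSums' (b : ℕ) (hb : Odd b) (Q : ℕ) (hQ : 2 ≤ Q) :
    (primorial Q).totient ^ 3 ≤ unitSums (ZMod (primorial Q)) b * primorial Q := by
  have h := totient_pow_le_unitSums b hb Q hQ
  have h2 : (Q - 1) * (unitSums (ZMod (primorial Q)) b * primorial Q) ≤
    Q * (unitSums (ZMod (primorial Q)) b * primorial Q) := Nat.mul_le_mul_right _ (by omega)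
  exact Nat.le_of_mul_le_mul_left (h.trans h2) (by omega)

lemma unitSums_mul_sq_le_card (P t A b : ℕ) (hP : 0 < P) :
    unitSums (ZMod P) b * t ^ 2 ≤ (((Finset.Ico A (A + P * t)) ×ˢ (Finset.Ico A (A + P * t))).filter
      fun w : ℕ × ℕ => w.1.Coprime P ∧ w.2.Coprime P ∧
        (w.1 + w.2 ≤ b → (b - w.1 - w.2).Coprime P)).card := by
  classical
  have : NeZero P := ⟨hP.ne'⟩
  set ρ : ZMod P → ℕ → ℕ := fun u i => A + (u - A).val + P * i with hρ
  have hρc : ∀ u i, ((ρ u i : ℕ) : ZMod P) = u := fun u i => by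
    rw [hρ]
    push_cast
    rw [ZMod.natCast_val, ZMod.cast_id', id, ZMod.natCast_self P]
    ring
  have hρm : ∀ u i, i < t → ρ u i ∈ Finset.Ico A (A + P * t) := fun u i hi => by
    rw [Finset.mem_Ico, hρ]
    simp only
    have h1 := ZMod.val_lt (u - (A : ZMod P))
    have h2 : P * (i + 1) ≤ P * t := Nat.mul_le_mul_left _ hi
    rw [mul_add, mul_one] at h2
    omega
  have hρi : ∀ u i u' i', ρ u i = ρ u' i' → u = u' ∧ i = i' := fun u i u' i' h => by
    have hu : u = u' := by rw [← hρc u i, ← hρc u' i', h]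
    subst hu
    refine ⟨rfl, ?_⟩
    rw [hρ] at h
    simp only [add_right_inj] at h
    exact Nat.eq_of_mul_eq_mul_left hP h
  rw [unitSums, Nat.card_eq_fintype_card, Fintype.card_subtype, sq, ← Finset.card_range t,
    ← Finset.card_product, ← Finset.card_product]
  refine Finset.card_le_card_of_injOn (fun w => (ρ w.1.1 w.2.1, ρ w.1.2 w.2.2)) ?_ ?_
  · rintro ⟨⟨u, v⟩, i, j⟩ hw
    rw [Finset.mem_coe, Finset.mem_product, Finset.mem_product, Finset.mem_filter,
      Finset.mem_range, Finset.mem_range] at hw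
    obtain ⟨⟨-, h1, h2, h3⟩, hi, hj⟩ := hw
    rw [Finset.mem_coe, Finset.mem_filter, Finset.mem_product]
    refine ⟨⟨?_, ?_⟩, ?_, ?_, fun hle => ?_⟩
    · simpa using hρm u i hi
    · simpa using hρm v j hj
    · rw [← ZMod.isUnit_iff_coprime, hρc]; exact h1
    · rw [← ZMod.isUnit_iff_coprime, hρc]; exact h2
    · simp only at hle ⊢
      rw [← ZMod.isUnit_iff_coprime, Nat.sub_sub, Nat.cast_sub hle, Nat.cast_add, hρc, hρc,
        ← sub_sub]
      exact h3
  · rintro ⟨⟨u, v⟩, i, j⟩ _ ⟨⟨u', v'⟩, i', j'⟩ _ h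
    obtain ⟨h1, h2⟩ := Prod.mk.inj h
    obtain ⟨rfl, rfl⟩ := hρi _ _ _ _ h1
    obtain ⟨rfl, rfl⟩ := hρi _ _ _ _ h2
    rfl

/-- The weighted number of ternary representations `∑ h(n₁) h(n₂) h(n₃) g(n₁ + n₂ + n₃)`. -/
noncomputable def convSum (g h : ℕ → ℝ) (L : ℕ) : ℝ :=
  ∑ i ∈ Finset.Ioc 0 L, ∑ j ∈ Finset.Ioc 0 L, ∑ k ∈ Finset.Ioc 0 L, h i * h j * h k * g (i + j + k)

lemma sum_mul_sum_mul_sum_mul_sum {ι R : Type*} [CommSemiring R] (I : Finset ι) (u v w z : ι → R) :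
    (∑ i ∈ I, u i) * (∑ j ∈ I, v j) * (∑ k ∈ I, w k) * ∑ b ∈ I, z b =
      ∑ i ∈ I, ∑ j ∈ I, ∑ k ∈ I, ∑ b ∈ I, u i * v j * w k * z b := by
  generalize hz : ∑ b ∈ I, z b = Z
  generalize hw : ∑ k ∈ I, w k = Y
  generalize hv : ∑ j ∈ I, v j = V
  rw [Finset.sum_mul, Finset.sum_mul, Finset.sum_mul]
  refine Finset.sum_congr rfl fun i _ => ?_
  rw [← hv, Finset.mul_sum, Finset.sum_mul, Finset.sum_mul]
  refine Finset.sum_congr rfl fun j _ => ?_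
  rw [← hw, Finset.mul_sum, Finset.sum_mul]
  refine Finset.sum_congr rfl fun k _ => ?_
  rw [← hz, Finset.mul_sum]

lemma sum_conj_mul_expSum_pow (g h : ℕ → ℝ) (L M : ℕ) (hM : 3 * L < M) (hg : ∀ n, L < n → g n = 0) :
    ∑ r ∈ Finset.range M, (starRingEnd ℂ) (expSum g L (r / M)) * expSum h L (r / M) ^ 3 =
      M * convSum g h L := by
  set I := Finset.Ioc 0 L with hI
  have h1 : ∀ r : ℕ, (starRingEnd ℂ) (expSum g L (r / M)) * expSum h L (r / M) ^ 3 =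
      ∑ i ∈ I, ∑ j ∈ I, ∑ k ∈ I, ∑ b ∈ I, ((h i * h j * h k * g b : ℝ) : ℂ) *
        (ex (((i + j + k : ℕ) : ℝ) * (r / M - 0)) * (starRingEnd ℂ) (ex (b * (r / M - 0)))) := by
    intro r
    have e : ∀ i j k : ℕ, ex (((i + j + k : ℕ) : ℝ) * (r / M - 0)) =
        ex (i * (r / M)) * ex (j * (r / M)) * ex (k * (r / M)) := fun i j k => by
      rw [sub_zero, ← ex_add, ← ex_add]
      congr 1
      push_cast
      ring
    have e2 : (starRingEnd ℂ) (expSum g L (r / M)) =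
        ∑ b ∈ I, (g b : ℂ) * (starRingEnd ℂ) (ex (b * (r / M))) := by
      rw [expSum, map_sum]
      exact Finset.sum_congr rfl fun b _ => by rw [map_mul, Complex.conj_ofReal]
    rw [e2, mul_comm, pow_succ, sq, expSum, sum_mul_sum_mul_sum_mul_sum]
    refine Finset.sum_congr rfl fun i _ => Finset.sum_congr rfl fun j _ =>
      Finset.sum_congr rfl fun k _ => Finset.sum_congr rfl fun b _ => ?_
    rw [e, sub_zero]
    push_cast
    ring
  simp only [h1]
  rw [convSum, ← hI]
  push_cast
  rw [Finset.sum_comm, Finset.mul_sum]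
  refine Finset.sum_congr rfl fun i hi => ?_
  rw [Finset.sum_comm, Finset.mul_sum]
  refine Finset.sum_congr rfl fun j hj => ?_
  rw [Finset.sum_comm, Finset.mul_sum]
  refine Finset.sum_congr rfl fun k hk => ?_
  rw [Finset.sum_comm]
  rw [hI, Finset.mem_Ioc] at hi hj hk
  have h2 : ∀ b ∈ I, ∑ r ∈ Finset.range M, (h i * h j * h k * g b : ℂ) *
        (ex (((i + j + k : ℕ) : ℝ) * (r / M - 0)) * (starRingEnd ℂ) (ex (b * (r / M - 0)))) =
      if i + j + k = b then (M : ℂ) * (h i * h j * h k * g b) else 0 := fun b hb => by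
    rw [hI, Finset.mem_Ioc] at hb
    rw [← Finset.mul_sum, sum_ex_mul_conj M (by omega) _ _ (by omega) (by omega)]
    split_ifs
    · ring
    · simp
  push_cast at h2
  rw [Finset.sum_congr rfl h2, Finset.sum_ite_eq]
  split_ifs with h3
  · rfl
  · rw [hg _ (by rw [hI, Finset.mem_Ioc] at h3; omega)]
    simp

/-- The average of `f` over translates by multiples of `W`. -/
noncomputable def shiftAvg (f : ℕ → ℝ) (W J n : ℕ) : ℝ :=
  (∑ j ∈ Finset.range J, f (n - W * j)) / J

lemma expSum_shift (f : ℕ → ℝ) (N L s : ℕ) (h0 : f 0 = 0) (hf : ∀ n, N < n → f n = 0)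
    (hL : N + s ≤ L) (θ : ℝ) :
    ∑ n ∈ Finset.Ioc 0 L, (f (n - s) : ℂ) * ex (n * θ) = ex (s * θ) * expSum f L θ := by
  have h1 : ∀ K, N ≤ K → ∑ n ∈ Finset.Ioc 0 K, (f n : ℂ) * ex (n * θ) =
      ∑ n ∈ Finset.Ioc 0 N, (f n : ℂ) * ex (n * θ) := fun K hK => by
    symm
    refine Finset.sum_subset (Finset.Ioc_subset_Ioc_right hK) fun n hn hn' => ?_
    rw [Finset.mem_Ioc] at hn hn'
    rw [hf n (by omega)]
    simp
  rw [expSum, h1 L (by omega), ← h1 (L - s) (by omega),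
    ← Finset.Ioc_union_Ioc_eq_Ioc (Nat.zero_le s) (by omega : s ≤ L),
    Finset.sum_union (Finset.Ioc_disjoint_Ioc_of_le le_rfl)]
  have h2 : ∑ n ∈ Finset.Ioc 0 s, (f (n - s) : ℂ) * ex (n * θ) = 0 := by
    refine Finset.sum_eq_zero fun n hn => ?_
    rw [Finset.mem_Ioc] at hn
    rw [Nat.sub_eq_zero_of_le hn.2, h0]
    simp
  rw [h2, zero_add, Finset.mul_sum]
  refine Finset.sum_nbij' (fun n => n - s) (fun n => n + s) ?_ ?_ ?_ ?_ ?_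
  · intro n hn; rw [Finset.mem_Ioc] at hn ⊢; omega
  · intro n hn; rw [Finset.mem_Ioc] at hn ⊢; omega
  · intro n hn; rw [Finset.mem_Ioc] at hn; omega
  · intro n hn; simp
  · intro n hn
    rw [Finset.mem_Ioc] at hn
    rw [mul_left_comm, ← ex_add, Nat.cast_sub hn.1.le]
    congr 2
    ring

lemma expSum_shiftAvg (f : ℕ → ℝ) (N L W J : ℕ) (h0 : f 0 = 0) (hf : ∀ n, N < n → f n = 0)
    (hL : N + W * J ≤ L) (θ : ℝ) :
    expSum (shiftAvg f W J) L θ = dirichletSum J (W * θ) / J * expSum f L θ := by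
  have h1 : ∀ j ∈ Finset.range J, ∑ n ∈ Finset.Ioc 0 L, (f (n - W * j) : ℂ) * ex (n * θ) =
      ex (j * (W * θ)) * expSum f L θ := fun j hj => by
    rw [Finset.mem_range] at hj
    have : W * j ≤ W * J := Nat.mul_le_mul_left _ hj.le
    rw [expSum_shift f N L (W * j) h0 hf (by omega)]
    congr 2
    push_cast
    ring
  rw [div_mul_eq_mul_div, dirichletSum, Finset.sum_mul, ← Finset.sum_congr rfl h1, Finset.sum_comm,
    expSum, Finset.sum_div]
  refine Finset.sum_congr rfl fun n _ => ?_
  rw [shiftAvg, ← Finset.sum_mul]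
  push_cast
  ring

lemma norm_dirichletSum_div_le (J : ℕ) (θ : ℝ) : ‖dirichletSum J θ / (J : ℂ)‖ ≤ 1 := by
  rw [norm_div, Complex.norm_natCast]
  exact div_le_one_of_le₀ (norm_dirichletSum_le J θ) (Nat.cast_nonneg _)

lemma norm_one_sub_dirichletSum_div_le (J : ℕ) (hJ : 1 ≤ J) (θ : ℝ) :
    ‖1 - dirichletSum J θ / (J : ℂ)‖ ≤ 7 * J * dn θ := by
  have hJ0 : (0 : ℝ) < J := by exact_mod_cast hJ
  have hJc : (J : ℂ) ≠ 0 := by exact_mod_cast hJ0.ne'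
  have h1 : 1 - dirichletSum J θ / (J : ℂ) = (∑ j ∈ Finset.range J, (1 - ex (j * θ))) / J := by
    rw [Finset.sum_sub_distrib, dirichletSum]
    simp only [Finset.sum_const, Finset.card_range, nsmul_eq_mul, mul_one]
    rw [sub_div, div_self hJc]
  rw [h1, norm_div, Complex.norm_natCast, div_le_iff₀ hJ0]
  have hd := dn_nonneg θ
  have hpi := Real.pi_lt_d2
  have h2 : ∀ j ∈ Finset.range J, ‖1 - ex (j * θ)‖ ≤ 7 * J * dn θ := fun j hj => by
    have hj' : (j : ℝ) ≤ J := by exact_mod_cast (Finset.mem_range.1 hj).le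
    calc ‖1 - ex (j * θ)‖ ≤ 2 * Real.pi * dn (j * θ) := norm_one_sub_ex_le_dn _
      _ ≤ 7 * dn (j * θ) := by
          have := dn_nonneg (j * θ)
          nlinarith
      _ ≤ 7 * (j * dn θ) := by
          have := dn_nat_mul_le j θ
          linarith
      _ ≤ 7 * (J * dn θ) := by gcongr
      _ = _ := by ring
  refine (norm_sum_le_of_le _ h2).trans ?_
  rw [Finset.sum_const, Finset.card_range, nsmul_eq_mul]
  linarith

lemma norm_one_sub_pow_three_le (z : ℂ) (hz : ‖z‖ ≤ 1) : ‖1 - z ^ 3‖ ≤ 3 * ‖1 - z‖ := by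
  have h1 : 1 - z ^ 3 = (1 - z) * (1 + z + z ^ 2) := by ring
  have h2 : ‖1 + z + z ^ 2‖ ≤ 3 := by
    calc ‖1 + z + z ^ 2‖ ≤ ‖(1 : ℂ)‖ + ‖z‖ + ‖z ^ 2‖ := norm_add₃_le
      _ ≤ 1 + 1 + 1 := by
          rw [norm_one, norm_pow]
          have := pow_le_one₀ (n := 2) (norm_nonneg z) hz
          linarith
      _ = 3 := by norm_num
  rw [h1, norm_mul]
  nlinarith [norm_nonneg (1 - z)]

lemma mul_pow_three_le (a b τ : ℝ) (ha : 0 ≤ a) (hb : 0 ≤ b) (hτ : 0 < τ) :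
    a * b ^ 3 ≤ τ ^ 3 * a ^ 4 + b ^ 4 / τ := by
  rcases le_total (τ * a) b with h | h
  · have h1 : a * b ^ 3 ≤ b ^ 4 / τ := by
      rw [le_div_iff₀ hτ]
      calc a * b ^ 3 * τ = τ * a * b ^ 3 := by ring
        _ ≤ b * b ^ 3 := by gcongr
        _ = b ^ 4 := by ring
    have : 0 ≤ τ ^ 3 * a ^ 4 := by positivity
    linarith
  · have h1 : a * b ^ 3 ≤ a * (τ * a) ^ 3 := by gcongr
    have : 0 ≤ b ^ 4 / τ := by positivity
    nlinarith

open ArithmeticFunction in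
/-- Replacing the weight of the primes by its average over a long progression hardly changes
the number of ternary representations. -/
theorem exists_convSum_shiftAvg_le (C : ℕ) (hC : 1 ≤ C) (δ : ℝ) (hδ : 0 < δ) :
    ∃ Q : ℕ, 2 ≤ Q ∧ ∃ κ : ℝ, 0 < κ ∧ κ ≤ 1 ∧ ∃ X0 : ℕ, ∀ x ≥ X0, ∀ J : ℕ, 1 ≤ J →
    (Q.factorial * J : ℝ) ≤ κ * x → ∀ g : ℕ → ℝ, (∀ n, 0 ≤ g n ∧ g n ≤ vonMangoldt n) →
    (∀ n, C * x < n → g n = 0) → convSum g (primeWeight x (C * x)) (2 * (C * x)) = 0 →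
    convSum g (shiftAvg (primeWeight x (C * x)) Q.factorial J) (2 * (C * x)) ≤ δ * x ^ 3 := by
  obtain ⟨C1, hC1, N1, hN1, hall⟩ := sum_pow_four_le
  obtain ⟨C2, hC2, hsmall⟩ := sum_small_pow_four_le
  have hCr : (1 : ℝ) ≤ C := by exact_mod_cast hC
  set K : ℝ := 8 * C ^ 3 * (C1 + C2) with hK
  have hC3 : (1 : ℝ) ≤ (C : ℝ) ^ 3 := one_le_pow₀ hCr
  have hK1 : 1 ≤ K := by
    rw [hK]; nlinarith
  set τ := min δ 1 / (10 * K) with hτ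
  have hτ0 : 0 < τ := by positivity
  have hτK : 10 * K * τ ≤ δ := by
    rw [hτ, mul_div_cancel₀ _ (by positivity)]; exact min_le_left _ _
  have hτ1 : τ ≤ 1 := by
    rw [hτ, div_le_one (by positivity)]
    have := min_le_right δ 1
    linarith
  obtain ⟨N2, hN2, hsm⟩ := hsmall (τ ^ 2) (by positivity) (pow_le_one₀ hτ0.le hτ1)
  obtain ⟨Q, X0, hstruct⟩ := exists_dn_le_of_primeWeight C hC (τ ^ 2 * (2 * C)) (by positivity)
  refine ⟨Q + 2, by omega, τ / (7 * (Q + 2)), by positivity, ?_, X0 + N1 + N2, ?_⟩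
  · rw [div_le_one (by positivity)]
    have : (0 : ℝ) ≤ Q := Nat.cast_nonneg _
    linarith
  intro x hx J hJ hWJ g hg hgN hzero
  set N := C * x with hN
  have hxN : x ≤ N := Nat.le_mul_of_pos_left _ hC
  have hx0 : 1 ≤ x := by omega
  have hxr : (0 : ℝ) < x := by exact_mod_cast hx0
  set W := (Q + 2).factorial with hW
  set f := primeWeight x N with hf
  set L := 2 * N with hL
  set M := 4 * L with hM
  have hMr : (0 : ℝ) < M := by
    have : 1 ≤ M := by omega
    exact_mod_cast this
  have hfm := primeWeight_mem x N
  have hf0 : f 0 = 0 := by simp [hf, primeWeight]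
  have hfN : ∀ n, N < n → f n = 0 := fun n hn => by
    rw [hf, primeWeight, if_neg (by omega)]
  have hQ0 : (0 : ℝ) ≤ Q := Nat.cast_nonneg _
  have hWJx : W * J ≤ x := by
    have : (W * J : ℝ) ≤ x := hWJ.trans (by
      have : τ / (7 * (Q + 2)) ≤ 1 := by rw [div_le_one (by positivity)]; linarith
      nlinarith)
    exact_mod_cast this
  have hLr : (L : ℝ) = 2 * C * x := by rw [hL, hN]; push_cast; ring
  set k : ℕ → ℂ := fun r => dirichletSum J (W * (r / M)) / J with hk
  set F : ℕ → ℂ := fun r => expSum f L (r / M) with hF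
  set G : ℕ → ℂ := fun r => expSum g L (r / M) with hG
  have hkey : ∀ r : ℕ, ‖(starRingEnd ℂ) (G r) * F r ^ 3 * (1 - k r ^ 3)‖ ≤
      3 * τ * (‖G r‖ ^ 4 + ‖F r‖ ^ 4) + 2 * (τ ^ 3 * ‖G r‖ ^ 4 +
        (if ‖F r‖ < τ ^ 2 * L then ‖F r‖ ^ 4 else 0) / τ) := by
    intro r
    have hk1 : ‖k r‖ ≤ 1 := norm_dirichletSum_div_le _ _
    rw [norm_mul, norm_mul, norm_pow, Complex.norm_conj]
    have ha := norm_nonneg (G r)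
    have hb := norm_nonneg (F r)
    split_ifs with h
    · have h1 : ‖1 - k r ^ 3‖ ≤ 2 := by
        calc ‖1 - k r ^ 3‖ ≤ ‖(1 : ℂ)‖ + ‖k r ^ 3‖ := norm_sub_le _ _
          _ ≤ 1 + 1 := by
              rw [norm_one, norm_pow]
              have := pow_le_one₀ (n := 3) (norm_nonneg (k r)) hk1
              linarith
          _ = 2 := by norm_num
      have h2 := mul_pow_three_le ‖G r‖ ‖F r‖ τ ha hb hτ0
      have h3 : 0 ≤ 3 * τ * (‖G r‖ ^ 4 + ‖F r‖ ^ 4) := by positivity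
      have h4 : ‖G r‖ * ‖F r‖ ^ 3 * ‖1 - k r ^ 3‖ ≤ ‖G r‖ * ‖F r‖ ^ 3 * 2 := by gcongr
      linarith
    · obtain ⟨q, hq1, hqQ, hq⟩ := hstruct x (by omega) L (by omega) (r / M) (by
        refine le_trans (le_of_eq ?_) (not_lt.1 h)
        rw [hLr]; ring)
      have hqW : q ∣ W := Nat.dvd_factorial hq1 (by omega)
      obtain ⟨c, hc⟩ := hqW
      have hcW : (c : ℝ) ≤ W := by
        have : c ≤ W := by rw [hc]; exact Nat.le_mul_of_pos_left _ hq1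
        exact_mod_cast this
      have hdn : dn (W * ((r : ℝ) / M)) ≤ W * dn (q * ((r : ℝ) / M)) := by
        have h1 : (W : ℝ) * (r / M) = c * (q * (r / M)) := by
          rw [hc]; push_cast; ring
        rw [h1]
        exact (dn_nat_mul_le _ _).trans (mul_le_mul_of_nonneg_right hcW (dn_nonneg _))
      have h1 : ‖1 - k r‖ ≤ τ := by
        refine (norm_one_sub_dirichletSum_div_le J hJ _).trans ?_
        refine le_of_mul_le_mul_right ?_ hxr
        calc 7 * J * dn (W * ((r : ℝ) / M)) * x ≤ 7 * J * (W * dn (q * ((r : ℝ) / M))) * x := by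
              gcongr
          _ = 7 * (W * J) * (dn (q * ((r : ℝ) / M)) * x) := by ring
          _ ≤ 7 * (τ / (7 * (Q + 2)) * x) * (Q + 2) := by
              have h2 := hq.trans (le_add_of_nonneg_right (zero_le_two (α := ℝ)))
              have h3 := mul_nonneg (dn_nonneg (q * ((r : ℝ) / M))) hxr.le
              gcongr
          _ = τ * x := by field_simp
      have h2 := norm_one_sub_pow_three_le (k r) hk1
      have h3 := mul_pow_three_le ‖G r‖ ‖F r‖ 1 ha hb one_pos
      have h4 : ‖G r‖ * ‖F r‖ ^ 3 * ‖1 - k r ^ 3‖ ≤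
          (1 ^ 3 * ‖G r‖ ^ 4 + ‖F r‖ ^ 4 / 1) * (3 * τ) := by
        gcongr
        linarith
      have h5 : 0 ≤ τ ^ 3 * ‖G r‖ ^ 4 := by positivity
      rw [zero_div]
      linarith
  have hFt : ∀ r : ℕ, expSum (shiftAvg f W J) L (r / M) = k r * F r := fun r =>
    expSum_shiftAvg f N L W J hf0 hfN (by omega) _
  have hid : (M : ℂ) * (convSum g (shiftAvg f W J) L : ℝ) =
      -∑ r ∈ Finset.range M, (starRingEnd ℂ) (G r) * F r ^ 3 * (1 - k r ^ 3) := by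
    have h1 := sum_conj_mul_expSum_pow g f L M (by omega) (fun n hn => hgN n (by omega))
    rw [← sum_conj_mul_expSum_pow g _ L M (by omega) (fun n hn => hgN n (by omega))]
    rw [hzero] at h1
    simp only [hFt]
    simp only [mul_sub, mul_one, Finset.sum_sub_distrib]
    rw [h1]
    simp only [Complex.ofReal_zero, mul_zero, zero_sub, neg_neg]
    exact Finset.sum_congr rfl fun r _ => by rw [hG]; ring
  have hbound : (M : ℝ) * convSum g (shiftAvg f W J) L ≤
      3 * τ * (C1 * L ^ 3 * M + C1 * L ^ 3 * M) + 2 * (τ ^ 3 * (C1 * L ^ 3 * M) +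
        C2 * τ ^ 2 * L ^ 3 * M / τ) := by
    have h1 : (M : ℝ) * convSum g (shiftAvg f W J) L ≤
        ‖(M : ℂ) * (convSum g (shiftAvg f W J) L : ℝ)‖ := by
      rw [← Complex.ofReal_natCast, ← Complex.ofReal_mul, Complex.norm_real]
      exact Real.le_norm_self _
    refine h1.trans ?_
    rw [hid, norm_neg]
    refine (norm_sum_le_of_le _ fun r _ => hkey r).trans ?_
    rw [Finset.sum_add_distrib, ← Finset.mul_sum, ← Finset.mul_sum, Finset.sum_add_distrib,
      Finset.sum_add_distrib, ← Finset.mul_sum, ← Finset.sum_div, ← Finset.sum_filter]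
    have hL1 : N1 ≤ L := by omega
    have hL2 : N2 ≤ L := by omega
    have hs1 := hall L hL1 M (by omega) g hg
    have hs2 := hall L hL1 M (by omega) f hfm
    have hs3 := hsm L hL2 M (by omega) f hfm
    have hτ2 : 0 ≤ 3 * τ := by positivity
    gcongr
  have hfin : 3 * τ * (C1 * L ^ 3 * M + C1 * L ^ 3 * M) + 2 * (τ ^ 3 * (C1 * L ^ 3 * M) +
        C2 * τ ^ 2 * L ^ 3 * M / τ) ≤ M * (δ * x ^ 3) := by
    have hτ3 : τ ^ 3 ≤ τ := by
      calc τ ^ 3 = τ * τ ^ 2 := by ring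
        _ ≤ τ * 1 := by gcongr; exact pow_le_one₀ hτ0.le hτ1
        _ = τ := mul_one _
    have e1 : C2 * τ ^ 2 * L ^ 3 * M / τ = C2 * τ * L ^ 3 * M := by field_simp
    have hL3 : (L : ℝ) ^ 3 = 8 * C ^ 3 * x ^ 3 := by rw [hLr]; ring
    rw [e1]
    calc 3 * τ * (C1 * L ^ 3 * M + C1 * L ^ 3 * M) + 2 * (τ ^ 3 * (C1 * L ^ 3 * M) +
          C2 * τ * L ^ 3 * M)
        ≤ 3 * τ * (C1 * L ^ 3 * M + C1 * L ^ 3 * M) + 2 * (τ * (C1 * L ^ 3 * M) +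
          C2 * τ * L ^ 3 * M) := by gcongr
      _ = (8 * C1 + 2 * C2) * (τ * L ^ 3 * M) := by ring
      _ ≤ (10 * (C1 + C2)) * (τ * L ^ 3 * M) := by
          gcongr ?_ * _
          linarith
      _ = M * ((10 * K * τ) * x ^ 3) := by rw [hL3, hK]; ring
      _ ≤ _ := by gcongr
  exact le_of_mul_le_mul_left (hbound.trans hfin) hMr

open ArithmeticFunction in
/-- The prime number theorem in arithmetic progressions, with an error uniform in `y ≤ N`. -/
lemma exists_abs_sum_residueClass_sub_le (q : ℕ) [NeZero q] (a : ZMod q) (ha : IsUnit a)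
    (γ : ℝ) (hγ : 0 < γ) : ∃ N0 : ℕ, ∀ N ≥ N0, ∀ y ≤ N,
    |∑ n ∈ Finset.Ioc 0 y, vonMangoldt.residueClass a n - y / q.totient| ≤ γ * N := by
  have h := tendsto_sum_residueClass q a ha
  rw [Metric.tendsto_atTop] at h
  obtain ⟨Y, hY⟩ := h γ hγ
  obtain ⟨N0, hN0⟩ := exists_nat_ge (6 * (Y : ℝ) / γ)
  refine ⟨N0, fun N hN y hy => ?_⟩
  have hNr : (N0 : ℝ) ≤ N := by exact_mod_cast hN
  have hyr : (y : ℝ) ≤ N := by exact_mod_cast hy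
  have hφ : (1 : ℝ) ≤ q.totient := by
    exact_mod_cast Nat.totient_pos.2 (Nat.pos_of_ne_zero (NeZero.ne q))
  rcases Nat.eq_zero_or_pos y with rfl | hy0
  · simp only [Finset.Ioc_self, Finset.sum_empty, Nat.cast_zero, zero_div, sub_zero, abs_zero]
    positivity
  have hy0' : (0 : ℝ) < y := by exact_mod_cast hy0
  rcases le_or_gt Y y with hYy | hYy
  · have h1 := (hY y hYy).le
    rw [Real.dist_eq] at h1
    have h2 : ∑ n ∈ Finset.Ioc 0 y, vonMangoldt.residueClass a n - y / q.totient =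
        ((∑ n ∈ Finset.Ioc 0 y, vonMangoldt.residueClass a n) / y - (q.totient : ℝ)⁻¹) * y := by
      field_simp
    rw [h2, abs_mul, abs_of_pos hy0']
    exact mul_le_mul h1 hyr hy0'.le hγ.le
  · have h1 : 0 ≤ ∑ n ∈ Finset.Ioc 0 y, vonMangoldt.residueClass a n :=
      Finset.sum_nonneg fun n _ => vonMangoldt.residueClass_nonneg a n
    have h2 : ∑ n ∈ Finset.Ioc 0 y, vonMangoldt.residueClass a n ≤ 6 * y :=
      (Finset.sum_le_sum fun n _ => vonMangoldt.residueClass_le a n).trans (sum_vonMangoldt_le y)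
    have h3 : 6 * (Y : ℝ) ≤ γ * N := by
      rw [div_le_iff₀ hγ] at hN0
      nlinarith
    have h4 : (y : ℝ) / q.totient ≤ y := div_le_self hy0'.le hφ
    have h5 : 0 ≤ (y : ℝ) / q.totient := by positivity
    have h6 : (y : ℝ) ≤ Y := by exact_mod_cast hYy.le
    rw [abs_le]
    constructor <;> linarith

open ArithmeticFunction in
lemma sum_residueClass_le (x N W J n : ℕ) (hW : 1 ≤ W) (hn : x + W * J ≤ n) (hnN : n ≤ N) :
    ∑ m ∈ Finset.Ioc (n - W * J) n, vonMangoldt.residueClass (n : ZMod W) m ≤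
      ∑ j ∈ Finset.range J, primeWeight x N (n - W * j) +
        ∑ m ∈ Finset.Ioc 0 N with ¬ m.Prime, vonMangoldt m := by
  classical
  set I := Finset.Ioc (n - W * J) n with hI
  have hJ : ∀ j, j ≤ J → W * j ≤ W * J := fun j hj => Nat.mul_le_mul_left _ hj
  have h0 : ∑ m ∈ I, vonMangoldt.residueClass (n : ZMod W) m =
      ∑ m ∈ I.filter (fun m : ℕ => (m : ZMod W) = n), vonMangoldt m := by
    rw [Finset.sum_filter]
    refine Finset.sum_congr rfl fun m _ => ?_
    simp only [vonMangoldt.residueClass, Set.indicator_apply, Set.mem_ofPred_eq]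
  rw [h0, ← Finset.sum_filter_add_sum_filter_not _ (fun m => m.Prime)]
  have h1 : ∑ j ∈ Finset.range J, primeWeight x N (n - W * j) =
      ∑ m ∈ (Finset.range J).image fun j => n - W * j, primeWeight x N m := by
    rw [Finset.sum_image]
    intro i hi j hj h
    rw [Finset.mem_coe, Finset.mem_range] at hi hj
    have h2 := hJ i hi.le
    have h3 := hJ j hj.le
    simp only at h
    exact Nat.eq_of_mul_eq_mul_left hW (by omega : W * i = W * j)
  gcongr ?_ + ?_
  · rw [h1]
    have hsub : (I.filter fun m : ℕ => (m : ZMod W) = n).filter (fun m => m.Prime) ⊆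
        (Finset.range J).image fun j => n - W * j := by
      intro m hm
      rw [Finset.mem_filter, Finset.mem_filter, hI, Finset.mem_Ioc] at hm
      obtain ⟨⟨⟨h2, h3⟩, h4⟩, -⟩ := hm
      rw [ZMod.natCast_eq_natCast_iff] at h4
      obtain ⟨j, hj⟩ := (Nat.modEq_iff_dvd' h3).1 h4
      rw [Finset.mem_image]
      refine ⟨j, Finset.mem_range.2 ?_, by omega⟩
      exact Nat.lt_of_mul_lt_mul_left (a := W) (by omega)
    refine le_trans (Finset.sum_le_sum fun m hm => ?_)
      (Finset.sum_le_sum_of_subset_of_nonneg hsub fun m _ _ => (primeWeight_mem x N m).1)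
    rw [Finset.mem_filter, Finset.mem_filter, hI, Finset.mem_Ioc] at hm
    rw [vonMangoldt_apply_prime hm.2, primeWeight, if_pos ⟨hm.2, by omega, by omega⟩]
  · refine Finset.sum_le_sum_of_subset_of_nonneg (fun m hm => ?_) fun m _ _ => vonMangoldt_nonneg
    rw [Finset.mem_filter, Finset.mem_filter, hI, Finset.mem_Ioc] at hm
    rw [Finset.mem_filter, Finset.mem_Ioc]
    exact ⟨⟨by omega, by omega⟩, hm.2⟩

/-- The averaged weight of the primes is bounded below on the residues coprime to `W`. -/
theorem exists_le_shiftAvg (C W : ℕ) (hC : 1 ≤ C) (hW : 1 ≤ W) (κ : ℝ) (hκ : 0 < κ) :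
    ∃ X0 : ℕ, ∀ x ≥ X0, ∀ J : ℕ, 1 ≤ J → κ * x ≤ W * J → ∀ n, x + W * J ≤ n → n ≤ C * x →
      n.Coprime W → (W : ℝ) / (2 * W.totient) ≤ shiftAvg (primeWeight x (C * x)) W J n := by
  have : NeZero W := ⟨by omega⟩
  have hC0 : (0 : ℝ) < C := by exact_mod_cast hC
  have hφ : (0 : ℝ) < W.totient := by exact_mod_cast Nat.totient_pos.2 hW
  set γ := κ / (6 * C * W.totient) with hγ
  have hγ0 : 0 < γ := by positivity
  choose N1 hN1 using fun u : (ZMod W)ˣ =>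
    exists_abs_sum_residueClass_sub_le W (u : ZMod W) u.isUnit γ hγ0
  obtain ⟨N2, hN2⟩ := exists_sum_vonMangoldt_not_prime_le γ hγ0
  refine ⟨N2 + ∑ u, N1 u, fun x hx J hJ hκJ n hn hnN hcop => ?_⟩
  set u := ZMod.unitOfCoprime n hcop with hu
  have hun : (u : ZMod W) = (n : ZMod W) := ZMod.coe_unitOfCoprime n hcop
  have hxC : x ≤ C * x := Nat.le_mul_of_pos_left _ hC
  have hle : N1 u ≤ ∑ u, N1 u := Finset.single_le_sum (fun _ _ => Nat.zero_le _) (Finset.mem_univ u)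
  have e1 := hN1 u (C * x) (by omega) n hnN
  have e2 := hN1 u (C * x) (by omega) (n - W * J) (by omega)
  have e3 := hN2 (C * x) (by omega)
  have e4 := sum_residueClass_le x (C * x) W J n hW hn hnN
  rw [hun] at e1 e2
  rw [← Finset.Ioc_union_Ioc_eq_Ioc (Nat.zero_le (n - W * J)) (Nat.sub_le n (W * J)),
    Finset.sum_union (Finset.Ioc_disjoint_Ioc_of_le le_rfl)] at e1
  rw [Nat.cast_sub (by omega), sub_div] at e2
  rw [abs_le] at e1 e2
  have hJ0 : (0 : ℝ) < J := by exact_mod_cast hJ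
  rw [shiftAvg, le_div_iff₀ hJ0]
  have h6 : γ * ((C * x : ℕ) : ℝ) * 3 ≤ W * J / (2 * W.totient) := by
    rw [le_div_iff₀ (by positivity), hγ]
    push_cast
    calc κ / (6 * C * W.totient) * (C * x) * 3 * (2 * W.totient) = κ * x := by
          field_simp
          ring
      _ ≤ _ := hκJ
  have h7 : (W : ℝ) / (2 * W.totient) * J = W * J / (2 * W.totient) := by ring
  have h8 : ((W * J : ℕ) : ℝ) / W.totient = 2 * (W * J / (2 * W.totient)) := by
    push_cast
    field_simp
  rw [h7]
  linarith [e1.1, e2.2]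

lemma prime_dvd_primorial_of_dvd_factorial {Q p : ℕ} (hp : p.Prime) (h : p ∣ Q.factorial) :
    p ∣ primorial Q := hp.dvd_primorial_iff.2 (hp.dvd_factorial.1 h)

lemma coprime_factorial_of_coprime_primorial {Q n : ℕ} (h : n.Coprime (primorial Q)) :
    n.Coprime Q.factorial :=
  Nat.coprime_of_dvd fun _ hp h1 h2 =>
    (Nat.Prime.one_lt hp).ne' (Nat.dvd_one.1 (h ▸ Nat.dvd_gcd h1
      (prime_dvd_primorial_of_dvd_factorial hp h2)))

lemma factorial_mul_totient_primorial (Q : ℕ) :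
    Q.factorial * (primorial Q).totient = primorial Q * Q.factorial.totient := by
  have hpf : Q.factorial.primeFactors = (primorial Q).primeFactors := by
    ext p
    simp only [Nat.mem_primeFactors]
    refine ⟨fun h => ⟨h.1, prime_dvd_primorial_of_dvd_factorial h.1 h.2.1, (primorial_pos Q).ne'⟩,
      fun h => ⟨h.1, h.1.dvd_factorial.2 (h.1.dvd_primorial_iff.1 h.2.1), Nat.factorial_ne_zero Q⟩⟩
  have h1 := Nat.totient_mul_prod_primeFactors Q.factorial
  have h2 := Nat.totient_mul_prod_primeFactors (primorial Q)
  rw [hpf] at h1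
  have h3 : 0 < ∏ p ∈ (primorial Q).primeFactors, p :=
    Finset.prod_pos fun p hp => (Nat.prime_of_mem_primeFactors hp).pos
  refine Nat.eq_of_mul_eq_mul_right h3 ?_
  rw [mul_assoc, h2, mul_assoc, h1]
  ring

lemma sum_mul_card_le_convSum (B : Finset ℕ) (g h : ℕ → ℝ) (L : ℕ) (hg : ∀ n, 0 ≤ g n)
    (hh : ∀ n, 0 ≤ h n) (hB : ∀ b ∈ B, b ≤ L) (T : ℕ → Finset (ℕ × ℕ)) (c : ℝ) (hc : 0 ≤ c)
    (hT : ∀ b ∈ B, ∀ w ∈ T b, 1 ≤ w.1 ∧ 1 ≤ w.2 ∧ w.1 + w.2 < b ∧ c ≤ h w.1 ∧ c ≤ h w.2 ∧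
      c ≤ h (b - w.1 - w.2)) :
    ∑ b ∈ B, g b * ((T b).card * c ^ 3) ≤ convSum g h L := by
  classical
  set I := Finset.Ioc 0 L with hI
  have h1 : convSum g h L = ∑ w ∈ (I ×ˢ I) ×ˢ I,
      h w.1.1 * h w.1.2 * h w.2 * g (w.1.1 + w.1.2 + w.2) := by
    rw [Finset.sum_product, Finset.sum_product, convSum]
  have h2 : ∑ b ∈ B, g b * ((T b).card * c ^ 3) = ∑ v ∈ B.sigma T, g v.1 * c ^ 3 := by
    rw [Finset.sum_sigma]
    refine Finset.sum_congr rfl fun b _ => ?_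
    simp only [Finset.sum_const, nsmul_eq_mul]
    ring
  set φ : (Σ _ : ℕ, ℕ × ℕ) → (ℕ × ℕ) × ℕ := fun v => (v.2, v.1 - v.2.1 - v.2.2) with hφ
  have hinj : Set.InjOn φ (B.sigma T) := by
    rintro ⟨b, w⟩ hb ⟨b', w'⟩ hb' heq
    rw [Finset.mem_coe, Finset.mem_sigma] at hb hb'
    obtain ⟨h3, h4⟩ := Prod.mk.inj heq
    simp only at h3 h4 hb hb'
    subst h3
    have h5 := hT b hb.1 w hb.2
    have h6 := hT b' hb'.1 w hb'.2
    have : b = b' := by omega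
    rw [this]
  rw [h1, h2]
  calc ∑ v ∈ B.sigma T, g v.1 * c ^ 3
      ≤ ∑ v ∈ B.sigma T, h (φ v).1.1 * h (φ v).1.2 * h (φ v).2 *
          g ((φ v).1.1 + (φ v).1.2 + (φ v).2) := by
        refine Finset.sum_le_sum fun v hv => ?_
        rw [Finset.mem_sigma] at hv
        obtain ⟨-, -, h5, h6, h7, h8⟩ := hT v.1 hv.1 v.2 hv.2
        have h9 : (φ v).1.1 + (φ v).1.2 + (φ v).2 = v.1 := by simp only [hφ]; omega
        rw [h9, mul_comm]
        refine mul_le_mul_of_nonneg_right ?_ (hg _)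
        rw [pow_succ, sq]
        have := hh v.2.1
        have := hh v.2.2
        simp only [hφ]
        gcongr
    _ = ∑ w ∈ (B.sigma T).image φ, h w.1.1 * h w.1.2 * h w.2 * g (w.1.1 + w.1.2 + w.2) := by
        rw [Finset.sum_image hinj]
    _ ≤ _ := by
        refine Finset.sum_le_sum_of_subset_of_nonneg (fun w hw => ?_) fun w _ _ =>
          mul_nonneg (mul_nonneg (mul_nonneg (hh _) (hh _)) (hh _)) (hg _)
        obtain ⟨v, hv, rfl⟩ := Finset.mem_image.1 hw
        rw [Finset.mem_sigma] at hv
        obtain ⟨h3, h4, h5, -⟩ := hT v.1 hv.1 v.2 hv.2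
        have := hB v.1 hv.1
        simp only [Finset.mem_product, hφ, hI, Finset.mem_Ioc]
        omega

lemma convSum_eq_zero (B : Finset ℕ) (x N L : ℕ) (g : ℕ → ℝ) (hg : ∀ n, n ∉ B → g n = 0)
    (hB : ∀ b ∈ B, ∀ p q r : ℕ, p.Prime → q.Prime → r.Prime → x ≤ p → x ≤ q → x ≤ r →
      p + q + r ≠ b) : convSum g (primeWeight x N) L = 0 := by
  refine Finset.sum_eq_zero fun i _ => Finset.sum_eq_zero fun j _ => Finset.sum_eq_zero fun k _ => ?_
  by_contra hne
  simp only [mul_eq_zero, not_or] at hne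
  have h1 : ∀ n, primeWeight x N n ≠ 0 → n.Prime ∧ x ≤ n := fun n hn => by
    rw [primeWeight] at hn
    split_ifs at hn with h
    · exact ⟨h.1, h.2.1⟩
    · exact absurd rfl hn
  obtain ⟨⟨⟨hi, hj⟩, hk⟩, hb⟩ := hne
  by_cases hmem : i + j + k ∈ B
  · exact hB _ hmem i j k (h1 i hi).1 (h1 j hj).1 (h1 k hk).1 (h1 i hi).2 (h1 j hj).2 (h1 k hk).2 rfl
  · exact hb (hg _ hmem)

lemma exists_floor_mul_mem (W : ℕ) (hW : 1 ≤ W) (κ : ℝ) (hκ : 0 < κ) : ∃ X0 : ℕ, ∀ x ≥ X0,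
    ∃ J : ℕ, 1 ≤ J ∧ κ / 2 * x ≤ W * J ∧ (W * J : ℝ) ≤ κ * x := by
  have hW0 : (0 : ℝ) < W := by exact_mod_cast hW
  obtain ⟨X0, hX0⟩ := exists_nat_ge (2 * W / κ)
  refine ⟨X0, fun x hx => ⟨⌊κ * x / W⌋₊, ?_⟩⟩
  have hx' : (X0 : ℝ) ≤ x := by exact_mod_cast hx
  have h1 : 2 * W ≤ κ * x := by
    rw [div_le_iff₀ hκ] at hX0
    nlinarith
  have h2 := Nat.floor_le (a := κ * x / W) (by positivity)
  have h3 := Nat.lt_floor_add_one (κ * x / W)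
  rw [le_div_iff₀ hW0] at h2
  rw [div_lt_iff₀ hW0] at h3
  refine ⟨Nat.le_floor ?_, by nlinarith, by linarith⟩
  rw [le_div_iff₀ hW0]
  push_cast
  linarith

open ArithmeticFunction in
/-- Almost all primes in `[(3 + ε) x, C x]` are sums of three primes that are at least `x`. -/
theorem exists_sum_log_exceptional_le (C : ℕ) (hC : 1 ≤ C) (ε δ : ℝ) (hε : 0 < ε) (hδ : 0 < δ) :
    ∃ X0 : ℕ, ∀ x ≥ X0, ∀ B : Finset ℕ, (∀ b ∈ B, b.Prime ∧ (3 + ε) * x ≤ b ∧ b ≤ C * x ∧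
      ∀ p q r : ℕ, p.Prime → q.Prime → r.Prime → x ≤ p → x ≤ q → x ≤ r → p + q + r ≠ b) →
    ∑ b ∈ B, Real.log b ≤ δ * x := by
  classical
  obtain ⟨Q, hQ, κ, hκ, hκ1, X1, hmain⟩ :=
    exists_convSum_shiftAvg_le C hC (δ * (ε ^ 2 / 512)) (by positivity)
  set W := Q.factorial with hW
  set P := primorial Q with hP
  have hW1 : 1 ≤ W := Nat.factorial_pos Q
  have hP1 : 1 ≤ P := primorial_pos Q
  set κ' := min κ (ε / 6) with hκ'
  have hκ'0 : 0 < κ' := by positivity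
  obtain ⟨X2, hJ⟩ := exists_floor_mul_mem W hW1 κ' hκ'0
  obtain ⟨X3, ht⟩ := exists_floor_mul_mem P hP1 (ε / 4) (by positivity)
  obtain ⟨X4, hlow⟩ := exists_le_shiftAvg C W hC hW1 (κ' / 2) (by positivity)
  refine ⟨X1 + X2 + X3 + X4 + 1, fun x hx B hB => ?_⟩
  obtain ⟨J, hJ1, hJlow, hJup⟩ := hJ x (by omega)
  obtain ⟨t, ht1, htlow, htup⟩ := ht x (by omega)
  have hx1 : (1 : ℝ) ≤ x := by exact_mod_cast (by omega : 1 ≤ x)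
  set g : ℕ → ℝ := fun n => if n ∈ B then Real.log n else 0 with hgdef
  have hg : ∀ n, 0 ≤ g n ∧ g n ≤ vonMangoldt n := fun n => by
    simp only [hgdef]
    split_ifs with h
    · exact ⟨Real.log_natCast_nonneg n, (vonMangoldt_apply_prime (hB n h).1).ge⟩
    · exact ⟨le_rfl, vonMangoldt_nonneg⟩
  have hgB : ∀ n, n ∉ B → g n = 0 := fun n hn => if_neg hn
  have hup := hmain x (by omega) J hJ1
    (hJup.trans (mul_le_mul_of_nonneg_right (min_le_left _ _) (by positivity))) g hg
    (fun n hn => hgB n fun h => absurd (hB n h).2.2.1 (by omega))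
    (convSum_eq_zero B x _ _ g hgB fun b hb => (hB b hb).2.2.2)
  set h := shiftAvg (primeWeight x (C * x)) W J with hh
  have hh0 : ∀ n, 0 ≤ h n := fun n =>
    div_nonneg (Finset.sum_nonneg fun j _ => (primeWeight_mem x (C * x) _).1) (Nat.cast_nonneg _)
  set A := x + W * J with hA
  set T : ℕ → Finset (ℕ × ℕ) := fun b => ((Finset.Ico A (A + P * t)) ×ˢ
    (Finset.Ico A (A + P * t))).filter fun w : ℕ × ℕ => w.1.Coprime P ∧ w.2.Coprime P ∧
      (w.1 + w.2 ≤ b → (b - w.1 - w.2).Coprime P) with hT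
  have hφ : (0 : ℝ) < W.totient := by exact_mod_cast Nat.totient_pos.2 hW1
  have hφP : (0 : ℝ) < P.totient := by exact_mod_cast Nat.totient_pos.2 hP1
  set c : ℝ := W / (2 * W.totient) with hc
  have hcP : c = P / (2 * P.totient) := by
    rw [hc, div_eq_div_iff (by positivity) (by positivity)]
    have : (W * P.totient : ℝ) = P * W.totient := by
      exact_mod_cast factorial_mul_totient_primorial Q
    linarith
  have hc0 : 0 ≤ c := by positivity
  have hbox : 3 * (W * J : ℝ) + 2 * (P * t) ≤ ε * x := by
    have : (W * J : ℝ) ≤ ε / 6 * x :=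
      hJup.trans (mul_le_mul_of_nonneg_right (min_le_right _ _) (by positivity))
    linarith
  have hbig : ∀ b ∈ B, 2 * (A + P * t) + A ≤ b := fun b hb => by
    have h1 := (hB b hb).2.1
    have : ((2 * (A + P * t) + A : ℕ) : ℝ) ≤ b := by
      rw [hA]
      push_cast
      linarith
    exact_mod_cast this
  have hlowc : ∀ n, A ≤ n → n ≤ C * x → n.Coprime P → c ≤ h n := fun n h1 h2 h3 =>
    hlow x (by omega) J hJ1 hJlow n h1 h2 (coprime_factorial_of_coprime_primorial h3)
  have hlower := sum_mul_card_le_convSum B g h (2 * (C * x)) (fun n => (hg n).1) hh0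
    (fun b hb => by have := (hB b hb).2.2.1; omega) T c hc0 (fun b hb w hw => by
      rw [hT, Finset.mem_filter, Finset.mem_product, Finset.mem_Ico, Finset.mem_Ico] at hw
      obtain ⟨⟨⟨h1, h2⟩, h3, h4⟩, h5, h6, h7⟩ := hw
      have h8 := hbig b hb
      have h9 := (hB b hb).2.2.1
      exact ⟨by omega, by omega, by omega, hlowc _ h1 (by omega) h5, hlowc _ h3 (by omega) h6,
        hlowc _ (by omega) (by omega) (h7 (by omega))⟩)
  have hcard : ∀ b ∈ B, ε ^ 2 / 512 * (x : ℝ) ^ 2 ≤ (T b).card * c ^ 3 := fun b hb => by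
    have hodd : Odd b := (hB b hb).1.odd_of_ne_two (by
      have := hbig b hb
      have : 1 ≤ P * t := Nat.mul_pos hP1 ht1
      omega)
    have h1 := totient_pow_le_unitSums' b hodd Q hQ
    have h2 := unitSums_mul_sq_le_card P t A b hP1
    set U := unitSums (ZMod P) b with hU
    have h1' : (P.totient : ℝ) ^ 3 ≤ U * P := by exact_mod_cast h1
    have h2' : (U : ℝ) * t ^ 2 ≤ (T b).card := by exact_mod_cast h2
    have hP0 : (0 : ℝ) < P := by exact_mod_cast hP1
    calc ε ^ 2 / 512 * (x : ℝ) ^ 2 = (ε / 4 / 2 * x) ^ 2 / 8 := by ring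
      _ ≤ ((P : ℝ) * t) ^ 2 / 8 := by gcongr
      _ = (P.totient : ℝ) ^ 3 * (P ^ 2 * t ^ 2 / (8 * P.totient ^ 3)) := by field_simp
      _ ≤ U * P * (P ^ 2 * t ^ 2 / (8 * P.totient ^ 3)) := by gcongr
      _ = U * t ^ 2 * c ^ 3 := by
          rw [hcP]
          field_simp
          ring
      _ ≤ _ := by gcongr
  have hsum : (∑ b ∈ B, Real.log b) * (ε ^ 2 / 512 * (x : ℝ) ^ 2) ≤
      ∑ b ∈ B, g b * ((T b).card * c ^ 3) := by
    rw [Finset.sum_mul]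
    refine Finset.sum_le_sum fun b hb => ?_
    have : g b = Real.log b := if_pos hb
    rw [this]
    exact mul_le_mul_of_nonneg_left (hcard b hb) (Real.log_natCast_nonneg b)
  have hpos : 0 < ε ^ 2 / 512 * (x : ℝ) ^ 2 := by positivity
  refine le_of_mul_le_mul_right ?_ hpos
  calc _ ≤ δ * (ε ^ 2 / 512) * x ^ 3 := hsum.trans (hlower.trans hup)
    _ = _ := by ring

/-- The additive energy of a weight is controlled by the fourth moment of its exponential sum. -/
lemma sum_pow_four_le_card_mul (f : ℕ → ℝ) (N M : ℕ) (T : Finset ℕ)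
    (hT : T ⊆ Finset.range M)
    (hfT : ∀ i ∈ Finset.Ioc 0 N, ∀ j ∈ Finset.Ioc 0 N, f i * f j ≠ 0 → i + j ∈ T) :
    M * (∑ n ∈ Finset.Ioc 0 N, f n) ^ 4 ≤
      T.card * ∑ r ∈ Finset.range M, ‖expSum f N (r / M)‖ ^ 4 := by
  set I := Finset.Ioc 0 N with hI
  set a : ℕ → ℝ := fun n => ∑ w ∈ I ×ˢ I, if w.1 + w.2 = n then f w.1 * f w.2 else 0 with ha
  have hsum : ∀ c : ℕ → ℂ, ∑ n ∈ T, (a n : ℂ) * c n =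
      ∑ i ∈ I, ∑ j ∈ I, (f i * f j : ℂ) * c (i + j) := fun c => by
    have h1 : ∀ n ∈ T, (a n : ℂ) * c n = ∑ w ∈ I ×ˢ I,
        if w.1 + w.2 = n then (f w.1 * f w.2 : ℂ) * c n else 0 := fun n _ => by
      rw [ha]
      push_cast
      rw [Finset.sum_mul]
      refine Finset.sum_congr rfl fun w _ => ?_
      split_ifs
      · rw [Complex.ofReal_mul]
      · simp
    rw [Finset.sum_congr rfl h1, Finset.sum_comm]
    refine Eq.trans ?_ (Finset.sum_product' I I fun i j => (f i * f j : ℂ) * c (i + j))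
    refine Finset.sum_congr rfl fun w hw => ?_
    rw [Finset.mem_product] at hw
    rw [Finset.sum_ite_eq]
    split_ifs with h
    · rfl
    · have h2 : f w.1 * f w.2 = 0 := by
        by_contra h3
        exact h (hfT _ hw.1 _ hw.2 h3)
      rw [← Complex.ofReal_mul, h2]
      simp
  have h1 : ∀ r : ℕ, ∑ n ∈ T, (a n : ℂ) * ex (n * (r / M - 0)) = expSum f N (r / M) ^ 2 := fun r => by
    rw [hsum, sq, expSum, Finset.sum_mul_sum]
    refine Finset.sum_congr rfl fun i _ => Finset.sum_congr rfl fun j _ => ?_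
    have : ((i + j : ℕ) : ℝ) * (r / M - 0) = i * (r / M) + j * (r / M) := by push_cast; ring
    rw [this, ex_add]
    ring
  have h2 := plancherel M T hT (fun n => (a n : ℂ)) 0
  simp only [h1, norm_pow, Complex.norm_real, Real.norm_eq_abs, sq_abs] at h2
  have h3 : ∑ n ∈ T, a n = (∑ n ∈ I, f n) ^ 2 := by
    have := hsum fun _ => 1
    simp only [mul_one] at this
    rw [sq, Finset.sum_mul_sum]
    exact_mod_cast this
  have h4 : (∑ n ∈ T, a n) ^ 2 ≤ T.card * ∑ n ∈ T, a n ^ 2 := sq_sum_le_card_mul_sum_sq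
  have h5 : ∀ r : ℕ, ‖expSum f N (r / M)‖ ^ 4 = (‖expSum f N (r / M)‖ ^ 2) ^ 2 := fun r => by ring
  simp only [h5]
  rw [h2]
  calc M * (∑ n ∈ I, f n) ^ 4 = M * (∑ n ∈ T, a n) ^ 2 := by rw [h3]; ring
    _ ≤ M * (T.card * ∑ n ∈ T, a n ^ 2) := mul_le_mul_of_nonneg_left h4 (Nat.cast_nonneg _)
    _ = _ := by ring

lemma exists_le_sum_primeWeight : ∃ X0 : ℕ, ∀ x ≥ X0,
    (x : ℝ) / 2 ≤ ∑ n ∈ Finset.Ioc 0 (2 * x), primeWeight x (2 * x) n := by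
  have h := tendsto_theta_div
  rw [Metric.tendsto_atTop] at h
  obtain ⟨X0, hX0⟩ := h (1 / 6) (by norm_num)
  refine ⟨X0 + 1, fun x hx => ?_⟩
  have hx0 : (0 : ℝ) < x := by exact_mod_cast (by omega : 0 < x)
  have h1 := hX0 x (by omega)
  have h2 := hX0 (2 * x) (by omega)
  rw [Real.dist_eq, abs_lt] at h1 h2
  have h3 : Chebyshev.theta x ≤ (7 / 6) * x := by
    rw [← div_le_iff₀ hx0]; linarith [h1.2]
  have h4 : (5 / 6) * ((2 * x : ℕ) : ℝ) ≤ Chebyshev.theta (2 * x : ℕ) := by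
    rw [← le_div_iff₀ (by push_cast; positivity)]; linarith [h2.1]
  have h5 : Chebyshev.theta (2 * x : ℕ) - Chebyshev.theta x ≤
      ∑ n ∈ Finset.Ioc 0 (2 * x), primeWeight x (2 * x) n := by
    rw [Chebyshev.theta, Chebyshev.theta, Nat.floor_natCast, Nat.floor_natCast,
      Finset.sum_filter, Finset.sum_filter,
      ← Finset.Ioc_union_Ioc_eq_Ioc (Nat.zero_le x) (by omega : x ≤ 2 * x),
      Finset.sum_union (Finset.Ioc_disjoint_Ioc_of_le le_rfl),
      Finset.sum_union (Finset.Ioc_disjoint_Ioc_of_le le_rfl), add_sub_cancel_left]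
    refine le_add_of_nonneg_of_le (Finset.sum_nonneg fun n _ => (primeWeight_mem x _ n).1)
      (Finset.sum_le_sum fun n hn => ?_)
    rw [Finset.mem_Ioc] at hn
    rw [primeWeight]
    split_ifs with h6 h7 h7
    · exact le_rfl
    · exact absurd ⟨h6, hn.1.le, hn.2⟩ h7
    · exact Real.log_natCast_nonneg n
    · exact le_rfl
  push_cast at h4 h5
  linarith

open Classical in
/-- The sumset of the primes in `[x, 2x]` has positive density. -/
lemma exists_le_card_sumset : ∃ c : ℝ, 0 < c ∧ ∃ X0 : ℕ, ∀ x ≥ X0,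
    c * x ≤ ((Finset.Icc (2 * x) (4 * x)).filter fun n =>
      ∃ p q : ℕ, p.Prime ∧ q.Prime ∧ x ≤ p ∧ x ≤ q ∧ p + q = n).card := by
  classical
  obtain ⟨C, hC, N0, hN0, hmom⟩ := sum_pow_four_le
  obtain ⟨X1, hX1⟩ := exists_le_sum_primeWeight
  refine ⟨1 / (128 * C), by positivity, X1 + N0, fun x hx => ?_⟩
  set T := (Finset.Icc (2 * x) (4 * x)).filter fun n =>
      ∃ p q : ℕ, p.Prime ∧ q.Prime ∧ x ≤ p ∧ x ≤ q ∧ p + q = n with hT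
  have hx0 : (0 : ℝ) < x := by exact_mod_cast (by omega : 0 < x)
  have h1 := hmom (2 * x) (by omega) (4 * x + 1) (by omega) _ (primeWeight_mem x (2 * x))
  have h2 := sum_pow_four_le_card_mul (primeWeight x (2 * x)) (2 * x) (4 * x + 1) T
    (fun n hn => by
      rw [hT, Finset.mem_filter, Finset.mem_Icc] at hn
      rw [Finset.mem_range]
      omega)
    (fun i _ j _ hij => by
      have h3 : ∀ n, primeWeight x (2 * x) n ≠ 0 → n.Prime ∧ x ≤ n ∧ n ≤ 2 * x := fun n hn => by
        rw [primeWeight] at hn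
        split_ifs at hn with h
        · exact h
        · exact absurd rfl hn
      obtain ⟨h4, h5, h6⟩ := h3 i (left_ne_zero_of_mul hij)
      obtain ⟨h7, h8, h9⟩ := h3 j (right_ne_zero_of_mul hij)
      rw [hT, Finset.mem_filter, Finset.mem_Icc]
      exact ⟨⟨by omega, by omega⟩, i, j, h4, h7, h5, h8, rfl⟩)
  have h3 := hX1 x (by omega)
  have hM : (0 : ℝ) < ((4 * x + 1 : ℕ) : ℝ) := by positivity
  have h4 : ((4 * x + 1 : ℕ) : ℝ) * ((x : ℝ) / 2) ^ 4 ≤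
      ((4 * x + 1 : ℕ) : ℝ) * (T.card * (C * (2 * x) ^ 3)) := by
    calc _ ≤ ((4 * x + 1 : ℕ) : ℝ) * (∑ n ∈ Finset.Ioc 0 (2 * x), primeWeight x (2 * x) n) ^ 4 := by
          gcongr
      _ ≤ _ := h2
      _ ≤ T.card * (C * ((2 * x : ℕ) : ℝ) ^ 3 * ((4 * x + 1 : ℕ) : ℝ)) := by gcongr
      _ = _ := by push_cast; ring
  have h5 := le_of_mul_le_mul_left h4 hM
  rw [div_mul_eq_mul_div, one_mul, div_le_iff₀ (by positivity)]
  have h6 : (x : ℝ) * (x ^ 3 / 16) ≤ (T.card * (128 * C)) * (x ^ 3 / 16) := by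
    calc _ = ((x : ℝ) / 2) ^ 4 := by ring
      _ ≤ _ := h5
      _ = _ := by ring
  exact le_of_mul_le_mul_right h6 (by positivity)

lemma min_le_card_nsmul {p : ℕ} (hp : p.Prime) (T : Finset (ZMod p)) (hT : T.Nonempty) (k : ℕ) :
    min p (k * (T.card - 1) + 1) ≤ (k • T).card := by
  induction k with
  | zero => simp
  | succ k ih =>
    rw [succ_nsmul]
    have h1 := ZMod.cauchy_davenport hp (hT.nsmul (n := k)) hT
    have h2 := hT.card_pos
    have h3 : (k + 1) * (T.card - 1) = k * (T.card - 1) + (T.card - 1) := by ring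
    rw [h3]
    omega

/-- Every integer beyond a constant multiple of `p` is a sum of at least two primes
that are at least `p`. -/
theorem exists_add_of_lt : ∃ K X0 : ℕ, ∀ p ≥ X0, p.Prime → ∀ S : AddSubmonoid ℕ,
    (∀ q : ℕ, q.Prime → p ≤ q → q ∈ S) → ∀ m, K * p < m →
    ∃ s ∈ S, ∃ t ∈ S, s ≠ 0 ∧ t ≠ 0 ∧ s + t = m := by
  classical
  obtain ⟨c, hc, X1, hX1⟩ := exists_le_card_sumset
  obtain ⟨X2, hX2⟩ := exists_nat_ge (6 / c)
  obtain ⟨k, hk⟩ := exists_nat_ge (6 / c)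
  refine ⟨4 * (k + 1), X1 + X2, fun p hp hprime S hS m hm => ?_⟩
  set T := (Finset.Icc (2 * p) (4 * p)).filter fun n =>
      ∃ a b : ℕ, a.Prime ∧ b.Prime ∧ p ≤ a ∧ p ≤ b ∧ a + b = n with hT
  have hTc : c * p ≤ T.card := hX1 p (by omega)
  have hp0 : 0 < p := hprime.pos
  set T' := T.image (fun n : ℕ => (n : ZMod p)) with hT'
  have hfib : T.card ≤ 3 * T'.card := by
    refine Finset.card_le_mul_card_image T 3 fun z hz => ?_
    obtain ⟨n0, hn0, rfl⟩ := Finset.mem_image.1 hz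
    have hsub : (T.filter fun n : ℕ => (n : ZMod p) = n0).card ≤ (Finset.Icc 2 4).card := by
      refine Finset.card_le_card_of_injOn (fun n => n / p) (fun n hn => ?_) fun n hn n' hn' h => ?_
      · rw [Finset.mem_coe, Finset.mem_filter, hT, Finset.mem_filter, Finset.mem_Icc] at hn
        rw [Finset.mem_coe, Finset.mem_Icc, Nat.le_div_iff_mul_le hp0]
        exact ⟨hn.1.1.1, Nat.div_le_of_le_mul (by linarith [hn.1.1.2])⟩
      · rw [Finset.mem_coe, Finset.mem_filter] at hn hn'
        have h1 : n % p = n' % p := (ZMod.natCast_eq_natCast_iff' n n' p).1 (hn.2.trans hn'.2.symm)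
        simp only at h
        rw [← Nat.div_add_mod n p, ← Nat.div_add_mod n' p, h, h1]
    simpa using hsub
  have hpX : 6 / c ≤ p := hX2.trans (by exact_mod_cast (by omega : X2 ≤ p))
  have hfibr : (T.card : ℝ) ≤ 3 * T'.card := by exact_mod_cast hfib
  rw [div_le_iff₀ hc] at hpX hk
  have hT2 : 2 ≤ T'.card := by
    have : (2 : ℝ) ≤ T'.card := by linarith
    exact_mod_cast this
  have hne : T'.Nonempty := Finset.card_pos.1 (by omega)
  have hcover : p ≤ (k + 1) * (T'.card - 1) + 1 := by
    have h1 : (p : ℝ) * (c * 6) ≤ k * (T'.card - 1 : ℝ) * (c * 6) := by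
      have h2 : (c * p : ℝ) ≤ 6 * (T'.card - 1) := by
        have : (2 : ℝ) ≤ T'.card := by exact_mod_cast hT2
        linarith
      have h3 : (0 : ℝ) ≤ T'.card - 1 := by
        have : (2 : ℝ) ≤ T'.card := by exact_mod_cast hT2
        linarith
      nlinarith
    have h2 := le_of_mul_le_mul_right h1 (by positivity)
    have h3 : p ≤ k * (T'.card - 1) := by
      have : ((k * (T'.card - 1) : ℕ) : ℝ) = k * (T'.card - 1 : ℝ) := by
        rw [Nat.cast_mul, Nat.cast_sub (by omega)]
        simp
      rw [← this] at h2
      exact_mod_cast h2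
    have h4 : k * (T'.card - 1) ≤ (k + 1) * (T'.card - 1) := Nat.mul_le_mul_right _ (by omega)
    omega
  have hlift : ∀ j : ℕ, ∀ z ∈ j • T', ∃ s ∈ S, (s : ZMod p) = z ∧ j ≤ s ∧ s ≤ 4 * j * p := by
    intro j
    induction j with
    | zero =>
      intro z hz
      rw [zero_nsmul, Finset.mem_zero] at hz
      exact ⟨0, S.zero_mem, by simp [hz], le_rfl, Nat.zero_le _⟩
    | succ j ih =>
      intro z hz
      rw [succ_nsmul] at hz
      obtain ⟨y, hy, w, hw, rfl⟩ := Finset.mem_add.1 hz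
      obtain ⟨s, hs, rfl, hs1, hs2⟩ := ih y hy
      obtain ⟨n, hn, rfl⟩ := Finset.mem_image.1 hw
      rw [hT, Finset.mem_filter, Finset.mem_Icc] at hn
      obtain ⟨⟨hn1, hn2⟩, a, b, ha, hb, hpa, hpb, rfl⟩ := hn
      refine ⟨s + (a + b), S.add_mem hs (S.add_mem (hS a ha hpa) (hS b hb hpb)), by push_cast; rfl,
        by omega, ?_⟩
      have : 4 * (j + 1) * p = 4 * j * p + 4 * p := by ring
      omega
  have : NeZero p := ⟨hp0.ne'⟩
  have huniv : (k + 1) • T' = Finset.univ := by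
    rw [← Finset.card_eq_iff_eq_univ, ZMod.card]
    have h1 := min_le_card_nsmul hprime T' hne (k + 1)
    rw [min_eq_left hcover] at h1
    refine le_antisymm ?_ h1
    have h2 := Finset.card_le_univ ((k + 1) • T')
    rwa [ZMod.card] at h2
  obtain ⟨s, hs, hsm, hs1, hs2⟩ := hlift (k + 1) (m : ZMod p) (huniv ▸ Finset.mem_univ _)
  refine ⟨s, hs, m - s, ?_, by omega, by omega, by omega⟩
  rw [ZMod.natCast_eq_natCast_iff] at hsm
  obtain ⟨j, hj⟩ := (Nat.modEq_iff_dvd' (by omega : s ≤ m)).1 hsm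
  rw [hj, mul_comm, ← smul_eq_mul]
  exact S.nsmul_mem (hS p hprime le_rfl) j

lemma primeCounting_eq_card (N : ℕ) :
    Nat.primeCounting N = ((Finset.Ioc 0 N).filter Nat.Prime).card := by
  rw [Nat.primeCounting, Nat.primeCounting', Nat.count_eq_card_filter_range]
  congr 1
  ext q
  simp only [Finset.mem_filter, Finset.mem_range, Finset.mem_Ioc]
  refine ⟨fun h => ⟨⟨h.2.pos, by omega⟩, h.2⟩, fun h => ⟨by omega, h.2⟩⟩

lemma primeCounting_add_card (a b : ℕ) (h : a ≤ b) :
    Nat.primeCounting a + ((Finset.Ioc a b).filter Nat.Prime).card = Nat.primeCounting b := by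
  rw [primeCounting_eq_card, primeCounting_eq_card, ← Finset.Ioc_union_Ioc_eq_Ioc (Nat.zero_le a) h,
    Finset.filter_union, Finset.card_union_of_disjoint]
  exact Finset.disjoint_filter_filter (Finset.Ioc_disjoint_Ioc_of_le le_rfl)

lemma nthPrime_prime (n : ℕ) : (nthPrime n).Prime := Nat.prime_nth_prime _

lemma primeCounting_nthPrime (n : ℕ) (hn : 1 ≤ n) : Nat.primeCounting (nthPrime n) = n := by
  have h : Nat.count Nat.Prime (nthPrime n) = n - 1 := Nat.primeCounting'_nth_eq (n - 1)
  rw [Nat.primeCounting, Nat.primeCounting', Nat.count_succ, h, if_pos (nthPrime_prime n)]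
  omega

lemma le_nthPrime (n : ℕ) : n + 1 ≤ nthPrime n := by
  have := Nat.add_two_le_nth_prime (n - 1)
  rw [nthPrime]
  omega

lemma mem_S_of_prime {n q : ℕ} (hq : q.Prime) (h : nthPrime n ≤ q) : q ∈ S n :=
  AddSubmonoid.subset_closure ⟨hq, h⟩

lemma prime_of_mem_atoms {n a : ℕ} (ha : a ∈ atoms n) : a.Prime ∧ nthPrime n ≤ a := by
  obtain ⟨⟨h1, h2⟩, h3⟩ := ha
  have key : ∀ s ∈ S n, s = 0 ∨ (s.Prime ∧ nthPrime n ≤ s) ∨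
      s ∈ ((S n : Set ℕ) \ {0}) + ((S n : Set ℕ) \ {0}) := by
    intro s hs
    refine AddSubmonoid.closure_induction (fun x hx => Or.inr (Or.inl hx)) (Or.inl rfl)
      (fun x y hx hy ihx ihy => ?_) hs
    by_cases hx0 : x = 0
    · rw [hx0, zero_add]; exact ihy
    by_cases hy0 : y = 0
    · rw [hy0, add_zero]; exact ihx
    exact Or.inr (Or.inr (Set.add_mem_add ⟨hx, hx0⟩ ⟨hy, hy0⟩))
  rcases key a h1 with h | h | h
  · exact absurd h h2
  · exact h
  · exact absurd h h3

lemma parity_of_mem_S {n : ℕ} (hn : 2 ≤ n) {s : ℕ} (hs : s ∈ S n) :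
    s = 0 ∨ (s % 2 = 1 ∧ nthPrime n ≤ s) ∨ (s % 2 = 0 ∧ 2 * nthPrime n ≤ s) := by
  refine AddSubmonoid.closure_induction (fun x hx => ?_) (Or.inl rfl)
    (fun x y _ _ ihx ihy => by omega) hs
  obtain ⟨h1, h2⟩ := hx
  have := le_nthPrime n
  have h3 := h1.eq_two_or_odd
  omega

lemma mem_atoms_of_prime {n q : ℕ} (hn : 2 ≤ n) (hq : q.Prime) (h1 : nthPrime n ≤ q)
    (h2 : q ≤ 3 * nthPrime n) : q ∈ atoms n := by
  refine ⟨⟨mem_S_of_prime hq h1, hq.ne_zero⟩, ?_⟩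
  rintro ⟨s, ⟨hs, hs0⟩, t, ⟨ht, ht0⟩, hst⟩
  have hp := nthPrime_prime n
  have hpn := le_nthPrime n
  have hne : q ≠ 3 * nthPrime n := fun h => by
    rw [h] at hq
    exact Nat.not_prime_mul (by norm_num) (by omega) hq
  have h3 := hq.eq_two_or_odd
  have h4 := parity_of_mem_S hn hs
  have h5 := parity_of_mem_S hn ht
  simp only [Set.mem_singleton_iff] at hs0 ht0
  simp only at hst
  omega

lemma not_mem_atoms_of_add {n s t : ℕ} (hs : s ∈ S n) (ht : t ∈ S n) (hs0 : s ≠ 0) (ht0 : t ≠ 0) :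
    s + t ∉ atoms n := fun h => h.2 (Set.add_mem_add ⟨hs, hs0⟩ ⟨ht, ht0⟩)

lemma tendsto_nthPrime : Tendsto nthPrime atTop atTop :=
  tendsto_atTop_mono (fun n => (Nat.le_succ n).trans (le_nthPrime n)) tendsto_id

/-- The prime counting function is regularly varying of index one. -/
lemma tendsto_primeCounting_floor_div (c : ℝ) (hc : 1 ≤ c) :
    Tendsto (fun x : ℕ => (Nat.primeCounting ⌊c * x⌋₊ : ℝ) / Nat.primeCounting x) atTop (nhds c) := by
  have hfl : Tendsto (fun x : ℕ => ⌊c * x⌋₊) atTop atTop := by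
    refine tendsto_atTop_mono (fun x => Nat.le_floor ?_) tendsto_id
    have : (0 : ℝ) ≤ x := Nat.cast_nonneg x
    simp only [id]
    nlinarith
  have h1 := tendsto_primeCounting.comp hfl
  have h2 : Tendsto (fun x : ℕ => (⌊c * x⌋₊ : ℝ) / x) atTop (nhds c) :=
    (tendsto_nat_floor_mul_div_atTop (by linarith : 0 ≤ c)).comp tendsto_natCast_atTop_atTop
  have h3 : Tendsto (fun x : ℕ => Real.log x) atTop atTop :=
    Real.tendsto_log_atTop.comp tendsto_natCast_atTop_atTop
  have h4 : Tendsto (fun x : ℕ => Real.log ((⌊c * x⌋₊ : ℝ) / x)) atTop (nhds (Real.log c)) :=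
    h2.log (by linarith)
  have h5 : Tendsto (fun x : ℕ => 1 + Real.log ((⌊c * x⌋₊ : ℝ) / x) / Real.log x) atTop
      (nhds (1 + 0)) := (h4.div_atTop h3).const_add 1
  have h6 := ((h1.div tendsto_primeCounting one_ne_zero).mul h2).div h5 (by norm_num)
  have e : 1 / 1 * c / (1 + 0) = c := by norm_num
  rw [e] at h6
  refine h6.congr' ?_
  filter_upwards [eventually_ge_atTop 2] with x hx
  have hx0 : (0 : ℝ) < x := by exact_mod_cast (by omega : 0 < x)
  have hm : 2 ≤ ⌊c * x⌋₊ := Nat.le_floor (by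
    have : (2 : ℝ) ≤ x := by exact_mod_cast hx
    push_cast
    nlinarith)
  have hm0 : (0 : ℝ) < (⌊c * x⌋₊ : ℝ) := by exact_mod_cast (by omega : 0 < ⌊c * x⌋₊)
  have hl : 0 < Real.log x := Real.log_pos (by exact_mod_cast (by omega : 1 < x))
  have hlm : 0 < Real.log (⌊c * x⌋₊ : ℝ) :=
    Real.log_pos (by exact_mod_cast (by omega : 1 < ⌊c * x⌋₊))
  have hπ : (Nat.primeCounting x : ℝ) ≠ 0 := by
    have : Nat.primeCounting x ≠ 0 := fun h => by
      rw [Nat.primeCounting_eq_zero_iff] at h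
      omega
    exact_mod_cast this
  have e1 := Real.log_div hm0.ne' hx0.ne'
  have e2 : 1 + (Real.log (⌊c * x⌋₊ : ℝ) - Real.log x) / Real.log x =
      Real.log (⌊c * x⌋₊ : ℝ) / Real.log x := by
    field_simp
    ring
  simp only [Pi.div_apply, Function.comp, e1, e2]
  field_simp

lemma tendsto_primeCounting_nthPrime (c : ℝ) (hc : 1 ≤ c) :
    Tendsto (fun n : ℕ => (Nat.primeCounting ⌊c * nthPrime n⌋₊ : ℝ) / n) atTop (nhds c) := by
  refine ((tendsto_primeCounting_floor_div c hc).comp tendsto_nthPrime).congr' ?_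
  filter_upwards [eventually_ge_atTop 1] with n hn
  simp only [Function.comp]
  rw [primeCounting_nthPrime n hn]

/-- Every atom is small, exceptional, or a prime in the first interval. -/
lemma exists_atoms_subset (ε δ : ℝ) (hε : 0 < ε) (hδ : 0 < δ) : ∃ n0 : ℕ, ∀ n ≥ n0,
    ∃ B : Finset ℕ, (B.card : ℝ) * Real.log (nthPrime n) ≤ δ * nthPrime n ∧
      atoms n ⊆ ((insert (nthPrime n) ((Finset.Ioc (nthPrime n) ⌊(3 + ε) * nthPrime n⌋₊).filter
        Nat.Prime) ∪ B : Finset ℕ) : Set ℕ) := by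
  classical
  obtain ⟨K, X1, hK⟩ := exists_add_of_lt
  obtain ⟨X2, hB⟩ := exists_sum_log_exceptional_le (K + 1) (by omega) ε δ hε hδ
  refine ⟨X1 + X2, fun n hn => ?_⟩
  set p := nthPrime n with hp
  have hnp := le_nthPrime n
  set B := (Finset.range ((K + 1) * p + 1)).filter fun b : ℕ => b.Prime ∧ (3 + ε) * p ≤ b ∧
    ∀ q r s : ℕ, q.Prime → r.Prime → s.Prime → p ≤ q → p ≤ r → p ≤ s → q + r + s ≠ b with hBdef
  refine ⟨B, ?_, fun a ha => ?_⟩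
  · have h1 := hB p (by omega) B (fun b hb => by
      rw [hBdef, Finset.mem_filter, Finset.mem_range] at hb
      exact ⟨hb.2.1, hb.2.2.1, by omega, hb.2.2.2⟩)
    refine le_trans ?_ h1
    rw [← nsmul_eq_mul]
    refine Finset.card_nsmul_le_sum _ _ _ fun b hb => ?_
    rw [hBdef, Finset.mem_filter] at hb
    have hp0 : (0 : ℝ) < p := by exact_mod_cast (nthPrime_prime n).pos
    exact Real.log_le_log hp0 (by nlinarith [hb.2.2.1])
  · obtain ⟨h1, h2⟩ := prime_of_mem_atoms ha
    rw [Finset.mem_coe, Finset.mem_union, Finset.mem_insert, Finset.mem_filter, Finset.mem_Ioc]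
    by_contra! hcon
    obtain ⟨⟨h3, h4⟩, h5⟩ := hcon
    have h6 : a ≤ (K + 1) * p := by
      by_contra! h7
      obtain ⟨s, hs, t, ht, hs0, ht0, hst⟩ := hK p (by omega) (nthPrime_prime n) (S n)
        (fun q hq hpq => mem_S_of_prime hq hpq) a (lt_of_le_of_lt (by gcongr; omega) h7)
      exact not_mem_atoms_of_add hs ht hs0 ht0 (hst ▸ ha)
    have h7 : ¬ a ≤ ⌊(3 + ε) * p⌋₊ := fun h => h4 ⟨by omega, h⟩ h1
    have h8 : (3 + ε) * p ≤ a := (Nat.lt_of_floor_lt (not_le.1 h7)).le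
    refine h5 ?_
    rw [hBdef, Finset.mem_filter, Finset.mem_range]
    refine ⟨by omega, h1, h8, fun q r s hq hr hs hpq hpr hps heq => ?_⟩
    have h9 := not_mem_atoms_of_add
      (add_mem (mem_S_of_prime hq hpq) (mem_S_of_prime hr hpr)) (mem_S_of_prime hs hps)
      (by have := hq.pos; omega) hs.ne_zero
    exact h9 (heq ▸ ha)

lemma primeCounting_le_e_add {n : ℕ} (hn : 2 ≤ n) (hfin : (atoms n).Finite) :
    Nat.primeCounting (3 * nthPrime n) ≤ e n + n := by
  have h1 := primeCounting_add_card (nthPrime n) (3 * nthPrime n) (by omega)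
  rw [primeCounting_nthPrime n (by omega)] at h1
  have h2 : ((Finset.Ioc (nthPrime n) (3 * nthPrime n)).filter Nat.Prime).card ≤ e n := by
    rw [e, ← Set.ncard_coe_finset]
    refine Set.ncard_le_ncard (fun q hq => ?_) hfin
    rw [Finset.mem_coe, Finset.mem_filter, Finset.mem_Ioc] at hq
    exact mem_atoms_of_prime hn hq.2 hq.1.1.le hq.1.2
  omega

lemma e_add_le {n : ℕ} (hn : 1 ≤ n) (ε : ℝ) (hε : 0 < ε) (B : Finset ℕ)
    (hB : atoms n ⊆ ((insert (nthPrime n) ((Finset.Ioc (nthPrime n) ⌊(3 + ε) * nthPrime n⌋₊).filter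
        Nat.Prime) ∪ B : Finset ℕ) : Set ℕ)) :
    e n + n ≤ 1 + Nat.primeCounting ⌊(3 + ε) * nthPrime n⌋₊ + B.card := by
  have hle : nthPrime n ≤ ⌊(3 + ε) * nthPrime n⌋₊ := Nat.le_floor (by
    have : (0 : ℝ) ≤ nthPrime n := Nat.cast_nonneg _
    nlinarith)
  have h1 := primeCounting_add_card (nthPrime n) _ hle
  rw [primeCounting_nthPrime n hn] at h1
  have h2 := Set.ncard_le_ncard hB (Finset.finite_toSet _)
  rw [Set.ncard_coe_finset] at h2
  have h3 := Finset.card_union_le (insert (nthPrime n)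
    ((Finset.Ioc (nthPrime n) ⌊(3 + ε) * nthPrime n⌋₊).filter Nat.Prime)) B
  have h4 := Finset.card_insert_le (nthPrime n)
    ((Finset.Ioc (nthPrime n) ⌊(3 + ε) * nthPrime n⌋₊).filter Nat.Prime)
  rw [e]
  omega

lemma eventually_card_le (δ : ℝ) (hδ : 0 < δ) : ∀ᶠ n in atTop, ∀ k : ℕ,
    (k : ℝ) * Real.log (nthPrime n) ≤ δ / 2 * nthPrime n → (k : ℝ) ≤ δ * n := by
  have h := tendsto_primeCounting.comp tendsto_nthPrime
  filter_upwards [h.eventually_const_lt (show (1 / 2 : ℝ) < 1 by norm_num),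
    eventually_ge_atTop 1] with n hn hn1 k hk
  simp only [Function.comp] at hn
  rw [primeCounting_nthPrime n hn1] at hn
  have hp : (2 : ℝ) ≤ nthPrime n := by exact_mod_cast (nthPrime_prime n).two_le
  have hl : 0 < Real.log (nthPrime n) := Real.log_pos (by linarith)
  rw [lt_div_iff₀ (by linarith)] at hn
  refine le_of_mul_le_mul_right (hk.trans ?_) hl
  nlinarith

lemma tendsto_e_div : Tendsto (fun n => (e n : ℝ) / (n : ℝ)) atTop (nhds 2) := by
  rw [Metric.tendsto_nhds]
  intro η hη
  obtain ⟨n0, hn0⟩ := exists_atoms_subset (η / 4) (η / 4 / 2) (by positivity) (by positivity)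
  have hlow := tendsto_primeCounting_nthPrime 3 (by norm_num)
  have hup := tendsto_primeCounting_nthPrime (3 + η / 4) (by linarith)
  have hone : ∀ᶠ n : ℕ in atTop, 8 / η ≤ (n : ℝ) :=
    tendsto_natCast_atTop_atTop.eventually_ge_atTop _
  filter_upwards [hlow.eventually_const_lt (show 3 - η / 2 < 3 by linarith),
    hup.eventually_lt_const (show 3 + η / 4 < 3 + η / 4 + η / 8 by linarith),
    eventually_card_le (η / 4) (by positivity), eventually_ge_atTop n0, eventually_ge_atTop 2, hone]
    with n h1 h2 h3 h4 h5 h6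
  obtain ⟨B, hB1, hB2⟩ := hn0 n h4
  have hfin : (atoms n).Finite := (Finset.finite_toSet _).subset hB2
  have hl := primeCounting_le_e_add h5 hfin
  have hu := e_add_le (by omega) (η / 4) (by positivity) B hB2
  have h7 := h3 B.card hB1
  have hfl : ⌊(3 : ℝ) * nthPrime n⌋₊ = 3 * nthPrime n := by
    exact_mod_cast Nat.floor_natCast (R := ℝ) (3 * nthPrime n)
  rw [hfl] at h1
  have hn : (0 : ℝ) < n := by exact_mod_cast (by omega : 0 < n)
  rw [lt_div_iff₀ hn] at h1
  rw [div_lt_iff₀ hn] at h2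
  rw [div_le_iff₀ hη] at h6
  have hl' : (Nat.primeCounting (3 * nthPrime n) : ℝ) ≤ e n + n := by exact_mod_cast hl
  have hu' : (e n + n : ℝ) ≤
      1 + Nat.primeCounting ⌊(3 + η / 4) * nthPrime n⌋₊ + B.card := by exact_mod_cast hu
  have hηn : 0 < η * n := by positivity
  rw [Real.dist_eq, abs_lt]
  constructor
  · rw [lt_sub_iff_add_lt, lt_div_iff₀ hn]
    linarith
  · rw [sub_lt_iff_lt_add, div_lt_iff₀ hn]
    linarith

end PrimeAtoms

theorem embdim_asymptotic :
    Filter.Tendsto (fun n => (e n : ℝ) / (n : ℝ)) Filter.atTop (nhds 2) := by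
  exact PrimeAtoms.tendsto_e_div
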